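/- Let ω^T ∈ A^{[AB]}(T) and let u_0^*, u* be the backward-forward datum and solution associated to ω^T. Then a function u_0 ∈ L^∞(ℝ) belongs to I_T^{[AB]}(ω^T) if and only if for every x̄ ∈ ℝ there exists ȳ ∈ C_0(u*, x̄) such that ∫_y^{ȳ} u_0(x) dx ≤ ∫_y^{ȳ} u_0^*(x) dx for every y < min C_0(u*, x̄), and ∫_{ȳ}^{y} u_0(x) dx ≥ ∫_{ȳ}^{y} u_0^*(x) dx for every y > max C_0(u*, x̄). -/

import Mathlib

open MeasureTheory Set Filter

noncomputable section

/-- The discontinuous flux `f(x,u) = f_l(u)` for `x < 0`, `f_r(u)` for `x > 0`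
(the value at the interface is taken to be `f_r(u)`). -/
def dflux (fl fr : ℝ → ℝ) (x u : ℝ) : ℝ := if x < 0 then fl u else fr u

/-- The connection function `c^{AB}`. -/
def cAB (A B : ℝ) (x : ℝ) : ℝ := if x ≤ 0 then A else B

/-- An `AB`-entropy solution of `u_t + f(x,u)_x = 0` on `ℝ × [0,∞)` with
initial datum `u0`, for the flux `f(x,·) = fl` on `x<0` and `fr` on `x>0`,
relative to the connection `(A,B)`.  The structure bundles the solution `u`
(as a function of `(x,t)`), its one-sided spatial limits `um x t = u(x-,t)` and
`up x t = u(x+,t)` (for `t > 0`), the weak (distributional) formulation, the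
Kružkov entropy inequalities away from the interface, the `AB`-interface
entropy inequality, `L¹_loc`-continuity in time and the initial condition. -/
structure ABSol (fl fr : ℝ → ℝ) (A B : ℝ) (u0 : ℝ → ℝ) where
  u : ℝ → ℝ → ℝ
  meas : Measurable (Function.uncurry u)
  bdd : ∃ M : ℝ, ∀ x t, |u x t| ≤ M
  um : ℝ → ℝ → ℝ
  up : ℝ → ℝ → ℝ
  um_spec : ∀ x t, 0 < t →
    Tendsto (fun y => u y t) (nhdsWithin x (Iio x)) (nhds (um x t))
  up_spec : ∀ x t, 0 < t →
    Tendsto (fun y => u y t) (nhdsWithin x (Ioi x)) (nhds (up x t))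
  weak : ∀ φ : ℝ → ℝ → ℝ,
    ContDiff ℝ 1 (fun p : ℝ × ℝ => φ p.1 p.2) →
    HasCompactSupport (fun p : ℝ × ℝ => φ p.1 p.2) →
    (∀ x t, t ≤ 0 → φ x t = 0) →
    (∫ p : ℝ × ℝ, (u p.1 p.2 * deriv (fun s => φ p.1 s) p.2 +
        dflux fl fr p.1 (u p.1 p.2) * deriv (fun y => φ y p.2) p.1)) = 0
  kruzkov_l : ∀ (k : ℝ) (φ : ℝ → ℝ → ℝ),
    ContDiff ℝ 1 (fun p : ℝ × ℝ => φ p.1 p.2) →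
    HasCompactSupport (fun p : ℝ × ℝ => φ p.1 p.2) →
    (∀ x t, 0 ≤ φ x t) →
    (∀ x t, 0 ≤ x ∨ t ≤ 0 → φ x t = 0) →
    0 ≤ ∫ p : ℝ × ℝ, (|u p.1 p.2 - k| * deriv (fun s => φ p.1 s) p.2 +
        Real.sign (u p.1 p.2 - k) * (fl (u p.1 p.2) - fl k) *
          deriv (fun y => φ y p.2) p.1)
  kruzkov_r : ∀ (k : ℝ) (φ : ℝ → ℝ → ℝ),
    ContDiff ℝ 1 (fun p : ℝ × ℝ => φ p.1 p.2) →
    HasCompactSupport (fun p : ℝ × ℝ => φ p.1 p.2) →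
    (∀ x t, 0 ≤ φ x t) →
    (∀ x t, x ≤ 0 ∨ t ≤ 0 → φ x t = 0) →
    0 ≤ ∫ p : ℝ × ℝ, (|u p.1 p.2 - k| * deriv (fun s => φ p.1 s) p.2 +
        Real.sign (u p.1 p.2 - k) * (fr (u p.1 p.2) - fr k) *
          deriv (fun y => φ y p.2) p.1)
  interfaceEntropy : ∀ φ : ℝ → ℝ → ℝ,
    ContDiff ℝ 1 (fun p : ℝ × ℝ => φ p.1 p.2) →
    HasCompactSupport (fun p : ℝ × ℝ => φ p.1 p.2) →
    (∀ x t, 0 ≤ φ x t) →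
    (∀ x t, t ≤ 0 → φ x t = 0) →
    0 ≤ ∫ p : ℝ × ℝ, (|u p.1 p.2 - cAB A B p.1| * deriv (fun s => φ p.1 s) p.2 +
        Real.sign (u p.1 p.2 - cAB A B p.1) *
          (dflux fl fr p.1 (u p.1 p.2) - dflux fl fr p.1 (cAB A B p.1)) *
          deriv (fun y => φ y p.2) p.1)
  timeCont : ∀ (r t₀ : ℝ), 0 ≤ t₀ →
    Tendsto (fun t => ∫ x in Icc (-r) r, |u x t - u x t₀|)
      (nhdsWithin t₀ (Ici 0)) (nhds 0)
  init : ∀ᵐ x : ℝ ∂volume, u x 0 = u0 x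

/-- `AB`-genuine/interface characteristic for the `AB`-entropy solution `sol`,
on the time interval `[0,T]`, where `γ = f_l(A) = f_r(B)`. -/
def IsABgic (T : ℝ) (fl fr : ℝ → ℝ) (γ : ℝ) {A B : ℝ} {u0 : ℝ → ℝ}
    (sol : ABSol fl fr A B u0) (ζ : ℝ → ℝ) : Prop :=
  (∃ K : NNReal, LipschitzOnWith K ζ (Icc 0 T)) ∧
  (∀ᵐ t ∂(volume.restrict (Icc 0 T)),
    (ζ t < 0 → HasDerivAt ζ (deriv fl (sol.um (ζ t) t)) t ∧
      deriv fl (sol.um (ζ t) t) = deriv fl (sol.up (ζ t) t)) ∧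
    (0 < ζ t → HasDerivAt ζ (deriv fr (sol.um (ζ t) t)) t ∧
      deriv fr (sol.um (ζ t) t) = deriv fr (sol.up (ζ t) t)) ∧
    (ζ t = 0 → fl (sol.um 0 t) = γ ∧ fr (sol.up 0 t) = γ))

/-- `C(u,x)`: the set of `AB`-genuine/interface characteristics of `sol`
reaching `x` at time `T`. -/
def charSet (T : ℝ) (fl fr : ℝ → ℝ) (γ : ℝ) {A B : ℝ} {u0 : ℝ → ℝ}
    (sol : ABSol fl fr A B u0) (x : ℝ) : Set (ℝ → ℝ) :=
  {ζ | IsABgic T fl fr γ sol ζ ∧ ζ T = x}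

/-- `C₀(u,x)`: the set of initial positions `ζ(0)` of characteristics in `C(u,x)`. -/
def charSet0 (T : ℝ) (fl fr : ℝ → ℝ) (γ : ℝ) {A B : ℝ} {u0 : ℝ → ℝ}
    (sol : ABSol fl fr A B u0) (x : ℝ) : Set ℝ :=
  (fun ζ : ℝ → ℝ => ζ 0) '' charSet T fl fr γ sol x

/-- Membership in `L^∞(ℝ)`: measurable and (essentially) bounded. -/
def IsLinf (g : ℝ → ℝ) : Prop :=
  Measurable g ∧ ∃ M : ℝ, ∀ᵐ x : ℝ ∂volume, |g x| ≤ M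

/-- `ω ∈ A^{[AB]}(T)`: the profile `ω` is attainable at time `T`. -/
def Attainable (T : ℝ) (fl fr : ℝ → ℝ) (A B : ℝ) (ω : ℝ → ℝ) : Prop :=
  ∃ u0 : ℝ → ℝ, IsLinf u0 ∧
    ∃ sol : ABSol fl fr A B u0, ∀ᵐ x : ℝ ∂volume, sol.u x T = ω x

/-- `I_T^{[AB]}(ω)`: the set of (bounded) initial data whose `AB`-entropy
solution coincides a.e. with `ω` at time `T`. -/
def InitialSet (T : ℝ) (fl fr : ℝ → ℝ) (A B : ℝ) (ω : ℝ → ℝ) : Set (ℝ → ℝ) :=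
  {u0 | IsLinf u0 ∧
    ∃ sol : ABSol fl fr A B u0, ∀ᵐ x : ℝ ∂volume, sol.u x T = ω x}

/-- `x` is a point of continuity of `ω`: the one-sided limits exist and coincide. -/
def ContinuityPt (ω : ℝ → ℝ) (x : ℝ) : Prop :=
  ∃ l : ℝ, Tendsto ω (nhdsWithin x (Iio x)) (nhds l) ∧
    Tendsto ω (nhdsWithin x (Ioi x)) (nhds l)

notation "ℝ²" => ℝ × ℝ
notation "ν" n:max => 1 / ((n : ℝ) + 1)

section S1
structure CF (f : ℝ → ℝ) (a : ℝ) : Prop where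
  c2 : ContDiff ℝ 2 f
  pos : 0 < a
  conv : ∀ w, a ≤ deriv (deriv f) w

def GG (f : ℝ → ℝ) (p : ℝ) : ℝ := Function.invFun (deriv f) p
def LL (f : ℝ → ℝ) (p : ℝ) : ℝ := p * GG f p - f (GG f p)

namespace CF
variable {f : ℝ → ℝ} {a : ℝ}

lemma hd (h : CF f a) (q : ℝ) : HasDerivAt f (deriv f q) q :=
  (h.c2.differentiable (by norm_num) q).hasDerivAt

lemma cont (h : CF f a) : Continuous f := h.c2.continuous

lemma c1 (h : CF f a) : ContDiff ℝ 1 (deriv f) := by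
  have := (contDiff_succ_iff_deriv (n := 1) (f := f)).1 (by simpa [one_add_one_eq_two] using h.c2)
  exact this.2.2


lemma mono (h : CF f a) {x y : ℝ} (hxy : x ≤ y) : a * (y - x) ≤ deriv f y - deriv f x := by
  have := convex_univ.mul_sub_le_image_sub_of_le_deriv (f := deriv f) (C := a)
    h.c1.continuous.continuousOn (h.c1.differentiable (by norm_num)).differentiableOn
    (fun w _ => h.conv w) x (mem_univ _) y (mem_univ _) hxy
  exact this

lemma smono (h : CF f a) : StrictMono (deriv f) := fun x y hxy => by
  have := h.mono hxy.le
  have := mul_pos h.pos (sub_pos.2 hxy)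
  linarith

lemma surj (h : CF f a) : Function.Surjective (deriv f) := by
  refine h.c1.continuous.surjective ?_ ?_
  · refine tendsto_atTop_mono' _ (f₁ := fun x => a * x + deriv f 0) ?_ ?_
    · filter_upwards [eventually_ge_atTop 0] with x hx
      have := h.mono hx; linarith
    · exact tendsto_atTop_add_const_right _ _ (tendsto_id.const_mul_atTop h.pos)
  · refine tendsto_atBot_mono' _ (f₂ := deriv f) (f₁ := fun x => a * x + deriv f 0) ?_ ?_
    · filter_upwards [eventually_le_atBot 0] with x hx
      have := h.mono hx; linarith
    · exact tendsto_atBot_add_const_right _ _ (tendsto_id.const_mul_atBot h.pos)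

@[simp] lemma dG (h : CF f a) (p : ℝ) : deriv f (GG f p) = p :=
  Function.invFun_eq (h.surj p)

@[simp] lemma Gd (h : CF f a) (q : ℝ) : GG f (deriv f q) = q :=
  Function.leftInverse_invFun h.smono.injective q

lemma tang (h : CF f a) (q r : ℝ) : f q + deriv f q * (r - q) ≤ f r := by
  have hc : ConvexOn ℝ univ f := by
    refine MonotoneOn.convexOn_of_deriv convex_univ h.cont.continuousOn
      (h.c2.differentiable (by norm_num)).differentiableOn ?_
    exact h.smono.monotone.monotoneOn _
  rcases lt_trichotomy q r with hl | rfl | hl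
  · have := hc.le_slope_of_hasDerivAt (mem_univ q) (mem_univ r) hl (h.hd q)
    rw [slope_def_field, le_div_iff₀ (by linarith)] at this; linarith
  · simp
  · have := hc.slope_le_of_hasDerivAt (mem_univ r) (mem_univ q) hl (h.hd q)
    rw [slope_def_field, div_le_iff₀ (by linarith)] at this; linarith

lemma young (h : CF f a) (p q : ℝ) : p * q - f q ≤ LL f p := by
  have := h.tang (GG f p) q
  rw [h.dG] at this; unfold LL; linarith

lemma young_eq (h : CF f a) {p q : ℝ} (he : p * q - f q = LL f p) : deriv f q = p := by
  have hm : IsLocalMax (fun r => p * r - f r) q :=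
    Eventually.of_forall fun r => by simpa [he] using h.young p r
  have := hm.hasDerivAt_eq_zero (((hasDerivAt_id q).const_mul p).sub (h.hd q))
  linarith

lemma LL_d (h : CF f a) (q : ℝ) : LL f (deriv f q) = deriv f q * q - f q := by
  simp [LL, h.Gd]

lemma G_smono (h : CF f a) : StrictMono (GG f) := fun p r hpr => by
  by_contra hc
  have := h.smono.monotone (not_lt.1 hc)
  rw [h.dG, h.dG] at this; linarith

lemma G_lip' (h : CF f a) {p r : ℝ} (hpr : p ≤ r) : GG f r - GG f p ≤ (r - p) / a := by
  rw [le_div_iff₀ h.pos]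
  have := h.mono (h.G_smono.monotone hpr)
  rw [h.dG, h.dG] at this; linarith

lemma G_cont (h : CF f a) : Continuous (GG f) := by
  have : LipschitzWith (Real.toNNReal (1 / a)) (GG f) := by
    refine LipschitzWith.of_dist_le_mul fun x y => ?_
    rw [Real.coe_toNNReal _ (by have := h.pos; positivity), Real.dist_eq, Real.dist_eq, one_div,
      inv_mul_eq_div]
    rcases le_total x y with hxy | hxy
    · rw [abs_sub_comm, abs_sub_comm x y, abs_of_nonneg (sub_nonneg.2 hxy),
        abs_of_nonneg (sub_nonneg.2 (h.G_smono.monotone hxy))]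
      exact h.G_lip' hxy
    · rw [abs_of_nonneg (sub_nonneg.2 hxy),
        abs_of_nonneg (sub_nonneg.2 (h.G_smono.monotone hxy))]
      exact h.G_lip' hxy
  exact this.continuous

lemma LL_ge (h : CF f a) (p r : ℝ) : LL f p + GG f p * (r - p) ≤ LL f r := by
  have := h.young r (GG f p)
  simp only [LL] at *; linarith

lemma LL_le (h : CF f a) (p r : ℝ) : LL f r ≤ LL f p + GG f r * (r - p) := by
  have := h.LL_ge r p; linarith

lemma LL_hd (h : CF f a) (p : ℝ) : HasDerivAt (LL f) (GG f p) p := by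
  rw [hasDerivAt_iff_isLittleO, Asymptotics.isLittleO_iff]
  intro c hc
  have hG := (h.G_cont.tendsto p)
  filter_upwards [Metric.tendsto_nhds.1 hG c hc] with r hr
  rw [Real.dist_eq] at hr
  have h1 := h.LL_ge p r
  have h2 := h.LL_le p r
  rw [Real.norm_eq_abs, Real.norm_eq_abs, smul_eq_mul, abs_of_nonneg (by linarith)]
  calc LL f r - LL f p - (r - p) * GG f p ≤ (GG f r - GG f p) * (r - p) := by linarith
    _ ≤ |(GG f r - GG f p) * (r - p)| := le_abs_self _
    _ ≤ c * |r - p| := by rw [abs_mul]; gcongr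

lemma LL_cont (h : CF f a) : Continuous (LL f) :=
  continuous_iff_continuousAt.2 fun p => (h.LL_hd p).continuousAt

lemma LL_sup (h : CF f a) (N : ℝ) : ∃ C, 0 ≤ C ∧ ∀ p, N * |p| - C ≤ LL f p := by
  refine ⟨max 0 (max (f N) (f (-N))), le_max_left _ _, fun p => ?_⟩
  have h1 := h.young p N
  have h2 := h.young p (-N)
  have := le_max_left (f N) (f (-N)); have := le_max_right (f N) (f (-N))
  have := le_max_right 0 (max (f N) (f (-N)))
  rcases abs_cases p with ⟨e, _⟩ | ⟨e, _⟩ <;> rw [e] <;> linarith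

lemma LL0_ge (h : CF f a) (q : ℝ) : - f q ≤ LL f 0 := by have := h.young 0 q; linarith

lemma fG (p : ℝ) : p * GG f p - LL f p = f (GG f p) := by simp [LL]

lemma anti_left (h : CF f a) {x y : ℝ} (hxy : x ≤ y) (hy : deriv f y ≤ 0) : f y ≤ f x := by
  have := h.tang y x
  nlinarith [mul_nonneg_of_nonpos_of_nonpos hy (sub_nonpos.2 hxy)]

lemma mono_right (h : CF f a) {x y : ℝ} (hxy : x ≤ y) (hx : 0 ≤ deriv f x) : f x ≤ f y := by
  have := h.tang x y
  nlinarith [mul_nonneg hx (sub_nonneg.2 hxy)]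

lemma refl_d (q : ℝ) : deriv (fun r => f (-r)) q = - deriv f (-q) := by
  rw [deriv_comp_neg]

lemma reflect (h : CF f a) : CF (fun r => f (-r)) a := by
  refine ⟨h.c2.comp contDiff_neg, h.pos, fun w => ?_⟩
  have : deriv (fun r => f (-r)) = fun r => - deriv f (-r) := by ext; exact refl_d _
  rw [this, deriv.fun_neg, deriv_comp_neg (f := deriv f)]
  simpa using h.conv (-w)

lemma G_reflect (h : CF f a) (p : ℝ) : GG (fun r => f (-r)) p = - GG f (-p) := by
  apply h.reflect.smono.injective
  rw [h.reflect.dG, refl_d, neg_neg, h.dG, neg_neg]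

lemma LL_reflect (h : CF f a) (p : ℝ) : LL (fun r => f (-r)) p = LL f (-p) := by
  simp only [LL, h.G_reflect, neg_neg]; ring

end CF
end S1

section S2
open scoped Convolution Topology NNReal

def Dx (ψ : ℝ² → ℝ) (p : ℝ²) : ℝ := deriv (fun y => ψ (y, p.2)) p.1
def Dt (ψ : ℝ² → ℝ) (p : ℝ²) : ℝ := deriv (fun s => ψ (p.1, s)) p.2

lemma line_x (ψ : ℝ² → ℝ) (p : ℝ²) : lineDeriv ℝ ψ p (1, 0) = Dx ψ p := by
  have := deriv_comp_const_add (fun y => ψ (y, p.2)) p.1 0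
  simp only [add_zero] at this
  rw [Dx, ← this]
  simp only [lineDeriv]
  congr 1; ext t; congr 1; ext <;> simp

lemma line_t (ψ : ℝ² → ℝ) (p : ℝ²) : lineDeriv ℝ ψ p (0, 1) = Dt ψ p := by
  have := deriv_comp_const_add (fun s => ψ (p.1, s)) p.2 0
  simp only [add_zero] at this
  rw [Dt, ← this]
  simp only [lineDeriv]
  congr 1; ext t; congr 1; ext <;> simp

lemma Dx_bdd {ψ : ℝ² → ℝ} {K : ℝ≥0} (h : LipschitzWith K ψ) (p) : |Dx ψ p| ≤ K := by
  rw [← line_x]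
  refine (norm_lineDeriv_le_of_lipschitz ℝ h).trans ?_
  simp [Prod.norm_def]

lemma Dt_bdd {ψ : ℝ² → ℝ} {K : ℝ≥0} (h : LipschitzWith K ψ) (p) : |Dt ψ p| ≤ K := by
  rw [← line_t]
  refine (norm_lineDeriv_le_of_lipschitz ℝ h).trans ?_
  simp [Prod.norm_def]

lemma Dx_meas {ψ : ℝ² → ℝ} (h : Continuous ψ) : Measurable (Dx ψ) := by
  have := measurable_lineDeriv (𝕜 := ℝ) h (v := ((1, 0) : ℝ²))
  simpa [line_x] using this

lemma Dt_meas {ψ : ℝ² → ℝ} (h : Continuous ψ) : Measurable (Dt ψ) := by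
  have := measurable_lineDeriv (𝕜 := ℝ) h (v := ((0, 1) : ℝ²))
  simpa [line_t] using this

lemma lineDeriv_zero_of_notin {ψ : ℝ² → ℝ} {p v : ℝ²} (h : p ∉ tsupport ψ) :
    lineDeriv ℝ ψ p v = 0 := by
  have h1 : ψ =ᶠ[𝓝 p] fun _ => 0 := notMem_tsupport_iff_eventuallyEq.mp h
  have := h1.lineDeriv_eq (𝕜 := ℝ) (v := v)
  rw [this]; simp [lineDeriv]

lemma mollify {ψ : ℝ² → ℝ} {K : ℝ≥0} (hψ : LipschitzWith K ψ) (hc : HasCompactSupport ψ)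
    (hp : ∀ p, 0 ≤ ψ p) {Ω : Set ℝ²} (hΩ : IsOpen Ω) (hs : tsupport ψ ⊆ Ω) :
    ∃ (Q : Set ℝ²) (φ : ℕ → ℝ² → ℝ), IsCompact Q ∧ Q ⊆ Ω ∧ tsupport ψ ⊆ Q ∧
      (∀ n, ContDiff ℝ 1 (φ n) ∧ tsupport (φ n) ⊆ Q ∧ HasCompactSupport (φ n) ∧ (∀ p, 0 ≤ φ n p)) ∧
      (∀ n p v, |lineDeriv ℝ (φ n) p v| ≤ K * ‖v‖) ∧
      ∀ v, ∀ᵐ p, Tendsto (fun n => lineDeriv ℝ (φ n) p v) atTop (𝓝 (lineDeriv ℝ ψ p v)) := by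
  obtain ⟨δ, hδ, hδΩ⟩ := hc.isCompact.exists_cthickening_subset_open hΩ hs
  have hb : ∀ n : ℕ, 0 < δ / (2 * (n + 1)) := fun n => by positivity
  have hb2 : ∀ n : ℕ, δ / (2 * (n + 1)) < δ / (n + 1) := fun n => by
    apply div_lt_div_of_pos_left hδ (by positivity) (by linarith [n.cast_nonneg (α := ℝ)])
  let ρ : ℕ → ContDiffBump (0 : ℝ²) := fun n => ⟨δ / (2 * (n + 1)), δ / (n + 1), hb n, hb2 n⟩
  let φ : ℕ → ℝ² → ℝ := fun n => (ρ n).normed volume ⋆[ContinuousLinearMap.lsmul ℝ ℝ, volume] ψ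
  have hφ : ∀ n p, φ n p = ∫ x, (ρ n).normed volume x * ψ (p - x) := fun n p => by
    simp [φ, convolution_def]
  have hint : ∀ n, Integrable ((ρ n).normed volume) (volume : Measure (ℝ²)) :=
    fun n => (ρ n).integrable_normed
  have hi2 : ∀ n p, Integrable (fun x => (ρ n).normed volume x * ψ (p - x)) := fun n p => by
    refine ((((ρ n).continuous_normed).mul (hψ.continuous.comp
      (continuous_const.sub continuous_id))).integrable_of_hasCompactSupport ?_)
    exact (ρ n).hasCompactSupport_normed.mul_right
  have hlip : ∀ n, LipschitzWith K (φ n) := fun n => by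
    apply LipschitzWith.of_dist_le_mul
    intro p q
    rw [Real.dist_eq, hφ, hφ, ← integral_sub (hi2 n p) (hi2 n q)]
    have h1 : ∀ x, ‖(ρ n).normed volume x * ψ (p - x) - (ρ n).normed volume x * ψ (q - x)‖
        ≤ (ρ n).normed volume x * (K * dist p q) := fun x => by
      rw [← mul_sub, norm_mul, Real.norm_of_nonneg ((ρ n).nonneg_normed x)]
      apply mul_le_mul_of_nonneg_left _ ((ρ n).nonneg_normed x)
      have := hψ.dist_le_mul (p - x) (q - x)
      simpa [Real.dist_eq] using this
    refine (norm_integral_le_of_norm_le ((hint n).mul_const _) (Eventually.of_forall h1)).trans ?_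
    rw [integral_mul_const, (ρ n).integral_normed, one_mul]
  have hsup : ∀ n, tsupport (φ n) ⊆ Metric.cthickening δ (tsupport ψ) := fun n => by
    apply closure_minimal _ Metric.isClosed_cthickening
    refine (support_convolution_subset _).trans ?_
    rintro _ ⟨x, hx, y, hy, rfl⟩
    apply Metric.mem_cthickening_of_dist_le _ y _ _ (subset_tsupport _ hy)
    rw [(ρ n).support_normed_eq] at hx
    have hx : dist x 0 < δ / (n + 1) := hx
    have : δ / (n + 1) ≤ δ := div_le_self hδ.le (by linarith [n.cast_nonneg (α := ℝ)])
    simp only [dist_zero_right] at hx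
    simp only [dist_eq_norm, add_sub_cancel_right]
    linarith
  have hQ : IsCompact (Metric.cthickening δ (tsupport ψ)) := hc.isCompact.cthickening
  have hC1 : ∀ n, ContDiff ℝ 1 (φ n) := fun n =>
    (ρ n).hasCompactSupport_normed.contDiff_convolution_left _ ((ρ n).contDiff_normed)
      hψ.continuous.locallyIntegrable
  refine ⟨_, φ, hQ, hδΩ, Metric.self_subset_cthickening _, fun n => ⟨hC1 n, hsup n,
    hQ.of_isClosed_subset (isClosed_tsupport _) (hsup n), fun p => ?_⟩, fun n p v => ?_, fun v => ?_⟩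
  · rw [hφ]; exact integral_nonneg fun x => mul_nonneg ((ρ n).nonneg_normed x) (hp _)
  · exact norm_lineDeriv_le_of_lipschitz ℝ (hlip n)
  · have key : ∀ n p, lineDeriv ℝ (φ n) p v = ((ρ n).normed volume
        ⋆[ContinuousLinearMap.lsmul ℝ ℝ, volume] fun x => lineDeriv ℝ ψ x v) p := fun n p => by
      have h1 : HasLineDerivAt ℝ (φ n) (lineDeriv ℝ (φ n) p v) p v :=
        (((hC1 n).differentiable one_ne_zero) p).lineDifferentiableAt.hasLineDerivAt
      have h2 := h1.tendsto_slope_zero_right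
      have h3 := hψ.integral_inv_smul_sub_mul_tendsto_integral_lineDeriv_mul (μ := volume)
        (g := fun x => (ρ n).normed volume (p - x)) ((hint n).comp_sub_left p) v
      rw [convolution_lsmul_swap]
      simp only [smul_eq_mul, mul_comm ((ρ n).normed volume _)]
      refine tendsto_nhds_unique (h2.congr fun t => ?_) h3
      have e : ∀ q, φ n q = ∫ x, (ρ n).normed volume (p - x) * ψ (q - p + x) := fun q => by
        rw [hφ, ← integral_sub_left_eq_self _ _ p]
        congr 1; ext x; congr 2; abel
      have i : ∀ q, Integrable fun x => (ρ n).normed volume (p - x) * ψ (q - p + x) := fun q => by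
        have := (hi2 n q).comp_sub_left p
        convert this using 4
        abel
      rw [e, e, ← integral_sub (i _) (i _), smul_eq_mul, ← integral_const_mul]
      congr 1; ext x
      simp only [smul_eq_mul, add_sub_cancel_left, sub_self, zero_add]
      rw [add_comm x]; ring
    have := ContDiffBump.ae_convolution_tendsto_right_of_locallyIntegrable (μ := volume) (φ := ρ)
      (l := atTop) (K := 2) ?_ ?_ (hψ.locallyIntegrable_lineDeriv v)
    · filter_upwards [this] with p h
      simpa only [key] using h
    · have : Tendsto (fun n : ℕ => δ * (ν n)) atTop (𝓝 (δ * 0)) :=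
        tendsto_one_div_add_atTop_nhds_zero_nat.const_mul δ
      simpa [ρ, div_eq_mul_inv] using this
    · refine Eventually.of_forall fun n => le_of_eq ?_
      simp only [ρ]; field_simp

lemma lipTest {Ω : Set ℝ²} (hΩ : IsOpen Ω) {G1 G2 : ℝ² → ℝ} {M : ℝ}
    (m1 : Measurable G1) (m2 : Measurable G2) (b1 : ∀ p, |G1 p| ≤ M) (b2 : ∀ p, |G2 p| ≤ M)
    (H : ∀ φ : ℝ² → ℝ, ContDiff ℝ 1 φ → HasCompactSupport φ → (∀ p, 0 ≤ φ p) → tsupport φ ⊆ Ω →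
      0 ≤ ∫ p, (G1 p * Dt φ p + G2 p * Dx φ p))
    {ψ : ℝ² → ℝ} {K : ℝ≥0} (hψ : LipschitzWith K ψ) (hc : HasCompactSupport ψ)
    (hp : ∀ p, 0 ≤ ψ p) (hs : tsupport ψ ⊆ Ω) :
    0 ≤ ∫ p, (G1 p * Dt ψ p + G2 p * Dx ψ p) := by
  obtain ⟨Q, φ, hQ, hQΩ, -, h1, h2, h3⟩ := mollify hψ hc hp hΩ hs
  have hM : 0 ≤ M := (abs_nonneg _).trans (b1 0)
  have key : Tendsto (fun n => ∫ p, (G1 p * Dt (φ n) p + G2 p * Dx (φ n) p)) atTop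
      (𝓝 (∫ p, (G1 p * Dt ψ p + G2 p * Dx ψ p))) := by
    refine tendsto_integral_of_dominated_convergence
      (Q.indicator fun _ => M * K + M * K) (fun n => ?_) ?_ (fun n => ?_) ?_
    · have := (h1 n).1.continuous
      exact ((m1.mul (Dt_meas this)).add (m2.mul (Dx_meas this))).aestronglyMeasurable
    · exact (integrableOn_const hQ.measure_lt_top.ne).integrable_indicator hQ.measurableSet
    · refine Eventually.of_forall fun p => ?_
      by_cases hpq : p ∈ Q
      · rw [indicator_of_mem hpq]
        refine (norm_add_le _ _).trans (add_le_add ?_ ?_)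
        · rw [norm_mul, ← line_t]
          have := h2 n p (0, 1)
          simp [Prod.norm_def] at this
          exact mul_le_mul (b1 p) this (abs_nonneg _) hM
        · rw [norm_mul, ← line_x]
          have := h2 n p (1, 0)
          simp [Prod.norm_def] at this
          exact mul_le_mul (b2 p) this (abs_nonneg _) hM
      · rw [indicator_of_notMem hpq, ← line_t, ← line_x,
          lineDeriv_zero_of_notin (fun h => hpq ((h1 n).2.1 h)),
          lineDeriv_zero_of_notin (fun h => hpq ((h1 n).2.1 h))]
        simp
    · filter_upwards [h3 (0, 1), h3 (1, 0)] with p e1 e2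
      simp only [line_t, line_x] at e1 e2
      exact (e1.const_mul _).add (e2.const_mul _)
  exact ge_of_tendsto' key fun n => H _ (h1 n).1 (h1 n).2.2.1 (h1 n).2.2.2 ((h1 n).2.1.trans hQΩ)
end S2

section S3
open scoped Convolution Topology NNReal

lemma meas_sign : Measurable Real.sign := by
  unfold Real.sign
  exact Measurable.ite measurableSet_Iio measurable_const
    (Measurable.ite measurableSet_Ioi measurable_const measurable_const)

lemma abs_sign_le (x : ℝ) : |Real.sign x| ≤ 1 := by
  rcases Real.sign_apply_eq x with h | h | h <;> simp [h]

lemma cont_bdd {f : ℝ → ℝ} (hf : Continuous f) (M : ℝ) : ∃ C, 0 ≤ C ∧ ∀ q, |q| ≤ M → |f q| ≤ C := by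
  obtain ⟨C, hC⟩ := (isCompact_Icc (a := -M) (b := M)).exists_bound_of_continuousOn hf.continuousOn
  exact ⟨max C 0, le_max_right _ _, fun q hq => (hC q (abs_le.mp hq)).trans (le_max_left _ _)⟩

lemma dflux_meas {fl fr : ℝ → ℝ} (hl : Continuous fl) (hr : Continuous fr) {w : ℝ² → ℝ}
    (hw : Measurable w) : Measurable fun p : ℝ² => dflux fl fr p.1 (w p) :=
  Measurable.ite (measurable_fst measurableSet_Iio) (hl.measurable.comp hw) (hr.measurable.comp hw)

namespace ABSol
variable {fl fr : ℝ → ℝ} {A B : ℝ} {u0 : ℝ → ℝ}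

lemma bdd2 (s : ABSol fl fr A B u0) (hl : Continuous fl) (hr : Continuous fr) :
    ∃ M, 0 ≤ M ∧ (∀ x t, |s.u x t| ≤ M) ∧ (∀ q, (∃ x t, |q| ≤ |s.u x t|) → |fl q| ≤ M ∧ |fr q| ≤ M) := by
  obtain ⟨M, hM⟩ := s.bdd
  obtain ⟨C, hC, h1⟩ := cont_bdd hl M
  obtain ⟨D, hD, h2⟩ := cont_bdd hr M
  have h0 : 0 ≤ M := (abs_nonneg _).trans (hM 0 0)
  refine ⟨M + C + D, by positivity, fun x t => by linarith [hM x t], fun q ⟨x, t, h⟩ => ⟨?_, ?_⟩⟩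
  · linarith [h1 q (h.trans (hM x t))]
  · linarith [h2 q (h.trans (hM x t))]

lemma weakL (s : ABSol fl fr A B u0) (hl : Continuous fl) (hr : Continuous fr)
    {ψ : ℝ² → ℝ} {K : ℝ≥0} (hψ : LipschitzWith K ψ) (hc : HasCompactSupport ψ)
    (hp : ∀ p, 0 ≤ ψ p) (hs : tsupport ψ ⊆ {p | 0 < p.2}) :
    ∫ p : ℝ², (s.u p.1 p.2 * Dt ψ p + dflux fl fr p.1 (s.u p.1 p.2) * Dx ψ p) = 0 := by
  obtain ⟨M, hM, h1, h2⟩ := s.bdd2 hl hr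
  have hΩ : IsOpen {p : ℝ² | 0 < p.2} := isOpen_lt continuous_const continuous_snd
  have mu : Measurable fun p : ℝ² => s.u p.1 p.2 := s.meas
  have mF := dflux_meas hl hr mu
  have bF : ∀ p : ℝ², |dflux fl fr p.1 (s.u p.1 p.2)| ≤ M := fun p => by
    unfold dflux; split_ifs
    · exact (h2 _ ⟨_, _, le_rfl⟩).1
    · exact (h2 _ ⟨_, _, le_rfl⟩).2
  have w : ∀ φ : ℝ² → ℝ, ContDiff ℝ 1 φ → HasCompactSupport φ → (∀ p, 0 ≤ φ p) →
      tsupport φ ⊆ {p | 0 < p.2} →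
      ∫ p : ℝ², (s.u p.1 p.2 * Dt φ p + dflux fl fr p.1 (s.u p.1 p.2) * Dx φ p) = 0 := by
    intro φ c1 c2 c3 c4
    refine s.weak (fun x t => φ (x, t)) c1 c2 fun x t ht => ?_
    by_contra h
    exact absurd (c4 (subset_tsupport _ h)) (not_lt.mpr ht)
  apply le_antisymm
  · have := lipTest hΩ mu.neg mF.neg (M := M) (by simpa using fun a b => h1 a b) (by simpa using bF)
      (fun φ c1 c2 c3 c4 => ?_) hψ hc hp hs
    · simp only [Pi.neg_apply, neg_mul, ← neg_add, integral_neg] at this; linarith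
    · have := w φ c1 c2 c3 c4
      simp only [Pi.neg_apply, neg_mul, ← neg_add, integral_neg, this]; simp
  · exact lipTest hΩ mu mF (fun p => h1 _ _) bF (fun φ c1 c2 c3 c4 => (w φ c1 c2 c3 c4).ge) hψ hc hp hs

lemma entL {w : ℝ → ℝ → ℝ} (mw : Measurable (Function.uncurry w)) {M : ℝ} (bw : ∀ x t, |w x t| ≤ M)
    {Ω : Set ℝ²} (hΩ : IsOpen Ω) {f : ℝ → ℝ → ℝ} (mf : ∀ g : ℝ² → ℝ, Measurable g →
      Measurable fun p : ℝ² => f p.1 (g p)) {C : ℝ} (bf : ∀ x q, |q| ≤ M → |f x q| ≤ C)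
    {k : ℝ → ℝ} (mk : Measurable k) (bk : ∀ x, |k x| ≤ M)
    (H : ∀ φ : ℝ² → ℝ, ContDiff ℝ 1 φ → HasCompactSupport φ → (∀ p, 0 ≤ φ p) → tsupport φ ⊆ Ω →
      0 ≤ ∫ p : ℝ², (|w p.1 p.2 - k p.1| * Dt φ p + Real.sign (w p.1 p.2 - k p.1) *
        (f p.1 (w p.1 p.2) - f p.1 (k p.1)) * Dx φ p))
    {ψ : ℝ² → ℝ} {K : ℝ≥0} (hψ : LipschitzWith K ψ) (hc : HasCompactSupport ψ)
    (hp : ∀ p, 0 ≤ ψ p) (hs : tsupport ψ ⊆ Ω) :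
    0 ≤ ∫ p : ℝ², (|w p.1 p.2 - k p.1| * Dt ψ p + Real.sign (w p.1 p.2 - k p.1) *
        (f p.1 (w p.1 p.2) - f p.1 (k p.1)) * Dx ψ p) := by
  have mu : Measurable fun p : ℝ² => w p.1 p.2 := mw
  have mk' : Measurable fun p : ℝ² => k p.1 := mk.comp measurable_fst
  have hM : 0 ≤ M := (abs_nonneg _).trans (bk 0)
  have hC : 0 ≤ C := (abs_nonneg _).trans (bf 0 _ (bk 0))
  refine lipTest hΩ (G1 := fun p => |w p.1 p.2 - k p.1|) (G2 := fun p => Real.sign (w p.1 p.2 - k p.1) *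
        (f p.1 (w p.1 p.2) - f p.1 (k p.1))) (M := 2 * M + 2 * C) ?_ ?_ ?_ ?_ H hψ hc hp hs
  · exact (mu.sub mk').abs
  · exact (meas_sign.comp (mu.sub mk')).mul ((mf _ mu).sub (mf _ mk'))
  · intro p; rw [abs_abs]; have := abs_sub (w p.1 p.2) (k p.1); linarith [bw p.1 p.2, bk p.1]
  · intro p
    have h1 := abs_sub (f p.1 (w p.1 p.2)) (f p.1 (k p.1))
    have h2 := bf p.1 _ (bw p.1 p.2)
    have h3 := bf p.1 _ (bk p.1)
    rw [abs_mul]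
    have := mul_le_mul (abs_sign_le (w p.1 p.2 - k p.1)) (h1.trans (add_le_add h2 h3)) (abs_nonneg _) zero_le_one
    linarith

end ABSol

def rmp (c ε x : ℝ) : ℝ := max 0 (min 1 ((x - c) / ε))

lemma rmp_lip (c : ℝ) {ε : ℝ} (hε : 0 < ε) : LipschitzWith (Real.toNNReal ε⁻¹) (rmp c ε) := by
  have h : LipschitzWith (Real.toNNReal ε⁻¹) fun x : ℝ => (x - c) / ε := by
    apply LipschitzWith.of_dist_le_mul
    intro x y
    rw [Real.dist_eq, Real.dist_eq, ← sub_div, abs_div, abs_of_pos hε]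
    rw [Real.coe_toNNReal _ (by positivity)]
    rw [sub_sub_sub_cancel_right, div_eq_inv_mul]
  exact (h.const_min 1).const_max 0

lemma rmp_mem (c ε x : ℝ) : 0 ≤ rmp c ε x ∧ rmp c ε x ≤ 1 :=
  ⟨le_max_left _ _, max_le zero_le_one (min_le_left _ _)⟩

lemma rmp_zero {c ε x : ℝ} (hε : 0 < ε) (h : x ≤ c) : rmp c ε x = 0 :=
  max_eq_left ((min_le_right _ _).trans (div_nonpos_of_nonpos_of_nonneg (by linarith) hε.le))

lemma rmp_one {c ε x : ℝ} (hε : 0 < ε) (h : c + ε ≤ x) : rmp c ε x = 1 := by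
  have : 1 ≤ (x - c) / ε := by rw [le_div_iff₀ hε]; linarith
  rw [rmp, min_eq_left this, max_eq_right zero_le_one]

lemma rmp_anti {b c ε : ℝ} (hε : 0 < ε) (h : b ≤ c) (x : ℝ) : rmp c ε x ≤ rmp b ε x := by
  exact max_le_max le_rfl (min_le_min le_rfl (div_le_div_of_nonneg_right (by linarith) hε.le))

lemma rmp_deriv {c ε x : ℝ} (hε : 0 < ε) (h1 : x ≠ c) (h2 : x ≠ c + ε) :
    deriv (rmp c ε) x = (Ioo c (c + ε)).indicator (fun _ => ε⁻¹) x := by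
  rcases lt_or_gt_of_ne h1 with h | h
  · rw [indicator_of_notMem (by simp [h.le])]
    have : rmp c ε =ᶠ[𝓝 x] fun _ => 0 := by
      filter_upwards [Iio_mem_nhds h] with y hy using rmp_zero hε (le_of_lt hy)
    rw [this.deriv_eq]; simp
  rcases lt_or_gt_of_ne h2 with h' | h'
  · rw [indicator_of_mem (show x ∈ Ioo c (c + ε) from ⟨h, h'⟩)]
    have : rmp c ε =ᶠ[𝓝 x] fun y => (y - c) / ε := by
      filter_upwards [Ioo_mem_nhds h h'] with y hy
      have e1 : 0 ≤ (y - c) / ε := div_nonneg (by linarith [hy.1]) hε.le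
      have e2 : (y - c) / ε ≤ 1 := by rw [div_le_one hε]; linarith [hy.2]
      rw [rmp, min_eq_right e2, max_eq_right e1]
    rw [this.deriv_eq]; simp
  · rw [indicator_of_notMem (by simp [h'.le])]
    have : rmp c ε =ᶠ[𝓝 x] fun _ => 1 := by
      filter_upwards [Ioi_mem_nhds h'] with y hy using rmp_one hε (le_of_lt hy)
    rw [this.deriv_eq]; simp

lemma rmp_deriv_ae (c : ℝ) {ε : ℝ} (hε : 0 < ε) :
    ∀ᵐ x, deriv (rmp c ε) x = (Ioo c (c + ε)).indicator (fun _ => ε⁻¹) x ∧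
      DifferentiableAt ℝ (rmp c ε) x := by
  filter_upwards [(Set.finite_singleton c).countable.ae_notMem volume,
    (Set.finite_singleton (c + ε)).countable.ae_notMem volume, (rmp_lip c hε).ae_differentiableAt]
    with x h1 h2 h3 using ⟨rmp_deriv hε h1 h2, h3⟩

lemma rmp_integral {m : ℝ → ℝ} (c : ℝ) {ε : ℝ} (hε : 0 < ε) :
    ∫ x, m x * deriv (rmp c ε) x = ε⁻¹ * ∫ x in c..c + ε, m x := by
  have : ∫ x, m x * deriv (rmp c ε) x = ∫ x, (Ioo c (c + ε)).indicator (fun x => m x * ε⁻¹) x := by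
    apply integral_congr_ae
    filter_upwards [rmp_deriv_ae c hε] with x h
    rw [h.1]; by_cases hx : x ∈ Ioo c (c + ε) <;> simp [hx]
  rw [this, integral_indicator measurableSet_Ioo, integral_mul_const,
    intervalIntegral.integral_of_le (by linarith), integral_Ioc_eq_integral_Ioo, mul_comm]

lemma rmp_tendsto {m : ℝ → ℝ} {l c : ℝ} (hm : Measurable m)
    (hl : Tendsto m (𝓝[>] c) (𝓝 l)) :
    Tendsto (fun n : ℕ => ∫ x, m x * deriv (rmp c (ν n)) x) atTop (𝓝 l) := by
  have hi : IntervalIntegrable m volume c c := by simp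
  have h1 := intervalIntegral.integral_hasDerivWithinAt_of_tendsto_ae_right (a := c) (s := Ici c) (t := Ioi c) hi
    ⟨univ, univ_mem, hm.aestronglyMeasurable.restrict⟩ (hl.mono_left inf_le_left)
  have h2 := (hasDerivWithinAt_iff_tendsto_slope' (by simp)).mp h1.Ioi_of_Ici
  have h3 : Tendsto (fun n : ℕ => c + ν n) atTop (𝓝[>] c) := by
    refine tendsto_nhdsWithin_iff.mpr ⟨?_, Eventually.of_forall fun n => ?_⟩
    · simpa using tendsto_one_div_add_atTop_nhds_zero_nat.const_add c
    · simp only [mem_Ioi, lt_add_iff_pos_right]; positivity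
  refine (h2.comp h3).congr fun n => ?_
  rw [rmp_integral c (by positivity)]
  simp [slope]
end S3

section S4
open scoped Convolution Topology NNReal

lemma rmp_lim (c x : ℝ) :
    Tendsto (fun n : ℕ => rmp c (ν n) x) atTop (𝓝 ((Ioi c).indicator (fun _ => 1) x)) := by
  rcases le_or_gt x c with h | h
  · rw [indicator_of_notMem (by simpa using h)]
    simp_rw [rmp_zero (show (0:ℝ) < 1 / ((_ : ℕ) + 1) by positivity) h]
    exact tendsto_const_nhds
  · rw [indicator_of_mem (show x ∈ Ioi c from h)]
    have h1 : ∀ᶠ n : ℕ in atTop, ν n < x - c :=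
      tendsto_one_div_add_atTop_nhds_zero_nat.eventually_lt_const (by linarith)
    refine tendsto_const_nhds.congr' ?_
    filter_upwards [h1] with n hn
    rw [rmp_one (by positivity) (by linarith)]

def trp (a b ε x : ℝ) : ℝ := rmp a ε x - rmp b ε x

lemma trp_mem {a b ε : ℝ} (hab : a ≤ b) (hε : 0 < ε) (x : ℝ) : 0 ≤ trp a b ε x ∧ trp a b ε x ≤ 1 := by
  have := rmp_anti hε hab x
  have h1 := rmp_mem a ε x
  have h2 := rmp_mem b ε x
  unfold trp; constructor <;> linarith

lemma trp_lip (a b : ℝ) {ε : ℝ} (hε : 0 < ε) : ∃ K, LipschitzWith K (trp a b ε) :=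
  ⟨_, (rmp_lip a hε).sub (rmp_lip b hε)⟩

lemma trp_zero {a b ε x : ℝ} (hab : a ≤ b) (hε : 0 < ε) (h : x ∉ Icc a (b + ε)) : trp a b ε x = 0 := by
  simp only [mem_Icc, not_and_or, not_le] at h
  unfold trp
  rcases h with h | h
  · rw [rmp_zero hε h.le, rmp_zero hε (by linarith), sub_zero]
  · rw [rmp_one hε (by linarith), rmp_one hε h.le, sub_self]

lemma trp_integrable {a b ε : ℝ} (hab : a ≤ b) (hε : 0 < ε) : Integrable (trp a b ε) := by
  obtain ⟨K, hK⟩ := trp_lip a b hε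
  refine hK.continuous.integrable_of_hasCompactSupport (HasCompactSupport.intro (isCompact_Icc (a := a) (b := b + ε)) fun x hx => ?_)
  exact trp_zero hab hε hx

lemma trp_deriv {a b ε : ℝ} (hε : 0 < ε) :
    ∀ᵐ x, deriv (trp a b ε) x = deriv (rmp a ε) x - deriv (rmp b ε) x := by
  filter_upwards [rmp_deriv_ae a hε, rmp_deriv_ae b hε] with x h1 h2
  exact deriv_sub h1.2 h2.2

lemma rmp_d_integrable {a ε : ℝ} (hε : 0 < ε) : Integrable (deriv (rmp a ε)) := by
  have : Integrable ((Ioo a (a + ε)).indicator (fun _ => ε⁻¹)) :=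
    (integrableOn_const (by simp)).integrable_indicator measurableSet_Ioo
  refine this.congr ?_
  filter_upwards [rmp_deriv_ae a hε] with x h using h.1.symm

lemma trp_int_lim {h : ℝ → ℝ} (hm : Measurable h) {M : ℝ} (hb : ∀ x, |h x| ≤ M) {a b : ℝ} (hab : a ≤ b) :
    Tendsto (fun n : ℕ => ∫ x, h x * trp a b (ν n) x) atTop (𝓝 (∫ x in a..b, h x)) := by
  have e : ∫ x in a..b, h x = ∫ x, h x * ((Ioi a).indicator (fun _ => 1) x - (Ioi b).indicator (fun _ => 1) x) := by
    rw [intervalIntegral.integral_of_le hab, ← integral_indicator measurableSet_Ioc]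
    congr 1; ext x
    simp only [indicator, mem_Ioc, mem_Ioi]
    split_ifs <;> first | (exfalso; linarith) | grind
  rw [e]
  refine tendsto_integral_of_dominated_convergence ((Icc a (b + 1)).indicator fun _ => M) (fun n => ?_) ?_ (fun n => ?_) ?_
  · obtain ⟨K, hK⟩ := trp_lip a b (show (0:ℝ) < ν n by positivity)
    exact (hm.mul hK.continuous.measurable).aestronglyMeasurable
  · exact (integrableOn_const (by simp)).integrable_indicator measurableSet_Icc
  · refine Eventually.of_forall fun x => ?_
    have h0 : (0:ℝ) < ν n := by positivity
    have h1 : ν n ≤ 1 := by rw [div_le_one (by positivity)]; linarith [n.cast_nonneg (α := ℝ)]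
    by_cases hx : x ∈ Icc a (b + 1)
    · rw [indicator_of_mem hx, norm_mul, Real.norm_eq_abs, Real.norm_of_nonneg (trp_mem hab h0 x).1]
      nlinarith [hb x, (trp_mem hab h0 x).2, (trp_mem hab h0 x).1, abs_nonneg (h x)]
    · rw [indicator_of_notMem hx, trp_zero hab h0 (fun h => hx ⟨h.1, h.2.trans (by linarith)⟩)]; simp
  · exact Eventually.of_forall fun x => ((rmp_lim a x).sub (rmp_lim b x)).const_mul _

lemma prod_int {w : ℝ² → ℝ} (mw : Measurable w) {M : ℝ} (bw : ∀ p, |w p| ≤ M) {α χ : ℝ → ℝ}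
    (hα : Integrable α) (hχ : Integrable χ) : Integrable fun p : ℝ² => w p * (α p.1 * χ p.2) :=
  (hα.mul_prod hχ).bdd_mul mw.aestronglyMeasurable (Eventually.of_forall bw)

lemma prod_lip {α χ : ℝ → ℝ} {K L : ℝ≥0} (hα : LipschitzWith K α) (hχ : LipschitzWith L χ)
    (bα : ∀ x, |α x| ≤ 1) (bχ : ∀ x, |χ x| ≤ 1) :
    LipschitzWith (K + L) fun p : ℝ² => α p.1 * χ p.2 := by
  apply LipschitzWith.of_dist_le_mul
  intro p q
  have h1 := hα.dist_le_mul p.1 q.1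
  have h2 := hχ.dist_le_mul p.2 q.2
  have h3 : dist p.1 q.1 ≤ dist p q := le_max_left _ _
  have h4 : dist p.2 q.2 ≤ dist p q := le_max_right _ _
  rw [Real.dist_eq] at h1 h2 ⊢
  have e : α p.1 * χ p.2 - α q.1 * χ q.2 = (α p.1 - α q.1) * χ p.2 + α q.1 * (χ p.2 - χ q.2) := by ring
  rw [e]
  refine (abs_add_le _ _).trans ?_
  rw [abs_mul, abs_mul]
  push_cast
  have h5 : |α p.1 - α q.1| ≤ K * dist p q := h1.trans (by gcongr)
  have h6 : |χ p.2 - χ q.2| ≤ L * dist p q := h2.trans (by gcongr)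
  nlinarith [bα q.1, bχ p.2, abs_nonneg (α p.1 - α q.1), abs_nonneg (χ p.2 - χ q.2), abs_nonneg (α q.1), abs_nonneg (χ p.2)]

lemma prod_int_t {w : ℝ² → ℝ} (mw : Measurable w) {M : ℝ} (bw : ∀ p, |w p| ≤ M) {α χ : ℝ → ℝ}
    (hα : Integrable α) (hχ : Integrable χ) :
    ∫ p : ℝ², w p * (α p.1 * χ p.2) = ∫ t, (∫ x, w (x, t) * α x) * χ t := by
  have := prod_int mw bw hα hχ
  rw [Measure.volume_eq_prod] at this ⊢
  rw [integral_prod_symm _ this]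
  congr 1; ext t
  rw [← integral_mul_const]
  congr 1; ext x; ring

lemma int_t_meas {w : ℝ² → ℝ} (mw : Measurable w) {α : ℝ → ℝ} (hα : Measurable α) :
    Measurable fun t => ∫ x, w (x, t) * α x := by
  have : StronglyMeasurable fun q : ℝ² => w (q.2, q.1) * α q.2 :=
    ((mw.comp measurable_swap).mul (hα.comp measurable_snd)).stronglyMeasurable
  exact this.integral_prod_right.measurable

namespace ABSol
variable {fl fr : ℝ → ℝ} {A B : ℝ} {u0 : ℝ → ℝ}

def P (s : ABSol fl fr A B u0) (x t : ℝ) : ℝ := if 0 < t then s.up x t else 0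
def N (s : ABSol fl fr A B u0) (x t : ℝ) : ℝ := if 0 < t then s.um x t else 0

lemma P_lim (s : ABSol fl fr A B u0) {x t : ℝ} (ht : 0 < t) :
    Tendsto (fun y => s.u y t) (𝓝[>] x) (𝓝 (s.P x t)) := by
  simpa [P, ht] using s.up_spec x t ht

lemma N_lim (s : ABSol fl fr A B u0) {x t : ℝ} (ht : 0 < t) :
    Tendsto (fun y => s.u y t) (𝓝[<] x) (𝓝 (s.N x t)) := by
  simpa [N, ht] using s.um_spec x t ht

lemma P_bdd (s : ABSol fl fr A B u0) {M : ℝ} (hM : ∀ x t, |s.u x t| ≤ M) (x t) : |s.P x t| ≤ M := by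
  rcases lt_or_ge 0 t with h | h
  · exact le_of_tendsto (s.P_lim h).abs (Eventually.of_forall fun y => hM y t)
  · simpa [P, not_lt.mpr h] using (abs_nonneg _).trans (hM 0 0)

lemma N_bdd (s : ABSol fl fr A B u0) {M : ℝ} (hM : ∀ x t, |s.u x t| ≤ M) (x t) : |s.N x t| ≤ M := by
  rcases lt_or_ge 0 t with h | h
  · exact le_of_tendsto (s.N_lim h).abs (Eventually.of_forall fun y => hM y t)
  · simpa [N, not_lt.mpr h] using (abs_nonneg _).trans (hM 0 0)

lemma seqR (x : ℝ) : Tendsto (fun n : ℕ => x + ν n) atTop (𝓝[>] x) := by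
  refine tendsto_nhdsWithin_iff.mpr ⟨?_, Eventually.of_forall fun n => ?_⟩
  · simpa using tendsto_one_div_add_atTop_nhds_zero_nat.const_add x
  · simp only [mem_Ioi, lt_add_iff_pos_right]; positivity

lemma seqL (x : ℝ) : Tendsto (fun n : ℕ => x - ν n) atTop (𝓝[<] x) := by
  refine tendsto_nhdsWithin_iff.mpr ⟨?_, Eventually.of_forall fun n => ?_⟩
  · simpa using tendsto_one_div_add_atTop_nhds_zero_nat.const_sub x
  · simp only [mem_Iio, sub_lt_self_iff]; positivity

lemma P_meas (s : ABSol fl fr A B u0) : Measurable fun p : ℝ² => s.P p.1 p.2 := by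
  refine measurable_of_tendsto_metrizable (f := fun (n : ℕ) (p : ℝ²) =>
    if 0 < p.2 then s.u (p.1 + ν n) p.2 else 0) (fun n => ?_) ?_
  · refine Measurable.ite (measurable_snd measurableSet_Ioi) ?_ measurable_const
    exact s.meas.comp ((measurable_fst.add_const _).prodMk measurable_snd)
  · refine tendsto_pi_nhds.mpr fun p => ?_
    by_cases h : 0 < p.2
    · simpa [h, Function.comp_def] using (s.P_lim h).comp (seqR p.1)
    · simp [h, P]

lemma N_meas (s : ABSol fl fr A B u0) : Measurable fun p : ℝ² => s.N p.1 p.2 := by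
  refine measurable_of_tendsto_metrizable (f := fun (n : ℕ) (p : ℝ²) =>
    if 0 < p.2 then s.u (p.1 - ν n) p.2 else 0) (fun n => ?_) ?_
  · refine Measurable.ite (measurable_snd measurableSet_Ioi) ?_ measurable_const
    exact s.meas.comp ((measurable_fst.sub_const _).prodMk measurable_snd)
  · refine tendsto_pi_nhds.mpr fun p => ?_
    by_cases h : 0 < p.2
    · simpa [h, Function.comp_def] using (s.N_lim h).comp (seqL p.1)
    · simp [h, N]

end ABSol
end S4

section S5
open scoped Convolution Topology NNReal

namespace ABSol
variable {fl fr : ℝ → ℝ} {A B : ℝ} {u0 : ℝ → ℝ}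

lemma slice_meas (s : ABSol fl fr A B u0) (t : ℝ) : Measurable fun x => s.u x t :=
  s.meas.comp (measurable_id.prodMk measurable_const)

lemma slice_ii (s : ABSol fl fr A B u0) (t a b : ℝ) :
    IntervalIntegrable (fun x => s.u x t) volume a b := by
  obtain ⟨M, hM⟩ := s.bdd
  rw [intervalIntegrable_iff]
  exact Measure.integrableOn_of_bounded (M := M) (by simp) (s.slice_meas t).aestronglyMeasurable
    (Eventually.of_forall fun x => hM x t)

lemma dflux_P_lim (s : ABSol fl fr A B u0) (hl : Continuous fl) (hr : Continuous fr) {x t : ℝ} (ht : 0 < t) :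
    Tendsto (fun y => dflux fl fr y (s.u y t)) (𝓝[>] x) (𝓝 (dflux fl fr x (s.P x t))) := by
  rcases lt_or_ge x 0 with h | h
  · have : Tendsto (fun y => fl (s.u y t)) (𝓝[>] x) (𝓝 (fl (s.P x t))) :=
      (hl.tendsto _).comp (s.P_lim ht)
    rw [show dflux fl fr x (s.P x t) = fl (s.P x t) by simp [dflux, h]]
    refine this.congr' ?_
    filter_upwards [nhdsWithin_le_nhds (Iio_mem_nhds h)] with y hy
    simp [dflux, show y < 0 from hy]
  · have : Tendsto (fun y => fr (s.u y t)) (𝓝[>] x) (𝓝 (fr (s.P x t))) :=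
      (hr.tendsto _).comp (s.P_lim ht)
    rw [show dflux fl fr x (s.P x t) = fr (s.P x t) by simp [dflux, h]]
    refine this.congr' ?_
    filter_upwards [self_mem_nhdsWithin] with y hy
    simp [dflux, h.trans (le_of_lt hy)]

def dfluxm (fl fr : ℝ → ℝ) (x u : ℝ) : ℝ := if x ≤ 0 then fl u else fr u

lemma dfluxm_N_lim (s : ABSol fl fr A B u0) (hl : Continuous fl) (hr : Continuous fr) {x t : ℝ} (ht : 0 < t) :
    Tendsto (fun y => dflux fl fr y (s.u y t)) (𝓝[<] x) (𝓝 (dfluxm fl fr x (s.N x t))) := by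
  rcases le_or_gt x 0 with h | h
  · have : Tendsto (fun y => fl (s.u y t)) (𝓝[<] x) (𝓝 (fl (s.N x t))) :=
      (hl.tendsto _).comp (s.N_lim ht)
    rw [show dfluxm fl fr x (s.N x t) = fl (s.N x t) by simp [dfluxm, h]]
    refine this.congr' ?_
    filter_upwards [self_mem_nhdsWithin] with y hy
    simp [dflux, (show y < x from hy).trans_le h]
  · have : Tendsto (fun y => fr (s.u y t)) (𝓝[<] x) (𝓝 (fr (s.N x t))) :=
      (hr.tendsto _).comp (s.N_lim ht)
    rw [show dfluxm fl fr x (s.N x t) = fr (s.N x t) by simp [dfluxm, h]]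
    refine this.congr' ?_
    filter_upwards [nhdsWithin_le_nhds (Ioi_mem_nhds h)] with y hy
    simp [dflux, le_of_lt (show 0 < y from hy)]

lemma box1 (s : ABSol fl fr A B u0) (hl : Continuous fl) (hr : Continuous fr) {a b ε t1 t2 : ℝ} (hab : a ≤ b)
    (hε : 0 < ε) (ht1 : 0 < t1) (ht : t1 ≤ t2) :
    (∫ x, s.u x t1 * trp a b ε x) - (∫ x, s.u x t2 * trp a b ε x) +
      ∫ t in t1..t2, ∫ x, dflux fl fr x (s.u x t) * deriv (trp a b ε) x = 0 := by
  obtain ⟨M, hM, h1, h2⟩ := s.bdd2 hl hr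
  have mu : Measurable fun p : ℝ² => s.u p.1 p.2 := s.meas
  have mF := dflux_meas hl hr mu
  have bF : ∀ p : ℝ², |dflux fl fr p.1 (s.u p.1 p.2)| ≤ M := fun p => by
    unfold dflux; split_ifs
    · exact (h2 _ ⟨_, _, le_rfl⟩).1
    · exact (h2 _ ⟨_, _, le_rfl⟩).2
  obtain ⟨K, hK⟩ := trp_lip a b hε
  have iα := trp_integrable hab hε
  have idα : Integrable (deriv (trp a b ε)) :=
    ((rmp_d_integrable hε).sub (rmp_d_integrable hε)).congr ((trp_deriv hε).mono fun x h => h.symm)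
  set m : ℝ → ℝ := fun t => ∫ x, s.u x t * trp a b ε x with hm
  set h : ℝ → ℝ := fun t => ∫ x, dflux fl fr x (s.u x t) * deriv (trp a b ε) x with hh
  have mm : Measurable m := int_t_meas mu hK.continuous.measurable
  have mh : Measurable h := int_t_meas mF (measurable_deriv _)
  have bh : ∀ t, |h t| ≤ M * ∫ x, |deriv (trp a b ε) x| := fun t => by
    rw [← integral_const_mul, ← Real.norm_eq_abs]
    refine norm_integral_le_of_norm_le (idα.abs.const_mul M) (Eventually.of_forall fun x => ?_)
    rw [norm_mul]
    exact mul_le_mul_of_nonneg_right (bF (x, t)) (abs_nonneg _)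
  have cm : ∀ t, 0 < t → Tendsto m (𝓝[>] t) (𝓝 (m t)) := fun t ht => by
    have c := s.timeCont (|a| + |b + ε|) t ht.le
    have c' := c.mono_left (nhdsWithin_mono t (fun y (hy : t < y) => (ht.trans hy).le))
    rw [tendsto_iff_norm_sub_tendsto_zero]
    refine squeeze_zero (fun _ => norm_nonneg _) (fun t' => ?_) c'
    have ii : ∀ τ, Integrable fun x => s.u x τ * trp a b ε x := fun τ =>
      iα.bdd_mul (s.slice_meas τ).aestronglyMeasurable (Eventually.of_forall fun x => h1 x τ)
    simp only [hm]
    rw [← integral_sub (ii _) (ii _), ← integral_indicator measurableSet_Icc]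
    refine norm_integral_le_of_norm_le ?_ (Eventually.of_forall fun x => ?_)
    · refine IntegrableOn.integrable_indicator ?_ measurableSet_Icc
      refine Measure.integrableOn_of_bounded (M := M + M) (by simp)
        ((s.slice_meas t').sub (s.slice_meas t)).abs.aestronglyMeasurable (Eventually.of_forall fun x => ?_)
      rw [Real.norm_eq_abs, abs_abs]
      exact (abs_sub _ _).trans (add_le_add (h1 _ _) (h1 _ _))
    · rw [← sub_mul, norm_mul, Real.norm_eq_abs, Real.norm_of_nonneg (trp_mem hab hε x).1]
      by_cases hx : x ∈ Icc (-(|a| + |b + ε|)) (|a| + |b + ε|)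
      · rw [indicator_of_mem hx]
        exact mul_le_of_le_one_right (abs_nonneg _) (trp_mem hab hε x).2
      · rw [indicator_of_notMem hx, trp_zero hab hε, mul_zero]
        intro hx'
        exact hx ⟨by linarith [hx'.1, neg_abs_le a, abs_nonneg (b + ε)],
          by linarith [hx'.2, le_abs_self (b + ε), abs_nonneg a]⟩
  have key : ∀ n : ℕ, (∫ t, m t * deriv (rmp t1 (ν n)) t) -
      (∫ t, m t * deriv (rmp t2 (ν n)) t) + ∫ t, h t * trp t1 t2 (ν n) t = 0 := by
    intro n
    set δ : ℝ := ν n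
    have hδ : 0 < δ := by positivity
    obtain ⟨L, hL⟩ := trp_lip t1 t2 hδ
    have iχ := trp_integrable ht hδ
    have b1 : ∀ x, |trp a b ε x| ≤ 1 := fun x => by
      rw [abs_of_nonneg (trp_mem hab hε x).1]; exact (trp_mem hab hε x).2
    have b2 : ∀ x, |trp t1 t2 δ x| ≤ 1 := fun x => by
      rw [abs_of_nonneg (trp_mem ht hδ x).1]; exact (trp_mem ht hδ x).2
    have sub : tsupport (fun p : ℝ² => trp a b ε p.1 * trp t1 t2 δ p.2) ⊆ Icc a (b + ε) ×ˢ Icc t1 (t2 + δ) := by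
      refine closure_minimal (fun p hp => ?_) (isClosed_Icc.prod isClosed_Icc)
      by_contra hc
      rw [mem_prod, not_and_or] at hc
      refine hp ?_
      rcases hc with hc | hc
      · simp [trp_zero hab hε hc]
      · simp [trp_zero ht hδ hc]
    have w := s.weakL hl hr (prod_lip hK hL b1 b2)
      (HasCompactSupport.of_support_subset_isCompact (isCompact_Icc.prod isCompact_Icc)
        ((subset_tsupport _).trans sub)) (fun p => mul_nonneg (trp_mem hab hε _).1 (trp_mem ht hδ _).1)
      (fun p hp => ht1.trans_le (sub hp).2.1)
    have e1 : ∀ p : ℝ², Dt (fun p : ℝ² => trp a b ε p.1 * trp t1 t2 δ p.2) p =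
      trp a b ε p.1 * deriv (trp t1 t2 δ) p.2 := fun p => by
      simp only [Dt]; exact deriv_const_mul_field _
    have e2 : ∀ p : ℝ², Dx (fun p : ℝ² => trp a b ε p.1 * trp t1 t2 δ p.2) p =
      deriv (trp a b ε) p.1 * trp t1 t2 δ p.2 := fun p => by
      simp only [Dx]; exact deriv_mul_const_field _
    have idχ : Integrable (deriv (trp t1 t2 δ)) :=
      ((rmp_d_integrable hδ).sub (rmp_d_integrable hδ)).congr ((trp_deriv hδ).mono fun x h => h.symm)
    simp only [e1, e2] at w
    rw [integral_add (prod_int mu (fun p => h1 _ _) iα idχ) (prod_int mF bF idα iχ),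
      prod_int_t mu (fun p => h1 _ _) iα idχ, prod_int_t mF bF idα iχ] at w
    have bm : ∀ t, ‖m t‖ ≤ M * ∫ x, |trp a b ε x| := fun t => by
      rw [← integral_const_mul]
      refine norm_integral_le_of_norm_le (iα.abs.const_mul M) (Eventually.of_forall fun x => ?_)
      rw [norm_mul]
      exact mul_le_mul_of_nonneg_right (h1 x t) (abs_nonneg _)
    have im : ∀ c, Integrable fun t => m t * deriv (rmp c δ) t := fun c =>
      (rmp_d_integrable hδ).bdd_mul mm.aestronglyMeasurable (Eventually.of_forall bm)
    rw [← integral_sub (im _) (im _)]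
    rw [← w]; congr 1
    apply integral_congr_ae
    filter_upwards [trp_deriv (a := t1) (b := t2) hδ] with t e
    rw [e, mul_sub]
  have L1 := rmp_tendsto mm (cm t1 ht1)
  have L2 := rmp_tendsto mm (cm t2 (ht1.trans_le ht))
  have L3 := trp_int_lim mh bh ht
  have := ((L1.sub L2).add L3).congr key
  exact tendsto_nhds_unique this tendsto_const_nhds
end ABSol
end S5

section S6
open scoped Convolution Topology NNReal

namespace ABSol
variable {fl fr : ℝ → ℝ} {A B : ℝ} {u0 : ℝ → ℝ}

lemma bdd3 (s : ABSol fl fr A B u0) (hl : Continuous fl) (hr : Continuous fr) :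
    ∃ M, 0 ≤ M ∧ (∀ x t, |s.u x t| ≤ M) ∧ (∀ x t, |s.P x t| ≤ M) ∧ (∀ x t, |s.N x t| ≤ M) ∧
      (∀ x y t, |dflux fl fr x (s.u y t)| ≤ M) ∧ (∀ x y t, |dflux fl fr x (s.P y t)| ≤ M) ∧
      (∀ x y t, |dfluxm fl fr x (s.N y t)| ≤ M) := by
  obtain ⟨M, hM⟩ := s.bdd
  obtain ⟨C, hC, h1⟩ := cont_bdd hl M
  obtain ⟨D, hD, h2⟩ := cont_bdd hr M
  have h0 : 0 ≤ M := (abs_nonneg _).trans (hM 0 0)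
  refine ⟨M + C + D, by positivity, fun x t => by linarith [hM x t], fun x t => by linarith [s.P_bdd hM x t],
    fun x t => by linarith [s.N_bdd hM x t], fun x y t => ?_, fun x y t => ?_, fun x y t => ?_⟩
  · unfold dflux; split_ifs <;> linarith [h1 _ (hM y t), h2 _ (hM y t)]
  · unfold dflux; split_ifs <;> linarith [h1 _ (s.P_bdd hM y t), h2 _ (s.P_bdd hM y t)]
  · unfold dfluxm; split_ifs <;> linarith [h1 _ (s.N_bdd hM y t), h2 _ (s.N_bdd hM y t)]

lemma FP_meas (s : ABSol fl fr A B u0) (hl : Continuous fl) (hr : Continuous fr) :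
    Measurable fun p : ℝ² => dflux fl fr p.1 (s.P p.1 p.2) := dflux_meas hl hr s.P_meas

lemma FN_meas (s : ABSol fl fr A B u0) (hl : Continuous fl) (hr : Continuous fr) :
    Measurable fun p : ℝ² => dfluxm fl fr p.1 (s.N p.1 p.2) :=
  Measurable.ite (measurable_fst measurableSet_Iic) (hl.measurable.comp s.N_meas) (hr.measurable.comp s.N_meas)

lemma bdd_ii {h : ℝ → ℝ} (hm : Measurable h) {M : ℝ} (hb : ∀ x, |h x| ≤ M) (a b : ℝ) :
    IntervalIntegrable h volume a b := by
  rw [intervalIntegrable_iff]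
  exact Measure.integrableOn_of_bounded (M := M) (by simp) hm.aestronglyMeasurable (Eventually.of_forall hb)

lemma box2 (s : ABSol fl fr A B u0) (hl : Continuous fl) (hr : Continuous fr) {a b t1 t2 : ℝ} (hab : a ≤ b)
    (ht1 : 0 < t1) (ht : t1 ≤ t2) :
    (∫ x in a..b, s.u x t1) - (∫ x in a..b, s.u x t2) +
      ∫ t in t1..t2, (dflux fl fr a (s.P a t) - dflux fl fr b (s.P b t)) = 0 := by
  obtain ⟨M, hM, bu, bP, bN, bF, bFP, bFN⟩ := s.bdd3 hl hr
  have mu : Measurable fun p : ℝ² => s.u p.1 p.2 := s.meas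
  have mF := dflux_meas hl hr mu
  have L1 := trp_int_lim (s.slice_meas t1) (fun x => bu x t1) hab
  have L2 := trp_int_lim (s.slice_meas t2) (fun x => bu x t2) hab
  have hav : ∀ (n : ℕ) (c t : ℝ), |∫ x, dflux fl fr x (s.u x t) * deriv (rmp c (ν n)) x| ≤ M := by
    intro n c t
    have hδ : (0:ℝ) < ν n := by positivity
    rw [rmp_integral c hδ, abs_mul, abs_of_pos (by positivity)]
    have := intervalIntegral.norm_integral_le_of_norm_le_const (a := c) (b := c + ν n)
      (f := fun x => dflux fl fr x (s.u x t)) (C := M) fun x _ => bF x x t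
    rw [add_sub_cancel_left, abs_of_pos hδ, Real.norm_eq_abs] at this
    calc _ ≤ (ν n)⁻¹ * (M * (ν n)) := by gcongr
      _ = M := by field_simp
  have mslice : ∀ t, Measurable fun x => dflux fl fr x (s.u x t) := fun t =>
    mF.comp (measurable_id.prodMk measurable_const)
  have split : ∀ (n : ℕ) t, ∫ x, dflux fl fr x (s.u x t) * deriv (trp a b (ν n)) x =
      (∫ x, dflux fl fr x (s.u x t) * deriv (rmp a (ν n)) x) -
      ∫ x, dflux fl fr x (s.u x t) * deriv (rmp b (ν n)) x := by
    intro n t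
    have hδ : (0:ℝ) < ν n := by positivity
    have im : ∀ c, Integrable fun x => dflux fl fr x (s.u x t) * deriv (rmp c (ν n)) x := fun c =>
      (rmp_d_integrable hδ).bdd_mul (mslice t).aestronglyMeasurable (Eventually.of_forall fun x => bF x x t)
    rw [← integral_sub (im _) (im _)]
    apply integral_congr_ae
    filter_upwards [trp_deriv (a := a) (b := b) hδ] with t e
    rw [e, mul_sub]
  have L3 : Tendsto (fun n : ℕ => ∫ t in t1..t2, ∫ x, dflux fl fr x (s.u x t) *
      deriv (trp a b (ν n)) x) atTop
      (𝓝 (∫ t in t1..t2, (dflux fl fr a (s.P a t) - dflux fl fr b (s.P b t)))) := by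
    refine intervalIntegral.tendsto_integral_filter_of_dominated_convergence (fun _ => M + M)
      (Eventually.of_forall fun n => ?_) (Eventually.of_forall fun n => Eventually.of_forall fun t _ => ?_)
      (by simp) (Eventually.of_forall fun t htt => ?_)
    · exact (int_t_meas mF (measurable_deriv _)).aestronglyMeasurable
    · rw [split]
      exact (abs_sub _ _).trans (add_le_add (hav _ _ _) (hav _ _ _))
    · rw [uIoc_of_le ht] at htt
      have h0 : 0 < t := ht1.trans htt.1
      simp_rw [split]
      exact (rmp_tendsto (mslice t) (s.dflux_P_lim hl hr h0)).sub
        (rmp_tendsto (mslice t) (s.dflux_P_lim hl hr h0))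
  have := ((L1.sub L2).add L3).congr fun n => s.box1 hl hr hab (by positivity) ht1 ht
  exact tendsto_nhds_unique this tendsto_const_nhds

lemma box3 (s : ABSol fl fr A B u0) (hl : Continuous fl) (hr : Continuous fr) {a b t1 t2 : ℝ} (hab : a ≤ b)
    (ht1 : 0 ≤ t1) (ht : t1 ≤ t2) :
    (∫ x in a..b, s.u x t1) - (∫ x in a..b, s.u x t2) +
      ((∫ t in t1..t2, dflux fl fr a (s.P a t)) - ∫ t in t1..t2, dflux fl fr b (s.P b t)) = 0 := by
  obtain ⟨M, hM, bu, bP, bN, bF, bFP, bFN⟩ := s.bdd3 hl hr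
  have mP : ∀ c, Measurable fun t => dflux fl fr c (s.P c t) := fun c =>
    (s.FP_meas hl hr).comp (measurable_const.prodMk measurable_id)
  have ii : ∀ c x y, IntervalIntegrable (fun t => dflux fl fr c (s.P c t)) volume x y := fun c x y =>
    bdd_ii (mP c) (fun t => bFP c c t) x y
  rw [← intervalIntegral.integral_sub (ii _ _ _) (ii _ _ _)]
  rcases ht1.eq_or_lt with h | h
  swap
  · exact s.box2 hl hr hab h ht
  subst h
  rcases ht.eq_or_lt with h | h
  · subst h; simp
  have c1 : Tendsto (fun t => ∫ x in a..b, s.u x t) (𝓝[>] 0) (𝓝 (∫ x in a..b, s.u x 0)) := by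
    have c := (s.timeCont (|a| + |b|) 0 le_rfl).mono_left (nhdsWithin_mono 0 (Ioi_subset_Ici_self))
    rw [tendsto_iff_norm_sub_tendsto_zero]
    refine squeeze_zero (fun _ => norm_nonneg _) (fun t' => ?_) c
    rw [← intervalIntegral.integral_sub (s.slice_ii _ _ _) (s.slice_ii _ _ _), intervalIntegral.integral_of_le hab]
    refine (norm_integral_le_integral_norm _).trans (setIntegral_mono_set ?_ ?_ ?_)
    · refine Measure.integrableOn_of_bounded (M := M + M) (by simp)
        ((s.slice_meas t').sub (s.slice_meas 0)).abs.aestronglyMeasurable (Eventually.of_forall fun x => ?_)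
      rw [norm_norm]
      exact (abs_sub _ _).trans (add_le_add (bu _ _) (bu _ _))
    · exact Eventually.of_forall fun x => abs_nonneg _
    · refine Eventually.of_forall fun x (hx : x ∈ Ioc a b) => ?_
      exact ⟨by linarith [hx.1, neg_abs_le a, abs_nonneg b], by linarith [hx.2, le_abs_self b, abs_nonneg a]⟩
  have c2 : Tendsto (fun t => ∫ τ in t..t2, (dflux fl fr a (s.P a τ) - dflux fl fr b (s.P b τ))) (𝓝[>] 0)
      (𝓝 (∫ τ in (0:ℝ)..t2, (dflux fl fr a (s.P a τ) - dflux fl fr b (s.P b τ)))) := by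
    have := (intervalIntegral.continuous_primitive (fun x y => (ii a x y).sub (ii b x y)) t2).neg.tendsto 0
    simp only [intervalIntegral.integral_symm t2]
    exact this.mono_left nhdsWithin_le_nhds
  have := ((c1.sub_const (∫ x in a..b, s.u x t2)).add c2)
  refine tendsto_nhds_unique (this.congr' (f₂ := fun _ => 0) ?_) tendsto_const_nhds
  filter_upwards [Ioo_mem_nhdsGT h] with t ht'
  exact s.box2 hl hr hab ht'.1 ht'.2.le

structure Pot (s : ABSol fl fr A B u0) (U : ℝ² → ℝ) : Prop where
  lip : ∃ K, LipschitzWith K U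
  incx : ∀ t, 0 ≤ t → ∀ x y, U (y, t) - U (x, t) = ∫ z in x..y, s.u z t
  incP : ∀ x t1 t2, 0 ≤ t1 → t1 ≤ t2 → U (x, t2) - U (x, t1) = - ∫ t in t1..t2, dflux fl fr x (s.P x t)
  incN : ∀ x t1 t2, 0 ≤ t1 → t1 ≤ t2 → U (x, t2) - U (x, t1) = - ∫ t in t1..t2, dfluxm fl fr x (s.N x t)

lemma exists_pot (s : ABSol fl fr A B u0) (hl : Continuous fl) (hr : Continuous fr) : ∃ U, s.Pot U := by
  obtain ⟨M, hM, bu, bP, bN, bF, bFP, bFN⟩ := s.bdd3 hl hr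
  have mP : ∀ c, Measurable fun t => dflux fl fr c (s.P c t) := fun c =>
    (s.FP_meas hl hr).comp (measurable_const.prodMk measurable_id)
  have ii : ∀ c x y, IntervalIntegrable (fun t => dflux fl fr c (s.P c t)) volume x y := fun c x y =>
    bdd_ii (mP c) (fun t => bFP c c t) x y
  let U : ℝ² → ℝ := fun p => (∫ z in (0:ℝ)..p.1, s.u z (max p.2 0)) - ∫ t in (0:ℝ)..(max p.2 0), dflux fl fr 0 (s.P 0 t)
  have X : ∀ t x y, U (y, t) - U (x, t) = ∫ z in x..y, s.u z (max t 0) := fun t x y => by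
    simp only [U]
    rw [← intervalIntegral.integral_interval_sub_left (s.slice_ii _ 0 y) (s.slice_ii _ 0 x)]; ring
  have PP : ∀ x t1 t2, 0 ≤ t1 → t1 ≤ t2 → U (x, t2) - U (x, t1) = - ∫ t in t1..t2, dflux fl fr x (s.P x t) := by
    intro x t1 t2 h1 h2
    simp only [U, max_eq_left h1, max_eq_left (h1.trans h2)]
    have e := intervalIntegral.integral_interval_sub_left (ii 0 0 t2) (ii 0 0 t1)
    rcases le_total 0 x with h | h
    · have := s.box3 hl hr h h1 h2
      linarith
    · have := s.box3 hl hr h h1 h2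
      rw [intervalIntegral.integral_symm 0 x, intervalIntegral.integral_symm 0 x] at this
      linarith
  refine ⟨U, ⟨Real.toNNReal (2 * M), ?_⟩, fun t ht x y => by simpa [ht] using X t x y, PP, ?_⟩
  · apply LipschitzWith.of_dist_le_mul
    intro p q
    rw [Real.coe_toNNReal _ (by positivity)]
    have h3 : |p.1 - q.1| ≤ dist p q := le_max_left _ _
    have h4 : |p.2 - q.2| ≤ dist p q := le_max_right _ _
    have e1 : |U p - U (q.1, p.2)| ≤ M * |p.1 - q.1| := by
      rw [show U p = U (p.1, p.2) from rfl, X, ← Real.norm_eq_abs]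
      exact intervalIntegral.norm_integral_le_of_norm_le_const fun x _ => bu x _
    have e2 : ∀ t1 t2, 0 ≤ t1 → t1 ≤ t2 → |U (q.1, t2) - U (q.1, t1)| ≤ M * |t2 - t1| := fun t1 t2 h1 h2 => by
      rw [PP _ _ _ h1 h2, abs_neg, ← Real.norm_eq_abs]
      exact intervalIntegral.norm_integral_le_of_norm_le_const fun x _ => bFP _ _ x
    have e3 : |U (q.1, p.2) - U q| ≤ M * |p.2 - q.2| := by
      have hU : ∀ t, U (q.1, t) = U (q.1, max t 0) := fun t => by simp [U]
      rw [show U q = U (q.1, q.2) from rfl, hU p.2, hU q.2]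
      have := abs_max_sub_max_le_abs p.2 q.2 0
      refine le_trans ?_ (mul_le_mul_of_nonneg_left this hM)
      rcases le_total (max p.2 0) (max q.2 0) with h | h
      · rw [abs_sub_comm, abs_sub_comm (max p.2 0)]; exact e2 _ _ (le_max_right _ _) h
      · exact e2 _ _ (le_max_right _ _) h
    rw [Real.dist_eq]
    have := abs_sub_le (U p) (U (q.1, p.2)) (U q)
    nlinarith
  · intro x t1 t2 h1 h2
    have L1 : Tendsto (fun n : ℕ => - ∫ t in t1..t2, dflux fl fr (x - ν n) (s.P (x - ν n) t)) atTop
        (𝓝 (- ∫ t in t1..t2, dfluxm fl fr x (s.N x t))) := by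
      refine (intervalIntegral.tendsto_integral_filter_of_dominated_convergence (fun _ => M)
        (Eventually.of_forall fun n => ?_) (Eventually.of_forall fun n => Eventually.of_forall fun t _ => ?_)
        (by simp) (Eventually.of_forall fun t htt => ?_)).neg
      · exact (mP _).aestronglyMeasurable
      · exact bFP _ _ _
      · rw [uIoc_of_le h2] at htt
        have h0 : 0 < t := h1.trans_lt htt.1
        have L := s.dfluxm_N_lim hl hr (x := x) h0
        rw [Metric.tendsto_nhds] at L ⊢
        intro ε hε
        have := L (ε / 2) (by positivity)
        have := (eventually_eventually_nhdsWithin.mpr this)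
        have := (seqL x).eventually (this.and self_mem_nhdsWithin)
        filter_upwards [this] with n hn
        have R := s.dflux_P_lim hl hr (x := x - ν n) h0
        have hn' : ∀ᶠ y in 𝓝[>] (x - ν n), dist (dflux fl fr y (s.u y t)) (dfluxm fl fr x (s.N x t)) < ε / 2 := by
          have h5 := hn.1
          rw [(isOpen_Iio.nhdsWithin_eq hn.2)] at h5
          exact h5.filter_mono nhdsWithin_le_nhds
        have := le_of_tendsto (R.dist tendsto_const_nhds) (hn'.mono fun y hy => hy.le)
        linarith
    have L2 : Tendsto (fun n : ℕ => U (x - ν n, t2) - U (x - ν n, t1)) atTop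
        (𝓝 (U (x, t2) - U (x, t1))) := by
      have c : ∀ t, Continuous fun y => U (y, t) := fun t => by
        simp only [U]
        exact (intervalIntegral.continuous_primitive (fun a b => s.slice_ii _ a b) 0).sub continuous_const
      have := tendsto_nhdsWithin_iff.mp (seqL x)
      exact (((c t2).tendsto x).comp this.1).sub (((c t1).tendsto x).comp this.1)
    exact tendsto_nhds_unique (L2.congr fun n => PP _ _ _ h1 h2) L1

end ABSol
end S6

section S7
open scoped Convolution Topology NNReal

lemma lip_ftc {g : ℝ → ℝ} {K : ℝ≥0} (hg : LipschitzWith K g) (a b : ℝ) : ∫ t in a..b, deriv g t = g b - g a :=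
  (hg.lipschitzOnWith.absolutelyContinuousOnInterval (a := a) (b := b)).integral_deriv_eq_sub

lemma ae_of_slices {p : ℝ² → Prop} (hp : MeasurableSet {x | p x}) (h : ∀ t, ∀ᵐ x, p (x, t)) : ∀ᵐ z : ℝ², p z := by
  rw [Measure.volume_eq_prod, Measure.ae_prod_iff_ae_ae hp]
  exact (Measure.ae_ae_comm (p := fun x t => p (x, t)) hp).mpr (Eventually.of_forall h)

lemma ae_path {p : ℝ² → Prop} (h : ∀ᵐ z : ℝ², p z) {ζ : ℝ → ℝ} (hζ : Measurable ζ) :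
    ∀ᵐ z : ℝ, ∀ᵐ t : ℝ, p (ζ t - z, t) := by
  obtain ⟨S, hS, mS, S0⟩ := exists_measurable_superset_of_null (ae_iff.mp h)
  have hS' : ∀ q, q ∉ S → p q := fun q hq => by_contra fun h' => hq (hS h')
  have m1 : MeasurableSet {q : ℝ² | (q.1, q.2) ∉ S} := mS.compl
  have h1 : ∀ᵐ q : ℝ², q ∉ S := compl_mem_ae_iff.mpr S0
  rw [Measure.volume_eq_prod, Measure.ae_prod_iff_ae_ae mS.compl,
    Measure.ae_ae_comm (p := fun x t => (x, t) ∉ S) m1] at h1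
  have h2 : ∀ᵐ t : ℝ, ∀ᵐ z : ℝ, (ζ t - z, t) ∉ S := by
    filter_upwards [h1] with t ht
    exact (Measure.measurePreserving_sub_left volume (ζ t)).quasiMeasurePreserving.ae ht
  have m2 : MeasurableSet {q : ℝ² | (ζ q.1 - q.2, q.1) ∉ S} :=
    (((hζ.comp measurable_fst).sub measurable_snd).prodMk measurable_fst) mS.compl
  rw [Measure.ae_ae_comm (p := fun t z => (ζ t - z, t) ∉ S) m2] at h2
  filter_upwards [h2] with z hz
  filter_upwards [hz] with t ht using hS' _ ht

def AeD (U w F : ℝ² → ℝ) : Prop := ∀ᵐ p : ℝ², 0 < p.2 →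
  ∃ L : ℝ² →L[ℝ] ℝ, HasFDerivAt U L p ∧ ∀ a b, L (a, b) = w p * a - F p * b

lemma AeD.mk {U w F : ℝ² → ℝ} {K : ℝ≥0} (hU : LipschitzWith K U)
    (h1 : ∀ᵐ p : ℝ², 0 < p.2 → Dx U p = w p) (h2 : ∀ᵐ p : ℝ², 0 < p.2 → Dt U p = - F p) : AeD U w F := by
  unfold AeD
  filter_upwards [hU.ae_differentiableAt, h1, h2] with p d e1 e2 hp
  refine ⟨fderiv ℝ U p, d.hasFDerivAt, fun a b => ?_⟩
  have : ((a, b) : ℝ²) = a • (1, 0) + b • (0, 1) := by ext <;> simp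
  rw [this, map_add, map_smul, map_smul, ← d.lineDeriv_eq_fderiv, ← d.lineDeriv_eq_fderiv, line_x, line_t, e1 hp, e2 hp]
  simp; ring

lemma AeD.path {U w F : ℝ² → ℝ} {K : ℝ≥0} (hU : LipschitzWith K U) (h : AeD U w F)
    {ζ : ℝ → ℝ} {K' : ℝ≥0} (hζ : LipschitzWith K' ζ) : ∀ᵐ z : ℝ, ∀ a b, 0 ≤ a → a ≤ b →
    U (ζ b - z, b) - U (ζ a - z, a) = ∫ t in a..b, (w (ζ t - z, t) * deriv ζ t - F (ζ t - z, t)) := by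
  filter_upwards [ae_path h hζ.continuous.measurable] with z hz a b ha hab
  have hl : LipschitzWith (K * max K' 1) fun t => U (ζ t - z, t) := by
    refine hU.comp (LipschitzWith.prodMk ?_ LipschitzWith.id)
    simpa using hζ.sub (LipschitzWith.const z)
  rw [← lip_ftc hl]
  refine intervalIntegral.integral_congr_ae ?_
  filter_upwards [hz, hζ.ae_differentiableAt] with t ht d hm
  rw [uIoc_of_le hab] at hm
  obtain ⟨L, hL, e⟩ := ht (ha.trans_lt hm.1)
  have d2 : HasDerivAt (fun t => (ζ t - z, t)) (deriv ζ t, 1) t :=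
    (d.hasDerivAt.sub_const z).prodMk (hasDerivAt_id t)
  have := (HasFDerivAt.comp_hasDerivAt (f := fun t => (ζ t - z, t)) t hL d2).deriv
  rw [Function.comp_def] at this
  rw [this, e, mul_one]

lemma ae_seq_right {p : ℝ → Prop} (h : ∀ᵐ z, p z) : ∃ z : ℕ → ℝ, (∀ n, p (z n)) ∧ Tendsto z atTop (𝓝[>] 0) := by
  have : ∀ n : ℕ, ∃ z, p z ∧ 0 < z ∧ z < ν n := fun n => by
    by_contra hc
    push Not at hc
    have h0 : volume (Ioo (0:ℝ) (ν n)) = 0 :=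
      measure_mono_null (t := {z | ¬ p z}) (fun z hz h' => absurd (hc z h' hz.1) (not_le.mpr hz.2)) (ae_iff.mp h)
    simp at h0; linarith [n.cast_nonneg (α := ℝ)]
  choose z h1 h2 h3 using this
  refine ⟨z, h1, tendsto_nhdsWithin_iff.mpr ⟨?_, Eventually.of_forall h2⟩⟩
  exact squeeze_zero (fun n => (h2 n).le) (fun n => (h3 n).le) tendsto_one_div_add_atTop_nhds_zero_nat

namespace ABSol
variable {fl fr : ℝ → ℝ} {A B : ℝ} {u0 : ℝ → ℝ} {s : ABSol fl fr A B u0} {U : ℝ² → ℝ}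

lemma Pot.hdx (h : s.Pot U) {t : ℝ} (ht : 0 ≤ t) :
    ∀ᵐ x, HasDerivAt (fun y => U (y, t)) (s.u x t) x := by
  have li : LocallyIntegrable (fun x => s.u x t) volume := by
    obtain ⟨M, hM⟩ := s.bdd
    intro x
    refine ⟨Icc (x - 1) (x + 1), Icc_mem_nhds (by linarith) (by linarith), ?_⟩
    exact Measure.integrableOn_of_bounded (M := M) (by simp) (s.slice_meas t).aestronglyMeasurable
      (Eventually.of_forall fun x => hM x t)
  filter_upwards [LocallyIntegrable.ae_hasDerivAt_integral li] with x hx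
  have := (hx 0).add_const (U (0, t))
  refine this.congr_of_eventuallyEq (Eventually.of_forall fun y => ?_)
  have := h.incx t ht 0 y
  show U (y, t) = _; linarith

lemma Pot.hdP (h : s.Pot U) {t : ℝ} (ht : 0 < t) (x : ℝ) :
    HasDerivWithinAt (fun y => U (y, t)) (s.P x t) (Ici x) x := by
  have h1 := intervalIntegral.integral_hasDerivWithinAt_of_tendsto_ae_right (a := x) (b := x) (s := Ici x) (t := Ioi x)
    (s.slice_ii t x x) ⟨univ, univ_mem, (s.slice_meas t).aestronglyMeasurable.restrict⟩ ((s.P_lim ht).mono_left inf_le_left)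
  refine (h1.add_const (U (x, t))).congr (fun y _ => ?_) ?_
  · have := h.incx t ht.le x y; show U (y, t) = _; linarith
  · simp


lemma Pot.uP (h : s.Pot U) {t : ℝ} (ht : 0 < t) : ∀ᵐ x, s.u x t = s.P x t := by
  filter_upwards [h.hdx ht.le] with x hx
  exact (uniqueDiffWithinAt_Ici x).eq_deriv _ hx.hasDerivWithinAt (h.hdP ht x)

lemma Pot.aeD (h : s.Pot U) (hl : Continuous fl) (hr : Continuous fr) :
    AeD U (fun p => s.u p.1 p.2) (fun p => dflux fl fr p.1 (s.u p.1 p.2)) := by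
  obtain ⟨M, hM, bu, bP, bN, bF, bFP, bFN⟩ := s.bdd3 hl hr
  obtain ⟨K, hK⟩ := h.lip
  have mu : Measurable fun p : ℝ² => s.u p.1 p.2 := s.meas
  have mF := dflux_meas hl hr mu
  have mpos : MeasurableSet {p : ℝ² | 0 < p.2} := measurable_snd measurableSet_Ioi
  have mP : ∀ c, Measurable fun t => dflux fl fr c (s.P c t) := fun c =>
    (s.FP_meas hl hr).comp (measurable_const.prodMk measurable_id)
  refine AeD.mk hK (ae_of_slices ?_ fun t => ?_) ?_
  · simp only [imp_iff_not_or]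
    exact mpos.compl.union (measurableSet_eq_fun (Dx_meas hK.continuous) mu)
  · by_cases ht : 0 < t
    · filter_upwards [h.hdx ht.le] with x hx _ using hx.deriv
    · exact Eventually.of_forall fun x h' => absurd h' ht
  · have e1 : ∀ᵐ p : ℝ², 0 < p.2 → s.u p.1 p.2 = s.P p.1 p.2 := by
      refine ae_of_slices ?_ fun t => ?_
      · simp only [imp_iff_not_or]
        exact mpos.compl.union (measurableSet_eq_fun mu s.P_meas)
      · by_cases ht : 0 < t
        · filter_upwards [h.uP ht] with x hx _ using hx
        · exact Eventually.of_forall fun x h' => absurd h' ht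
    have e2 : ∀ᵐ p : ℝ², 0 < p.2 → Dt U p = - dflux fl fr p.1 (s.P p.1 p.2) := by
      rw [Measure.volume_eq_prod, Measure.ae_prod_iff_ae_ae]
      · refine Eventually.of_forall fun x => ?_
        have li : LocallyIntegrable (fun t => dflux fl fr x (s.P x t)) volume := by
          intro y
          refine ⟨Icc (y - 1) (y + 1), Icc_mem_nhds (by linarith) (by linarith), ?_⟩
          exact Measure.integrableOn_of_bounded (M := M) (by simp) (mP x).aestronglyMeasurable
            (Eventually.of_forall fun t => bFP x x t)
        filter_upwards [LocallyIntegrable.ae_hasDerivAt_integral li] with t hd ht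
        have := (hd 0).neg.add_const (U (x, 0))
        refine (this.congr_of_eventuallyEq ?_).deriv
        filter_upwards [Ioi_mem_nhds ht] with t' ht'
        have := h.incP x 0 t' le_rfl (le_of_lt ht')
        simp only [Pi.neg_apply]; linarith
      · simp only [imp_iff_not_or]
        exact mpos.compl.union (measurableSet_eq_fun (Dt_meas hK.continuous) (s.FP_meas hl hr).neg)
    filter_upwards [e1, e2] with p h1 h2 hp
    rw [h2 hp, h1 hp]

lemma Pot.pathN (h : s.Pot U) (hl : Continuous fl) (hr : Continuous fr)
    {ζ : ℝ → ℝ} {K : ℝ≥0} (hζ : LipschitzWith K ζ) {a b : ℝ} (ha : 0 ≤ a) (hab : a ≤ b) :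
    U (ζ b, b) - U (ζ a, a) = ∫ t in a..b, (s.N (ζ t) t * deriv ζ t - dfluxm fl fr (ζ t) (s.N (ζ t) t)) := by
  obtain ⟨M, hM, bu, bP, bN, bF, bFP, bFN⟩ := s.bdd3 hl hr
  obtain ⟨K', hK⟩ := h.lip
  have mu : Measurable fun p : ℝ² => s.u p.1 p.2 := s.meas
  have mF := dflux_meas hl hr mu
  have mζ := hζ.continuous.measurable
  obtain ⟨z, hz, hz0⟩ := ae_seq_right ((h.aeD hl hr).path hK hζ)
  have L1 : Tendsto (fun n => U (ζ b - z n, b) - U (ζ a - z n, a)) atTop (𝓝 (U (ζ b, b) - U (ζ a, a))) := by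
    have z0 := (tendsto_nhdsWithin_iff.mp hz0).1
    have : ∀ c d, Tendsto (fun n => U (c - z n, d)) atTop (𝓝 (U (c, d))) := fun c d => by
      refine (hK.continuous.tendsto _).comp ?_
      refine Tendsto.prodMk_nhds ?_ tendsto_const_nhds
      simpa using z0.const_sub c
    exact (this _ _).sub (this _ _)
  refine tendsto_nhds_unique (L1.congr fun n => hz n a b ha hab) ?_
  refine intervalIntegral.tendsto_integral_filter_of_dominated_convergence (fun _ => M * K + M)
    (Eventually.of_forall fun n => ?_) (Eventually.of_forall fun n => Eventually.of_forall fun t _ => ?_)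
    (by simp) (Eventually.of_forall fun t htt => ?_)
  · have m : Measurable fun t => (ζ t - z n, t) := (mζ.sub_const _).prodMk measurable_id
    exact (((mu.comp m).mul (measurable_deriv _)).sub (mF.comp m)).aestronglyMeasurable
  · refine (abs_sub _ _).trans (add_le_add ?_ (bF _ _ _))
    rw [abs_mul]
    exact mul_le_mul (bu _ _) (norm_deriv_le_of_lipschitz hζ) (abs_nonneg _) hM
  · rw [uIoc_of_le hab] at htt
    have h0 : 0 < t := ha.trans_lt htt.1
    have zl : Tendsto (fun n => ζ t - z n) atTop (𝓝[<] (ζ t)) := by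
      have := tendsto_nhdsWithin_iff.mp hz0
      refine tendsto_nhdsWithin_iff.mpr ⟨by simpa using this.1.const_sub (ζ t), this.2.mono fun n hn => ?_⟩
      have : 0 < z n := hn
      simp [this]
    exact (((s.N_lim h0).comp zl).mul_const _).sub ((s.dfluxm_N_lim hl hr h0).comp zl)

lemma Pot.pathP (h : s.Pot U) (hl : Continuous fl) (hr : Continuous fr)
    {ζ : ℝ → ℝ} {K : ℝ≥0} (hζ : LipschitzWith K ζ) {a b : ℝ} (ha : 0 ≤ a) (hab : a ≤ b) :
    U (ζ b, b) - U (ζ a, a) = ∫ t in a..b, (s.P (ζ t) t * deriv ζ t - dflux fl fr (ζ t) (s.P (ζ t) t)) := by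
  obtain ⟨M, hM, bu, bP, bN, bF, bFP, bFN⟩ := s.bdd3 hl hr
  obtain ⟨K', hK⟩ := h.lip
  have mu : Measurable fun p : ℝ² => s.u p.1 p.2 := s.meas
  have mF := dflux_meas hl hr mu
  have mζ := hζ.continuous.measurable
  obtain ⟨z, hz, hz0⟩ := ae_seq_right ((Measure.measurePreserving_neg volume).quasiMeasurePreserving.ae
    ((h.aeD hl hr).path hK hζ))
  simp only [sub_neg_eq_add] at hz
  have L1 : Tendsto (fun n => U (ζ b + z n, b) - U (ζ a + z n, a)) atTop (𝓝 (U (ζ b, b) - U (ζ a, a))) := by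
    have z0 := (tendsto_nhdsWithin_iff.mp hz0).1
    have : ∀ c d, Tendsto (fun n => U (c + z n, d)) atTop (𝓝 (U (c, d))) := fun c d => by
      refine (hK.continuous.tendsto _).comp ?_
      refine Tendsto.prodMk_nhds ?_ tendsto_const_nhds
      simpa using z0.const_add c
    exact (this _ _).sub (this _ _)
  refine tendsto_nhds_unique (L1.congr fun n => hz n a b ha hab) ?_
  refine intervalIntegral.tendsto_integral_filter_of_dominated_convergence (fun _ => M * K + M)
    (Eventually.of_forall fun n => ?_) (Eventually.of_forall fun n => Eventually.of_forall fun t _ => ?_)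
    (by simp) (Eventually.of_forall fun t htt => ?_)
  · have m : Measurable fun t => (ζ t + z n, t) := (mζ.add_const _).prodMk measurable_id
    exact (((mu.comp m).mul (measurable_deriv _)).sub (mF.comp m)).aestronglyMeasurable
  · refine (abs_sub _ _).trans (add_le_add ?_ (bF _ _ _))
    rw [abs_mul]
    exact mul_le_mul (bu _ _) (norm_deriv_le_of_lipschitz hζ) (abs_nonneg _) hM
  · rw [uIoc_of_le hab] at htt
    have h0 : 0 < t := ha.trans_lt htt.1
    have zl : Tendsto (fun n => ζ t + z n) atTop (𝓝[>] (ζ t)) := by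
      have := tendsto_nhdsWithin_iff.mp hz0
      refine tendsto_nhdsWithin_iff.mpr ⟨by simpa using this.1.const_add (ζ t), this.2.mono fun n hn => ?_⟩
      have : 0 < z n := hn
      simp [this]
    exact (((s.P_lim h0).comp zl).mul_const _).sub ((s.dflux_P_lim hl hr h0).comp zl)

end ABSol
end S7

section S8
open scoped Convolution Topology NNReal

lemma rmp_tendsto_left {m : ℝ → ℝ} {l : ℝ} (hm : Measurable m) (hl : Tendsto m (𝓝[<] 0) (𝓝 l)) :
    Tendsto (fun n : ℕ => ∫ x, m x * deriv (rmp (-(ν n)) (ν n)) x) atTop (𝓝 l) := by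
  have h := rmp_tendsto (m := fun x => m (-x)) (l := l) (c := 0) (hm.comp measurable_neg)
    (hl.comp (by simpa using tendsto_neg_nhdsGT (a := (0:ℝ))))
  refine h.congr fun n => ?_
  have hε : 0 < ν n := by positivity
  rw [rmp_integral _ hε, rmp_integral _ hε, intervalIntegral.integral_comp_neg]
  simp

lemma ae_of_int {h : ℝ → ℝ} (hm : Measurable h) {M : ℝ} (hb : ∀ x, |h x| ≤ M)
    (H : ∀ a b, 0 < a → a ≤ b → 0 ≤ ∫ t in a..b, h t) : ∀ᵐ t, 0 < t → 0 ≤ h t := by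
  have li : LocallyIntegrable h volume := by
    intro x
    refine ⟨Icc (x - 1) (x + 1), Icc_mem_nhds (by linarith) (by linarith), ?_⟩
    exact Measure.integrableOn_of_bounded (M := M) (by simp) hm.aestronglyMeasurable (Eventually.of_forall hb)
  filter_upwards [LocallyIntegrable.ae_hasDerivAt_integral li] with t hd ht
  have h1 := (hasDerivAt_iff_tendsto_slope.mp (hd t)).mono_left
    (nhdsWithin_mono (s := Ioi t) t (fun y (hy : t < y) => ne_of_gt hy))
  refine ge_of_tendsto h1 (eventually_nhdsWithin_of_forall fun y (hy : t < y) => ?_)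
  rw [slope_def_field, intervalIntegral.integral_same, sub_zero]
  exact div_nonneg (H t y ht hy.le) (by linarith)

lemma deriv_zero_ae (ζ : ℝ → ℝ) : ∀ᵐ t, ζ t = 0 → deriv ζ t = 0 := by
  have c := (countable_setOfPred_isolated_right_within (s := {t | ζ t = 0})).ae_notMem volume
  filter_upwards [c] with t ht h0
  by_cases d : DifferentiableAt ℝ ζ t
  · have hne : NeBot (𝓝[{t | ζ t = 0} ∩ Ioi t] t) := ⟨fun h => ht ⟨h0, h⟩⟩
    have h1 := (hasDerivAt_iff_tendsto_slope.mp d.hasDerivAt).mono_left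
      (nhdsWithin_mono (s := {t | ζ t = 0} ∩ Ioi t) t (fun y hy => ne_of_gt hy.2))
    refine tendsto_nhds_unique h1 (tendsto_const_nhds.congr' ?_)
    filter_upwards [self_mem_nhdsWithin] with y hy
    have hy0 : ζ y = 0 := hy.1
    simp [slope_def_field, hy0, h0]
  · exact deriv_zero_of_not_differentiableAt d

def qq (f : ℝ → ℝ) (k u : ℝ) : ℝ := Real.sign (u - k) * (f u - f k)

lemma qq_cont {f : ℝ → ℝ} (hf : Continuous f) (k : ℝ) : Continuous (qq f k) := by
  have e : qq f k = fun u => if u ≤ k then -(f u - f k) else f u - f k := by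
    ext u
    rcases lt_trichotomy u k with h | h | h
    · simp [qq, Real.sign_of_neg (sub_neg.mpr h), h.le]
    · simp [qq, h]
    · simp [qq, Real.sign_of_pos (sub_pos.mpr h), not_le.mpr h]
  rw [e]
  refine Continuous.if_le (by fun_prop) (by fun_prop) continuous_id continuous_const ?_
  intro x hx; simp [show x = k from hx]

structure Dat (fl fr : ℝ → ℝ) (A B a γ : ℝ) : Prop where
  l : CF fl a
  r : CF fr a
  fA : fl A = γ
  fB : fr B = γ
  dA : deriv fl A ≤ 0
  dB : 0 ≤ deriv fr B

namespace ABSol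
variable {fl fr : ℝ → ℝ} {A B : ℝ} {u0 : ℝ → ℝ} {s : ABSol fl fr A B u0} {U : ℝ² → ℝ}

lemma Pot.trace_eq (h : s.Pot U) (hl : Continuous fl) (hr : Continuous fr) :
    ∀ᵐ t, 0 < t → fl (s.N 0 t) = fr (s.P 0 t) := by
  obtain ⟨M, hM, bu, bP, bN, bF, bFP, bFN⟩ := s.bdd3 hl hr
  have mP : Measurable fun t => dflux fl fr 0 (s.P 0 t) :=
    (s.FP_meas hl hr).comp (measurable_const.prodMk measurable_id)
  have mN : Measurable fun t => dfluxm fl fr 0 (s.N 0 t) :=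
    (s.FN_meas hl hr).comp (measurable_const.prodMk measurable_id)
  have iP := bdd_ii mP (fun t => bFP 0 0 t)
  have iN := bdd_ii mN (fun t => bFN 0 0 t)
  have e : ∀ a b, 0 < a → a ≤ b → (∫ t in a..b, dflux fl fr 0 (s.P 0 t)) = ∫ t in a..b, dfluxm fl fr 0 (s.N 0 t) :=
    fun a b ha hb => by linarith [h.incP 0 a b ha.le hb, h.incN 0 a b ha.le hb]
  have b1 : ∀ t, |dflux fl fr 0 (s.P 0 t) - dfluxm fl fr 0 (s.N 0 t)| ≤ M + M := fun t =>
    (abs_sub _ _).trans (add_le_add (bFP _ _ _) (bFN _ _ _))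
  have h1 := ae_of_int (mP.sub mN) b1 fun a b ha hb => by
    simp only [Pi.sub_apply]
    rw [intervalIntegral.integral_sub (iP a b) (iN a b), e a b ha hb, sub_self]
  have h2 := ae_of_int (mN.sub mP) (fun t => by simp only [Pi.sub_apply]; rw [abs_sub_comm]; exact b1 t) fun a b ha hb => by
    simp only [Pi.sub_apply]
    rw [intervalIntegral.integral_sub (iN a b) (iP a b), e a b ha hb, sub_self]
  filter_upwards [h1, h2] with t k1 k2 ht
  have k1 := k1 ht; have k2 := k2 ht
  simp [dflux, dfluxm] at k1 k2
  linarith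

lemma ifc (s : ABSol fl fr A B u0) (hl : Continuous fl) (hr : Continuous fr) :
    ∀ᵐ t, 0 < t → qq fr B (s.P 0 t) ≤ qq fl A (s.N 0 t) := by
  obtain ⟨M0, hM0, h1, h2⟩ := s.bdd2 hl hr
  set M : ℝ := max M0 (max |A| |B|) with hM
  have bu : ∀ x t, |s.u x t| ≤ M := fun x t => (h1 x t).trans (le_max_left _ _)
  have bN := s.N_bdd bu
  have bP := s.P_bdd bu
  have M0' : 0 ≤ M := (abs_nonneg _).trans (bu 0 0)
  obtain ⟨C1, hC1, c1⟩ := cont_bdd hl M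
  obtain ⟨C2, hC2, c2⟩ := cont_bdd hr M
  obtain ⟨C3, hC3, c3⟩ := cont_bdd (qq_cont hl A) M
  obtain ⟨C4, hC4, c4⟩ := cont_bdd (qq_cont hr B) M
  have mu : Measurable fun p : ℝ² => s.u p.1 p.2 := s.meas
  have mc : Measurable (cAB A B) := Measurable.ite measurableSet_Iic measurable_const measurable_const
  have bc : ∀ x, |cAB A B x| ≤ M := fun x => by
    unfold cAB; split_ifs
    · exact (le_max_left _ _).trans (le_max_right _ _)
    · exact (le_max_right _ _).trans (le_max_right _ _)
  set Q : ℝ² → ℝ := fun p => if p.1 ≤ 0 then qq fl A (s.u p.1 p.2) else qq fr B (s.u p.1 p.2) with hQ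
  set E : ℝ² → ℝ := fun p => |s.u p.1 p.2 - cAB A B p.1| with hE
  have mQ : Measurable Q := Measurable.ite (measurable_fst measurableSet_Iic)
    ((qq_cont hl A).measurable.comp mu) ((qq_cont hr B).measurable.comp mu)
  have bQ : ∀ p, |Q p| ≤ C3 + C4 := fun p => by
    simp only [hQ]; split_ifs
    · linarith [c3 _ (bu p.1 p.2)]
    · linarith [c4 _ (bu p.1 p.2)]
  have mE : Measurable E := (mu.sub (mc.comp measurable_fst)).abs
  have bE : ∀ p, |E p| ≤ M + M := fun p => by
    simp only [hE, abs_abs]; exact (abs_sub _ _).trans (add_le_add (bu _ _) (bc _))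
  have ent := fun (ψ : ℝ² → ℝ) (K : ℝ≥0) (hψ : LipschitzWith K ψ) (hc : HasCompactSupport ψ) (hp : ∀ p, 0 ≤ ψ p)
      (hs : tsupport ψ ⊆ {p | 0 < p.2}) =>
    entL s.meas bu (isOpen_lt continuous_const continuous_snd) (f := dflux fl fr) (C := C1 + C2)
      (fun g hg => dflux_meas hl hr hg) (fun x q hq => by
        unfold dflux; split_ifs
        · linarith [c1 q hq]
        · linarith [c2 q hq]) mc bc
      (fun φ h1 h2 h3 h4 => s.interfaceEntropy (fun x t => φ (x, t)) h1 h2 (fun x t => h3 _)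
        (fun x t ht => by
          by_contra hc
          exact absurd (h4 (subset_tsupport _ hc)) (not_lt.mpr ht))) hψ hc hp hs
  have key : ∀ (n : ℕ) (t1 t2 δ : ℝ), 0 < t1 → t1 ≤ t2 → 0 < δ →
      0 ≤ (∫ t, (∫ x, E (x, t) * trp (-(ν n)) 0 (ν n) x) * deriv (trp t1 t2 δ) t) +
       ∫ t, ((∫ x, Q (x, t) * deriv (rmp (-(ν n)) (ν n)) x) -
          ∫ x, Q (x, t) * deriv (rmp 0 (ν n)) x) * trp t1 t2 δ t := by
    intro n t1 t2 δ ht1 ht hδ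
    set ε : ℝ := ν n
    have hε : 0 < ε := by positivity
    have hab : -ε ≤ 0 := by linarith
    obtain ⟨K, hK⟩ := trp_lip (-ε) 0 hε
    obtain ⟨L, hL⟩ := trp_lip t1 t2 hδ
    have iα := trp_integrable hab hε
    have iχ := trp_integrable ht hδ
    have idα : Integrable (deriv (trp (-ε) 0 ε)) :=
      ((rmp_d_integrable hε).sub (rmp_d_integrable hε)).congr ((trp_deriv hε).mono fun x h => h.symm)
    have idχ : Integrable (deriv (trp t1 t2 δ)) :=
      ((rmp_d_integrable hδ).sub (rmp_d_integrable hδ)).congr ((trp_deriv hδ).mono fun x h => h.symm)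
    have b1 : ∀ x, |trp (-ε) 0 ε x| ≤ 1 := fun x => by
      rw [abs_of_nonneg (trp_mem hab hε x).1]; exact (trp_mem hab hε x).2
    have b2 : ∀ x, |trp t1 t2 δ x| ≤ 1 := fun x => by
      rw [abs_of_nonneg (trp_mem ht hδ x).1]; exact (trp_mem ht hδ x).2
    have sub : tsupport (fun p : ℝ² => trp (-ε) 0 ε p.1 * trp t1 t2 δ p.2) ⊆ Icc (-ε) (0 + ε) ×ˢ Icc t1 (t2 + δ) := by
      refine closure_minimal (fun p hp => ?_) (isClosed_Icc.prod isClosed_Icc)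
      by_contra hc
      rw [mem_prod, not_and_or] at hc
      refine hp ?_
      rcases hc with hc | hc
      · simp [trp_zero hab hε hc]
      · simp [trp_zero ht hδ hc]
    have w := ent _ _ (prod_lip hK hL b1 b2)
      (HasCompactSupport.of_support_subset_isCompact (isCompact_Icc.prod isCompact_Icc)
        ((subset_tsupport _).trans sub)) (fun p => mul_nonneg (trp_mem hab hε _).1 (trp_mem ht hδ _).1)
      (fun p hp => ht1.trans_le (sub hp).2.1)
    have e1 : ∀ p : ℝ², Dt (fun p : ℝ² => trp (-ε) 0 ε p.1 * trp t1 t2 δ p.2) p =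
      trp (-ε) 0 ε p.1 * deriv (trp t1 t2 δ) p.2 := fun p => by
      simp only [Dt]; exact deriv_const_mul_field _
    have e2 : ∀ p : ℝ², Dx (fun p : ℝ² => trp (-ε) 0 ε p.1 * trp t1 t2 δ p.2) p =
      deriv (trp (-ε) 0 ε) p.1 * trp t1 t2 δ p.2 := fun p => by
      simp only [Dx]; exact deriv_mul_const_field _
    simp only [e1, e2] at w
    have e3 : ∀ᵐ p : ℝ², |s.u p.1 p.2 - cAB A B p.1| * (trp (-ε) 0 ε p.1 * deriv (trp t1 t2 δ) p.2) +
        Real.sign (s.u p.1 p.2 - cAB A B p.1) * (dflux fl fr p.1 (s.u p.1 p.2) - dflux fl fr p.1 (cAB A B p.1)) *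
        (deriv (trp (-ε) 0 ε) p.1 * trp t1 t2 δ p.2) = E p * (trp (-ε) 0 ε p.1 * deriv (trp t1 t2 δ) p.2) +
          Q p * (deriv (trp (-ε) 0 ε) p.1 * trp t1 t2 δ p.2) := by
      have : ∀ᵐ p : ℝ², p.1 ≠ 0 := by
        rw [Measure.volume_eq_prod]
        exact Measure.quasiMeasurePreserving_fst.ae (p := fun x : ℝ => x ≠ 0) (by simp [ae_iff])
      filter_upwards [this] with p hp
      rcases lt_or_gt_of_ne hp with h | h
      · simp [hE, hQ, cAB, dflux, h, h.le, qq]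
      · simp [hE, hQ, cAB, dflux, not_le.mpr h, not_lt.mpr h.le, qq]
    rw [integral_congr_ae e3, integral_add (prod_int mE bE iα idχ) (prod_int mQ bQ idα iχ),
      prod_int_t mE bE iα idχ, prod_int_t mQ bQ idα iχ] at w
    refine w.trans_eq (congrArg₂ _ rfl (integral_congr_ae (Eventually.of_forall fun t => ?_)))
    have mQt : Measurable fun x => Q (x, t) := mQ.comp (measurable_id.prodMk measurable_const)
    have iQ : ∀ c, Integrable fun x => Q (x, t) * deriv (rmp c ε) x := fun c =>
      (rmp_d_integrable hε).bdd_mul mQt.aestronglyMeasurable (Eventually.of_forall fun x => bQ (x, t))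
    show (∫ x, Q (x, t) * deriv (trp (-ε) 0 ε) x) * _ = ((∫ x, Q (x, t) * deriv (rmp (-ε) ε) x) - ∫ x, Q (x, t) * deriv (rmp 0 ε) x) * _
    rw [← integral_sub (iQ _) (iQ _)]
    congr 1
    refine integral_congr_ae ((trp_deriv (a := -ε) (b := 0) hε).mono fun x hx => ?_)
    show Q (x, t) * deriv (trp (-ε) 0 ε) x = _
    rw [hx]; ring
  have pm : ∀ x, Measurable fun t : ℝ => ((x, t) : ℝ²) := fun x => measurable_const.prodMk measurable_id
  have mD : Measurable fun t => qq fl A (s.N 0 t) - qq fr B (s.P 0 t) :=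
    ((qq_cont hl A).measurable.comp (s.N_meas.comp (pm 0))).sub
      ((qq_cont hr B).measurable.comp (s.P_meas.comp (pm 0)))
  have bD : ∀ t, |qq fl A (s.N 0 t) - qq fr B (s.P 0 t)| ≤ C3 + C4 := fun t =>
    (abs_sub _ _).trans (add_le_add (c3 _ (bN _ _)) (c4 _ (bP _ _)))
  have bI : ∀ (c ε : ℝ), 0 < ε → ∀ t, |∫ x, Q (x, t) * deriv (rmp c ε) x| ≤ C3 + C4 := fun c ε hε t => by
    rw [rmp_integral _ hε, abs_mul, abs_of_pos (inv_pos.mpr hε), ← Real.norm_eq_abs (intervalIntegral _ _ _ _)]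
    have := intervalIntegral.norm_integral_le_of_norm_le_const (a := c) (b := c + ε) (f := fun x => Q (x, t))
      (C := C3 + C4) fun x _ => bQ (x, t)
    rw [inv_mul_le_iff₀ hε]
    simpa [abs_of_pos hε, mul_comm] using this
  have lim : ∀ (t1 t2 δ : ℝ), 0 < t1 → t1 ≤ t2 → 0 < δ →
      0 ≤ ∫ t, (qq fl A (s.N 0 t) - qq fr B (s.P 0 t)) * trp t1 t2 δ t := by
    intro t1 t2 δ ht1 ht hδ
    have iχ := trp_integrable ht hδ
    have idχ : Integrable (deriv (trp t1 t2 δ)) :=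
      ((rmp_d_integrable hδ).sub (rmp_d_integrable hδ)).congr ((trp_deriv hδ).mono fun x h => h.symm)
    have hε0 : ∀ n : ℕ, 0 < ν n := fun n => by positivity
    have l1 : Tendsto (fun n : ℕ => ∫ t, (∫ x, E (x, t) * trp (-(ν n)) 0 (ν n) x) *
        deriv (trp t1 t2 δ) t) atTop (𝓝 0) := by
      have hlim : Tendsto (fun n : ℕ => (M + M) * (2 * (ν n)) * ∫ t, |deriv (trp t1 t2 δ) t|) atTop (𝓝 0) := by
        have := ((tendsto_one_div_add_atTop_nhds_zero_nat (𝕜 := ℝ)).const_mul 2).const_mul (M + M)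
        simpa using this.mul_const (∫ t, |deriv (trp t1 t2 δ) t|)
      refine squeeze_zero_norm (fun n => ?_) hlim
      rw [← integral_const_mul]
      refine norm_integral_le_of_norm_le (idχ.abs.const_mul _) (Eventually.of_forall fun t => ?_)
      rw [norm_mul]
      refine mul_le_mul_of_nonneg_right ?_ (abs_nonneg _)
      have hab : -(ν n) ≤ 0 := by linarith [hε0 n]
      have : ∫ x, E (x, t) * trp (-(ν n)) 0 (ν n) x =
          ∫ x in Icc (-(ν n)) (0 + ν n),
            E (x, t) * trp (-(ν n)) 0 (ν n) x := by
        rw [setIntegral_eq_integral_of_forall_compl_eq_zero]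
        intro x hx
        rw [trp_zero hab (hε0 n) hx, mul_zero]
      rw [this]
      refine (norm_setIntegral_le_of_norm_le_const (C := M + M) (by simp) fun x _ => ?_).trans_eq ?_
      · rw [norm_mul, Real.norm_eq_abs, Real.norm_of_nonneg (trp_mem hab (hε0 n) x).1]
        exact (mul_le_mul (bE _) (trp_mem hab (hε0 n) x).2 (trp_mem hab (hε0 n) x).1 (by linarith)).trans_eq (mul_one _)
      · rw [Real.volume_real_Icc_of_le (by linarith [hε0 n])]; ring
    have l2 : Tendsto (fun n : ℕ => ∫ t, ((∫ x, Q (x, t) * deriv (rmp (-(ν n)) (ν n)) x) -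
          ∫ x, Q (x, t) * deriv (rmp 0 (ν n)) x) * trp t1 t2 δ t) atTop
          (𝓝 (∫ t, (qq fl A (s.N 0 t) - qq fr B (s.P 0 t)) * trp t1 t2 δ t)) := by
      refine tendsto_integral_of_dominated_convergence (fun t => (C3 + C4 + (C3 + C4)) * |trp t1 t2 δ t|)
        (fun n => ?_) (iχ.abs.const_mul _) (fun n => Eventually.of_forall fun t => ?_) (Eventually.of_forall fun t => ?_)
      · obtain ⟨L, hL⟩ := trp_lip t1 t2 hδ
        exact (((int_t_meas mQ (measurable_deriv _)).sub (int_t_meas mQ (measurable_deriv _))).mul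
          hL.continuous.measurable).aestronglyMeasurable
      · rw [norm_mul]
        refine mul_le_mul_of_nonneg_right ((abs_sub _ _).trans (add_le_add ?_ ?_)) (abs_nonneg _)
        · exact bI _ _ (hε0 n) t
        · exact bI _ _ (hε0 n) t
      · rcases le_or_gt t 0 with h0 | h0
        · rw [trp_zero ht hδ (fun h => by linarith [h.1])]; simp
        · have mQt : Measurable fun x => Q (x, t) := mQ.comp (measurable_id.prodMk measurable_const)
          refine ((rmp_tendsto_left mQt ?_).sub (rmp_tendsto mQt ?_)).mul_const _
          · refine (((qq_cont hl A).tendsto _).comp (s.N_lim h0)).congr' ?_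
            filter_upwards [self_mem_nhdsWithin] with x hx
            have : x ≤ 0 := le_of_lt hx
            simp [hQ, this]
          · refine (((qq_cont hr B).tendsto _).comp (s.P_lim h0)).congr' ?_
            filter_upwards [self_mem_nhdsWithin] with x hx
            have : ¬ x ≤ 0 := not_le.mpr hx
            simp [hQ, this]
    have := ge_of_tendsto' (l1.add l2) fun n => key n t1 t2 δ ht1 ht hδ
    simpa using this
  have fin := ae_of_int mD bD fun a b ha hb =>
    ge_of_tendsto' (trp_int_lim mD bD hb) fun n => lim a b _ ha hb (by positivity)
  filter_upwards [fin] with t h ht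
  linarith [h ht]

lemma Pot.trace {a γ : ℝ} (h : s.Pot U) (d : Dat fl fr A B a γ) : ∀ᵐ t, 0 < t → fl (s.N 0 t) = fr (s.P 0 t) ∧
    γ ≤ fl (s.N 0 t) ∧ (γ < fl (s.N 0 t) → 0 < deriv fl (s.N 0 t) ∨ deriv fr (s.P 0 t) < 0) := by
  filter_upwards [s.ifc d.l.cont d.r.cont, h.trace_eq d.l.cont d.r.cont] with t h1 h2 ht
  have h1 := h1 ht
  have h2 := h2 ht
  simp only [qq, d.fA, d.fB, ← h2] at h1
  refine ⟨h2, ?_, ?_⟩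
  · by_contra hc
    push Not at hc
    have e1 : A < s.N 0 t := by
      by_contra h'; push Not at h'
      linarith [d.l.anti_left h' d.dA, d.fA]
    have e2 : s.P 0 t < B := by
      by_contra h'; push Not at h'
      linarith [d.r.mono_right h' d.dB, d.fB]
    rw [Real.sign_of_pos (sub_pos.mpr e1), Real.sign_of_neg (sub_neg.mpr e2)] at h1
    linarith
  · intro hg
    by_contra hc
    push Not at hc
    have e1 : s.N 0 t < A := by
      by_contra h'; push Not at h'
      linarith [d.l.anti_left h' hc.1, d.fA]
    have e2 : B < s.P 0 t := by
      by_contra h'; push Not at h'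
      linarith [d.r.mono_right h' hc.2, d.fB]
    rw [Real.sign_of_neg (sub_neg.mpr e1), Real.sign_of_pos (sub_pos.mpr e2)] at h1
    linarith

end ABSol
end S8

section S9
open scoped Convolution Topology NNReal

def ell (fl fr : ℝ → ℝ) (γ x p : ℝ) : ℝ := if x < 0 then LL fl p else if 0 < x then LL fr p else -γ

lemma Dat.ell_meas {fl fr : ℝ → ℝ} {A B a γ : ℝ} (d : Dat fl fr A B a γ) {x p : ℝ → ℝ} (hx : Measurable x) (hp : Measurable p) :
    Measurable fun t => ell fl fr γ (x t) (p t) :=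
  Measurable.ite (hx measurableSet_Iio) (d.l.LL_cont.measurable.comp hp)
    (Measurable.ite (hx measurableSet_Ioi) (d.r.LL_cont.measurable.comp hp) measurable_const)

lemma Dat.ell_ii {fl fr : ℝ → ℝ} {A B a γ : ℝ} (d : Dat fl fr A B a γ) {ζ : ℝ → ℝ} {K : ℝ≥0} (hζ : LipschitzWith K ζ) (x y : ℝ) :
    IntervalIntegrable (fun t => ell fl fr γ (ζ t) (deriv ζ t)) volume x y := by
  obtain ⟨C, hC, h1⟩ := cont_bdd d.l.LL_cont K
  obtain ⟨D, hD, h2⟩ := cont_bdd d.r.LL_cont K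
  refine ABSol.bdd_ii (d.ell_meas hζ.continuous.measurable (measurable_deriv _)) (M := C + D + |γ|) (fun t => ?_) x y
  have h3 : |deriv ζ t| ≤ K := norm_deriv_le_of_lipschitz hζ
  unfold ell; split_ifs
  · linarith [h1 _ h3, abs_nonneg γ]
  · linarith [h2 _ h3, abs_nonneg γ]
  · rw [abs_neg]; linarith

namespace ABSol
variable {fl fr : ℝ → ℝ} {A B : ℝ} {u0 : ℝ → ℝ} {s : ABSol fl fr A B u0} {U : ℝ² → ℝ} {a γ : ℝ}

lemma Pot.iiN (_ : s.Pot U) (hl : Continuous fl) (hr : Continuous fr) {ζ : ℝ → ℝ} {K : ℝ≥0} (hζ : LipschitzWith K ζ)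
    (x y : ℝ) : IntervalIntegrable (fun t => s.N (ζ t) t * deriv ζ t - dfluxm fl fr (ζ t) (s.N (ζ t) t)) volume x y := by
  obtain ⟨M, hM, bu, bP, bN, bF, bFP, bFN⟩ := s.bdd3 hl hr
  have m : Measurable fun t => (ζ t, t) := hζ.continuous.measurable.prodMk measurable_id
  refine bdd_ii (((s.N_meas.comp m).mul (measurable_deriv _)).sub ((s.FN_meas hl hr).comp m)) (M := M * K + M) (fun t => ?_) x y
  refine (abs_sub _ _).trans (add_le_add ?_ (bFN _ _ _))
  simp only [Pi.mul_apply, Function.comp]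
  rw [abs_mul]
  exact mul_le_mul (bN _ _) (norm_deriv_le_of_lipschitz hζ) (abs_nonneg _) hM

lemma Pot.iiP (_ : s.Pot U) (hl : Continuous fl) (hr : Continuous fr) {ζ : ℝ → ℝ} {K : ℝ≥0} (hζ : LipschitzWith K ζ)
    (x y : ℝ) : IntervalIntegrable (fun t => s.P (ζ t) t * deriv ζ t - dflux fl fr (ζ t) (s.P (ζ t) t)) volume x y := by
  obtain ⟨M, hM, bu, bP, bN, bF, bFP, bFN⟩ := s.bdd3 hl hr
  have m : Measurable fun t => (ζ t, t) := hζ.continuous.measurable.prodMk measurable_id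
  refine bdd_ii (((s.P_meas.comp m).mul (measurable_deriv _)).sub ((s.FP_meas hl hr).comp m)) (M := M * K + M) (fun t => ?_) x y
  refine (abs_sub _ _).trans (add_le_add ?_ (bFP _ _ _))
  simp only [Pi.mul_apply, Function.comp]
  rw [abs_mul]
  exact mul_le_mul (bP _ _) (norm_deriv_le_of_lipschitz hζ) (abs_nonneg _) hM

lemma Pot.leN (h : s.Pot U) (d : Dat fl fr A B a γ) (ζ : ℝ → ℝ) :
    ∀ᵐ t, 0 < t → s.N (ζ t) t * deriv ζ t - dfluxm fl fr (ζ t) (s.N (ζ t) t) ≤ ell fl fr γ (ζ t) (deriv ζ t) := by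
  filter_upwards [h.trace d, deriv_zero_ae ζ] with t h1 h2 ht
  rcases lt_trichotomy (ζ t) 0 with h | h | h
  · simp only [dfluxm, ell, h, h.le, if_true]; linarith [d.l.young (deriv ζ t) (s.N (ζ t) t)]
  · simp [dfluxm, ell, h, h2 h, (h1 ht).2.1]
  · simp only [dfluxm, ell, h, not_le.mpr h, not_lt.mpr h.le, if_true, if_false]
    linarith [d.r.young (deriv ζ t) (s.N (ζ t) t)]

lemma Pot.leP (h : s.Pot U) (d : Dat fl fr A B a γ) (ζ : ℝ → ℝ) :
    ∀ᵐ t, 0 < t → s.P (ζ t) t * deriv ζ t - dflux fl fr (ζ t) (s.P (ζ t) t) ≤ ell fl fr γ (ζ t) (deriv ζ t) := by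
  filter_upwards [h.trace d, deriv_zero_ae ζ] with t h1 h2 ht
  rcases lt_trichotomy (ζ t) 0 with h | h | h
  · simp only [dflux, ell, h, if_true]; linarith [d.l.young (deriv ζ t) (s.P (ζ t) t)]
  · simp [dflux, ell, h, h2 h, (h1 ht).2.1, ← (h1 ht).1]
  · simp only [dflux, ell, h, not_lt.mpr h.le, if_true, if_false]
    linarith [d.r.young (deriv ζ t) (s.P (ζ t) t)]

lemma Pot.sub (h : s.Pot U) (d : Dat fl fr A B a γ) {ζ : ℝ → ℝ} {K : ℝ≥0} (hζ : LipschitzWith K ζ) {t1 t2 : ℝ}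
    (h1 : 0 ≤ t1) (h2 : t1 ≤ t2) : U (ζ t2, t2) ≤ U (ζ t1, t1) + ∫ t in t1..t2, ell fl fr γ (ζ t) (deriv ζ t) := by
  have := h.pathN d.l.cont d.r.cont hζ h1 h2
  have : ∫ t in t1..t2, (s.N (ζ t) t * deriv ζ t - dfluxm fl fr (ζ t) (s.N (ζ t) t)) ≤ ∫ t in t1..t2, ell fl fr γ (ζ t) (deriv ζ t) := by
    rw [intervalIntegral.integral_of_le h2, intervalIntegral.integral_of_le h2]
    refine setIntegral_mono_ae_restrict (h.iiN d.l.cont d.r.cont hζ t1 t2).1 (d.ell_ii hζ t1 t2).1 ?_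
    rw [EventuallyLE, ae_restrict_iff' measurableSet_Ioc]
    exact (h.leN d ζ).mono fun t ht hm => ht (h1.trans_lt hm.1)
  linarith

lemma ae_eq_of_int {g1 g2 : ℝ → ℝ} {T : ℝ} (hT : 0 < T) (i1 : IntervalIntegrable g1 volume 0 T)
    (i2 : IntervalIntegrable g2 volume 0 T) (hle : ∀ᵐ t, 0 < t → g1 t ≤ g2 t)
    (he : ∫ t in (0:ℝ)..T, g1 t = ∫ t in (0:ℝ)..T, g2 t) : ∀ᵐ t ∂(volume.restrict (Icc 0 T)), g1 t = g2 t := by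
  rw [← restrict_Ioc_eq_restrict_Icc]
  rw [intervalIntegral.integral_of_le hT.le, intervalIntegral.integral_of_le hT.le] at he
  refine (integral_eq_iff_of_ae_le i1.1 i2.1 ?_).mp he
  rw [EventuallyLE, ae_restrict_iff' measurableSet_Ioc]
  exact hle.mono fun t ht hm => ht hm.1

lemma Pot.gic_iff (h : s.Pot U) (d : Dat fl fr A B a γ) {T : ℝ} (hT : 0 < T) {ζ : ℝ → ℝ} {K : ℝ≥0} (hζ : LipschitzWith K ζ) :
    IsABgic T fl fr γ s ζ ↔ U (ζ T, T) = U (ζ 0, 0) + ∫ t in (0:ℝ)..T, ell fl fr γ (ζ t) (deriv ζ t) := by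
  have p1 := h.pathN d.l.cont d.r.cont hζ le_rfl hT.le
  have p2 := h.pathP d.l.cont d.r.cont hζ le_rfl hT.le
  have pos : ∀ᵐ t ∂(volume.restrict (Icc 0 T)), 0 < t := by
    rw [← restrict_Ioc_eq_restrict_Icc]
    filter_upwards [ae_restrict_mem measurableSet_Ioc] with t ht using ht.1
  constructor
  · rintro ⟨-, hg⟩
    have : ∫ t in (0:ℝ)..T, (s.N (ζ t) t * deriv ζ t - dfluxm fl fr (ζ t) (s.N (ζ t) t)) =
        ∫ t in (0:ℝ)..T, ell fl fr γ (ζ t) (deriv ζ t) := by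
      rw [intervalIntegral.integral_of_le hT.le, intervalIntegral.integral_of_le hT.le]
      simp only [← integral_Icc_eq_integral_Ioc]
      refine integral_congr_ae ?_
      filter_upwards [hg, pos, ae_restrict_of_ae (deriv_zero_ae ζ)] with t h1 ht h2
      have eN : s.N (ζ t) t = s.um (ζ t) t := by simp [N, ht]
      rcases lt_trichotomy (ζ t) 0 with h | h | h
      · simp only [dfluxm, ell, h, h.le, if_true, eN]
        rw [(h1.1 h).1.deriv, d.l.LL_d]; ring
      · have := (h1.2.2 h).1
        rw [h] at eN
        simp [dfluxm, ell, h, h2 h, eN, this]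
      · simp only [dfluxm, ell, h, not_le.mpr h, not_lt.mpr h.le, if_true, if_false, eN]
        rw [(h1.2.1 h).1.deriv, d.r.LL_d]; ring
    linarith
  · intro he
    refine ⟨⟨K, hζ.lipschitzOnWith⟩, ?_⟩
    have e1 := ae_eq_of_int hT (h.iiN d.l.cont d.r.cont hζ 0 T) (d.ell_ii hζ 0 T) (h.leN d ζ) (by linarith)
    have e2 := ae_eq_of_int hT (h.iiP d.l.cont d.r.cont hζ 0 T) (d.ell_ii hζ 0 T) (h.leP d ζ) (by linarith)
    filter_upwards [e1, e2, pos, ae_restrict_of_ae (deriv_zero_ae ζ), ae_restrict_of_ae hζ.ae_differentiableAt]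
      with t h1 h2 ht h3 dd
    have eN : s.N (ζ t) t = s.um (ζ t) t := by simp [N, ht]
    have eP : s.P (ζ t) t = s.up (ζ t) t := by simp [P, ht]
    refine ⟨fun h => ?_, fun h => ?_, fun h => ?_⟩
    · simp only [dfluxm, dflux, ell, h, h.le, if_true, eN, eP] at h1 h2
      rw [mul_comm] at h1 h2
      have k1 := d.l.young_eq h1; have k2 := d.l.young_eq h2
      exact ⟨k1 ▸ dd.hasDerivAt, by rw [k1, k2]⟩
    · simp only [dfluxm, dflux, ell, h, not_le.mpr h, not_lt.mpr h.le, if_true, if_false, eN, eP] at h1 h2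
      rw [mul_comm] at h1 h2
      have k1 := d.r.young_eq h1; have k2 := d.r.young_eq h2
      exact ⟨k1 ▸ dd.hasDerivAt, by rw [k1, k2]⟩
    · rw [h] at eN eP
      simp [dfluxm, dflux, ell, h, h3 h, eN, eP] at h1 h2
      exact ⟨h1, h2⟩

lemma gic_ext {T : ℝ} (hT : 0 < T) {ζ : ℝ → ℝ} (hg : IsABgic T fl fr γ s ζ) : ∃ ξ : ℝ → ℝ, ∃ K, LipschitzWith K ξ ∧
    IsABgic T fl fr γ s ξ ∧ ξ T = ζ T ∧ ξ 0 = ζ 0 := by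
  obtain ⟨⟨K, hK⟩, hg⟩ := hg
  obtain ⟨ξ, hξ, e⟩ := hK.extend_real
  refine ⟨ξ, K, hξ, ⟨⟨K, hξ.lipschitzOnWith⟩, ?_⟩, (e ⟨hT.le, le_rfl⟩).symm, (e ⟨le_rfl, hT.le⟩).symm⟩
  rw [← restrict_Ioo_eq_restrict_Icc] at hg ⊢
  filter_upwards [hg, ae_restrict_mem measurableSet_Ioo] with t h1 ht
  have e1 : ζ t = ξ t := e ⟨ht.1.le, ht.2.le⟩
  have e2 : ξ =ᶠ[𝓝 t] ζ := by
    filter_upwards [Icc_mem_nhds ht.1 ht.2] with y hy using (e hy).symm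
  rw [← e1]
  exact ⟨fun h => ⟨(h1.1 h).1.congr_of_eventuallyEq e2, (h1.1 h).2⟩,
    fun h => ⟨(h1.2.1 h).1.congr_of_eventuallyEq e2, (h1.2.1 h).2⟩, h1.2.2⟩

lemma Pot.mem_C0 (h : s.Pot U) (d : Dat fl fr A B a γ) {T : ℝ} (hT : 0 < T) {x y : ℝ} :
    y ∈ charSet0 T fl fr γ s x ↔ ∃ ζ : ℝ → ℝ, ∃ K, LipschitzWith K ζ ∧ ζ T = x ∧ ζ 0 = y ∧
      U (x, T) = U (y, 0) + ∫ t in (0:ℝ)..T, ell fl fr γ (ζ t) (deriv ζ t) := by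
  constructor
  · rintro ⟨ζ, ⟨hg, hx⟩, hy⟩
    obtain ⟨ξ, K, hK, hg', e1, e2⟩ := gic_ext hT hg
    refine ⟨ξ, K, hK, e1.trans hx, e2.trans hy, ?_⟩
    have := (h.gic_iff d hT hK).mp hg'
    rwa [e1.trans hx, e2.trans hy] at this
  · rintro ⟨ζ, K, hK, hx, hy, he⟩
    refine ⟨ζ, ⟨(h.gic_iff d hT hK).mpr ?_, hx⟩, hy⟩
    rw [hx, hy]; exact he

lemma Pot.C0_bdd (h : s.Pot U) (d : Dat fl fr A B a γ) {T : ℝ} (hT : 0 < T) : ∃ L, ∀ x y, y ∈ charSet0 T fl fr γ s x →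
    |x - y| ≤ L := by
  obtain ⟨M, hM, bu, bP, bN, bF, bFP, bFN⟩ := s.bdd3 d.l.cont d.r.cont
  obtain ⟨C, hC, h1⟩ := cont_bdd d.l.c1.continuous M
  obtain ⟨D, hD, h2⟩ := cont_bdd d.r.c1.continuous M
  refine ⟨(C + D) * T, fun x y hy => ?_⟩
  obtain ⟨ζ, ⟨hg, hx⟩, hy⟩ := hy
  obtain ⟨ξ, K, hK, ⟨-, hg'⟩, e1, e2⟩ := gic_ext hT hg
  have hy : ζ 0 = y := hy
  rw [← hx, ← hy, ← e1, ← e2, ← lip_ftc hK, ← Real.norm_eq_abs, intervalIntegral.integral_of_le hT.le,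
    ← integral_Icc_eq_integral_Ioc]
  have : ‖∫ t in Icc 0 T, deriv ξ t‖ ≤ (C + D) * volume.real (Icc 0 T) := by
    refine norm_setIntegral_le_of_norm_le_const_ae (by simp) ?_
    rw [← restrict_Ioc_eq_restrict_Icc] at hg' 
    have : ∀ᵐ t ∂volume.restrict (Ioc 0 T), ‖deriv ξ t‖ ≤ C + D := by
      filter_upwards [hg', ae_restrict_of_ae (deriv_zero_ae ξ), ae_restrict_mem measurableSet_Ioc] with t h3 h4 ht
      have eN : s.um (ξ t) t = s.N (ξ t) t := by simp [N, ht.1]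
      rcases lt_trichotomy (ξ t) 0 with h | h | h
      · rw [(h3.1 h).1.deriv, eN]; exact (h1 _ (bN _ _)).trans (by linarith)
      · rw [h4 h]; simp; linarith
      · rw [(h3.2.1 h).1.deriv, eN]; exact (h2 _ (bN _ _)).trans (by linarith)
    rw [restrict_Ioc_eq_restrict_Icc] at this
    exact this
  simpa [hT.le] using this

end ABSol
end S9

section S10
open scoped Convolution Topology NNReal

structure Reg (U w : ℝ² → ℝ) (f : ℝ → ℝ) (M : ℝ) (K : ℝ≥0) (Ω : Set ℝ²) : Prop where
  op : IsOpen Ω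
  lip : LipschitzWith K U
  mw : Measurable w
  bw : ∀ p, |w p| ≤ M
  hd : ∀ᵐ p : ℝ², p ∈ Ω → ∃ L : ℝ² →L[ℝ] ℝ, HasFDerivAt U L p ∧ ∀ a b, L (a, b) = w p * a - f (w p) * b
  krz : ∀ (k : ℝ) (ψ : ℝ² → ℝ) (K : ℝ≥0), LipschitzWith K ψ → HasCompactSupport ψ → (∀ p, 0 ≤ ψ p) →
    tsupport ψ ⊆ Ω → 0 ≤ ∫ p : ℝ², (|w p - k| * Dt ψ p + Real.sign (w p - k) * (f (w p) - f k) * Dx ψ p)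

lemma sgn_lip {f : ℝ → ℝ} {a M C : ℝ} (hf : CF f a) (hC : ∀ q, |q| ≤ M → |deriv f q| ≤ C) {x y : ℝ} (hx : |x| ≤ M)
    (hy : |y| ≤ M) : |f x - f y| ≤ C * |x - y| := by
  have := Convex.norm_image_sub_le_of_norm_deriv_le (f := f) (s := Icc (-M) M) (C := C) (fun z _ => (hf.hd z).differentiableAt)
    (fun z hz => hC z (abs_le.mpr hz)) (convex_Icc _ _) (abs_le.mp hy) (abs_le.mp hx)
  simpa [Real.norm_eq_abs] using this

lemma dx_of {ψ : ℝ² → ℝ} {L : ℝ² →L[ℝ] ℝ} {p : ℝ²} (h : HasFDerivAt ψ L p) : Dx ψ p = L (1, 0) ∧ Dt ψ p = L (0, 1) := by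
  rw [← line_x, ← line_t, h.differentiableAt.lineDeriv_eq_fderiv, h.differentiableAt.lineDeriv_eq_fderiv, h.fderiv]
  exact ⟨rfl, rfl⟩

lemma Reg.const_t {U w : ℝ² → ℝ} {f : ℝ → ℝ} {M : ℝ} {K : ℝ≥0} {Ω : Set ℝ²} (h : Reg U w f M K Ω) {k : ℝ} {z1 : ℝ²} {ρ : ℝ}
    (hk : ∀ᵐ p : ℝ², p ∈ Metric.ball z1 ρ → p ∈ Ω ∧ w p = k) (hρ : 0 < ρ) {t : ℝ} (ht : t ∈ Ioo (z1.2 - ρ) z1.2) :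
    U (z1.1, z1.2) - U (z1.1, t) = - f k * (z1.2 - t) := by
  have h1 : ∀ᵐ p : ℝ², p ∈ Metric.ball z1 ρ → Dt U p = - f k := by
    filter_upwards [hk, h.hd] with p e1 e2 hp
    obtain ⟨L, hL, e⟩ := e2 (e1 hp).1
    rw [(dx_of hL).2, e, (e1 hp).2]; ring
  have h2 := ae_path h1 (measurable_const (a := z1.1))
  obtain ⟨z, hz, hz0⟩ := ae_seq_right h2
  have z0 := (tendsto_nhdsWithin_iff.mp hz0).1
  have L1 : Tendsto (fun n => U (z1.1 - z n, z1.2) - U (z1.1 - z n, t)) atTop (𝓝 (U (z1.1, z1.2) - U (z1.1, t))) := by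
    have : ∀ c d, Tendsto (fun n => U (c - z n, d)) atTop (𝓝 (U (c, d))) := fun c d => by
      refine (h.lip.continuous.tendsto _).comp ?_
      refine Tendsto.prodMk_nhds ?_ tendsto_const_nhds
      simpa using z0.const_sub c
    exact (this _ _).sub (this _ _)
  refine tendsto_nhds_unique L1 (tendsto_const_nhds.congr' ?_)
  have ev : ∀ᶠ n in atTop, |z n| < ρ := by
    have := z0.abs; rw [abs_zero] at this; exact this.eventually_lt_const hρ
  filter_upwards [ev] with n hn
  have hl : LipschitzWith (K * max 0 1) fun t => U (z1.1 - z n, t) :=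
    h.lip.comp (LipschitzWith.prodMk (LipschitzWith.const _) LipschitzWith.id)
  rw [← lip_ftc hl]
  have : ∫ τ in t..z1.2, deriv (fun t => U (z1.1 - z n, t)) τ = ∫ τ in t..z1.2, - f k := by
    refine intervalIntegral.integral_congr_ae ?_
    filter_upwards [hz n] with τ hτ hm
    rw [uIoc_of_le ht.2.le] at hm
    refine hτ ?_
    rw [Metric.mem_ball, Prod.dist_eq, Real.dist_eq, Real.dist_eq]
    refine max_lt ?_ ?_
    · simpa using hn
    · rw [abs_lt]; constructor <;> simp <;> linarith [hm.1, hm.2, ht.1]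
  rw [this]; simp; ring

lemma Reg.touch {U w : ℝ² → ℝ} {f : ℝ → ℝ} {M a : ℝ} {K : ℝ≥0} {Ω : Set ℝ²} (h : Reg U w f M K Ω) (hf : CF f a)
    {z1 : ℝ²} (hz : z1 ∈ Ω) {k l : ℝ} (H : ∀ η > 0, ∀ᶠ z in 𝓝 z1, U z1 + k * (z.1 - z1.1) + l * (z.2 - z1.2) - η * dist z z1 ≤ U z) :
    0 ≤ l + f k := by
  by_contra hc
  push Not at hc
  obtain ⟨δ, hδ, hδ'⟩ : ∃ δ > 0, l + f k = -2 * δ := ⟨-(l + f k) / 2, by linarith, by ring⟩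
  obtain ⟨C, hC, hC'⟩ := cont_bdd hf.c1.continuous (max M |k|)
  obtain ⟨η, hη, hη'⟩ : ∃ η > 0, η * (1 + C) ≤ δ := ⟨δ / (1 + C), by positivity, by rw [div_mul_cancel₀]; positivity⟩
  obtain ⟨r, hr, hr'⟩ := Metric.eventually_nhds_iff_ball.mp ((H (η / 2) (by positivity)).and (h.op.mem_nhds hz))
  obtain ⟨Bg, hBg⟩ : ∃ Bg : ℝ, Bg = 2 * (K + |k| + |l| + 1) := ⟨_, rfl⟩
  have hK0 : (0:ℝ) ≤ K := K.2
  have hBg0 : 0 ≤ Bg := by rw [hBg]; positivity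
  set E : ℝ² → ℝ := fun z => U z1 + k * (z.1 - z1.1) + l * (z.2 - z1.2) - η * dist z z1 + η * r / 4
    - Bg * max 0 (dist z z1 - r / 2) - U z with hE
  have d1 : ∀ z : ℝ², |z.1 - z1.1| ≤ dist z z1 := fun z => le_max_left _ _
  have d2 : ∀ z : ℝ², |z.2 - z1.2| ≤ dist z z1 := fun z => le_max_right _ _
  have small : ∀ z, 0 < E z → dist z z1 < r / 2 := by
    intro z hz
    by_contra hcc
    push Not at hcc
    simp only [hE] at hz
    rw [max_eq_right (by linarith)] at hz
    rcases lt_or_ge (dist z z1) r with h' | h'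
    · have := (hr' z h').1
      nlinarith [mul_nonneg hBg0 (sub_nonneg.mpr hcc), mul_pos hη hr]
    · have e1 : |U z1 - U z| ≤ K * dist z z1 := by
        have := h.lip.dist_le_mul z z1; rw [Real.dist_eq, abs_sub_comm] at this; exact this
      have e2 : k * (z.1 - z1.1) ≤ |k| * dist z z1 :=
        (le_abs_self _).trans (by rw [abs_mul]; exact mul_le_mul_of_nonneg_left (d1 z) (abs_nonneg _))
      have e3 : l * (z.2 - z1.2) ≤ |l| * dist z z1 :=
        (le_abs_self _).trans (by rw [abs_mul]; exact mul_le_mul_of_nonneg_left (d2 z) (abs_nonneg _))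
      have e4 : Bg * (dist z z1 / 2) ≤ Bg * (dist z z1 - r / 2) := mul_le_mul_of_nonneg_left (by linarith) hBg0
      rw [hBg] at e4 hz
      nlinarith [le_abs_self (U z1 - U z), mul_le_mul_of_nonneg_left h' hη.le, mul_pos hη hr, dist_nonneg (x := z) (y := z1)]
  have Nlip : LipschitzWith 1 fun z : ℝ² => dist z z1 := LipschitzWith.dist_left z1
  have lip1 : LipschitzWith 1 fun z : ℝ² => z.1 - z1.1 := by simpa using LipschitzWith.prod_fst.sub (LipschitzWith.const z1.1)
  have lip2 : LipschitzWith 1 fun z : ℝ² => z.2 - z1.2 := by simpa using LipschitzWith.prod_snd.sub (LipschitzWith.const z1.2)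
  have cm : ∀ (c : ℝ) {K' : ℝ≥0} {g : ℝ² → ℝ}, LipschitzWith K' g → ∃ K'', LipschitzWith K'' fun z => c * g z := fun c K' g hg =>
    ⟨_, (lipschitzWith_smul c).comp hg⟩
  obtain ⟨KE, hKE⟩ : ∃ KE, LipschitzWith KE E := by
    obtain ⟨K1, h1⟩ := cm k lip1
    obtain ⟨K2, h2⟩ := cm l lip2
    obtain ⟨K3, h3⟩ := cm η Nlip
    obtain ⟨K4, h4⟩ := cm Bg ((Nlip.sub (LipschitzWith.const (r / 2))).const_max 0)
    exact ⟨_, (((((((LipschitzWith.const (U z1)).add h1).add h2).sub h3).add (LipschitzWith.const (η * r / 4))).sub h4).sub h.lip)⟩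
  set ψ : ℝ² → ℝ := fun z => max 0 (E z) with hψ
  have lψ : LipschitzWith KE ψ := hKE.const_max 0
  have sψ : Function.support ψ ⊆ Metric.closedBall z1 (r / 2) := fun z hz => by
    refine (small z ?_).le
    by_contra h'; push Not at h'
    exact hz (max_eq_left h')
  have tψ : tsupport ψ ⊆ Metric.closedBall z1 (r / 2) := closure_minimal sψ Metric.isClosed_closedBall
  have kr := h.krz k ψ KE lψ (HasCompactSupport.of_support_subset_isCompact (isCompact_closedBall _ _) sψ)
    (fun p => le_max_left _ _) (tψ.trans fun z hz => (hr' z (by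
      rw [Metric.mem_closedBall] at hz; rw [Metric.mem_ball]; linarith)).2)
  set S : Set ℝ² := {z | 0 < E z} with hS
  have opS : IsOpen S := isOpen_lt continuous_const hKE.continuous
  have SB : S ⊆ Metric.closedBall z1 (r / 2) := fun z hz => (small z hz).le
  have fS : volume S ≠ ⊤ := ((measure_mono SB).trans_lt measure_closedBall_lt_top).ne
  set g : ℝ² → ℝ := fun p => |w p - k| * Dt ψ p + Real.sign (w p - k) * (f (w p) - f k) * Dx ψ p with hg
  set hh : ℝ² → ℝ := S.indicator fun p => δ * |w p - k| with hhh
  have bk : ∀ p, |w p - k| ≤ M + |k| := fun p => (abs_sub _ _).trans (add_le_add (h.bw p) le_rfl)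
  have bfk : ∀ p, |f (w p) - f k| ≤ C * |w p - k| := fun p =>
    sgn_lip hf hC' ((h.bw p).trans (le_max_left _ _)) (le_max_right _ _)
  have gz : ∀ p, p ∉ S → g p = 0 := fun p hp => by
    have e0 : ψ p = 0 := max_eq_left (not_lt.mp hp)
    have e1 : Dt ψ p = 0 := IsLocalMin.deriv_eq_zero (Eventually.of_forall fun t => by
      show ψ (p.1, p.2) ≤ _; rw [e0]; exact le_max_left _ _)
    have e2 : Dx ψ p = 0 := IsLocalMin.deriv_eq_zero (Eventually.of_forall fun t => by
      show ψ (p.1, p.2) ≤ _; rw [e0]; exact le_max_left _ _)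
    simp [hg, e1, e2]
  have gle : ∀ᵐ p, g p ≤ - hh p := by
    filter_upwards [h.hd, Nlip.ae_differentiableAt] with p hp dN
    by_cases hpS : p ∈ S
    · obtain ⟨L, hL, e⟩ := hp (hr' p (by have := small p hpS; rw [Metric.mem_ball]; linarith)).2
      set LN := fderiv ℝ (fun z : ℝ² => dist z z1) p
      have hN : HasFDerivAt (fun z : ℝ² => dist z z1) LN p := dN.hasFDerivAt
      have nLN : ‖LN‖ ≤ 1 := by simpa using norm_fderiv_le_of_lipschitz ℝ Nlip (x₀ := p)
      have b1 : |LN (1, 0)| ≤ 1 := (LN.le_opNorm _).trans (by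
        rw [Prod.norm_mk]; simpa using nLN)
      have b2 : |LN (0, 1)| ≤ 1 := (LN.le_opNorm _).trans (by
        rw [Prod.norm_mk]; simpa using nLN)
      have hf1 : HasFDerivAt (fun z : ℝ² => z.1 - z1.1) (ContinuousLinearMap.fst ℝ ℝ ℝ) p := hasFDerivAt_fst.sub_const _
      have hf2 : HasFDerivAt (fun z : ℝ² => z.2 - z1.2) (ContinuousLinearMap.snd ℝ ℝ ℝ) p := hasFDerivAt_snd.sub_const _
      have hψ' : HasFDerivAt ψ (k • ContinuousLinearMap.fst ℝ ℝ ℝ + l • ContinuousLinearMap.snd ℝ ℝ ℝ - η • LN - L) p := by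
        have h0 := ((((hf1.const_smul k).add (hf2.const_smul l)).sub (hN.const_smul η)).sub hL).const_add (U z1 + η * r / 4)
        refine h0.congr_of_eventuallyEq ?_
        have nb : ∀ᶠ z in 𝓝 p, z ∈ S := opS.mem_nhds hpS
        filter_upwards [nb] with z hz
        have hz' : 0 < E z := hz
        simp only [hψ, max_eq_right hz'.le]
        simp only [hE, max_eq_left (show dist z z1 - r / 2 ≤ 0 by linarith [small z hz'])]
        simp; ring
      obtain ⟨ex, et⟩ := dx_of hψ'
      have el1 := e 1 0
      have el2 := e 0 1
      simp at ex et el1 el2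
      rw [el1] at ex; rw [el2] at et
      simp only [hg, hhh, indicator_of_mem hpS, ex, et]
      set W := w p
      have key : Real.sign (W - k) * (W - k) = |W - k| := by
        rcases lt_trichotomy (W - k) 0 with h | h | h
        · rw [Real.sign_of_neg h, abs_of_neg h]; ring
        · rw [h]; simp
        · rw [Real.sign_of_pos h, abs_of_pos h]; ring
      have q1 : |W - k| * (-(η * LN (0, 1))) ≤ |W - k| * η := by
        refine mul_le_mul_of_nonneg_left ?_ (abs_nonneg _)
        nlinarith [abs_le.mp b2]
      have q2 : Real.sign (W - k) * (f W - f k) * (-(η * LN (1, 0))) ≤ C * |W - k| * η := by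
        refine (le_abs_self _).trans ?_
        rw [abs_mul, abs_mul, abs_neg, abs_mul, abs_of_pos hη]
        have : |Real.sign (W - k)| * |f W - f k| ≤ 1 * (C * |W - k|) :=
          mul_le_mul (by rcases Real.sign_apply_eq (W - k) with h | h | h <;> simp [h]) (bfk p) (abs_nonneg _) zero_le_one
        refine (mul_le_mul this (mul_le_mul_of_nonneg_left b1 hη.le) (by positivity) (by positivity)).trans_eq (by ring)
      have q3 : |W - k| * (η * (1 + C)) ≤ |W - k| * δ := mul_le_mul_of_nonneg_left hη' (abs_nonneg _)
      have q4 : |W - k| * (l + f k) = |W - k| * (-2 * δ) := by rw [hδ']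
      have q5 : Real.sign (W - k) * (f W - f k) * (k - W) = - (f W - f k) * |W - k| := by rw [← key]; ring
      nlinarith
    · rw [gz p hpS, hhh, indicator_of_notMem hpS, neg_zero]
  have ih : Integrable hh := by
    refine IntegrableOn.integrable_indicator ?_ opS.measurableSet
    refine Measure.integrableOn_of_bounded (M := δ * (M + |k|)) fS
      ((h.mw.sub_const k).abs.const_mul δ).aestronglyMeasurable (Eventually.of_forall fun p => ?_)
    rw [norm_mul, Real.norm_of_nonneg hδ.le, Real.norm_eq_abs, abs_abs]
    exact mul_le_mul_of_nonneg_left (bk p) hδ.le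
  have ig : Integrable g := by
    have : g = S.indicator g := by
      ext p; by_cases hp : p ∈ S
      · rw [indicator_of_mem hp]
      · rw [indicator_of_notMem hp, gz p hp]
    rw [this]
    refine IntegrableOn.integrable_indicator ?_ opS.measurableSet
    have mg : Measurable g := ((h.mw.sub_const k).abs.mul (Dt_meas lψ.continuous)).add
      (((meas_sign.comp (h.mw.sub_const k)).mul ((hf.cont.measurable.comp h.mw).sub_const _)).mul (Dx_meas lψ.continuous))
    refine Measure.integrableOn_of_bounded (M := (M + |k|) * KE + 1 * (C * (M + |k|)) * KE) fS
      mg.aestronglyMeasurable (Eventually.of_forall fun p => ?_)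
    refine (norm_add_le _ _).trans (add_le_add ?_ ?_)
    · rw [norm_mul, Real.norm_eq_abs, abs_abs]
      exact mul_le_mul (bk p) (Dt_bdd lψ p) (abs_nonneg _) ((abs_nonneg _).trans (bk p))
    · rw [norm_mul, norm_mul]
      have h0 : 0 ≤ M + |k| := (abs_nonneg _).trans (bk p)
      refine mul_le_mul (mul_le_mul ?_ ((bfk p).trans (mul_le_mul_of_nonneg_left (bk p) hC)) (norm_nonneg _) zero_le_one)
        (Dx_bdd lψ p) (norm_nonneg _) (by positivity)
      rcases Real.sign_apply_eq (w p - k) with h | h | h <;> simp [h]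
  have hh0 : ∀ p, 0 ≤ hh p := fun p => indicator_nonneg (fun p _ => by positivity) p
  have I0 : ∫ p, hh p = 0 := by
    have h1 := integral_mono_ae ig ih.neg gle
    have h2 : ∫ p, (-hh) p = - ∫ p, hh p := integral_neg _
    have h3 := integral_nonneg (μ := volume) (f := hh) hh0
    rw [h2] at h1
    linarith [kr]
  have hz0 := (integral_eq_zero_iff_of_nonneg hh0 ih).mp I0
  have z1S : z1 ∈ S := by
    simp only [hS, mem_setOf_eq, hE]
    rw [dist_self, max_eq_left (by linarith)]; simp; positivity
  obtain ⟨ρ, hρ, hρ'⟩ := Metric.isOpen_iff.mp opS z1 z1S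
  have hk : ∀ᵐ p : ℝ², p ∈ Metric.ball z1 ρ → p ∈ Ω ∧ w p = k := by
    filter_upwards [hz0] with p hp hpb
    have hpS := hρ' hpb
    refine ⟨(hr' p (by have := small p hpS; rw [Metric.mem_ball]; linarith)).2, ?_⟩
    rw [hhh, indicator_of_mem hpS] at hp
    have : δ * |w p - k| = 0 := hp
    have := (mul_eq_zero.mp this).resolve_left hδ.ne'
    linarith [abs_eq_zero.mp this]
  obtain ⟨r2, hr2, hr2'⟩ := Metric.eventually_nhds_iff_ball.mp (H δ hδ)
  obtain ⟨τ, τ0, τ1, τ2⟩ : ∃ τ > 0, τ < ρ ∧ τ < r2 := ⟨min ρ r2 / 2, by positivity, by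
    have := min_le_left ρ r2; have : 0 < min ρ r2 := by positivity
    linarith, by
    have := min_le_right ρ r2; have : 0 < min ρ r2 := by positivity
    linarith⟩
  have e1 := h.const_t hk hρ (t := z1.2 - τ) ⟨by linarith, by linarith⟩
  have dd : dist ((z1.1, z1.2 - τ) : ℝ²) z1 = τ := by
    rw [Prod.dist_eq]; simp [Real.dist_eq, abs_of_pos τ0]; exact τ0.le
  have e2 := hr2' (z1.1, z1.2 - τ) (by rw [Metric.mem_ball, dd]; exact τ2)
  rw [dd] at e2
  simp only [Prod.mk.eta, sub_self, mul_zero, add_zero] at e1 e2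
  nlinarith
end S10

section S11
open scoped Convolution Topology NNReal

def cst (f : ℝ → ℝ) (x t y s : ℝ) : ℝ := (t - s) * LL f ((x - y) / (t - s))

lemma CF.cst_cont {f : ℝ → ℝ} {a : ℝ} (hf : CF f a) (x t : ℝ) :
    ContinuousOn (fun z : ℝ² => cst f x t z.1 z.2) {z | z.2 < t} := by
  unfold cst
  refine ContinuousOn.mul (by fun_prop) (hf.LL_cont.comp_continuousOn (ContinuousOn.div (by fun_prop) (by fun_prop) ?_))
  intro z hz; have : z.2 < t := hz; linarith

lemma CF.cst_hd {f : ℝ → ℝ} {a : ℝ} (hf : CF f a) {x t : ℝ} {z : ℝ²} (hz : z.2 < t) {p : ℝ} (hp : p = (x - z.1) / (t - z.2)) :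
    HasFDerivAt (fun z : ℝ² => cst f x t z.1 z.2)
      (-(GG f p) • ContinuousLinearMap.fst ℝ ℝ ℝ + (f (GG f p)) • ContinuousLinearMap.snd ℝ ℝ ℝ) z := by
  have h1 : HasFDerivAt (fun z : ℝ² => x - z.1) (-ContinuousLinearMap.fst ℝ ℝ ℝ) z := hasFDerivAt_fst.const_sub _
  have h2 : HasFDerivAt (fun z : ℝ² => t - z.2) (-ContinuousLinearMap.snd ℝ ℝ ℝ) z := hasFDerivAt_snd.const_sub _
  have hne : t - z.2 ≠ 0 := by linarith
  have h3 := h1.mul' ((hasDerivAt_inv hne).comp_hasFDerivAt z h2)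
  have h4 := h2.mul ((hf.LL_hd ((x - z.1) / (t - z.2))).comp_hasFDerivAt z h3)
  refine h4.congr_fderiv ?_
  have e := CF.fG (f := f) p
  ext
  · simp [← hp]; field_simp
  · simp [← hp]; field_simp
    have : x - z.1 = p * (t - z.2) := by rw [hp]; field_simp
    rw [this, ← e]; field_simp; ring

lemma CF.cst_low {f : ℝ → ℝ} {U : ℝ² → ℝ} {K : ℝ≥0} (hU : LipschitzWith K U) {C : ℝ}
    (hC : ∀ p, (K + 1) * |p| - C ≤ LL f p) {x t y s : ℝ} (hs : s < t) :
    U (x, t) + |x - y| - (C + K) * (t - s) ≤ U (y, s) + cst f x t y s := by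
  have h1 := hU.dist_le_mul (x, t) (y, s)
  rw [Prod.dist_eq, Real.dist_eq, Real.dist_eq, Real.dist_eq] at h1
  simp only at h1
  have h2 : max |x - y| |t - s| ≤ |x - y| + (t - s) := by
    refine max_le (by linarith) ?_
    rw [abs_of_pos (sub_pos.mpr hs)]; linarith [abs_nonneg (x - y)]
  have h3 := (le_abs_self _).trans (h1.trans (mul_le_mul_of_nonneg_left h2 K.2))
  have h4 := mul_le_mul_of_nonneg_left (hC ((x - y) / (t - s))) (sub_pos.mpr hs).le
  rw [abs_div, abs_of_pos (sub_pos.mpr hs)] at h4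
  have h5 : (t - s) * ((K + 1) * (|x - y| / (t - s)) - C) = (K + 1) * |x - y| - C * (t - s) := by
    have : t - s ≠ 0 := by linarith
    field_simp
  unfold cst
  have : (K:ℝ) * (|x - y| + (t - s)) = K * |x - y| + K * (t - s) := by ring
  linarith

lemma hU_aux {U : ℝ² → ℝ} {K : ℝ≥0} (hU : LipschitzWith K U) (x t δ : ℝ) (hδ : 0 < δ) : U (x, t - δ) ≤ U (x, t) + K * δ := by
  have h1 := hU.dist_le_mul (x, t - δ) (x, t)
  rw [Prod.dist_eq, Real.dist_eq, Real.dist_eq, Real.dist_eq] at h1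
  simp [abs_of_pos hδ, hδ.le] at h1
  linarith [le_abs_self (U (x, t - δ) - U (x, t))]

lemma Reg.cone0 {U w : ℝ² → ℝ} {f : ℝ → ℝ} {M a : ℝ} {K : ℝ≥0} {H : Set ℝ} (hH : IsClosed H) (hf : CF f a)
    (h : Reg U w f M K {z | z.1 ∈ H ∧ z.1 ≠ 0 ∧ 0 < z.2}) {x0 t0 : ℝ} (hx : x0 ∈ H) (ht : 0 < t0) :
    ∃ C1, 0 ≤ C1 ∧ ∀ δ, 0 < δ → δ < t0 → ∃ y s, y ∈ H ∧ 0 ≤ s ∧ s < t0 ∧ (s = 0 ∨ y = 0) ∧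
      U (y, s) + cst f x0 t0 y s ≤ U (x0, t0) + C1 * δ := by
  obtain ⟨C, hC, hC'⟩ := hf.LL_sup (K + 1)
  refine ⟨K + |LL f 0| + t0 + 2, by positivity, fun δ hδ hδt => ?_⟩
  set C1 : ℝ := K + |LL f 0| + t0 + 2 with hC1
  set S := t0 - δ / 2 with hS
  set Ψ : ℝ² → ℝ := fun z => U z + cst f x0 t0 z.1 z.2 + δ * z.2 + δ ^ 2 / (S - z.2) with hΨ
  set R : ℝ := C1 * δ + (C + K) * t0 + 1 with hR
  have R0 : 0 < R := by positivity
  set V := U (x0, t0) + C1 * δ with hV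
  have hK0 : (0:ℝ) ≤ K := K.2
  have e0 : Ψ (x0, t0 - δ) ≤ V := by
    have h1 := hU_aux h.lip x0 t0 δ hδ
    simp only [hΨ, cst, hS, sub_self, zero_div, hV, hC1]
    have e1 : t0 - (t0 - δ) = δ := by ring
    have e2 : δ ^ 2 / (t0 - δ / 2 - (t0 - δ)) = 2 * δ := by
      have : t0 - δ / 2 - (t0 - δ) = δ / 2 := by ring
      rw [this]; field_simp
    rw [e1, e2]
    nlinarith [mul_le_mul_of_nonneg_left (le_abs_self (LL f 0)) hδ.le]
  have low : ∀ z : ℝ², 0 ≤ z.2 → z.2 < S → Ψ z ≤ V → |x0 - z.1| ≤ R ∧ δ ^ 2 / R ≤ S - z.2 := by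
    intro z h1 h2 h3
    have l := CF.cst_low h.lip hC' (x := x0) (t := t0) (y := z.1) (s := z.2) (by linarith)
    have p1 : 0 < δ ^ 2 / (S - z.2) := by have : 0 < S - z.2 := by linarith
                                          positivity
    have p2 : 0 ≤ δ * z.2 := by positivity
    have p3 : (C + K) * (t0 - z.2) ≤ (C + K) * t0 := mul_le_mul_of_nonneg_left (by linarith) (by positivity)
    simp only [hΨ] at h3
    refine ⟨by linarith, ?_⟩
    have : δ ^ 2 / (S - z.2) ≤ R := by linarith [abs_nonneg (x0 - z.1)]
    rw [div_le_iff₀ (by linarith)] at this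
    rw [div_le_iff₀ R0]; linarith
  set Q : Set ℝ² := (H ∩ Icc (x0 - R) (x0 + R)) ×ˢ Icc 0 (S - δ ^ 2 / R) with hQ
  have cQ : IsCompact Q := (isCompact_Icc.inter_left hH).prod isCompact_Icc
  have inQ : ∀ z : ℝ², z.1 ∈ H → 0 ≤ z.2 → z.2 < S → Ψ z ≤ V → z ∈ Q := fun z h0 h1 h2 h3 => by
    obtain ⟨a1, a2⟩ := low z h1 h2 h3
    rw [abs_le] at a1
    exact ⟨⟨h0, by linarith, by linarith⟩, h1, by linarith⟩
  have q1 : (x0, t0 - δ) ∈ Q := inQ _ hx (by simp; linarith) (by simp [hS]; linarith) e0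
  have QS : ∀ z ∈ Q, z.2 < S := fun z hz => by
    have := hz.2.2; have : 0 < δ ^ 2 / R := by positivity
    linarith
  have cΨ : ContinuousOn Ψ Q := by
    refine ContinuousOn.add (ContinuousOn.add (ContinuousOn.add h.lip.continuous.continuousOn
      ((hf.cst_cont x0 t0).mono fun z hz => ?_)) (by fun_prop)) (ContinuousOn.div (by fun_prop) (by fun_prop) fun z hz => ?_)
    · have := QS z hz; show z.2 < t0; linarith
    · have := QS z hz; linarith
  obtain ⟨z, hz, hm⟩ := cQ.exists_isMinOn ⟨_, q1⟩ cΨ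
  have hzV : Ψ z ≤ V := (hm q1).trans e0
  have zS := QS z hz
  have glob : ∀ z' : ℝ², z'.1 ∈ H → 0 ≤ z'.2 → z'.2 < S → Ψ z ≤ Ψ z' := fun z' h0 h1 h2 => by
    by_cases h3 : Ψ z' ≤ V
    · exact hm (inQ z' h0 h1 h2 h3)
    · linarith
  have src : z.2 = 0 ∨ z.1 = 0 := by
    by_contra hc
    push Not at hc
    have z2 : 0 < z.2 := lt_of_le_of_ne hz.2.1 (Ne.symm hc.1)
    have hΩ : z ∈ {z : ℝ² | z.1 ∈ H ∧ z.1 ≠ 0 ∧ 0 < z.2} := ⟨hz.1.1, hc.2, z2⟩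
    set p := (x0 - z.1) / (t0 - z.2) with hp
    have hS0 : S - z.2 ≠ 0 := by linarith
    have d1 := hf.cst_hd (x := x0) (t := t0) (z := z) (by linarith) hp
    have d2 : HasFDerivAt (fun z : ℝ² => δ * z.2) (δ • ContinuousLinearMap.snd ℝ ℝ ℝ) z := hasFDerivAt_snd.const_mul δ
    have d3 : HasFDerivAt (fun z : ℝ² => δ ^ 2 / (S - z.2)) ((δ ^ 2 / (S - z.2) ^ 2) • ContinuousLinearMap.snd ℝ ℝ ℝ) z := by
      have := (((hasDerivAt_id z.2).const_sub S).inv hS0).const_mul (δ ^ 2)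
      have := this.comp_hasFDerivAt z (hasFDerivAt_snd (𝕜 := ℝ) (E := ℝ) (F := ℝ) (p := z))
      refine (this.congr_fderiv ?_)
      ext <;> simp [div_eq_mul_inv]
    have d4 := (d1.add d2).add d3
    have := h.touch hf hΩ (k := GG f p) (l := - (f (GG f p) + δ + δ ^ 2 / (S - z.2) ^ 2)) ?_
    · have : 0 < δ ^ 2 / (S - z.2) ^ 2 := by positivity
      linarith
    · intro η hη
      have lo := (hasFDerivAt_iff_isLittleO.mp d4).def hη
      have n1 : ∀ᶠ z' in 𝓝 z, z' ∈ {z : ℝ² | z.1 ∈ H ∧ z.1 ≠ 0 ∧ 0 < z.2} := h.op.mem_nhds hΩ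
      have n2 : ∀ᶠ z' : ℝ² in 𝓝 z, z'.2 < S := (continuous_snd.tendsto z).eventually_lt_const zS
      filter_upwards [lo, n1, n2] with z' h1 h2 h3
      have g := glob z' h2.1 h2.2.2.le h3
      simp only [hΨ] at g
      rw [Real.norm_eq_abs, ← dist_eq_norm] at h1
      have h1 := (le_abs_self _).trans h1
      simp at h1
      nlinarith
  refine ⟨z.1, z.2, hz.1.1, hz.2.1, by linarith, src, ?_⟩
  have p1 : 0 < δ ^ 2 / (S - z.2) := by have : 0 < S - z.2 := by linarith
                                        positivity
  have p2 : 0 ≤ δ * z.2 := mul_nonneg hδ.le hz.2.1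
  simp only [hΨ] at hzV
  linarith
end S11

section S12
open scoped Convolution Topology NNReal

lemma Reg.cone {U w : ℝ² → ℝ} {f : ℝ → ℝ} {M a : ℝ} {K : ℝ≥0} {H : Set ℝ} (hH : IsClosed H) (hf : CF f a)
    (h : Reg U w f M K {z | z.1 ∈ H ∧ z.1 ≠ 0 ∧ 0 < z.2}) {x0 t0 : ℝ} (hx : x0 ∈ H) (hx0 : x0 ≠ 0) (ht : 0 < t0) :
    ∃ y s, y ∈ H ∧ 0 ≤ s ∧ s < t0 ∧ (s = 0 ∨ y = 0) ∧ U (y, s) + cst f x0 t0 y s ≤ U (x0, t0) := by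
  obtain ⟨C1, hC1, h1⟩ := h.cone0 hH hf hx ht
  obtain ⟨C, hC, hC'⟩ := hf.LL_sup (K + 1)
  have hK0 : (0:ℝ) ≤ K := K.2
  set c := min t0 (|x0| / (2 * (C + K + 1))) with hc
  have ax : 0 < |x0| := abs_pos.mpr hx0
  have c0 : 0 < c := lt_min ht (by positivity)
  set R : ℝ := (C + K) * t0 + |x0| with hR
  set Q : Set ℝ² := ((H ∩ Icc (x0 - R) (x0 + R)) ×ˢ Icc 0 (t0 - c)) ∩ ({z | z.2 = 0} ∪ {z | z.1 = 0}) with hQ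
  have cQ : IsCompact Q := ((isCompact_Icc.inter_left hH).prod isCompact_Icc).inter_right
    ((isClosed_eq continuous_snd continuous_const).union (isClosed_eq continuous_fst continuous_const))
  have cF : ContinuousOn (fun z : ℝ² => U z + cst f x0 t0 z.1 z.2) Q :=
    h.lip.continuous.continuousOn.add ((hf.cst_cont x0 t0).mono fun z hz => by
      have := hz.1.2.2; show z.2 < t0; linarith)
  have key : ∀ δ, 0 < δ → δ < t0 → C1 * δ ≤ |x0| / 2 → ∃ z ∈ Q, U z + cst f x0 t0 z.1 z.2 ≤ U (x0, t0) + C1 * δ := by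
    intro δ d0 d1 d2
    obtain ⟨y, s, hy, s0, s1, hs, he⟩ := h1 δ d0 d1
    have l := CF.cst_low h.lip hC' (x := x0) (t := t0) (y := y) (s := s) s1
    have p3 : (C + K) * (t0 - s) ≤ (C + K) * t0 := mul_le_mul_of_nonneg_left (by linarith) (by positivity)
    refine ⟨(y, s), ⟨⟨⟨hy, ?_⟩, s0, ?_⟩, hs⟩, he⟩
    · have : |x0 - y| ≤ R := by linarith
      rw [abs_le] at this; constructor <;> linarith
    · simp only
      rcases hs with hs | hs
      · rw [hs]; linarith [min_le_left t0 (|x0| / (2 * (C + K + 1)))]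
      · rw [hs, sub_zero] at l
        have : |x0| / (2 * (C + K + 1)) ≤ t0 - s := by
          rw [div_le_iff₀ (by positivity)]; rw [hs] at he; nlinarith
        linarith [min_le_right t0 (|x0| / (2 * (C + K + 1)))]
  have ev : ∀ᶠ δ in 𝓝[>] (0:ℝ), 0 < δ ∧ δ < t0 ∧ C1 * δ ≤ |x0| / 2 := by
    have t1 : Tendsto (fun δ : ℝ => C1 * δ) (𝓝[>] 0) (𝓝 0) := by
      have : Tendsto (fun δ : ℝ => C1 * δ) (𝓝 0) (𝓝 (C1 * 0)) := tendsto_id.const_mul C1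
      rw [mul_zero] at this; exact this.mono_left inf_le_left
    filter_upwards [self_mem_nhdsWithin, Ioo_mem_nhdsGT ht, t1.eventually_lt_const (half_pos ax)] with δ a1 a2 a3
    exact ⟨a1, a2.2, a3.le⟩
  obtain ⟨δ, e1, e2, e3⟩ := ev.exists
  obtain ⟨z0, hz0, -⟩ := key δ e1 e2 e3
  obtain ⟨z, hz, hm⟩ := cQ.exists_isMinOn ⟨_, hz0⟩ cF
  refine ⟨z.1, z.2, hz.1.1.1, hz.1.2.1, by linarith [hz.1.2.2], hz.2, ?_⟩
  have t2 : Tendsto (fun δ : ℝ => U (x0, t0) + C1 * δ) (𝓝[>] 0) (𝓝 (U (x0, t0) + C1 * 0)) :=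
    ((tendsto_id.const_mul C1).const_add _).mono_left inf_le_left
  rw [mul_zero, add_zero] at t2
  refine ge_of_tendsto t2 ?_
  filter_upwards [ev] with δ hδ
  obtain ⟨z', hz', he⟩ := key δ hδ.1 hδ.2.1 hδ.2.2
  exact (hm hz').trans he

namespace ABSol
variable {fl fr : ℝ → ℝ} {A B a γ : ℝ} {u0 : ℝ → ℝ} {s : ABSol fl fr A B u0} {U : ℝ² → ℝ}

lemma Pot.regl (h : s.Pot U) (d : Dat fl fr A B a γ) : ∃ M K, Reg U (fun p => s.u p.1 p.2) fl M K {z | z.1 ∈ Iic (0:ℝ) ∧ z.1 ≠ 0 ∧ 0 < z.2} := by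
  obtain ⟨M, hM⟩ := s.bdd
  obtain ⟨K, hK⟩ := h.lip
  have op : IsOpen {z : ℝ² | z.1 ∈ Iic (0:ℝ) ∧ z.1 ≠ 0 ∧ 0 < z.2} := by
    have : {z : ℝ² | z.1 ∈ Iic (0:ℝ) ∧ z.1 ≠ 0 ∧ 0 < z.2} = Iio 0 ×ˢ Ioi 0 := by
      ext z; simp only [mem_setOf_eq, mem_prod, mem_Iio, mem_Iic, mem_Ioi, ← and_assoc, ← lt_iff_le_and_ne]
    rw [this]; exact isOpen_Iio.prod isOpen_Ioi
  refine ⟨M, K, op, hK, s.meas, fun p => hM _ _, ?_, fun k ψ K' h1 h2 h3 h4 => ?_⟩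
  · filter_upwards [h.aeD d.l.cont d.r.cont] with p hp ⟨h1, h2, h3⟩
    obtain ⟨L, hL, e⟩ := hp h3
    refine ⟨L, hL, fun x y => ?_⟩
    rw [e, dflux, if_pos (lt_of_le_of_ne h1 h2)]
  · obtain ⟨C, -, hC⟩ := cont_bdd d.l.cont (max M |k|)
    refine entL (k := fun _ => k) (f := fun _ => fl) s.meas (fun x t => (hM x t).trans (le_max_left M |k|)) op
      (fun g hg => d.l.cont.measurable.comp hg) (fun _ q hq => hC q hq) measurable_const (fun _ => le_max_right _ _)
      (fun φ c1 c2 c3 c4 => ?_) h1 h2 h3 h4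
    refine s.kruzkov_l k (fun x t => φ (x, t)) c1 c2 (fun x t => c3 _) (fun x t hx => ?_)
    by_contra hc
    have := c4 (subset_tsupport φ hc)
    rcases hx with hx | hx
    · exact this.2.1 (le_antisymm this.1 hx)
    · exact absurd this.2.2 (not_lt.mpr hx)

lemma Pot.regr (h : s.Pot U) (d : Dat fl fr A B a γ) : ∃ M K, Reg U (fun p => s.u p.1 p.2) fr M K {z | z.1 ∈ Ici (0:ℝ) ∧ z.1 ≠ 0 ∧ 0 < z.2} := by
  obtain ⟨M, hM⟩ := s.bdd
  obtain ⟨K, hK⟩ := h.lip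
  have op : IsOpen {z : ℝ² | z.1 ∈ Ici (0:ℝ) ∧ z.1 ≠ 0 ∧ 0 < z.2} := by
    have : {z : ℝ² | z.1 ∈ Ici (0:ℝ) ∧ z.1 ≠ 0 ∧ 0 < z.2} = Ioi 0 ×ˢ Ioi 0 := by
      ext z; simp only [mem_setOf_eq, mem_prod, mem_Ici, mem_Ioi, ← and_assoc, lt_iff_le_and_ne, ne_comm (a := z.1)]
    rw [this]; exact isOpen_Ioi.prod isOpen_Ioi
  refine ⟨M, K, op, hK, s.meas, fun p => hM _ _, ?_, fun k ψ K' h1 h2 h3 h4 => ?_⟩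
  · filter_upwards [h.aeD d.l.cont d.r.cont] with p hp ⟨h1, h2, h3⟩
    obtain ⟨L, hL, e⟩ := hp h3
    refine ⟨L, hL, fun x y => ?_⟩
    rw [e, dflux, if_neg (not_lt.mpr h1)]
  · obtain ⟨C, -, hC⟩ := cont_bdd d.r.cont (max M |k|)
    refine entL (k := fun _ => k) (f := fun _ => fr) s.meas (fun x t => (hM x t).trans (le_max_left M |k|)) op
      (fun g hg => d.r.cont.measurable.comp hg) (fun _ q hq => hC q hq) measurable_const (fun _ => le_max_right _ _)
      (fun φ c1 c2 c3 c4 => ?_) h1 h2 h3 h4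
    refine s.kruzkov_r k (fun x t => φ (x, t)) c1 c2 (fun x t => c3 _) (fun x t hx => ?_)
    by_contra hc
    have := c4 (subset_tsupport φ hc)
    rcases hx with hx | hx
    · exact this.2.1 (le_antisymm hx this.1)
    · exact absurd this.2.2 (not_lt.mpr hx)

end ABSol
end S12

section S13
open scoped Convolution Topology NNReal

def Dn (fl fr : ℝ → ℝ) (γ : ℝ) (U : ℝ² → ℝ) (x t y s : ℝ) : Prop := ∃ ζ : ℝ → ℝ, ∃ K, LipschitzWith K ζ ∧ ζ s = y ∧ ζ t = x ∧
  U (y, s) + ∫ τ in s..t, ell fl fr γ (ζ τ) (deriv ζ τ) ≤ U (x, t)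

lemma Dn.trans {fl fr : ℝ → ℝ} {A B a γ : ℝ} (d : Dat fl fr A B a γ) {U : ℝ² → ℝ} {x t z r y s : ℝ} (hs : s ≤ r) (hr : r ≤ t)
    (h1 : Dn fl fr γ U z r y s) (h2 : Dn fl fr γ U x t z r) : Dn fl fr γ U x t y s := by
  obtain ⟨ζ1, K1, l1, a1, b1, c1⟩ := h1
  obtain ⟨ζ2, K2, l2, a2, b2, c2⟩ := h2
  have L : LipschitzWith (K1 * 1 + K2 * 1 + 0) fun τ => ζ1 (min τ r) + ζ2 (max τ r) - ζ1 r :=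
    ((l1.comp (LipschitzWith.id.min_const r)).add (l2.comp (LipschitzWith.id.max_const r))).sub (LipschitzWith.const (ζ1 r))
  refine ⟨_, _, L, ?_, ?_, ?_⟩
  · simp [hs, a2, b1, a1]
  · simp [hr, b1, b2]
  · rw [← intervalIntegral.integral_add_adjacent_intervals (d.ell_ii L s r) (d.ell_ii L r t)]
    have e1 : ∫ τ in s..r, ell fl fr γ (ζ1 (min τ r) + ζ2 (max τ r) - ζ1 r) (deriv (fun τ => ζ1 (min τ r) + ζ2 (max τ r) - ζ1 r) τ)
        = ∫ τ in s..r, ell fl fr γ (ζ1 τ) (deriv ζ1 τ) := by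
      refine intervalIntegral.integral_congr_ae ?_
      filter_upwards [(countable_singleton r).ae_notMem volume] with τ hτ hm
      rw [uIoc_of_le hs] at hm
      have lt : τ < r := lt_of_le_of_ne hm.2 hτ
      have ev : (fun τ => ζ1 (min τ r) + ζ2 (max τ r) - ζ1 r) =ᶠ[𝓝 τ] ζ1 := by
        filter_upwards [Iio_mem_nhds lt] with q hq
        have hq : q < r := hq
        rw [min_eq_left hq.le, max_eq_right hq.le, a2, b1]; ring
      rw [ev.deriv_eq, ← ev.eq_of_nhds]
    have e2 : ∫ τ in r..t, ell fl fr γ (ζ1 (min τ r) + ζ2 (max τ r) - ζ1 r) (deriv (fun τ => ζ1 (min τ r) + ζ2 (max τ r) - ζ1 r) τ)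
        = ∫ τ in r..t, ell fl fr γ (ζ2 τ) (deriv ζ2 τ) := by
      refine intervalIntegral.integral_congr_ae ?_
      filter_upwards with τ hm
      rw [uIoc_of_le hr] at hm
      have ev : (fun τ => ζ1 (min τ r) + ζ2 (max τ r) - ζ1 r) =ᶠ[𝓝 τ] ζ2 := by
        filter_upwards [Ioi_mem_nhds hm.1] with q hq
        have hq : r < q := hq
        rw [min_eq_right hq.le, max_eq_left hq.le]; ring
      rw [ev.deriv_eq, ← ev.eq_of_nhds]
    rw [e1, e2]; linarith

def seg (x t y s τ : ℝ) : ℝ := y + (τ - s) * ((x - y) / (t - s))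

lemma seg_hd (x t y s τ : ℝ) : HasDerivAt (seg x t y s) ((x - y) / (t - s)) τ := by
  exact ((((hasDerivAt_id τ).sub_const s).mul_const ((x - y) / (t - s))).const_add y).congr_deriv (one_mul _)

lemma seg_lip (x t y s : ℝ) : ∃ K, LipschitzWith K (seg x t y s) :=
  ⟨‖(x - y) / (t - s)‖₊, lipschitzWith_of_nnnorm_deriv_le (fun τ => (seg_hd x t y s τ).differentiableAt)
    fun τ => by rw [(seg_hd x t y s τ).deriv]⟩

lemma seg_end {x t y s : ℝ} (h : s < t) : seg x t y s s = y ∧ seg x t y s t = x := by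
  have : t - s ≠ 0 := by linarith
  simp only [seg]; constructor
  · simp
  · field_simp; ring

lemma seg_mem {x t y s τ : ℝ} (h : s < t) (h1 : s ≤ τ) (h2 : τ ≤ t) : ∃ c, 0 ≤ c ∧ c ≤ 1 ∧ seg x t y s τ = y * (1 - c) + x * c := by
  have : 0 < t - s := by linarith
  refine ⟨(τ - s) / (t - s), div_nonneg (by linarith) this.le, (div_le_one this).mpr (by linarith), ?_⟩
  simp only [seg]; field_simp; ring

lemma Dat.seg_int {fl fr : ℝ → ℝ} {A B a γ : ℝ} (d : Dat fl fr A B a γ) {f : ℝ → ℝ} {x t y s : ℝ} (h : s < t)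
    (hf : (x ≤ 0 ∧ y ≤ 0 ∧ f = fl) ∨ (0 ≤ x ∧ 0 ≤ y ∧ f = fr)) :
    ∫ τ in s..t, ell fl fr γ (seg x t y s τ) (deriv (seg x t y s) τ) ≤ cst f x t y s := by
  obtain ⟨K, hK⟩ := seg_lip x t y s
  have e : cst f x t y s = ∫ τ in s..t, LL f ((x - y) / (t - s)) := by simp [cst]
  rw [e]
  rw [intervalIntegral.integral_of_le h.le, intervalIntegral.integral_of_le h.le]
  refine setIntegral_mono_ae_restrict (d.ell_ii hK s t).1 (intervalIntegrable_const (μ := volume) (a := s) (b := t) (c := LL f ((x - y) / (t - s)))).1 ?_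
  rw [EventuallyLE, ae_restrict_iff' measurableSet_Ioc]
  filter_upwards [deriv_zero_ae (seg x t y s)] with τ h0 hτ
  rw [(seg_hd x t y s τ).deriv] at h0 ⊢
  obtain ⟨c, c0, c1, hc⟩ := seg_mem (x := x) (y := y) h hτ.1.le hτ.2
  rcases hf with ⟨hx, hy, rfl⟩ | ⟨hx, hy, rfl⟩
  · have : seg x t y s τ ≤ 0 := by rw [hc]; nlinarith
    rcases this.lt_or_eq with h' | h'
    · simp [ell, h']
    · rw [h0 h']; simp only [ell, h', lt_irrefl, if_false]; rw [← d.fA]; exact d.l.LL0_ge A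
  · have : 0 ≤ seg x t y s τ := by rw [hc]; nlinarith
    rcases this.lt_or_eq with h' | h'
    · simp [ell, h', not_lt.mpr h'.le]
    · rw [h0 h'.symm]; simp only [ell, ← h', lt_irrefl, if_false]; rw [← d.fB]; exact d.r.LL0_ge B

lemma Dn.seg {fl fr : ℝ → ℝ} {A B a γ : ℝ} (d : Dat fl fr A B a γ) {f : ℝ → ℝ} {U : ℝ² → ℝ} {x t y s : ℝ} (h : s < t)
    (hf : (x ≤ 0 ∧ y ≤ 0 ∧ f = fl) ∨ (0 ≤ x ∧ 0 ≤ y ∧ f = fr)) (hU : U (y, s) + cst f x t y s ≤ U (x, t)) : Dn fl fr γ U x t y s := by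
  obtain ⟨K, hK⟩ := seg_lip x t y s
  exact ⟨_, K, hK, (seg_end h).1, (seg_end h).2, by linarith [d.seg_int h hf]⟩

lemma CF.D_lim {f : ℝ → ℝ} {a : ℝ} (hf : CF f a) {U : ℝ² → ℝ} {K : ℝ≥0} (hU : LipschitzWith K U) {H : Set ℝ} (hH : IsClosed H)
    {X T : ℕ → ℝ} {x t : ℝ} (hX : Tendsto X atTop (𝓝 x)) (hT : Tendsto T atTop (𝓝 t)) (ht : 0 < t)
    (h : ∀ᶠ n in atTop, ∃ y ∈ H, U (y, 0) + cst f (X n) (T n) y 0 ≤ U (X n, T n)) :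
    ∃ y ∈ H, U (y, 0) + cst f x t y 0 ≤ U (x, t) := by
  obtain ⟨C, hC, hC'⟩ := hf.LL_sup (K + 1)
  have hK0 : (0:ℝ) ≤ K := K.2
  have h' : ∀ᶠ n in atTop, ∃ y ∈ H ∩ Icc (x - 1 - (C + K) * (t + 1)) (x + 1 + (C + K) * (t + 1)), U (y, 0) + cst f (X n) (T n) y 0 ≤ U (X n, T n) := by
    filter_upwards [h, hX.eventually_const_lt (show x - 1 < x by linarith), hX.eventually_lt_const (show x < x + 1 by linarith),
      hT.eventually_const_lt ht, hT.eventually_lt_const (show t < t + 1 by linarith)] with n ⟨y, hy, hn⟩ h1 h2 h3 h4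
    refine ⟨y, ⟨hy, ?_⟩, hn⟩
    have l := CF.cst_low hU hC' (x := X n) (t := T n) (y := y) (s := 0) h3
    have : (C + K) * (T n - 0) ≤ (C + K) * (t + 1) := mul_le_mul_of_nonneg_left (by linarith) (by positivity)
    have : |X n - y| ≤ (C + K) * (t + 1) := by linarith
    rw [abs_le] at this
    constructor <;> linarith
  obtain ⟨N, hN⟩ := eventually_atTop.mp h'
  choose! y hy1 hy2 using hN
  obtain ⟨z, hz, φ, hφ, hl⟩ := (isCompact_Icc.inter_left hH).tendsto_subseq (x := fun n => y (n + N)) (fun n => hy1 (n + N) (by omega))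
  have tt : Tendsto (fun n => φ n + N) atTop atTop := tendsto_atTop_mono (fun n => Nat.le_add_right _ _) hφ.tendsto_atTop
  have X' := hX.comp tt
  have T' := hT.comp tt
  refine ⟨z, hz.1, ?_⟩
  have c1 : Tendsto (fun n => U (y (φ n + N), 0)) atTop (𝓝 (U (z, 0))) := (hU.continuous.tendsto _).comp (hl.prodMk_nhds tendsto_const_nhds)
  have c2 : Tendsto (fun n => U (X (φ n + N), T (φ n + N))) atTop (𝓝 (U (x, t))) := (hU.continuous.tendsto _).comp (X'.prodMk_nhds T')
  have c3 : Tendsto (fun n => cst f (X (φ n + N)) (T (φ n + N)) (y (φ n + N)) 0) atTop (𝓝 (cst f x t z 0)) := by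
    unfold cst
    refine (T'.sub_const 0).mul ((hf.LL_cont.tendsto _).comp ((X'.sub hl).div (T'.sub_const 0) (by linarith)))
  exact le_of_tendsto_of_tendsto' (c1.add c3) c2 fun n => hy2 _ (by omega)

namespace ABSol
variable {fl fr : ℝ → ℝ} {A B a γ : ℝ} {u0 : ℝ → ℝ} {s : ABSol fl fr A B u0} {U : ℝ² → ℝ}

lemma Pot.sub_seg (h : s.Pot U) (d : Dat fl fr A B a γ) {f : ℝ → ℝ} {x t y r : ℝ} (h0 : 0 ≤ r) (hr : r < t)
    (hf : (x ≤ 0 ∧ y ≤ 0 ∧ f = fl) ∨ (0 ≤ x ∧ 0 ≤ y ∧ f = fr)) : U (x, t) ≤ U (y, r) + cst f x t y r := by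
  obtain ⟨K, hK⟩ := seg_lip x t y r
  have := h.sub d hK h0 hr.le
  rw [(seg_end hr).1, (seg_end hr).2] at this
  linarith [d.seg_int hr hf]

lemma cst_hdx {f : ℝ → ℝ} (hf : CF f a) {x t y r : ℝ} (h : r < t) : HasDerivAt (fun x => cst f x t y r) (GG f ((x - y) / (t - r))) x := by
  have h1 := (hf.LL_hd ((x - y) / (t - r))).comp x (((hasDerivAt_id x).sub_const y).div_const (t - r))
  have : t - r ≠ 0 := by linarith
  refine (h1.const_mul (t - r)).congr_deriv ?_
  field_simp

lemma Pot.slope (h : s.Pot U) (d : Dat fl fr A B a γ) {f : ℝ → ℝ} (hf : CF f a) {x t y r c : ℝ} (h0 : 0 ≤ r) (hr : r < t) (hx0 : x ≠ 0)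
    (hc : (x ≤ 0 ∧ y ≤ 0 ∧ f = fl) ∨ (0 ≤ x ∧ 0 ≤ y ∧ f = fr)) (hle : U (y, r) + cst f x t y r ≤ U (x, t))
    (hd : HasDerivAt (fun y => U (y, t)) c x) : (x - y) / (t - r) = deriv f c := by
  have hm : IsLocalMin (fun x' => cst f x' t y r - U (x', t)) x := by
    rcases hc with ⟨h1, h2, rfl⟩ | ⟨h1, h2, rfl⟩
    · filter_upwards [Iio_mem_nhds (lt_of_le_of_ne h1 hx0)] with x' hx'
      have := h.sub_seg d h0 hr (f := f) (x := x') (y := y) (Or.inl ⟨le_of_lt hx', h2, rfl⟩)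
      linarith
    · filter_upwards [Ioi_mem_nhds (lt_of_le_of_ne h1 hx0.symm)] with x' hx'
      have := h.sub_seg d h0 hr (f := f) (x := x') (y := y) (Or.inr ⟨le_of_lt hx', h2, rfl⟩)
      linarith
  have := hm.hasDerivAt_eq_zero ((cst_hdx hf hr).sub hd)
  rw [← sub_eq_zero.mp this, hf.dG]

lemma Pot.Dl (h : s.Pot U) (d : Dat fl fr A B a γ) {t : ℝ} (ht : 0 < t) (hd : 0 < deriv fl (s.N 0 t)) :
    ∃ y ∈ Iic (0:ℝ), U (y, 0) + cst fl 0 t y 0 ≤ U (0, t) := by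
  obtain ⟨M, K, hR⟩ := h.regl d
  have q : ∀ᵐ z : ℝ, HasDerivAt (fun y => U (y, t)) (s.u (-z) t) (-z) :=
    (Measure.measurePreserving_neg (volume : Measure ℝ)).quasiMeasurePreserving.ae (h.hdx ht.le)
  obtain ⟨z, hz, hz0⟩ := ae_seq_right q
  have z1 : Tendsto (fun n => - z n) atTop (𝓝[<] 0) := by
    have := tendsto_neg_nhdsGT (a := (0:ℝ)); rw [neg_zero] at this; exact this.comp hz0
  have lim : Tendsto (fun n => deriv fl (s.u (- z n) t)) atTop (𝓝 (deriv fl (s.N 0 t))) :=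
    (d.l.c1.continuous.tendsto _).comp ((s.N_lim ht).comp z1)
  refine d.l.D_lim hR.lip isClosed_Iic (tendsto_nhdsWithin_iff.mp z1).1 (tendsto_const_nhds (x := t)) ht ?_
  filter_upwards [lim.eventually_const_lt hd, (tendsto_nhdsWithin_iff.mp z1).2] with n h1 h2
  have h2 : - z n < 0 := h2
  obtain ⟨y, r, hy, r0, rt, hs, hle⟩ := hR.cone isClosed_Iic d.l h2.le h2.ne ht
  have e := h.slope d d.l r0 rt h2.ne (Or.inl ⟨h2.le, hy, rfl⟩) hle (hz n)
  rcases hs with rfl | rfl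
  · exact ⟨y, hy, hle⟩
  · rw [← e] at h1
    exact absurd h1 (not_lt.mpr (div_nonpos_of_nonpos_of_nonneg (by linarith) (by linarith)))

lemma Pot.Dr (h : s.Pot U) (d : Dat fl fr A B a γ) {t : ℝ} (ht : 0 < t) (hd : deriv fr (s.P 0 t) < 0) :
    ∃ y ∈ Ici (0:ℝ), U (y, 0) + cst fr 0 t y 0 ≤ U (0, t) := by
  obtain ⟨M, K, hR⟩ := h.regr d
  obtain ⟨z, hz, z1⟩ := ae_seq_right (h.hdx ht.le)
  have lim : Tendsto (fun n => deriv fr (s.u (z n) t)) atTop (𝓝 (deriv fr (s.P 0 t))) :=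
    (d.r.c1.continuous.tendsto _).comp ((s.P_lim ht).comp z1)
  refine d.r.D_lim hR.lip isClosed_Ici (tendsto_nhdsWithin_iff.mp z1).1 (tendsto_const_nhds (x := t)) ht ?_
  filter_upwards [lim.eventually_lt_const hd, (tendsto_nhdsWithin_iff.mp z1).2] with n h1 h2
  have h2 : 0 < z n := h2
  obtain ⟨y, r, hy, r0, rt, hs, hle⟩ := hR.cone isClosed_Ici d.r h2.le h2.ne' ht
  have e := h.slope d d.r r0 rt h2.ne' (Or.inr ⟨h2.le, hy, rfl⟩) hle (hz n)
  rcases hs with rfl | rfl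
  · exact ⟨y, hy, hle⟩
  · rw [← e] at h1
    exact absurd h1 (not_lt.mpr (div_nonneg (by linarith) (by linarith)))

lemma Pot.super0 (h : s.Pot U) (d : Dat fl fr A B a γ) {t : ℝ} (ht : 0 ≤ t) : ∃ y, Dn fl fr γ U 0 t y 0 := by
  obtain ⟨K, hK⟩ := h.lip
  have cl : ∀ (f : ℝ → ℝ) (hf : CF f a) (H : Set ℝ), IsClosed H →
      IsClosed {t : ℝ | t = 0 ∨ (0 < t ∧ ∃ y ∈ H, U (y, 0) + cst f 0 t y 0 ≤ U (0, t))} := fun f hf H hH => by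
    refine IsSeqClosed.isClosed fun T t hT hl => ?_
    have t0 : 0 ≤ t := ge_of_tendsto' hl fun n => (hT n).elim (fun h => h.ge) fun h => h.1.le
    rcases t0.eq_or_lt with h | h
    · exact Or.inl h.symm
    · refine Or.inr ⟨h, hf.D_lim hK hH tendsto_const_nhds hl h ?_⟩
      filter_upwards [hl.eventually_const_lt h] with n hn
      exact ((hT n).resolve_left hn.ne').2
  have cS := (cl fl d.l (Iic 0) isClosed_Iic).union (cl fr d.r (Ici 0) isClosed_Ici)
  set S := {t : ℝ | t = 0 ∨ (0 < t ∧ ∃ y ∈ Iic (0:ℝ), U (y, 0) + cst fl 0 t y 0 ≤ U (0, t))} ∪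
    {t : ℝ | t = 0 ∨ (0 < t ∧ ∃ y ∈ Ici (0:ℝ), U (y, 0) + cst fr 0 t y 0 ≤ U (0, t))} with hS
  obtain ⟨r, hr, hm⟩ := (isCompact_Icc (a := (0:ℝ)) (b := t)).inter_left cS |>.exists_isGreatest ⟨0, Or.inl (Or.inl rfl), le_rfl, ht⟩
  have r0 : 0 ≤ r := hr.2.1
  have stay : Dn fl fr γ U 0 t 0 r := by
    refine ⟨fun _ => 0, 0, LipschitzWith.const 0, rfl, rfl, ?_⟩
    have e := h.incN 0 r t r0 hr.2.2
    have : ∫ τ in r..t, dfluxm fl fr 0 (s.N 0 τ) = ∫ τ in r..t, γ := by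
      refine intervalIntegral.integral_congr_ae ?_
      filter_upwards [h.trace d] with τ h1 h2
      rw [uIoc_of_le hr.2.2] at h2
      have tp : 0 < τ := by linarith [h2.1]
      obtain ⟨-, g1, g2⟩ := h1 tp
      simp only [dfluxm, le_refl, if_true]
      by_contra hc
      have : τ ∈ S := by
        rcases g2 (lt_of_le_of_ne g1 (Ne.symm hc)) with g | g
        · exact Or.inl (Or.inr ⟨tp, h.Dl d tp g⟩)
        · exact Or.inr (Or.inr ⟨tp, h.Dr d tp g⟩)
      have := hm ⟨this, tp.le, h2.2⟩
      linarith [h2.1]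
    rw [this] at e
    simp [ell] at e ⊢
    linarith
  have ini : ∃ y, Dn fl fr γ U 0 r y 0 := by
    have triv : r = 0 → ∃ y, Dn fl fr γ U 0 r y 0 := fun h => by
      subst h; exact ⟨0, fun _ => 0, 0, LipschitzWith.const 0, rfl, rfl, by simp⟩
    rcases hr.1 with (h | ⟨h1, y, hy, h2⟩) | (h | ⟨h1, y, hy, h2⟩)
    · exact triv h
    · exact ⟨y, Dn.seg d h1 (Or.inl ⟨le_rfl, hy, rfl⟩) h2⟩
    · exact triv h
    · exact ⟨y, Dn.seg d h1 (Or.inr ⟨le_rfl, hy, rfl⟩) h2⟩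
  obtain ⟨y, hy⟩ := ini
  exact ⟨y, hy.trans d r0 hr.2.2 stay⟩

lemma Pot.super (h : s.Pot U) (d : Dat fl fr A B a γ) {t : ℝ} (ht : 0 < t) (x : ℝ) : ∃ y, Dn fl fr γ U x t y 0 := by
  have fin : ∀ {f : ℝ → ℝ} {y r : ℝ}, 0 ≤ r → r < t → (r = 0 ∨ y = 0) → ((x ≤ 0 ∧ y ≤ 0 ∧ f = fl) ∨ (0 ≤ x ∧ 0 ≤ y ∧ f = fr)) →
      U (y, r) + cst f x t y r ≤ U (x, t) → ∃ y, Dn fl fr γ U x t y 0 := by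
    intro f y r r0 rt hs hf hle
    have g := Dn.seg d rt hf hle
    rcases hs with rfl | rfl
    · exact ⟨y, g⟩
    · obtain ⟨z, hz⟩ := h.super0 d r0
      exact ⟨z, hz.trans d r0 rt.le g⟩
  rcases lt_trichotomy x 0 with hx | rfl | hx
  · obtain ⟨M, K, hR⟩ := h.regl d
    obtain ⟨y, r, hy, r0, rt, hs, hle⟩ := hR.cone isClosed_Iic d.l hx.le hx.ne ht
    exact fin r0 rt hs (Or.inl ⟨hx.le, hy, rfl⟩) hle
  · exact h.super0 d ht.le
  · obtain ⟨M, K, hR⟩ := h.regr d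
    obtain ⟨y, r, hy, r0, rt, hs, hle⟩ := hR.cone isClosed_Ici d.r hx.le hx.ne' ht
    exact fin r0 rt hs (Or.inr ⟨hx.le, hy, rfl⟩) hle

end ABSol
end S13

section S14
open scoped Convolution Topology NNReal

def Act (T : ℝ) (fl fr : ℝ → ℝ) (γ x y α : ℝ) : Prop := ∃ ζ : ℝ → ℝ, ∃ K, LipschitzWith K ζ ∧ ζ T = x ∧ ζ 0 = y ∧
  α = ∫ t in (0:ℝ)..T, ell fl fr γ (ζ t) (deriv ζ t)

lemma Act.rev {T : ℝ} {fl fr : ℝ → ℝ} {γ x y α : ℝ} (h : Act T fl fr γ x y α) : Act T fr fl γ (-y) (-x) α := by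
  obtain ⟨ζ, K, hK, h1, h2, h3⟩ := h
  refine ⟨fun t => - ζ (T - t), K, ?_, by simp [h2], by simp [h1], ?_⟩
  · refine LipschitzWith.of_dist_le_mul fun a b => ?_
    have := hK.dist_le_mul (T - a) (T - b)
    have e : T - a - (T - b) = b - a := by ring
    rw [Real.dist_eq, Real.dist_eq, e, abs_sub_comm b] at this
    rw [Real.dist_eq, Real.dist_eq, neg_sub_neg, abs_sub_comm]; exact this
  · have e := intervalIntegral.integral_comp_sub_left (fun t => ell fl fr γ (ζ t) (deriv ζ t)) (a := 0) (b := T) T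
    simp only [sub_self, sub_zero] at e
    rw [h3, ← e]
    congr 1; ext t
    have : deriv (fun t => - ζ (T - t)) t = deriv ζ (T - t) := by
      rw [deriv.fun_neg, deriv_comp_const_sub, neg_neg]
    rw [this]
    unfold ell
    rcases lt_trichotomy (ζ (T - t)) 0 with h | h | h
    · simp [h, h.not_gt]
    · simp [h]
    · simp [h, h.not_gt]

namespace ABSol
variable {fl fr : ℝ → ℝ} {A B a γ : ℝ} {u0 : ℝ → ℝ} {s : ABSol fl fr A B u0} {U : ℝ² → ℝ}

lemma Pot.hl (h : s.Pot U) (d : Dat fl fr A B a γ) {T : ℝ} (hT : 0 < T) : (∀ x y α, Act T fl fr γ x y α → U (x, T) ≤ U (y, 0) + α) ∧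
    ∀ x, ∃ y α, Act T fl fr γ x y α ∧ U (y, 0) + α ≤ U (x, T) := by
  constructor
  · rintro x y α ⟨ζ, K, hK, rfl, rfl, rfl⟩
    exact h.sub d hK le_rfl hT.le
  · intro x
    obtain ⟨y, ζ, K, hK, h1, h2, h3⟩ := h.super d hT x
    exact ⟨y, _, ⟨ζ, K, hK, h2, h1, rfl⟩, h3⟩

lemma Pot.inc0 (h : s.Pot U) (x y : ℝ) : U (y, 0) - U (x, 0) = ∫ z in x..y, u0 z := by
  rw [h.incx 0 le_rfl]
  exact intervalIntegral.integral_congr_ae (s.init.mono fun z hz _ => hz)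

end ABSol

theorem main_reduction {T a A B γ : ℝ} {fl fr : ℝ → ℝ} (hT : 0 < T) (d : Dat fl fr A B a γ) {Bb Aa : ℝ} (d' : Dat fr fl Bb Aa a γ)
    {ω : ℝ → ℝ} (hω : Attainable T fl fr A B ω) (v : ABSol fr fl Bb Aa (fun x => ω (-x)))
    (ustar : ABSol fl fr A B (fun x => v.u (-x) T)) (u0 : ℝ → ℝ) (hu0 : IsLinf u0) (E : Nonempty (ABSol fl fr A B u0)) :
    u0 ∈ InitialSet T fl fr A B ω ↔
      ∀ xb : ℝ, ∃ yb ∈ charSet0 T fl fr γ ustar xb,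
        (∀ y : ℝ, y < sInf (charSet0 T fl fr γ ustar xb) →
          (∫ x in y..yb, u0 x) ≤ ∫ x in y..yb, v.u (-x) T) ∧
        (∀ y : ℝ, sSup (charSet0 T fl fr γ ustar xb) < y →
          (∫ x in yb..y, v.u (-x) T) ≤ ∫ x in yb..y, u0 x) := by
  obtain ⟨V, hV⟩ := v.exists_pot d.r.cont d.l.cont
  obtain ⟨Us, hUs⟩ := ustar.exists_pot d.l.cont d.r.cont
  set Y : ℝ → ℝ := fun y => - V (-y, T) with hY
  set W : ℝ → ℝ := fun x => - V (-x, 0) with hW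
  have Yi : ∀ x y, Y y - Y x = ∫ z in x..y, v.u (-z) T := fun x y => by
    have := hV.incx T hT.le (-y) (-x)
    rw [intervalIntegral.integral_comp_neg (fun z => v.u z T), ← this]; simp only [hY]; ring
  have Wi : ∀ x y, W y - W x = ∫ z in x..y, ω z := fun x y => by
    have := hV.inc0 (-y) (-x)
    rw [← intervalIntegral.integral_comp_neg] at this
    simp only [neg_neg] at this
    rw [← this]; simp only [hW]; ring
  obtain ⟨V1, V2⟩ := hV.hl d' hT
  have h1 : ∀ x y α, Act T fl fr γ x y α → W x ≤ Y y + α := fun x y α h => by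
    have := V1 _ _ _ h.rev; simp only [hY, hW]; linarith
  have h2 : ∀ y, ∃ x α, Act T fl fr γ x y α ∧ Y y + α ≤ W x := fun y => by
    obtain ⟨x, α, hα, h⟩ := V2 (-y)
    refine ⟨-x, α, by simpa using hα.rev, ?_⟩
    simp only [hY, hW, neg_neg]; linarith
  have wc : ∀ {w0 : ℝ → ℝ} (s : ABSol fl fr A B w0) (U : ℝ² → ℝ), s.Pot U → (∀ᵐ x, s.u x T = ω x) → ∃ c, ∀ x, U (x, T) = W x + c := by
    intro w0 s U hU he
    refine ⟨U (0, T) - W 0, fun x => ?_⟩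
    have e1 := hU.incx T hT.le 0 x
    have e2 : ∫ z in (0:ℝ)..x, s.u z T = ∫ z in (0:ℝ)..x, ω z := intervalIntegral.integral_congr_ae (he.mono fun z hz _ => hz)
    have := Wi 0 x
    linarith
  have lemA : ∀ {w0 : ℝ → ℝ} (s : ABSol fl fr A B w0) (U : ℝ² → ℝ) (c : ℝ), s.Pot U → (∀ x, U (x, T) = W x + c) →
      (∀ y, Y y + c ≤ U (y, 0)) ∧ ∀ x, ∃ y α, Act T fl fr γ x y α ∧ Y y + α = W x ∧ U (y, 0) = Y y + c := by
    intro w0 s U c hU hc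
    obtain ⟨a1, a2⟩ := hU.hl d hT
    have A1 : ∀ y, Y y + c ≤ U (y, 0) := fun y => by
      obtain ⟨x, α, hα, h⟩ := h2 y
      have := a1 _ _ _ hα
      rw [hc] at this; linarith
    refine ⟨A1, fun x => ?_⟩
    obtain ⟨y, α, hα, h⟩ := a2 x
    rw [hc] at h
    exact ⟨y, α, hα, by linarith [A1 y, h1 _ _ _ hα], by linarith [A1 y, h1 _ _ _ hα]⟩
  obtain ⟨ua, -, sa, ha⟩ := hω
  obtain ⟨Ua, hUa⟩ := sa.exists_pot d.l.cont d.r.cont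
  obtain ⟨ca, hca⟩ := wc sa Ua hUa ha
  obtain ⟨-, cal⟩ := lemA sa Ua ca hUa hca
  obtain ⟨s1, s2⟩ := hUs.hl d hT
  obtain ⟨cs, U0s⟩ : ∃ cs, ∀ y, Us (y, 0) = Y y + cs := ⟨Us (0, 0) - Y 0, fun y => by
    have e1 := hUs.inc0 0 y; have e2 := Yi 0 y; linarith⟩
  have UTs : ∀ x, Us (x, T) = W x + cs := fun x => by
    obtain ⟨y, α, hα, e, -⟩ := cal x
    obtain ⟨y', α', hα', e'⟩ := s2 x
    have b1 := s1 _ _ _ hα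
    have b2 := h1 _ _ _ hα'
    rw [U0s] at b1 e'
    linarith
  have C0 : ∀ x y, y ∈ charSet0 T fl fr γ ustar x ↔ ∃ α, Act T fl fr γ x y α ∧ Y y + α = W x := fun x y => by
    rw [hUs.mem_C0 d hT]
    constructor
    · rintro ⟨ζ, K, hK, e1, e2, e3⟩
      refine ⟨_, ⟨ζ, K, hK, e1, e2, rfl⟩, ?_⟩
      rw [UTs, U0s] at e3; linarith
    · rintro ⟨α, ⟨ζ, K, hK, e1, e2, e3⟩, e⟩
      refine ⟨ζ, K, hK, e1, e2, ?_⟩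
      rw [UTs, U0s, ← e3]; linarith
  obtain ⟨L, hL⟩ := hUs.C0_bdd d hT
  have ba : ∀ x, BddAbove (charSet0 T fl fr γ ustar x) := fun x => ⟨x + L, fun y hy => by
    have := abs_le.mp (hL x y hy); linarith⟩
  have bb : ∀ x, BddBelow (charSet0 T fl fr γ ustar x) := fun x => ⟨x - L, fun y hy => by
    have := abs_le.mp (hL x y hy); linarith⟩
  constructor
  · rintro ⟨-, s, hs⟩ x
    obtain ⟨U, hU⟩ := s.exists_pot d.l.cont d.r.cont
    obtain ⟨c, hc⟩ := wc s U hU hs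
    obtain ⟨A1, A2⟩ := lemA s U c hU hc
    obtain ⟨y, α, hα, e, e'⟩ := A2 x
    refine ⟨y, (C0 x y).mpr ⟨α, hα, e⟩, fun z _ => ?_, fun z _ => ?_⟩
    · rw [← hU.inc0, ← Yi]; linarith [A1 z]
    · rw [← hU.inc0, ← Yi]; linarith [A1 z]
  · intro H
    obtain ⟨s⟩ := E
    refine ⟨hu0, s, ?_⟩
    obtain ⟨U, hU⟩ := s.exists_pot d.l.cont d.r.cont
    choose yb hyb H1 H2 using H
    have D : ∀ x y, U (yb x, 0) - Y (yb x) ≤ U (y, 0) - Y y := fun x y => by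
      set x' := max y (yb x) + |x| + 4 * |L| + 1 + |sSup (charSet0 T fl fr γ ustar x)| with hx'
      have n := le_abs_self L
      have n0 := abs_nonneg L
      have n1 := abs_nonneg x
      have n2 := abs_nonneg (sSup (charSet0 T fl fr γ ustar x))
      have m1 := le_max_left y (yb x)
      have m2 := le_max_right y (yb x)
      have a1 : y < sInf (charSet0 T fl fr γ ustar x') := by
        refine lt_of_lt_of_le (show y < x' - L by linarith) (le_csInf ⟨_, hyb x'⟩ fun z hz => ?_)
        have := abs_le.mp (hL x' z hz); linarith
      have a2 : sSup (charSet0 T fl fr γ ustar x) < yb x' := by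
        have b1 := abs_le.mp (hL x' _ (hyb x'))
        have b2 := abs_le.mp (hL x _ (hyb x))
        have b3 : sSup (charSet0 T fl fr γ ustar x) ≤ x + L := csSup_le ⟨_, hyb x⟩ fun z hz => by
          have := abs_le.mp (hL x z hz); linarith
        linarith
      have c1 := H1 x' y a1
      have c2 := H2 x (yb x') a2
      rw [← hU.inc0, ← Yi] at c1 c2
      linarith
    obtain ⟨a1, a2⟩ := hU.hl d hT
    have UT : ∀ x, U (x, T) = W x + (U (yb 0, 0) - Y (yb 0)) := fun x => by
      obtain ⟨α, hα, e⟩ := (C0 x (yb x)).mp (hyb x)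
      obtain ⟨y', α', hα', e'⟩ := a2 x
      have b1 := a1 _ _ _ hα
      have b2 := h1 _ _ _ hα'
      have := D 0 y'
      have := D x (yb 0)
      linarith
    have q : ∀ᵐ z : ℝ, HasDerivAt (fun y => V (y, 0)) (v.u (-z) 0) (-z) :=
      (Measure.measurePreserving_neg (volume : Measure ℝ)).quasiMeasurePreserving.ae (hV.hdx le_rfl)
    have q' : ∀ᵐ z : ℝ, v.u (-z) 0 = ω (- -z) :=
      (Measure.measurePreserving_neg (volume : Measure ℝ)).quasiMeasurePreserving.ae v.init
    filter_upwards [hU.hdx hT.le, q, q'] with x e1 e2 e3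
    have e4 : HasDerivAt W (ω x) x := by
      have := (e2.comp x (hasDerivAt_neg x)).neg
      rw [e3, neg_neg] at this
      exact this.congr_deriv (by ring)
    have e5 : HasDerivAt (fun y => U (y, T)) (ω x) x := by
      have := e4.add_const (U (yb 0, 0) - Y (yb 0))
      refine this.congr_of_eventuallyEq (Eventually.of_forall fun y => UT y)
    exact e1.unique e5
end S14

section S15
open scoped Convolution Topology NNReal

lemma CF.LL_quad {f : ℝ → ℝ} {a : ℝ} (hf : CF f a) (p r : ℝ) :
    LL f r ≤ LL f p + GG f p * (r - p) + (r - p) ^ 2 / a := by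
  have h1 := hf.LL_le p r
  have h2 : (GG f r - GG f p) * (r - p) ≤ (r - p) ^ 2 / a := by
    rcases le_total p r with h | h
    · have := mul_le_mul_of_nonneg_right (hf.G_lip' h) (sub_nonneg.2 h)
      calc _ ≤ _ := this
        _ = _ := by ring
    · have := mul_le_mul_of_nonneg_right (hf.G_lip' h) (sub_nonneg.2 h)
      calc _ = (GG f p - GG f r) * (p - r) := by ring
        _ ≤ _ := this
        _ = _ := by ring
  linarith

lemma CF.phi_quad {f : ℝ → ℝ} {a : ℝ} (hf : CF f a) (p τ : ℝ) {τ' : ℝ} (ξ' : ℝ) (h : 0 < τ') :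
    τ' * LL f (ξ' / τ') ≤ τ * LL f p + GG f p * (ξ' - p * τ) - f (GG f p) * (τ' - τ)
      + ((ξ' - p * τ) - p * (τ' - τ)) ^ 2 / (a * τ') := by
  have h1 := mul_le_mul_of_nonneg_left (hf.LL_quad p (ξ' / τ')) h.le
  have h2 : τ' * (LL f p + GG f p * (ξ' / τ' - p) + (ξ' / τ' - p) ^ 2 / a) =
    τ' * LL f p + GG f p * (ξ' - p * τ') + (ξ' - p * τ') ^ 2 / (a * τ') := by
    have := hf.pos.ne'
    field_simp
  rw [h2] at h1
  have h3 : LL f p = p * GG f p - f (GG f p) := rfl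
  have h4 : (ξ' - p * τ) - p * (τ' - τ) = ξ' - p * τ' := by ring
  rw [h4]
  have h5 : τ' * LL f p + GG f p * (ξ' - p * τ') = τ * LL f p + GG f p * (ξ' - p * τ)
    - f (GG f p) * (τ' - τ) := by rw [h3]; ring
  linarith

lemma inf_fam {X : Type*} [PseudoMetricSpace X] {S : Set ℝ} (hS : IsCompact S) (hn : S.Nonempty)
    (F : ℝ → X → ℝ) {K : ℝ≥0} (hF : ∀ p ∈ S, LipschitzWith K (F p))
    (hc : ∀ x, ContinuousOn (fun p => F p x) S) :
    ∃ g : X → ℝ, LipschitzWith K g ∧ ∀ x, (∀ p ∈ S, g x ≤ F p x) ∧ ∃ p ∈ S, g x = F p x := by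
  have h := fun x => hS.exists_isMinOn hn (hc x)
  choose q hq hm using h
  refine ⟨fun x => F (q x) x, LipschitzWith.of_le_add_mul K fun x y => ?_, fun x =>
    ⟨fun p hp => hm x hp, q x, hq x, rfl⟩⟩
  have h1 : F (q x) x ≤ F (q y) x := hm x (hq y)
  have h2 := (hF _ (hq y)).le_add_mul x y
  exact h1.trans h2

lemma lip_id_max : LipschitzWith 1 (fun t : ℝ => max t 0) :=
  LipschitzWith.id.max_const 0

lemma exists_e {f U0 : ℝ → ℝ} {a : ℝ} {N : ℝ≥0} (hf : CF f a) (hU : LipschitzWith N U0) :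
    ∃ (e : ℝ → ℝ) (K : ℝ≥0) (Λ : ℝ), LipschitzWith K e ∧ ∀ t, 0 ≤ t →
      (∀ p, 0 ≤ p → e t ≤ U0 (-p * t) + t * LL f p) ∧
      ∃ p, 0 ≤ p ∧ p ≤ Λ ∧ e t = U0 (-p * t) + t * LL f p := by
  obtain ⟨C, hC0, hC⟩ := hf.LL_sup (N + 1)
  set Λ := C + |LL f 0|
  have hΛ : 0 ≤ Λ := by positivity
  obtain ⟨D, hD0, hD⟩ := cont_bdd hf.LL_cont Λ
  obtain ⟨e, he, hh⟩ := inf_fam (X := ℝ) (S := Icc 0 Λ) isCompact_Icc ⟨0, by simpa⟩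
    (fun p t => U0 (-p * max t 0) + max t 0 * LL f p) (K := (N * Λ + D).toNNReal) (fun p hp => by
      refine LipschitzWith.of_dist_le_mul fun s t => ?_
      rw [Real.coe_toNNReal _ (by positivity), Real.dist_eq, Real.dist_eq]
      have h0 := lip_id_max.dist_le_mul s t
      rw [Real.dist_eq, Real.dist_eq, NNReal.coe_one, one_mul] at h0
      have h1 := hU.dist_le_mul (-p * max s 0) (-p * max t 0)
      rw [Real.dist_eq, Real.dist_eq, ← mul_sub, abs_mul, abs_neg, abs_of_nonneg hp.1] at h1
      have h2 : |LL f p| ≤ D := hD p (abs_le.2 ⟨by linarith [hp.1], hp.2⟩)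
      have h3 : |(max s 0 - max t 0) * LL f p| ≤ |s - t| * D := by
        rw [abs_mul]; gcongr
      have h4 : N * (p * |max s 0 - max t 0|) ≤ N * (Λ * |s - t|) := by
        gcongr; exact hp.2
      calc _ = |(U0 (-p * max s 0) - U0 (-p * max t 0)) + (max s 0 - max t 0) * LL f p| := by
            congr 1; ring
        _ ≤ _ := abs_add_le _ _
        _ ≤ _ := by linarith) (fun t => by
      have := hU.continuous; have := hf.LL_cont; fun_prop)
  refine ⟨e, _, Λ, he, fun t ht => ?_⟩
  have hm : max t 0 = t := max_eq_left ht
  obtain ⟨h1, p, hp, h2⟩ := hh t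
  simp only [hm] at h1 h2
  refine ⟨fun p hp => ?_, p, hp.1, hp.2, h2⟩
  by_cases hpΛ : p ≤ Λ
  · exact h1 p ⟨hp, hpΛ⟩
  · have h3 := h1 0 ⟨le_rfl, hΛ⟩
    have h4 := hC p
    rw [abs_of_nonneg hp] at h4
    have h5 := hU.dist_le_mul (-p * t) 0
    rw [Real.dist_eq, Real.dist_eq, sub_zero, abs_mul, abs_neg, abs_of_nonneg hp,
      abs_of_nonneg ht] at h5
    have h6 := (abs_le.1 h5).1
    have h7 : LL f 0 + N * p ≤ LL f p := by
      have := le_abs_self (LL f 0); push Not at hpΛ; simp only [Λ] at hpΛ; linarith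
    have h8 := mul_le_mul_of_nonneg_left h7 ht
    simp only [neg_zero, zero_mul] at h3
    linarith

def Tc (b : ℝ → ℝ) : Prop := ∀ ε > 0, ∃ C, 0 ≤ C ∧ ∀ t, ε ≤ t → ∃ M, ∀ t', ε ≤ t' →
  b t' ≤ b t + M * (t' - t) + C * (t' - t) ^ 2

lemma Tc_e {f U0 e : ℝ → ℝ} {a Λ : ℝ} (hf : CF f a) (h : ∀ t, 0 ≤ t →
      (∀ p, 0 ≤ p → e t ≤ U0 (-p * t) + t * LL f p) ∧
      ∃ p, 0 ≤ p ∧ p ≤ Λ ∧ e t = U0 (-p * t) + t * LL f p) : Tc e := by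
  intro ε hε
  have ha := hf.pos
  refine ⟨Λ ^ 2 / (a * ε), by positivity, fun t ht => ?_⟩
  obtain ⟨-, p, hp, hpΛ, he⟩ := h t (hε.le.trans ht)
  refine ⟨- f (GG f p), fun t' ht' => ?_⟩
  have ht0 : 0 < t' := hε.trans_le ht'
  have h1 := (h t' ht0.le).1 (p * t / t') (by have := hε.le.trans ht; positivity)
  have h2 := hf.phi_quad p t (p * t) ht0
  have h3 : -(p * t / t') * t' = -p * t := by field_simp
  rw [h3] at h1
  have h4 : ((p * t - p * t) - p * (t' - t)) ^ 2 / (a * t') ≤ Λ ^ 2 / (a * ε) * (t' - t) ^ 2 := by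
    rw [sub_self, zero_sub, neg_sq, mul_pow, div_mul_eq_mul_div]
    gcongr
  linarith

lemma Tc_min {b c : ℝ → ℝ} (hb : Tc b) (hc : Tc c) : Tc (fun t => min (b t) (c t)) := by
  intro ε hε
  obtain ⟨C, hC, h1⟩ := hb ε hε
  obtain ⟨D, hD, h2⟩ := hc ε hε
  refine ⟨max C D, le_max_of_le_left hC, fun t ht => ?_⟩
  rcases le_total (b t) (c t) with h | h
  · obtain ⟨M, hM⟩ := h1 t ht
    refine ⟨M, fun t' ht' => ?_⟩
    simp only [min_eq_left h]
    refine (min_le_left _ _).trans ((hM t' ht').trans ?_)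
    gcongr; exact le_max_left _ _
  · obtain ⟨M, hM⟩ := h2 t ht
    refine ⟨M, fun t' ht' => ?_⟩
    simp only [min_eq_right h]
    refine (min_le_right _ _).trans ((hM t' ht').trans ?_)
    gcongr; exact le_max_right _ _

lemma Tc_lin {b : ℝ → ℝ} (hb : Tc b) (γ : ℝ) : Tc (fun t => b t + γ * t) := by
  intro ε hε
  obtain ⟨C, hC, h1⟩ := hb ε hε
  refine ⟨C, hC, fun t ht => ?_⟩
  obtain ⟨M, hM⟩ := h1 t ht
  exact ⟨M + γ, fun t' ht' => by have := hM t' ht'; nlinarith⟩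

lemma slope_zero {M C δ : ℝ} (hδ : 0 < δ) (h : ∀ s, |s| < δ → 0 ≤ M * s + C * s ^ 2) : M = 0 := by
  have hm : IsLocalMin (fun s : ℝ => M * s + C * s ^ 2) 0 := by
    filter_upwards [Metric.ball_mem_nhds (0 : ℝ) hδ] with s hs
    have := h s (by simpa using hs)
    simpa using this
  have hd : HasDerivAt (fun s : ℝ => M * s + C * s ^ 2) (M * 1 + C * (2 * 0)) 0 := by
    have h1 := ((hasDerivAt_id (0 : ℝ)).const_mul M).fun_add
      (((hasDerivAt_id (0 : ℝ)).pow 2).const_mul C)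
    simpa using h1
  have := hm.hasDerivAt_eq_zero hd
  linarith

lemma Tc_K {k K : ℝ → ℝ} (hk : Tc k) (h1 : ∀ t, 0 ≤ t → ∀ s, 0 ≤ s → s ≤ t → K t ≤ k s)
    (h2 : ∀ t, 0 ≤ t → ∃ s, 0 ≤ s ∧ s ≤ t ∧ K t = k s) : Tc K := by
  intro ε hε
  obtain ⟨C, hC, h3⟩ := hk ε hε
  refine ⟨C, hC, fun t ht => ?_⟩
  obtain ⟨s, hs0, hst, hs⟩ := h2 t (hε.le.trans ht)
  rcases hst.eq_or_lt with rfl | hlt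
  · obtain ⟨M, hM⟩ := h3 s ht
    exact ⟨M, fun t' ht' => by
      rw [hs]; exact (h1 t' (hε.le.trans ht') t' (hε.le.trans ht') le_rfl).trans (hM t' ht')⟩
  · refine ⟨0, fun t' ht' => ?_⟩
    have hq : 0 ≤ C * (t' - t) ^ 2 := by positivity
    have ht0 := hε.le.trans ht'
    rcases le_or_gt s t' with h | h
    · have := h1 t' ht0 s hs0 h
      linarith
    · obtain ⟨M, hM⟩ := h3 s (ht'.trans h.le)
      have hM0 : M = 0 := by
        refine slope_zero (C := C) (δ := min (s - t') (t - s)) (lt_min (by linarith) (by linarith))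
          fun r hr => ?_
        have hr1 := (abs_lt.1 hr).1; have hr2 := (abs_lt.1 hr).2
        have := min_le_left (s - t') (t - s); have := min_le_right (s - t') (t - s)
        have h5 := hM (s + r) (by linarith)
        have h6 := h1 t (by linarith) (s + r) (by linarith) (by linarith)
        rw [add_sub_cancel_left] at h5
        linarith
      have h5 := hM t' ht'
      have h6 := h1 t' ht0 t' ht0 le_rfl
      have h7 : (t' - s) ^ 2 ≤ (t' - t) ^ 2 := by nlinarith
      have := mul_le_mul_of_nonneg_left h7 hC
      subst hM0
      linarith

structure Bd (fl fr U0 : ℝ → ℝ) (γ : ℝ) (b : ℝ → ℝ) : Prop where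
  lip : ∃ K, LipschitzWith K b
  z : b 0 = U0 0
  l : ∀ t, 0 ≤ t → ∀ p, 0 ≤ p → b t ≤ U0 (-p * t) + t * LL fl p
  r : ∀ t, 0 ≤ t → ∀ p, p ≤ 0 → b t ≤ U0 (-p * t) + t * LL fr p
  g : ∀ s t, 0 ≤ s → s ≤ t → b t ≤ b s - γ * (t - s)
  tc : Tc b
  alt : ∀ t, 0 < t → (∃ s, 0 ≤ s ∧ s < t ∧ ∀ r, s ≤ r → r ≤ t → b r = b t + γ * (t - r)) ∨
    (∃ p, 0 ≤ p ∧ b t = U0 (-p * t) + t * LL fl p) ∨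
    (∃ p, p ≤ 0 ∧ b t = U0 (-p * t) + t * LL fr p)

lemma exists_b {fl fr U0 : ℝ → ℝ} {a : ℝ} {N : ℝ≥0} (hl : CF fl a) (hr : CF fr a)
    (hU : LipschitzWith N U0) (γ : ℝ) : ∃ b, Bd fl fr U0 γ b := by
  obtain ⟨el, K1, Λ1, hK1, h1⟩ := exists_e hl hU
  have hU' : LipschitzWith N (fun x => U0 (-x)) := by
    refine LipschitzWith.of_dist_le_mul fun x y => (hU.dist_le_mul _ _).trans_eq ?_
    rw [dist_neg_neg]
  obtain ⟨er, K2, Λ2, hK2, h2⟩ := exists_e hr.reflect hU'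
  have hTl := Tc_e hl h1
  have hTr := Tc_e (U0 := fun x => U0 (-x)) hr.reflect h2
  set k : ℝ → ℝ := fun t => min (el t) (er t) + γ * t
  have hk : Tc k := Tc_lin (Tc_min hTl hTr) γ
  have hkl : LipschitzWith (max K1 K2 + ‖γ‖₊) k := by
    refine (hK1.min hK2).add ?_
    refine LipschitzWith.of_dist_le_mul fun s t => ?_
    rw [Real.dist_eq, Real.dist_eq, ← mul_sub, abs_mul]; simp
  obtain ⟨K, hKl, hK⟩ := inf_fam (X := ℝ) (S := Icc (0:ℝ) 1) isCompact_Icc ⟨0, by simp⟩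
    (fun p t => k (p * max t 0)) (K := (max K1 K2 + ‖γ‖₊)) (fun p hp => by
      refine LipschitzWith.of_dist_le_mul fun s t => ?_
      refine (hkl.dist_le_mul _ _).trans ?_
      gcongr
      have h0 := lip_id_max.dist_le_mul s t
      rw [Real.dist_eq, Real.dist_eq, NNReal.coe_one, one_mul] at h0
      rw [Real.dist_eq, Real.dist_eq, ← mul_sub, abs_mul, abs_of_nonneg hp.1]
      nlinarith [hp.2, abs_nonneg (max s 0 - max t 0)]) (fun t => by
      have := hkl.continuous; fun_prop)
  have a1 : ∀ t, 0 ≤ t → ∀ s, 0 ≤ s → s ≤ t → K t ≤ k s := fun t ht s hs hst => by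
    have hm : max t 0 = t := max_eq_left ht
    rcases ht.eq_or_lt with rfl | hpos
    · have := (hK 0).1 0 (by simp)
      have hs0 : s = 0 := le_antisymm hst hs
      subst hs0; simpa using this
    have := (hK t).1 (s / t) ⟨by positivity, (div_le_one hpos).2 hst⟩
    simpa only [hm, div_mul_cancel₀ s hpos.ne'] using this
  have a2 : ∀ t, 0 ≤ t → ∃ s, 0 ≤ s ∧ s ≤ t ∧ K t = k s := fun t ht => by
    obtain ⟨-, p, hp, h⟩ := hK t
    rw [max_eq_left ht] at h
    exact ⟨p * t, mul_nonneg hp.1 ht, by nlinarith [hp.2], h⟩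
  have e0 : ∀ t, 0 ≤ t → K t ≤ el t + γ * t ∧ K t ≤ er t + γ * t := fun t ht => by
    have := a1 t ht t ht le_rfl
    exact ⟨this.trans (by simp only [k]; gcongr; exact min_le_left _ _),
      this.trans (by simp only [k]; gcongr; exact min_le_right _ _)⟩
  have anti : ∀ s t, 0 ≤ s → s ≤ t → K t ≤ K s := fun s t hs hst => by
    obtain ⟨r, hr, hrs, h⟩ := a2 s hs
    rw [h]; exact a1 t (hs.trans hst) r hr (hrs.trans hst)
  refine ⟨fun t => K t - γ * t, ⟨_, hKl.sub (g := fun t => γ * t) (Kg := ‖γ‖₊) ?_⟩, ?_, ?_, ?_, ?_,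
    ?_, ?_⟩
  · refine LipschitzWith.of_dist_le_mul fun s t => ?_
    rw [Real.dist_eq, Real.dist_eq, ← mul_sub, abs_mul]; simp
  · obtain ⟨s, hs, hs', h⟩ := a2 0 le_rfl
    have : s = 0 := le_antisymm hs' hs
    subst this
    obtain ⟨-, p, -, -, hp⟩ := h1 0 le_rfl
    obtain ⟨-, q, -, -, hq⟩ := h2 0 le_rfl
    simp only [mul_zero, zero_mul, add_zero, neg_zero] at hp hq
    simp [h, k, hp, hq]
  · intro t ht p hp
    have := (e0 t ht).1; have := (h1 t ht).1 p hp
    linarith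
  · intro t ht p hp
    have := (e0 t ht).2; have := (h2 t ht).1 (-p) (by linarith)
    rw [hr.LL_reflect] at this
    simp only [neg_neg] at this
    rw [neg_mul]
    linarith
  · intro s t hs hst
    have := anti s t hs hst
    linarith
  · have := Tc_lin (Tc_K hk a1 a2) (-γ)
    simpa [sub_eq_add_neg] using this
  · intro t ht
    obtain ⟨s, hs, hst, h⟩ := a2 t ht.le
    rcases hst.eq_or_lt with rfl | hlt
    · right
      rcases le_total (el s) (er s) with h' | h'
      · left
        obtain ⟨-, p, hp, -, he⟩ := h1 s hs
        refine ⟨p, hp, ?_⟩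
        rw [← he, h]; simp [k, h']
      · right
        obtain ⟨-, p, hp, -, he⟩ := h2 s hs
        refine ⟨-p, by linarith, ?_⟩
        rw [hr.LL_reflect] at he
        simp only [neg_neg, neg_mul] at he ⊢
        rw [← he, h]; simp [k, h']
    · left
      refine ⟨s, hs, hlt, fun r hr hr' => ?_⟩
      have b1 := anti r t (hs.trans hr) hr'
      have b2 := a1 r (hs.trans hr) s hs hr
      have : K r = K t := le_antisymm (b2.trans h.ge) b1
      rw [this]; ring
end S15

section S16
open scoped Convolution Topology NNReal

lemma CF.subadd {f : ℝ → ℝ} {a : ℝ} (hf : CF f a) {τ h p ξ : ℝ} (hτ : 0 ≤ τ) (hh : 0 < h) :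
    (τ + h) * LL f ((p * τ + ξ) / (τ + h)) ≤ τ * LL f p + h * LL f (ξ / h) := by
  have hp : 0 < τ + h := by linarith
  set r := (p * τ + ξ) / (τ + h)
  have hr : r * (τ + h) = p * τ + ξ := div_mul_cancel₀ _ hp.ne'
  have h1 := mul_le_mul_of_nonneg_left (hf.young p (GG f r)) hτ
  have h2 := mul_le_mul_of_nonneg_left (hf.young (ξ / h) (GG f r)) hh.le
  have h3 : h * (ξ / h * GG f r - f (GG f r)) = ξ * GG f r - h * f (GG f r) := by
    field_simp
  have h4 : (τ + h) * LL f r = (r * (τ + h)) * GG f r - (τ + h) * f (GG f r) := by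
    unfold LL; ring
  rw [h4, hr]; linarith

structure HS (f U0 b : ℝ → ℝ) (H : ℝ → ℝ → ℝ) : Prop where
  lip : ∃ K, LipschitzWith K (fun z : ℝ² => H z.1 z.2)
  i : ∀ x, x ≤ 0 → ∀ t, t ≤ 0 → H x t = U0 x
  bd : ∀ t, 0 ≤ t → H 0 t = b t
  D : ∀ x t y s, x ≤ 0 → y ≤ 0 → 0 ≤ s → s < t → H x t ≤ H y s + cst f x t y s
  A : ∃ Λ, 1 ≤ Λ ∧ ∀ x t, x < 0 → 0 < t → ∃ p τ, |p| ≤ Λ ∧ 0 < τ ∧ τ ≤ t ∧ min t (-x) ≤ Λ * τ ∧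
    x - p * τ ≤ 0 ∧ (x - p * τ = 0 ∨ τ = t) ∧ H x t = H (x - p * τ) (t - τ) + τ * LL f p

def tu (x p t : ℝ) : ℝ := if p < 0 then min t (x / p) else t

lemma tu_eq {x p t : ℝ} (hx : x < 0) (ht : 0 ≤ t) : tu x p t = t * x / min x (p * t) := by
  unfold tu
  split_ifs with hp
  · rcases le_total x (p * t) with h | h
    · rw [min_eq_left h, min_eq_left ((le_div_iff_of_neg hp).2 (by linarith)),
        mul_div_cancel_right₀ _ hx.ne]
    · have htp : t ≠ 0 := by rintro rfl; simp at h; linarith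
      rw [min_eq_right h, min_eq_right ((div_le_iff_of_neg hp).2 (by linarith))]
      field_simp
  · rw [min_eq_left (hx.le.trans (mul_nonneg (not_lt.1 hp) ht)), mul_div_cancel_right₀ _ hx.ne]

lemma tu_lip (x p s t : ℝ) : |tu x p s - tu x p t| ≤ |s - t| := by
  unfold tu
  split_ifs with hp
  · have := abs_min_sub_min_le_max s (x / p) t (x / p)
    simpa using this
  · exact le_rfl

lemma tu_props {x p t : ℝ} (hx : x < 0) (ht : 0 ≤ t) : 0 ≤ tu x p t ∧ tu x p t ≤ t ∧
    x - p * tu x p t ≤ 0 ∧ (x - p * tu x p t = 0 ∨ tu x p t = t) ∧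
    min t (-x) ≤ max 1 |p| * tu x p t := by
  unfold tu
  split_ifs with hp
  · have h0 : 0 < x / p := div_pos_of_neg_of_neg hx hp
    have h1 : p * (x / p) = x := mul_div_cancel₀ _ hp.ne
    refine ⟨le_min ht h0.le, min_le_left _ _, ?_, ?_, ?_⟩
    · have := min_le_right t (x / p); nlinarith
    · rcases le_total t (x / p) with h | h
      · right; exact min_eq_left h
      · left; rw [min_eq_right h, h1, sub_self]
    · rcases le_total t (x / p) with h | h
      · rw [min_eq_left h]
        exact (min_le_left _ _).trans (by nlinarith [le_max_left 1 |p|])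
      · rw [min_eq_right h]
        refine (min_le_right _ _).trans ?_
        have := le_max_right 1 |p|
        rw [abs_of_neg hp] at this ⊢
        nlinarith
  · push Not at hp
    refine ⟨ht, le_rfl, by nlinarith, Or.inr rfl, (min_le_left _ _).trans ?_⟩
    nlinarith [le_max_left 1 |p|]

lemma exists_HS {f U0 b : ℝ → ℝ} {a : ℝ} {N : ℝ≥0} (hf : CF f a) (hU : LipschitzWith N U0)
    (hb : LipschitzWith N b) (h0 : b 0 = U0 0)
    (bl : ∀ t, 0 ≤ t → ∀ p, 0 ≤ p → b t ≤ U0 (-p * t) + t * LL f p)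
    (bg : ∀ s t, 0 ≤ s → s ≤ t → b t ≤ b s + (t - s) * LL f 0) : ∃ H, HS f U0 b H := by
  set β : ℝ → ℝ := fun σ => U0 (min σ 0) + b (max σ 0) - U0 0
  have hβ1 : ∀ y, y ≤ 0 → β y = U0 y := fun y hy => by simp [β, hy, h0]
  have hβ2 : ∀ y, 0 ≤ y → β y = b y := fun y hy => by simp [β, hy]
  have hβ : LipschitzWith (N + N) β := by
    refine LipschitzWith.of_dist_le_mul fun x y => ?_
    have h1 := (hU.comp (LipschitzWith.id.min_const 0)).dist_le_mul x y
    have h2 := (hb.comp (LipschitzWith.id.max_const 0)).dist_le_mul x y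
    simp only [Real.dist_eq, Function.comp, id, mul_one, NNReal.coe_add] at *
    have := abs_add_le (U0 (min x 0) - U0 (min y 0)) (b (max x 0) - b (max y 0))
    calc _ = |(U0 (min x 0) - U0 (min y 0)) + (b (max x 0) - b (max y 0))| := by
          simp only [β]; congr 1; ring
      _ ≤ _ := this
      _ ≤ _ := by linarith
  set N2 : ℝ := N + N
  have hN2 : 0 ≤ N2 := by positivity
  have hβl : ∀ x y, β x ≤ β y + N2 * |x - y| := fun x y => by
    simpa [N2, Real.dist_eq] using hβ.le_add_mul x y
  set c := N2 + |LL f (-1)|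
  obtain ⟨C, hC0, hC⟩ := hf.LL_sup (c + 1)
  set Λ := C + c + 1
  have hc : 0 ≤ c := by positivity
  have hΛ : 1 ≤ Λ := by simp only [Λ]; linarith
  obtain ⟨E, hE0, hE⟩ := cont_bdd hf.LL_cont Λ
  set F : ℝ → ℝ → ℝ → ℝ := fun x p t =>
    β (x + t - (1 + p) * tu x p t) + tu x p t * LL f p
  set Kt : ℝ≥0 := (N2 * (2 + Λ) + E).toNNReal
  have hKt : (Kt : ℝ) = N2 * (2 + Λ) + E := Real.coe_toNNReal _ (by positivity)
  have key : ∀ x, x < 0 → ∃ g : ℝ → ℝ, LipschitzWith Kt g ∧ ∀ t, (∀ p ∈ Icc (-Λ) Λ,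
      g t ≤ F x p (max t 0)) ∧ ∃ p ∈ Icc (-Λ) Λ, g t = F x p (max t 0) := by
    intro x hx
    refine inf_fam isCompact_Icc ⟨0, by constructor <;> linarith⟩
      (fun p t => F x p (max t 0)) (fun p hp => ?_) (fun t => ?_)
    · refine LipschitzWith.of_le_add_mul _ fun s t => ?_
      rw [hKt, Real.dist_eq]
      have hm := lip_id_max.dist_le_mul s t
      rw [Real.dist_eq, Real.dist_eq, NNReal.coe_one, one_mul] at hm
      have h1 := (tu_lip x p (max s 0) (max t 0)).trans hm
      set s' := max s 0; set t' := max t 0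
      set A := tu x p s'; set A' := tu x p t'
      have hp' : |p| ≤ Λ := abs_le.2 hp
      have h2 := hβl (x + s' - (1 + p) * A) (x + t' - (1 + p) * A')
      have h3 : |(x + s' - (1 + p) * A) - (x + t' - (1 + p) * A')| ≤ (2 + Λ) * |s - t| := by
        calc _ = |(s' - t') + (-(1 + p)) * (A - A')| := by congr 1; ring
          _ ≤ _ := abs_add_le _ _
          _ = |s' - t'| + |1 + p| * |A - A'| := by rw [abs_mul, abs_neg]
          _ ≤ |s - t| + (1 + Λ) * |s - t| := by
            have : |1 + p| ≤ 1 + Λ := (abs_add_le _ _).trans (by simpa using hp')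
            gcongr
          _ = _ := by ring
      have h4 : A * LL f p - A' * LL f p ≤ |s - t| * E := by
        rw [← sub_mul]
        refine (le_abs_self _).trans ?_
        rw [abs_mul]
        have := hE p hp'
        gcongr
      have h5 := mul_le_mul_of_nonneg_left h3 hN2
      simp only [F]
      linarith
    · have h1 := hβ.continuous; have h2 := hf.LL_cont
      have ht : 0 ≤ max t 0 := le_max_right _ _
      have h3 : Continuous fun p => tu x p (max t 0) := by
        have : (fun p => tu x p (max t 0)) = fun p => max t 0 * x / min x (p * max t 0) := by
          ext p; exact tu_eq hx ht
        rw [this]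
        exact Continuous.div (by fun_prop) (by fun_prop) fun p =>
          ((min_le_left _ _).trans_lt hx).ne
      exact Continuous.continuousOn (by simp only [F]; fun_prop)
  choose! g hgl hg using key
  have gall : ∀ x t p, x < 0 → 0 ≤ t → g x t ≤ F x p t := by
    intro x t p hx ht
    have hm : max t 0 = t := max_eq_left ht
    by_cases hp : p ∈ Icc (-Λ) Λ
    · simpa only [hm] using (hg x hx t).1 p hp
    have hpΛ : Λ ≤ |p| := by
      by_contra hcon
      exact hp (abs_le.1 (not_le.1 hcon).le)
    have h1 := (hg x hx t).1 (-1) ⟨by linarith, by linarith⟩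
    rw [hm] at h1
    obtain ⟨p1, p2, p3, p4, p5⟩ := tu_props (p := p) hx ht
    have q : tu x (-1) t = min t (-x) := by simp [tu, div_neg]
    rw [max_eq_right (hΛ.trans hpΛ)] at p5
    simp only [F, q] at h1 ⊢
    set τ := tu x p t
    have h2 := hβl (x + t) (x + t - (1 + p) * τ)
    have h3 : |x + t - (x + t - (1 + p) * τ)| ≤ (1 + |p|) * τ := by
      rw [sub_sub_cancel, abs_mul, abs_of_nonneg p1]
      gcongr
      exact (abs_add_le _ _).trans (by simp)
    have h4 : min t (-x) * LL f (-1) ≤ (|p| * τ) * |LL f (-1)| := by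
      refine (le_abs_self _).trans ?_
      rw [abs_mul]; gcongr
      rw [abs_of_nonneg (le_min ht (by linarith))]; exact p5
    have h5 : c * (1 + |p|) ≤ LL f p := by
      have := hC p; simp only [Λ] at hpΛ; nlinarith
    have h6 := mul_le_mul_of_nonneg_left h5 p1
    have h7 := mul_le_mul_of_nonneg_left h3 hN2
    have h8 : x + t - (1 + -1) * min t (-x) = x + t := by ring
    have h9 := mul_nonneg p1 (abs_nonneg (LL f (-1)))
    rw [h8] at h1
    have h10 : τ * (c * (1 + |p|)) = N2 * ((1 + |p|) * τ) + (|p| * τ) * |LL f (-1)|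
      + τ * |LL f (-1)| := by simp only [c]; ring
    linarith
  set H : ℝ → ℝ → ℝ := fun x t => if x < 0 then g x t else b (max t 0)
  have Hlt : ∀ x t, x < 0 → H x t = g x t := fun x t hx => if_pos hx
  have H0 : ∀ t, 0 ≤ t → H 0 t = b t := fun t ht => by simp [H, ht]
  have Hi : ∀ x t, x ≤ 0 → t ≤ 0 → H x t = U0 x := by
    intro x t hx ht
    rcases hx.eq_or_lt with rfl | hx
    · simp [H, ht, h0]
    · obtain ⟨-, p, -, h⟩ := hg x hx t
      obtain ⟨p1, p2, -⟩ := tu_props (p := p) hx le_rfl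
      have : tu x p 0 = 0 := le_antisymm p2 p1
      rw [Hlt x t hx, h, max_eq_right ht]; simp [F, this, hβ1 x hx.le]
  have HS0 : ∀ x t y s, x ≤ 0 → y ≤ 0 → 0 ≤ s → s < t → (y = 0 ∨ s = 0) →
      H x t ≤ H y s + cst f x t y s := by
    intro x t y s hx hy hs hst h
    have hts : 0 < t - s := sub_pos.2 hst
    rcases hx.eq_or_lt with rfl | hx
    · rw [H0 t (by linarith)]
      rcases h with rfl | rfl
      · rw [H0 s hs]; simpa [cst] using bg s t hs hst.le
      · rw [Hi y 0 hy le_rfl]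
        have := bl t hst.le (-y / t) (div_nonneg (by linarith) hst.le)
        have h2 : -(-y / t) * t = y := by field_simp
        rw [h2] at this
        simpa [cst] using this
    · have h1 := gall x t ((x - y) / (t - s)) hx (hs.trans hst.le)
      rw [Hlt x t hx]
      have hp : (x - y) / (t - s) * (t - s) = x - y := div_mul_cancel₀ _ hts.ne'
      set p := (x - y) / (t - s)
      have ht : tu x p t = t - s := by
        unfold tu
        split_ifs with hpn
        · rcases h with rfl | rfl
          · have : x / p = t - s := by
              rw [div_eq_iff hpn.ne]; linarith
            rw [this]; exact min_eq_right (by linarith)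
          · rw [sub_zero]; refine min_eq_left ((le_div_iff_of_neg hpn).2 ?_)
            rw [sub_zero] at hp; linarith
        · rcases h with rfl | rfl
          · exfalso; apply hpn
            exact div_neg_of_neg_of_pos (by linarith) hts
          · ring
      have hβv : β (x + t - (1 + p) * (t - s)) = H y s := by
        have e : x + t - (1 + p) * (t - s) = y + s := by
          have : (1 + p) * (t - s) = (t - s) + (x - y) := by rw [add_mul, hp]; ring
          rw [this]; ring
        rw [e]
        rcases h with rfl | rfl
        · rw [zero_add, hβ2 s hs, H0 s hs]
        · rw [add_zero, hβ1 y hy, Hi y 0 hy le_rfl]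
      simp only [F, ht, hβv] at h1
      exact h1
  have HA : ∀ x t, x < 0 → 0 < t → ∃ p τ, |p| ≤ Λ ∧ 0 < τ ∧ τ ≤ t ∧ min t (-x) ≤ Λ * τ ∧
    x - p * τ ≤ 0 ∧ (x - p * τ = 0 ∨ τ = t) ∧ H x t = H (x - p * τ) (t - τ) + τ * LL f p := by
    intro x t hx ht
    obtain ⟨-, p, hp, h⟩ := hg x hx t
    obtain ⟨p1, p2, p3, p4, p5⟩ := tu_props (p := p) hx ht.le
    have hpΛ := abs_le.2 hp
    have p6 : min t (-x) ≤ Λ * tu x p t := p5.trans (by gcongr; exact max_le hΛ hpΛ)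
    have p7 : 0 < tu x p t := by
      have : 0 < min t (-x) := lt_min ht (by linarith)
      by_contra hcon
      have : tu x p t = 0 := le_antisymm (not_lt.1 hcon) p1
      rw [this] at p6; linarith
    refine ⟨p, _, hpΛ, p7, p2, p6, p3, p4, ?_⟩
    rw [Hlt x t hx, h, max_eq_left ht.le]
    simp only [F]
    congr 1
    rcases p4 with h4 | h4
    · have : x + t - (1 + p) * tu x p t = t - tu x p t := by linarith
      rw [h4, this, hβ2 _ (by linarith), H0 _ (by linarith)]
    · have : x + t - (1 + p) * tu x p t = x - p * tu x p t := by rw [h4]; ring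
      rw [this, hβ1 _ p3, Hi _ _ p3 (by linarith)]
  have HD : ∀ x t y s, x ≤ 0 → y ≤ 0 → 0 ≤ s → s < t → H x t ≤ H y s + cst f x t y s := by
    intro x t y s hx hy hs hst
    by_cases h : y = 0 ∨ s = 0
    · exact HS0 x t y s hx hy hs hst h
    push Not at h
    obtain ⟨p, τ, -, q1, q2, -, q3, q4, q5⟩ := HA y s (lt_of_le_of_ne hy h.1) (lt_of_le_of_ne hs h.2.symm)
    have h1 := HS0 x t (y - p * τ) (s - τ) hx q3 (by linarith) (by linarith)
      (q4.imp id fun h => by linarith)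
    have h2 := hf.subadd (p := p) (ξ := x - y) q1.le (sub_pos.2 hst)
    rw [q5]
    simp only [cst] at h1 ⊢
    have e1 : t - (s - τ) = τ + (t - s) := by ring
    have e2 : x - (y - p * τ) = p * τ + (x - y) := by ring
    rw [e1, e2] at h1
    linarith
  have hKt0 := Kt.coe_nonneg
  have Ht : ∀ x s t, x ≤ 0 → H x s ≤ H x t + (Kt + N) * |s - t| := by
    intro x s t hx
    rcases hx.eq_or_lt with rfl | hx
    · have := (hb.comp lip_id_max).le_add_mul s t
      simp only [Function.comp, mul_one, Real.dist_eq] at this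
      simp only [H, lt_irrefl, if_false]
      nlinarith [abs_nonneg (s - t)]
    · rw [Hlt _ _ hx, Hlt _ _ hx]
      have := (hgl x hx).le_add_mul s t
      rw [Real.dist_eq] at this
      have : (0:ℝ) ≤ N * |s - t| := by positivity
      linarith
  set Q : ℝ := 2 * (Kt + N) + N + |LL f 1| + |LL f (-1)|
  have Hx : ∀ x y t, x ≤ 0 → y ≤ 0 → H x t ≤ H y t + Q * |x - y| := by
    intro x y t hx hy
    have hu := hU.le_add_mul x y
    rw [Real.dist_eq] at hu
    have ha := abs_nonneg (x - y)
    have n1 := abs_nonneg (LL f 1); have n2 := abs_nonneg (LL f (-1))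
    have n3 := N.coe_nonneg
    rcases le_or_gt t 0 with ht0 | ht0
    · rw [Hi x t hx ht0, Hi y t hy ht0]
      refine hu.trans ?_
      gcongr; simp only [Q]; linarith
    rcases ha.eq_or_lt with he | hpos
    · have : x = y := sub_eq_zero.1 (abs_eq_zero.1 he.symm)
      subst this; simp
    rcases le_or_gt |x - y| t with hle | hlt
    · have h1 := HD x t y (t - |x - y|) hx hy (by linarith) (by linarith)
      have h2 := Ht y (t - |x - y|) t hy
      have e1 : |t - |x - y| - t| = |x - y| := by rw [sub_sub_cancel_left, abs_neg, abs_abs]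
      have h3 : cst f x t y (t - |x - y|) ≤ |x - y| * (|LL f 1| + |LL f (-1)|) := by
        unfold cst
        rw [sub_sub_cancel]
        gcongr
        rcases le_total y x with h | h
        · have hx : x - y ≠ 0 := fun h => by rw [h] at hpos; simp at hpos
          rw [abs_of_nonneg (sub_nonneg.2 h), div_self hx]
          linarith [le_abs_self (LL f 1)]
        · have hx : x - y ≠ 0 := fun h => by rw [h] at hpos; simp at hpos
          rw [abs_of_nonpos (sub_nonpos.2 h), div_neg, div_self hx]
          linarith [le_abs_self (LL f (-1))]
      rw [e1] at h2
      simp only [Q]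
      nlinarith
    · have h1 := Ht x t 0 hx
      have h2 := Ht y 0 t hy
      rw [Hi x 0 hx le_rfl] at h1; rw [Hi y 0 hy le_rfl] at h2
      rw [sub_zero, abs_of_pos ht0] at h1
      rw [zero_sub, abs_neg, abs_of_pos ht0] at h2
      have h3 : (Kt + N) * t ≤ (Kt + N) * |x - y| := by gcongr
      have h4 : (2 * (Kt + N) + N) * |x - y| ≤ Q * |x - y| := by
        gcongr; simp only [Q]; linarith
      linarith
  have hQ : 0 ≤ Q := by positivity
  have m0 : ∀ x : ℝ, min x 0 ≤ 0 := fun x => min_le_right _ _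
  refine ⟨fun x t => H (min x 0) t, ⟨(Q + (Kt + N)).toNNReal, ?_⟩, ?_, ?_, ?_, Λ, hΛ, ?_⟩
  · refine LipschitzWith.of_le_add_mul _ fun z w => ?_
    rw [Real.coe_toNNReal _ (by positivity)]
    have h1 := Hx (min z.1 0) (min w.1 0) z.2 (m0 _) (m0 _)
    have h2 := Ht (min w.1 0) z.2 w.2 (m0 _)
    have h3 : |min z.1 0 - min w.1 0| ≤ dist z w := by
      have := (LipschitzWith.id.min_const (0:ℝ)).dist_le_mul z.1 w.1
      simp only [id, Real.dist_eq, NNReal.coe_one, one_mul] at this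
      exact this.trans (by rw [← Real.dist_eq]; exact le_max_left _ _)
    have h4 : |z.2 - w.2| ≤ dist z w := by rw [← Real.dist_eq]; exact le_max_right _ _
    have h5 := mul_le_mul_of_nonneg_left h3 hQ
    have h6 := mul_le_mul_of_nonneg_left h4 (by positivity : (0:ℝ) ≤ Kt + N)
    linarith
  · intro x hx t ht
    simp only [min_eq_left hx]; exact Hi x t hx ht
  · intro t ht
    simp only [min_self]; exact H0 t ht
  · intro x t y s hx hy hs hst
    simp only [min_eq_left hx, min_eq_left hy]; exact HD x t y s hx hy hs hst
  · intro x t hx ht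
    obtain ⟨p, τ, h1, h2, h3, h4, h5, h6, h7⟩ := HA x t hx ht
    exact ⟨p, τ, h1, h2, h3, h4, h5, h6, by simp only [min_eq_left hx.le, min_eq_left h5]; exact h7⟩
end S16

section S17
open scoped Convolution Topology NNReal

lemma CF.tang2 {f : ℝ → ℝ} {a : ℝ} (h : CF f a) (q r : ℝ) :
    f q + deriv f q * (r - q) + a / 2 * (r - q) ^ 2 ≤ f r := by
  have hd : ∀ r, HasDerivAt (fun r => f r - a / 2 * r ^ 2) (deriv f r - a * r) r := fun r => by
    have := (h.hd r).fun_sub (((hasDerivAt_id r).pow 2).const_mul (a / 2))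
    refine this.congr_deriv ?_
    simp; ring
  have hc : ConvexOn ℝ univ (fun r => f r - a / 2 * r ^ 2) := by
    refine MonotoneOn.convexOn_of_deriv convex_univ
      (fun r _ => (hd r).continuousAt.continuousWithinAt)
      (fun r _ => (hd r).differentiableAt.differentiableWithinAt) ?_
    intro x _ y _ hxy
    rw [(hd x).deriv, (hd y).deriv]
    have := h.mono hxy; linarith
  rcases lt_trichotomy q r with hl | rfl | hl
  · have := hc.le_slope_of_hasDerivAt (mem_univ q) (mem_univ r) hl (hd q)
    rw [slope_def_field, le_div_iff₀ (by linarith)] at this; nlinarith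
  · simp
  · have := hc.slope_le_of_hasDerivAt (mem_univ r) (mem_univ q) hl (hd q)
    rw [slope_def_field, div_le_iff₀ (by linarith)] at this; nlinarith

lemma mono_lim {g : ℝ → ℝ} {c x0 M : ℝ} (hc : c < x0) (hg : MonotoneOn g (Ioo c x0))
    (hM : ∀ x ∈ Ioo c x0, g x ≤ M) : ∃ L, Tendsto g (𝓝[<] x0) (𝓝 L) ∧
      ∀ x ∈ Ioo c x0, g x ≤ L := by
  have hb : BddAbove (g '' Ioo c x0) := ⟨M, by rintro _ ⟨x, hx, rfl⟩; exact hM x hx⟩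
  have h := hg.tendsto_nhdsWithin_Ioo_left (nonempty_Ioo.2 hc) hb
  refine ⟨_, h, fun x hx => le_csSup hb ⟨x, hx, rfl⟩⟩

structure HM (f U0 b : ℝ → ℝ) (H m : ℝ → ℝ → ℝ) : Prop where
  touch : ∀ ε > 0, ∃ C δ, 0 ≤ C ∧ 0 < δ ∧ ∀ x t, x ≤ -ε → ε ≤ t → ∀ x' t', |x' - x| ≤ δ → |t' - t| ≤ δ →
    H x' t' ≤ H x t + m x t * (x' - x) - f (m x t) * (t' - t) + C * (|x' - x| + |t' - t|) ^ 2
  lim0 : ∀ t, 0 < t → ∃ L, Tendsto (fun x => m x t) (𝓝[<] 0) (𝓝 L)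
  init : ∀ x, x < 0 → ∀ q, HasDerivAt U0 q x → Tendsto (fun t => m x t) (𝓝[>] 0) (𝓝 q)

structure Sel (f : ℝ → ℝ) (H : ℝ → ℝ → ℝ) (Λ : ℝ) (p τ : ℝ → ℝ → ℝ) : Prop where
  one : 1 ≤ Λ
  A1 : ∀ x t, x < 0 → 0 < t → |p x t| ≤ Λ
  A2 : ∀ x t, x < 0 → 0 < t → 0 < τ x t
  A3 : ∀ x t, x < 0 → 0 < t → τ x t ≤ t
  A4 : ∀ x t, x < 0 → 0 < t → min t (-x) ≤ Λ * τ x t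
  A5 : ∀ x t, x < 0 → 0 < t → x - p x t * τ x t ≤ 0
  A6 : ∀ x t, x < 0 → 0 < t → (x - p x t * τ x t = 0 ∨ τ x t = t)
  A7 : ∀ x t, x < 0 → 0 < t → H x t = H (x - p x t * τ x t) (t - τ x t) + τ x t * LL f (p x t)

section
variable {f U0 b : ℝ → ℝ} {H p τ : ℝ → ℝ → ℝ} {a Λ : ℝ}

lemma Sel.touch (hf : CF f a) (h : HS f U0 b H) (w : Sel f H Λ p τ) : ∀ ε > 0, ∃ C δ, 0 ≤ C ∧
    0 < δ ∧ ∀ x t, x ≤ -ε → ε ≤ t → ∀ x' t', |x' - x| ≤ δ → |t' - t| ≤ δ →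
    H x' t' ≤ H x t + GG f (p x t) * (x' - x) - f (GG f (p x t)) * (t' - t)
      + C * (|x' - x| + |t' - t|) ^ 2 := by
  obtain ⟨hΛ, A1, A2, A3, A4, A5, A6, A7⟩ := w
  have ha := hf.pos
  have hΛ0 : 0 < Λ := by linarith
  intro ε hε
  refine ⟨Λ ^ 2 * (2 * Λ) / (a * ε), ε / (2 * Λ), by positivity, by positivity, ?_⟩
  intro x t hx ht x' t' hx' ht'
  have hx0 : x < 0 := by linarith
  have ht0 : 0 < t := by linarith
  have a1 := A1 x t hx0 ht0; have a2 := A2 x t hx0 ht0; have a3 := A3 x t hx0 ht0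
  have a4 := A4 x t hx0 ht0; have a5 := A5 x t hx0 ht0; have a7 := A7 x t hx0 ht0
  set P := p x t; set S := τ x t
  have hS : ε / Λ ≤ S := by
    rw [div_le_iff₀ hΛ0]
    have : ε ≤ min t (-x) := le_min ht (by linarith)
    rw [mul_comm]; exact this.trans a4
  have hδ : ε / (2 * Λ) = ε / Λ / 2 := by field_simp
  have hΛε : ε / Λ ≤ ε := div_le_self hε.le hΛ
  rw [hδ] at hx' ht'
  have b1 := abs_le.1 hx'; have b2 := abs_le.1 ht'
  set τ' := t' - (t - S)
  have hτ' : ε / Λ / 2 ≤ τ' := by simp only [τ']; linarith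
  have hpos : 0 < ε / Λ / 2 := by positivity
  have c1 := h.D x' t' (x - P * S) (t - S) (by linarith) a5 (by linarith)
    (by simp only [τ'] at hτ'; linarith)
  have c2 := hf.phi_quad P S (x' - (x - P * S)) (hpos.trans_le hτ')
  have e1 : x' - (x - P * S) - P * S = x' - x := by ring
  have e2 : τ' - S = t' - t := by simp only [τ']; ring
  rw [e1, e2] at c2
  have c3 : (x' - x - P * (t' - t)) ^ 2 ≤ Λ ^ 2 * (|x' - x| + |t' - t|) ^ 2 := by
    rw [← mul_pow, ← sq_abs]
    gcongr
    refine (abs_sub _ _).trans ?_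
    rw [abs_mul]
    nlinarith [abs_nonneg (x' - x), abs_nonneg (t' - t)]
  have c4 : (x' - x - P * (t' - t)) ^ 2 / (a * τ') ≤
      Λ ^ 2 * (2 * Λ) / (a * ε) * (|x' - x| + |t' - t|) ^ 2 := by
    calc _ ≤ Λ ^ 2 * (|x' - x| + |t' - t|) ^ 2 / (a * (ε / Λ / 2)) := by gcongr
      _ = _ := by field_simp
  simp only [cst] at c1
  rw [a7]
  linarith

lemma Sel.mono (hf : CF f a) (h : HS f U0 b H) (w : Sel f H Λ p τ) {t : ℝ} (ht : 0 < t) :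
    ∀ x1 x2, x1 < x2 → x2 < 0 → x1 - p x1 t * τ x1 t ≤ x2 - p x2 t * τ x2 t ∧
        τ x2 t ≤ τ x1 t := by
  obtain ⟨hΛ, A1, A2, A3, A4, A5, A6, A7⟩ := w
  intro x1 x2 h12 h20
  have h10 := h12.trans h20
  have a2 := A2 x1 t h10 ht; have a3 := A3 x1 t h10 ht; have a5 := A5 x1 t h10 ht
  have a6 := A6 x1 t h10 ht; have a7 := A7 x1 t h10 ht
  have b2 := A2 x2 t h20 ht; have b3 := A3 x2 t h20 ht; have b5 := A5 x2 t h20 ht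
  have b6 := A6 x2 t h20 ht; have b7 := A7 x2 t h20 ht
  have ea : (x1 - (x1 - p x1 t * τ x1 t)) / τ x1 t = p x1 t := by
    rw [sub_sub_cancel]; field_simp
  have eb : (x2 - (x2 - p x2 t * τ x2 t)) / τ x2 t = p x2 t := by
    rw [sub_sub_cancel]; field_simp
  set y1 := x1 - p x1 t * τ x1 t; set y2 := x2 - p x2 t * τ x2 t
  set S1 := τ x1 t; set S2 := τ x2 t
  have d1 := h.D x1 t y2 (t - S2) h10.le b5 (by linarith) (by linarith)
  have d2 := h.D x2 t y1 (t - S1) h20.le a5 (by linarith) (by linarith)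
  have f1 : H x1 t = H y1 (t - S1) + cst f x1 t y1 (t - S1) := by
    rw [cst, sub_sub_cancel, ea]; exact a7
  have f2 : H x2 t = H y2 (t - S2) + cst f x2 t y2 (t - S2) := by
    rw [cst, sub_sub_cancel, eb]; exact b7
  by_contra hcon
  have hs : ∀ x, x < 0 → (x - y1) / S1 < (x - y2) / S2 := by
    intro x hx
    rw [div_lt_div_iff₀ a2 b2]
    rw [not_and_or, not_le, not_le] at hcon
    rcases a6 with a6 | a6 <;> rcases b6 with b6 | b6
    · rw [a6, b6] at hcon ⊢; simp at hcon; nlinarith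
    · rw [a6] at hcon ⊢; rw [b6] at hcon ⊢
      have : S1 < t ∨ y2 < 0 := by
        rcases hcon with h | h
        · exact Or.inr h
        · exact Or.inl h
      rcases this with h | h <;> nlinarith
    · have : ¬ (S1 < S2) := by linarith
      rcases hcon with h | h
      · linarith
      · exact absurd h this
    · rw [a6, b6] at hcon ⊢; simp at hcon; nlinarith
  have hm : StrictMonoOn (fun x => cst f x t y2 (t - S2) - cst f x t y1 (t - S1)) (Icc x1 x2) := by
    have hd : ∀ x, HasDerivAt (fun x => cst f x t y2 (t - S2) - cst f x t y1 (t - S1))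
        (GG f ((x - y2) / S2) - GG f ((x - y1) / S1)) x := fun x => by
      have g1 := ABSol.cst_hdx hf (x := x) (y := y1) (show t - S1 < t by linarith)
      have g2 := ABSol.cst_hdx hf (x := x) (y := y2) (show t - S2 < t by linarith)
      rw [sub_sub_cancel] at g1 g2
      exact g2.fun_sub g1
    refine strictMonoOn_of_deriv_pos (convex_Icc _ _)
      (fun x _ => (hd x).continuousAt.continuousWithinAt) fun x hx => ?_
    rw [(hd x).deriv]
    rw [interior_Icc] at hx
    have := hf.G_smono (hs x (hx.2.trans h20)); linarith
  have := hm ⟨le_rfl, h12.le⟩ ⟨h12.le, le_rfl⟩ h12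
  simp only at this
  linarith

lemma Sel.lim0 (hf : CF f a) (h : HS f U0 b H) (hb : Tc b) (w : Sel f H Λ p τ) {t : ℝ} (ht : 0 < t) :
    ∃ L, Tendsto (fun x => GG f (p x t)) (𝓝[<] 0) (𝓝 L) := by
  have mono := w.mono hf h ht
  obtain ⟨hΛ, A1, A2, A3, A4, A5, A6, A7⟩ := w
  have ha := hf.pos
  have hI : (-1 : ℝ) < 0 := by norm_num
  obtain ⟨yb, hy, hy'⟩ := mono_lim (g := fun x => x - p x t * τ x t) (M := 0) hI
    (fun x1 _ x2 h2 h12 => by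
      rcases h12.eq_or_lt with rfl | h12
      · exact le_rfl
      exact (mono x1 x2 h12 h2.2).1) (fun x hx => A5 x t hx.2 ht)
  obtain ⟨sb, hs, hs'⟩ := mono_lim (g := fun x => t - τ x t) (M := t) hI
    (fun x1 _ x2 h2 h12 => by
      rcases h12.eq_or_lt with rfl | h12
      · exact le_rfl
      linarith [(mono x1 x2 h12 h2.2).2]) (fun x hx => by
        linarith [A2 x t hx.2 ht])
  have hxs : Tendsto (fun x : ℝ => x) (𝓝[<] 0) (𝓝 0) := tendsto_nhdsWithin_of_tendsto_nhds tendsto_id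
  have hneg : ∀ᶠ x : ℝ in 𝓝[<] 0, x < 0 := self_mem_nhdsWithin
  have hsb : sb ≤ t := le_of_tendsto hs (hneg.mono fun x hx => by
    linarith [A2 x t hx ht])
  rcases hsb.lt_or_eq with hlt | heq
  · refine ⟨GG f ((0 - yb) / (t - sb)), ?_⟩
    have := (hxs.sub hy).div (tendsto_const_nhds.sub hs) (sub_pos.2 hlt).ne'
      (f := fun x : ℝ => x - (x - p x t * τ x t)) (g := fun x => t - (t - τ x t))
    refine (hf.G_cont.tendsto _).comp (this.congr' ?_)
    filter_upwards [hneg] with x hx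
    have := (A2 x t hx ht).ne'
    rw [Pi.div_apply, sub_sub_cancel, sub_sub_cancel]
    exact mul_div_cancel_right₀ _ this
  · rw [heq] at hs hs'
    have hε : 0 < t / 4 := by linarith
    obtain ⟨C, hC, hM⟩ := hb (t / 4) hε
    choose! M hM using hM
   
    have hev : ∀ᶠ x : ℝ in 𝓝[<] 0, t / 2 < t - τ x t := hs.eventually_const_lt (by linarith)
    obtain ⟨c, hc, hcI⟩ := (mem_nhdsLT_iff_exists_Ioo_subset' hI).1 (inter_mem hev hneg)
    have hcond : ∀ x ∈ Ioo c 0, p x t * τ x t = x ∧ t / 2 < t - τ x t ∧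
        f (GG f (p x t)) = - M (t - τ x t) := by
      intro x hx
      have hx1 : t / 2 < t - τ x t := (hcI hx).1
      have hx0 : x < 0 := hx.2
      have a2 := A2 x t hx0 ht
      have hz : x - p x t * τ x t = 0 := (A6 x t hx0 ht).resolve_right fun h => by linarith
      refine ⟨by linarith, hx1, ?_⟩
      have a7 := A7 x t hx0 ht
      rw [hz] at a7
      generalize p x t = P at *; generalize τ x t = S at *
      have hPS : P * S = x := by linarith
      have key : M (t - S) + f (GG f P) = 0 := by
        refine slope_zero (C := C + P ^ 2 / (a * (S / 2))) (δ := min (S / 2) (t / 4))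
          (by positivity) fun r hr => ?_
        have hr1 := (abs_lt.1 hr).1; have hr2 := (abs_lt.1 hr).2
        have m1 := min_le_left (S / 2) (t / 4); have m2 := min_le_right (S / 2) (t / 4)
        have c1 := hM (t - S) (by linarith) (t - S + r) (by linarith)
        have c2 := h.D x t 0 (t - S + r) hx0.le le_rfl (by linarith) (by linarith)
        have hpos : 0 < t - (t - S + r) := by linarith
        have c3 := hf.phi_quad P S (x - 0) hpos
        rw [h.bd _ (by linarith)] at c2 a7
        have e1 : x - 0 - P * S = 0 := by linarith
        have e2 : t - (t - S + r) - S = -r := by ring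
        rw [e1, e2] at c3
        have c4 : (0 - P * -r) ^ 2 / (a * (t - (t - S + r))) ≤ P ^ 2 / (a * (S / 2)) * r ^ 2 := by
          calc _ = P ^ 2 * r ^ 2 / (a * (t - (t - S + r))) := by ring
            _ ≤ P ^ 2 * r ^ 2 / (a * (S / 2)) := by gcongr; linarith
            _ = _ := by ring
        simp only [cst] at c2
        rw [add_sub_cancel_left] at c1
        linarith
      linarith
    have hmono : MonotoneOn (fun x => f (GG f (p x t)) + 2 * C * (t - τ x t)) (Ioo c 0) := by
      intro x1 h1 x2 h2 h12
      rcases h12.eq_or_lt with rfl | h12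
      · exact le_rfl
      obtain ⟨-, b1, e1⟩ := hcond x1 h1
      obtain ⟨-, b2, e2⟩ := hcond x2 h2
      have hss := (mono x1 x2 h12 h2.2).2
      simp only [e1, e2]
      set s1 := t - τ x1 t with hs1
      set s2 := t - τ x2 t with hs2
      have hle : s1 ≤ s2 := by linarith
      rcases hle.eq_or_lt with he | hlt
      · rw [he]
      have g1 := hM s1 (by linarith) s2 (by linarith)
      have g2 := hM s2 (by linarith) s1 (by linarith)
      have hd : 0 < s2 - s1 := by linarith
      have e3 : (s1 - s2) ^ 2 = (s2 - s1) ^ 2 := by ring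
      rw [e3] at g2
      have : (M s2 - M s1) * (s2 - s1) ≤ (2 * C * (s2 - s1)) * (s2 - s1) := by linarith
      have := le_of_mul_le_mul_right this hd
      linarith
    obtain ⟨R, hR0, hR⟩ := cont_bdd hf.G_cont Λ
    obtain ⟨R', hR'0, hR'⟩ := cont_bdd hf.cont R
    have hPR : ∀ x ∈ Ioo c 0, |GG f (p x t)| ≤ R := fun x hx => hR _ (A1 x t hx.2 ht)
    have hc0 : c < 0 := hc
    obtain ⟨ℓ, hℓ, -⟩ := mono_lim hc0 hmono (M := R' + 2 * C * t) (fun x hx => by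
      have i1 := (abs_le.1 (hR' _ (hPR x hx))).2
      have i2 : 2 * C * (t - τ x t) ≤ 2 * C * t := by
        gcongr; linarith [A2 x t hx.2 ht]
      linarith)
    have hfm : Tendsto (fun x => f (GG f (p x t))) (𝓝[<] 0) (𝓝 (ℓ - 2 * C * t)) := by
      refine (hℓ.sub (hs.const_mul (2 * C))).congr fun x => ?_
      ring
    have hIoo : ∀ᶠ x in 𝓝[<] (0:ℝ), x ∈ Ioo c 0 := Ioo_mem_nhdsLT hc0
    have hneg' : ∀ x ∈ Ioo c 0, p x t ≤ 0 := fun x hx => by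
      have := (hcond x hx).1; have h2 := A2 x t hx.2 ht
      by_contra hcon; push Not at hcon
      have := mul_pos hcon h2; linarith [hx.2]
    have hcl : IsClosed (f '' Icc (-R) (GG f 0)) :=
      (isCompact_Icc.image hf.cont).isClosed
    obtain ⟨L, hL, hLℓ⟩ := hcl.mem_of_tendsto hfm (hIoo.mono fun x hx =>
      ⟨_, ⟨(abs_le.1 (hPR x hx)).1, hf.G_smono.monotone (hneg' x hx)⟩, rfl⟩)
    refine ⟨L, ?_⟩
    have hdL : deriv f L ≤ 0 := by
      have := hf.smono.monotone hL.2; rwa [hf.dG] at this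
    rw [← hLℓ] at hfm
    have h1 : Tendsto (fun x => 2 / a * |f (GG f (p x t)) - f L|) (𝓝[<] 0) (𝓝 0) := by
      have := (hfm.sub_const (f L)).abs.const_mul (2 / a)
      simpa using this
    have h2 : Tendsto (fun x => (GG f (p x t) - L) ^ 2) (𝓝[<] 0) (𝓝 0) := by
      refine squeeze_zero' (Eventually.of_forall fun _ => sq_nonneg _) ?_ h1
      filter_upwards [hIoo] with x hx
      have k1 := hf.tang2 L (GG f (p x t)); have k2 := hf.tang2 (GG f (p x t)) L
      rw [hf.dG] at k2
      have k3 := hneg' x hx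
      have k4 := le_abs_self (f (GG f (p x t)) - f L)
      have k5 := neg_abs_le (f (GG f (p x t)) - f L)
      rw [div_mul_eq_mul_div, le_div_iff₀ ha]
      rcases le_total (GG f (p x t)) L with hle | hle
      · have := mul_nonneg_of_nonpos_of_nonpos hdL (sub_nonpos.2 hle)
        linarith
      · have := mul_nonneg_of_nonpos_of_nonpos k3 (sub_nonpos.2 hle)
        have e : (L - GG f (p x t)) ^ 2 = (GG f (p x t) - L) ^ 2 := by ring
        rw [e] at k2
        linarith
    have h3 := (Real.continuous_sqrt.tendsto 0).comp h2
    rw [Real.sqrt_zero] at h3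
    have h4 : Tendsto (fun x => |GG f (p x t) - L|) (𝓝[<] 0) (𝓝 0) := by
      refine h3.congr fun x => ?_
      simp [Real.sqrt_sq_eq_abs]
    exact tendsto_sub_nhds_zero_iff.1 ((tendsto_zero_iff_abs_tendsto_zero _).2 h4)

lemma Sel.init (hf : CF f a) (h : HS f U0 b H) (w : Sel f H Λ p τ) {x q : ℝ} (hx : x < 0)
    (hq : HasDerivAt U0 q x) : Tendsto (fun t => GG f (p x t)) (𝓝[>] 0) (𝓝 q) := by
  obtain ⟨hΛ, A1, A2, A3, A4, A5, A6, A7⟩ := w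
  have ha := hf.pos
  have hΛ0 : 0 < Λ := by linarith
  set p0 := deriv f q
  set R := Λ + |p0|
  have hR : 0 < R := by positivity
  rw [Metric.tendsto_nhds]
  intro ε hε
  set η := a / 2 * ε ^ 2 / (4 * R)
  have hη : 0 < η := by positivity
  have h1 := hasDerivAt_iff_isLittleO.1 hq
  obtain ⟨δ, hδ, h2⟩ := Metric.eventually_nhds_iff.1 (h1.def hη)
  set t1 := min (δ / R) (-x / R)
  have ht1 : 0 < t1 := lt_min (by positivity) (div_pos (by linarith) hR)
  filter_upwards [Ioo_mem_nhdsGT ht1] with t ht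
  have ht0 := ht.1
  have k1 : R * t < δ := by
    have := ht.2.trans_le (min_le_left _ _); rwa [lt_div_iff₀' hR] at this
  have k2 : R * t < -x := by
    have := ht.2.trans_le (min_le_right _ _); rwa [lt_div_iff₀' hR] at this
  have a1 := A1 x t hx ht0; have a5 := A5 x t hx ht0; have a6 := A6 x t hx ht0
  have a7 := A7 x t hx ht0; have a3 := A3 x t hx ht0; have a2 := A2 x t hx ht0
  have loc : ∀ r, |r| ≤ R → |U0 (x - r * t) - U0 x + q * r * t| ≤ η * (R * t) ∧ x - r * t ≤ 0 := by
    intro r hr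
    have i1 : |r * t| ≤ R * t := by rw [abs_mul, abs_of_pos ht0]; gcongr
    have := h2 (y := x - r * t) (by
      rw [Real.dist_eq, sub_sub_cancel_left, abs_neg]; exact i1.trans_lt k1)
    rw [sub_sub_cancel_left, Real.norm_eq_abs, Real.norm_eq_abs, abs_neg, smul_eq_mul] at this
    refine ⟨?_, by linarith [neg_abs_le (r * t)]⟩
    calc _ = |U0 (x - r * t) - U0 x - -(r * t) * q| := by congr 1; ring
      _ ≤ _ := this
      _ ≤ _ := by gcongr
  have n0 := abs_nonneg p0
  have hτ : τ x t = t := a6.resolve_left fun hz => by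
    have : -x ≤ Λ * t := by
      have := abs_mul (p x t) (τ x t)
      have i3 : |p x t * τ x t| = -x := by rw [← sub_eq_zero.1 hz, abs_of_neg hx]
      rw [← i3, this, abs_of_pos a2]; gcongr
    nlinarith
  rw [hτ, sub_self, h.i _ (by rw [hτ] at a5; exact a5) _ le_rfl] at a7
  obtain ⟨l1, -⟩ := loc (p x t) (by linarith)
  obtain ⟨l2, l3⟩ := loc p0 (by simp only [R]; linarith)
  have d := h.D x t (x - p0 * t) 0 hx.le l3 le_rfl ht0
  rw [h.i _ l3 _ le_rfl, cst, sub_zero, sub_sub_cancel, mul_div_cancel_right₀ _ ht0.ne', hf.LL_d] at d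
  have i1 := (abs_le.1 l1).1; have i2 := (abs_le.1 l2).2
  have i4 : t * (LL f (p x t) - q * p x t + f q) ≤ t * (2 * η * R) := by
    rw [a7] at d; simp only [p0] at d i2; linarith
  have i5 := le_of_mul_le_mul_left i4 ht0
  have i6 := hf.tang2 (GG f (p x t)) q
  rw [hf.dG] at i6
  have i7 : LL f (p x t) = p x t * GG f (p x t) - f (GG f (p x t)) := rfl
  have i8 : 2 * η * R = a / 2 * ε ^ 2 / 2 := by simp only [η]; field_simp; ring
  have i9 : 0 < a / 2 * ε ^ 2 := by positivity
  have i10 : a / 2 * (q - GG f (p x t)) ^ 2 < a / 2 * ε ^ 2 := by linarith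
  have i11 := lt_of_mul_lt_mul_left i10 (by positivity)
  rw [dist_comm, Real.dist_eq]
  exact abs_lt_of_sq_lt_sq i11 hε.le

lemma HS.exists_m (hf : CF f a) (h : HS f U0 b H) (hb : Tc b) : ∃ m, HM f U0 b H m := by
  obtain ⟨Λ, hΛ, hA⟩ := h.A
  choose! p τ A1 A2 A3 A4 A5 A6 A7 using hA
  have w : Sel f H Λ p τ := ⟨hΛ, A1, A2, A3, A4, A5, A6, A7⟩
  exact ⟨fun x t => GG f (p x t), w.touch hf h, fun t ht => w.lim0 hf h hb ht,
    fun x hx q hq => w.init hf h hx hq⟩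

end
end S17

section S18
open scoped Convolution Topology NNReal

lemma limsup_Icc {s : ℕ → ℝ} {a b : ℝ} (h : ∀ᶠ n in atTop, a ≤ s n ∧ s n ≤ b) : a ≤ limsup s atTop ∧ limsup s atTop ≤ b := by
  have h1 : IsBoundedUnder (· ≤ ·) atTop s := ⟨b, eventually_map.2 (h.mono fun n h => h.2)⟩
  have h2 : IsBoundedUnder (· ≥ ·) atTop s := ⟨a, eventually_map.2 (h.mono fun n h => h.1)⟩
  exact ⟨le_limsup_of_frequently_le (h.mono fun n h => h.1).frequently h1,
    limsup_le_of_le h2.isCoboundedUnder_le (h.mono fun n h => h.2)⟩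

def hn (n : ℕ) : ℝ := ν n
lemma hn_pos (n) : 0 < hn n := by unfold hn; positivity
lemma hn_lim : Tendsto hn atTop (𝓝 0) := tendsto_one_div_add_atTop_nhds_zero_nat

def quo (U : ℝ² → ℝ) (n : ℕ) (x t : ℝ) : ℝ := (U (x + hn n, t) - U (x, t)) / hn n
def uu (U : ℝ² → ℝ) (x t : ℝ) : ℝ := limsup (fun n => quo U n x t) atTop

lemma uu_meas {U : ℝ² → ℝ} (h : Continuous U) : Measurable (Function.uncurry (uu U)) := by
  refine Measurable.limsup (f := fun n (p : ℝ²) => quo U n p.1 p.2) fun n => Continuous.measurable ?_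
  unfold quo
  fun_prop

lemma lip_x {U : ℝ² → ℝ} {K : ℝ≥0} (h : LipschitzWith K U) (x y t : ℝ) : |U (y, t) - U (x, t)| ≤ K * |y - x| := by
  have := h.dist_le_mul (y, t) (x, t)
  simpa [Real.dist_eq, Prod.dist_eq] using this

lemma lip_t {U : ℝ² → ℝ} {K : ℝ≥0} (h : LipschitzWith K U) (x s t : ℝ) : |U (x, s) - U (x, t)| ≤ K * |s - t| := by
  have := h.dist_le_mul (x, s) (x, t)
  simpa [Real.dist_eq, Prod.dist_eq] using this

lemma lip_sl {U : ℝ² → ℝ} {K : ℝ≥0} (h : LipschitzWith K U) (t : ℝ) : LipschitzWith K fun x => U (x, t) :=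
  LipschitzWith.of_dist_le_mul fun x y => lip_x h y x t

lemma quo_bdd {U : ℝ² → ℝ} {K : ℝ≥0} (h : LipschitzWith K U) (n x t) : |quo U n x t| ≤ K := by
  have := lip_x h x (x + hn n) t
  rw [quo, abs_div, div_le_iff₀ (abs_pos.2 (hn_pos n).ne')]
  simpa using this

lemma uu_bdd {U : ℝ² → ℝ} {K : ℝ≥0} (h : LipschitzWith K U) (x t) : |uu U x t| ≤ K :=
  abs_le.2 (limsup_Icc (Eventually.of_forall fun n => abs_le.1 (quo_bdd h n x t)))

lemma hn_seq : Tendsto hn atTop (𝓝[≠] 0) :=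
  tendsto_nhdsWithin_iff.2 ⟨hn_lim, Eventually.of_forall fun n => (hn_pos n).ne'⟩

lemma quo_lim {U : ℝ² → ℝ} {x t q : ℝ} (h : HasDerivAt (fun y => U (y, t)) q x) :
    Tendsto (fun n => quo U n x t) atTop (𝓝 q) := by
  refine (h.tendsto_slope_zero.comp hn_seq).congr fun n => ?_
  simp [quo, div_eq_inv_mul]

lemma uu_of {U : ℝ² → ℝ} {x t q : ℝ} (h : HasDerivAt (fun y => U (y, t)) q x) : uu U x t = q :=
  (quo_lim h).limsup_eq

def Tch (f : ℝ → ℝ) (U : ℝ² → ℝ) (m : ℝ → ℝ → ℝ) (S : Set ℝ) : Prop :=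
  ∀ ε > 0, ∃ C δ, 0 ≤ C ∧ 0 < δ ∧ ∀ x t, x ∈ S → ε ≤ |x| → ε ≤ t → ∀ x' t', |x' - x| ≤ δ → |t' - t| ≤ δ →
    U (x', t') ≤ U (x, t) + m x t * (x' - x) - f (m x t) * (t' - t) + C * (|x' - x| + |t' - t|) ^ 2

lemma one_touch {g : ℝ → ℝ} {q k C δ x : ℝ} (hg : HasDerivAt g q x) (hδ : 0 < δ)
    (h : ∀ y, |y - x| ≤ δ → g y ≤ g x + k * (y - x) + C * |y - x| ^ 2) : q = k := by
  have h1 : HasDerivAt (fun y => g y - k * (y - x) - C * (y - x) ^ 2) (q - k * 1 - C * (2 * (x - x) * 1)) x := by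
    refine (hg.fun_sub (((hasDerivAt_id' x).sub_const x).const_mul k)).fun_sub (HasDerivAt.const_mul C ?_)
    simpa using ((hasDerivAt_id' x).sub_const x).fun_pow 2
  have h2 : IsLocalMax (fun y => g y - k * (y - x) - C * (y - x) ^ 2) x := by
    filter_upwards [Metric.closedBall_mem_nhds x hδ] with y hy
    have := h y hy
    rw [sq_abs] at this
    simp only [sub_self, mul_zero]
    linarith
  have := h2.hasDerivAt_eq_zero h1
  simp at this
  linarith

variable {f U0 b : ℝ → ℝ} {U : ℝ² → ℝ} {m : ℝ → ℝ → ℝ} {S : Set ℝ} {K : ℝ≥0} {x t q : ℝ}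

lemma Tch.sp (h : Tch f U m S) (hS : IsOpen S) (hx : x ∈ S) (x0 : x ≠ 0) (ht : 0 < t) : ∃ C δ, 0 ≤ C ∧ 0 < δ ∧
    ∀ y s, |y - x| < δ → |s - t| < δ → y ∈ S ∧ ∀ y', |y' - y| < δ → U (y', s) ≤ U (y, s) + m y s * (y' - y) + C * |y' - y| ^ 2 := by
  have hε : 0 < min (|x| / 2) (t / 2) := lt_min (by positivity) (by positivity)
  obtain ⟨C, δ, hC, hδ, H⟩ := h _ hε
  obtain ⟨η, hη, hS⟩ := Metric.isOpen_iff.1 hS x hx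
  refine ⟨C, min (min δ η) (min (|x| / 2) (t / 2)), hC, lt_min (lt_min hδ hη) hε, fun y s hy hs => ?_⟩
  simp only [lt_min_iff] at hy hs
  have e1 := abs_sub_abs_le_abs_sub x y
  rw [abs_sub_comm] at e1
  have e2 := (abs_lt.1 hs.2.2).1
  have yS := hS (show dist y x < η from hy.1.2)
  refine ⟨yS, fun y' hy' => ?_⟩
  simp only [lt_min_iff] at hy'
  have := H y s yS ((min_le_left _ _).trans (by linarith)) ((min_le_right _ _).trans (by linarith)) y' s hy'.1.1.le (by simpa using hδ.le)
  simpa using this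

lemma Tch.dx (h : Tch f U m S) (hS : IsOpen S) (hx : x ∈ S) (x0 : x ≠ 0) (ht : 0 < t)
    (hq : HasDerivAt (fun y => U (y, t)) q x) : q = m x t := by
  obtain ⟨C, δ, hC, hδ, H⟩ := h.sp hS hx x0 ht
  exact one_touch (δ := δ / 2) hq (by positivity) fun y hy => (H x t (by simpa) (by simpa)).2 y (by linarith)

lemma Tch.dt (h : Tch f U m S) (hx : x ∈ S) (x0 : x ≠ 0) (ht : 0 < t)
    (hq : HasDerivAt (fun s => U (x, s)) q t) : q = - f (m x t) := by
  obtain ⟨C, δ, hC, hδ, H⟩ := h (min |x| t) (lt_min (by positivity) ht)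
  refine one_touch hq hδ (C := C) fun y hy => ?_
  have := H x t hx (min_le_left _ _) (min_le_right _ _) x y (by simpa using hδ.le) hy
  simp only [sub_self, abs_zero, mul_zero, zero_add] at this
  linarith

lemma Tch.pair (h : Tch f U m S) (hS : IsOpen S) (hx : x ∈ S) (x0 : x ≠ 0) (ht : 0 < t) : ∃ C δ, 0 ≤ C ∧ 0 < δ ∧
    ∀ y z, |y - x| < δ → |z - x| < δ → y < z →
      m z t - C * (z - y) ≤ (U (z, t) - U (y, t)) / (z - y) ∧ (U (z, t) - U (y, t)) / (z - y) ≤ m y t + C * (z - y) := by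
  obtain ⟨C, δ, hC, hδ, H⟩ := h.sp hS hx x0 ht
  refine ⟨C, δ / 2, hC, by positivity, fun y z hy hz hyz => ?_⟩
  have hd : 0 < z - y := sub_pos.2 hyz
  have e : |z - y| = z - y := abs_of_pos hd
  have l : |z - y| < δ := by
    calc |z - y| = |(z - x) - (y - x)| := by ring_nf
      _ ≤ _ := abs_sub _ _
      _ < δ := by linarith
  have h1 := (H y t (by linarith) (by simpa)).2 z l
  have h2 := (H z t (by linarith) (by simpa)).2 y (by rwa [abs_sub_comm])
  rw [abs_sub_comm] at h2
  rw [e] at h1 h2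
  rw [le_div_iff₀ hd, div_le_iff₀ hd]
  constructor <;> nlinarith

lemma Tch.lims (h : Tch f U m S) (hU : LipschitzWith K U) (hS : IsOpen S) (hx : x ∈ S) (x0 : x ≠ 0) (ht : 0 < t) :
    (∃ L, Tendsto (fun y => m y t) (𝓝[<] x) (𝓝 L)) ∧ ∃ L, Tendsto (fun y => m y t) (𝓝[>] x) (𝓝 L) := by
  obtain ⟨C, δ, hC, hδ, H⟩ := h.pair hS hx x0 ht
  have q : ∀ y z, y < z → |(U (z, t) - U (y, t)) / (z - y)| ≤ K := fun y z hyz => by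
    rw [abs_div, div_le_iff₀ (abs_pos.2 (sub_pos.2 hyz).ne')]
    exact lip_x hU y z t
  have B : ∀ y, |y - x| < δ / 2 → |2 * C * y - m y t| ≤ 2 * C * (|x| + δ) + K + C * δ := fun y hy => by
    have h' := abs_lt.1 hy
    have h1 := H y (y + δ / 4) (by linarith) (by rw [abs_lt]; constructor <;> linarith) (by linarith)
    have h2 := H (y - δ / 4) y (by rw [abs_lt]; constructor <;> linarith) (by linarith) (by linarith)
    have g1 := abs_le.1 (q y (y + δ / 4) (by linarith))
    have g2 := abs_le.1 (q (y - δ / 4) y (by linarith))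
    have l1 : |y| ≤ |x| + δ := by have := abs_sub_abs_le_abs_sub y x; linarith
    have l2 := abs_le.1 ((abs_mul (2 * C) y).le.trans (by rw [abs_of_nonneg (by positivity : 0 ≤ 2 * C)]; gcongr) : |2 * C * y| ≤ 2 * C * (|x| + δ))
    have l3 : 0 ≤ C * δ := by positivity
    simp only [add_sub_cancel_left, sub_sub_cancel] at h1 h2 g1 g2
    rw [abs_le]
    constructor <;> linarith
  have M : ∀ y z, |y - x| < δ / 2 → |z - x| < δ / 2 → y ≤ z → 2 * C * y - m y t ≤ 2 * C * z - m z t := fun y z hy hz hyz => by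
    rcases hyz.eq_or_lt with rfl | hyz
    · exact le_rfl
    have := H y z (by linarith) (by linarith) hyz
    linarith
  have I1 : ∀ y ∈ Ioo (x - δ / 2) x, |y - x| < δ / 2 := fun y hy => by rw [abs_lt]; constructor <;> linarith [hy.1, hy.2]
  have I2 : ∀ y ∈ Ioo x (x + δ / 2), |y - x| < δ / 2 := fun y hy => by rw [abs_lt]; constructor <;> linarith [hy.1, hy.2]
  have lin : Continuous fun y : ℝ => 2 * C * y := by fun_prop
  constructor
  · have := MonotoneOn.tendsto_nhdsWithin_Ioo_left (y := x - δ / 2) (x := x) (f := fun y => 2 * C * y - m y t) ⟨x - δ / 4, by constructor <;> linarith⟩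
      (fun y hy z hz hyz => M y z (I1 y hy) (I1 z hz) hyz) ⟨_, forall_mem_image.2 fun y hy => (abs_le.1 (B y (I1 y hy))).2⟩
    exact ⟨_, (((lin.tendsto x).mono_left nhdsWithin_le_nhds).sub this).congr fun y => by ring⟩
  · have := MonotoneOn.tendsto_nhdsWithin_Ioo_right (x := x) (y := x + δ / 2) (f := fun y => 2 * C * y - m y t) ⟨x + δ / 4, by constructor <;> linarith⟩
      (fun y hy z hz hyz => M y z (I2 y hy) (I2 z hz) hyz) ⟨_, forall_mem_image.2 fun y hy => (abs_le.1 (B y (I2 y hy))).1⟩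
    exact ⟨_, (((lin.tendsto x).mono_left nhdsWithin_le_nhds).sub this).congr fun y => by ring⟩

lemma Tch.uu_lim (h : Tch f U m S) (hS : IsOpen S) (S0 : (0 : ℝ) ∉ S) (ht : 0 < t) {V : Set ℝ} (hV : IsOpen V) (hVS : ∀ᶠ y in 𝓝[V] x, y ∈ S)
    {L : ℝ} (hL : Tendsto (fun y => m y t) (𝓝[V] x) (𝓝 L)) : Tendsto (fun y => uu U y t) (𝓝[V] x) (𝓝 L) := by
  rw [Metric.tendsto_nhds] at hL ⊢
  intro ε hε
  have h1 := eventually_eventually_nhdsWithin.2 ((hL (ε / 4) (by positivity)).and hVS)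
  filter_upwards [h1, self_mem_nhdsWithin] with y hy yV
  rw [hV.nhdsWithin_eq yV] at hy
  obtain ⟨-, yS⟩ := hy.self_of_nhds
  obtain ⟨C, δ, hC, hδ, H⟩ := h.pair hS yS (fun h => S0 (h ▸ yS)) ht
  have l1 : Tendsto (fun n => y + hn n) atTop (𝓝 y) := by simpa using hn_lim.const_add y
  have l2 : Tendsto (fun n => C * hn n) atTop (𝓝 0) := by simpa using hn_lim.const_mul C
  have := limsup_Icc (s := fun n => quo U n y t) (a := L - ε / 2) (b := L + ε / 2) (by
    filter_upwards [l1.eventually hy, l2.eventually_lt_const (by positivity : 0 < ε / 4), hn_lim.eventually_lt_const hδ] with n e1 e2 e3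
    have e4 := hy.self_of_nhds.1
    have e5 := H y (y + hn n) (by simpa) (by rw [add_sub_cancel_left, abs_of_pos (hn_pos n)]; exact e3) (by linarith [hn_pos n])
    simp only [add_sub_cancel_left] at e5
    have f1 := abs_lt.1 e1.1
    have f2 := abs_lt.1 e4
    unfold quo
    constructor <;> linarith)
  rw [Real.dist_eq, uu, abs_lt]
  constructor <;> linarith

lemma Tch.tc (h : Tch f U m S) (hU : LipschitzWith K U) (hS : IsOpen S) (hx : x ∈ S) (x0 : x ≠ 0) (ht : 0 < t)
    (hq : HasDerivAt (fun y => U (y, t)) q x) : Tendsto (fun s => m x s) (𝓝 t) (𝓝 q) := by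
  obtain ⟨C, δ, hC, hδ, H⟩ := h.sp hS hx x0 ht
  rw [Metric.tendsto_nhds]
  intro ε hε
  have l2 : Tendsto (fun r : ℝ => C * |r|) (𝓝[≠] 0) (𝓝 0) := by
    have : Continuous fun r : ℝ => C * |r| := by fun_prop
    simpa using (this.tendsto 0).mono_left nhdsWithin_le_nhds
  have l3 : Tendsto (fun r : ℝ => |r|) (𝓝[≠] 0) (𝓝 0) := by
    simpa using (continuous_abs.tendsto (0 : ℝ)).mono_left nhdsWithin_le_nhds
  have e := ((Metric.tendsto_nhds.1 hq.tendsto_slope_zero (ε / 4) (by positivity)).and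
    ((l2.eventually_lt_const (by positivity : 0 < ε / 4)).and (l3.eventually_lt_const hδ)))
  obtain ⟨h1, ⟨p1, p2, p3⟩, n1⟩ := ((e.filter_mono (nhdsGT_le_nhdsNE (0:ℝ))).and self_mem_nhdsWithin).exists
  obtain ⟨h2, ⟨m1, m2, m3⟩, n2⟩ := ((e.filter_mono (nhdsLT_le_nhdsNE (0:ℝ))).and self_mem_nhdsWithin).exists
  have key : ∀ r, r ≠ 0 → |r| < δ → dist (r⁻¹ • (U (x + r, t) - U (x, t))) q < ε / 4 → C * |r| < ε / 4 → ∀ᶠ s in 𝓝 t,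
      U (x + r, s) - U (x, s) ≤ m x s * r + ε / 4 * |r| ∧ |U (x + r, s) - U (x, s) - q * r| ≤ ε / 2 * |r| := by
    intro r hr r1 r2 r3
    have : Tendsto (fun s => U (x + r, s) - U (x, s) - q * r) (𝓝 t) (𝓝 (U (x + r, t) - U (x, t) - q * r)) := by
      have := hU.continuous
      exact Continuous.tendsto (by fun_prop) t
    have lt : |U (x + r, t) - U (x, t) - q * r| < ε / 2 * |r| := by
      have h0 : U (x + r, t) - U (x, t) - q * r = (r⁻¹ • (U (x + r, t) - U (x, t)) - q) * r := by
        rw [smul_eq_mul]; field_simp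
      rw [h0, abs_mul]
      rw [Real.dist_eq] at r2
      have := abs_pos.2 hr
      gcongr
      linarith
    filter_upwards [this.abs.eventually_lt_const lt, Metric.ball_mem_nhds t hδ] with s e1 e2
    have := (H x s (by simpa) e2).2 (x + r) (by simpa)
    simp only [add_sub_cancel_left] at this
    refine ⟨?_, e1.le⟩
    have : C * |r| ^ 2 ≤ ε / 4 * |r| := by rw [pow_two, ← mul_assoc]; gcongr
    linarith
  have n1 : 0 < h1 := n1
  have n2 : h2 < 0 := n2
  filter_upwards [key h1 n1.ne' p3 p1 p2, key h2 n2.ne m3 m1 m2] with s s1 s2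
  rw [abs_of_pos n1] at s1
  rw [abs_of_neg n2] at s2
  have g1 := abs_le.1 s1.2
  have g2 := abs_le.1 s2.2
  have k1 : (q - 3 / 4 * ε - m x s) * h1 ≤ 0 := by linarith [s1.1, g1.1]
  have k2 : (q + 3 / 4 * ε - m x s) * h2 ≤ 0 := by linarith [s2.1, g2.1]
  rw [Real.dist_eq, abs_lt]
  constructor
  · by_contra hh; push Not at hh
    have := mul_pos (by linarith : 0 < q - 3 / 4 * ε - m x s) n1
    linarith
  · by_contra hh; push Not at hh
    have := mul_pos_of_neg_of_neg (by linarith : q + 3 / 4 * ε - m x s < 0) n2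
    linarith
end S18

section S19
open scoped Convolution Topology NNReal

lemma hn_one (n) : hn n ≤ 1 := by
  unfold hn
  rw [div_le_one (by positivity)]
  linarith [n.cast_nonneg (α := ℝ)]

lemma c1_lip {φ : ℝ² → ℝ} (h1 : ContDiff ℝ 1 φ) (hc : HasCompactSupport φ) : ∃ K, LipschitzWith K φ :=
  h1.lipschitzWith_of_hasCompactSupport hc one_ne_zero

lemma line_c1 {φ : ℝ² → ℝ} (h1 : ContDiff ℝ 1 φ) (v : ℝ²) : Continuous fun p => lineDeriv ℝ φ p v := by
  have : (fun p => lineDeriv ℝ φ p v) = fun p => fderiv ℝ φ p v :=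
    funext fun p => ((h1.differentiable one_ne_zero) p).lineDeriv_eq_fderiv
  rw [this]
  exact (h1.continuous_fderiv one_ne_zero).clm_apply continuous_const

lemma cs_integrable {g : ℝ² → ℝ} {Q : Set ℝ²} (hQ : IsCompact Q) (hg : Measurable g) {M : ℝ} (hM : ∀ p, |g p| ≤ M)
    (h0 : ∀ p, p ∉ Q → g p = 0) : Integrable g := by
  refine Integrable.mono' ((integrableOn_const hQ.measure_lt_top.ne (C := M)).integrable_indicator hQ.measurableSet)
    hg.aestronglyMeasurable (Eventually.of_forall fun p => ?_)
  by_cases hp : p ∈ Q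
  · rw [indicator_of_mem hp]; exact hM p
  · rw [h0 p hp, indicator_of_notMem hp]; simp

lemma shift_cs {φ : ℝ² → ℝ} (hc : HasCompactSupport φ) : ∃ Q, IsCompact Q ∧ ∀ p v, ‖v‖ ≤ 1 → p ∉ Q → φ (p + v) = 0 := by
  refine ⟨_, hc.isCompact.cthickening (r := 1), fun p v hv hp => ?_⟩
  by_contra h
  exact hp (Metric.mem_cthickening_of_dist_le p (p + v) _ _ (subset_tsupport _ h) (by simpa using hv))

lemma lip_shift {φ : ℝ² → ℝ} {L : ℝ≥0} (hL : LipschitzWith L φ) (v : ℝ²) : LipschitzWith L fun p => φ (p + v) :=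
  LipschitzWith.of_dist_le_mul fun p q => by simpa using hL.dist_le_mul (p + v) (q + v)

lemma fd_shift {φ : ℝ² → ℝ} {D : ℝ² →L[ℝ] ℝ} {p v : ℝ²} (h : HasFDerivAt φ D (p + v)) :
    HasFDerivAt (fun p => φ (p + v)) D p := by
  simpa [Function.comp_def] using h.comp p ((hasFDerivAt_id p).add_const v)

lemma curl {U φ : ℝ² → ℝ} {K : ℝ≥0} (hU : LipschitzWith K U) (h1 : ContDiff ℝ 1 φ) (hc : HasCompactSupport φ) :
    ∫ p, Dx U p * Dt φ p = ∫ p, Dt U p * Dx φ p := by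
  obtain ⟨L, hL⟩ := c1_lip h1 hc
  obtain ⟨Q, hQ, hQ0⟩ := shift_cs hc
  have hn' : Tendsto hn atTop (𝓝[>] 0) := tendsto_nhdsWithin_iff.2 ⟨hn_lim, Eventually.of_forall hn_pos⟩
  have ev : ∀ n, ‖hn n • ((0 : ℝ), (1 : ℝ))‖ ≤ 1 := fun n => by
    simpa [Prod.norm_def, abs_of_pos (hn_pos n), (hn_pos n).le] using hn_one n
  have i1 : Integrable (Q.indicator (Dx U)) := by
    refine cs_integrable hQ ((Dx_meas hU.continuous).indicator hQ.measurableSet) (M := K) (fun p => ?_) fun p hp => indicator_of_notMem hp _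
    exact (norm_indicator_le_norm_self (Dx U) p).trans (Dx_bdd hU p)
  have cx : Continuous (Dx φ) := by simpa only [line_x] using line_c1 h1 (1, 0)
  have sx : ∀ p, p ∉ tsupport φ → Dx φ p = 0 := fun p hp => by rw [← line_x]; exact lineDeriv_zero_of_notin hp
  have i2 : Integrable (Dx φ) := cs_integrable hc.isCompact cx.measurable (Dx_bdd hL) sx
  have t1 := (hL.integral_inv_smul_sub_mul_tendsto_integral_lineDeriv_mul i1 (0, 1)).comp hn'
  have t2 := ((hU.integral_inv_smul_sub_mul_tendsto_integral_lineDeriv_mul i2 (-(0, 1))).neg).comp hn'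
  have iU : ∀ v, Integrable fun p => U (p + v) * Dx φ p := fun v => by
    have := hU.continuous
    refine Continuous.integrable_of_hasCompactSupport (by fun_prop) (hc.mono' fun p hp => ?_)
    by_contra h
    exact hp (by simp [sx p h])
  have e : ∀ n, ∫ p, (hn n)⁻¹ • (φ (p + hn n • (0, 1)) - φ p) * Q.indicator (Dx U) p =
      - ∫ p, (hn n)⁻¹ • (U (p + hn n • (-(0, 1))) - U p) * Dx φ p := fun n => by
    set v : ℝ² := hn n • (0, 1) with hv
    have a1 : ∀ p, (hn n)⁻¹ • (φ (p + v) - φ p) * Q.indicator (Dx U) p = (hn n)⁻¹ * (lineDeriv ℝ U p (1, 0) * (φ (p + v) - φ p)) := fun p => by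
      rw [line_x]
      by_cases hp : p ∈ Q
      · rw [indicator_of_mem hp, smul_eq_mul]; ring
      · have := hQ0 p 0 (by simp) hp
        rw [add_zero] at this
        rw [indicator_of_notMem hp, hQ0 p v (ev n) hp, this]; simp
    have l1 : LipschitzWith (L + L) fun p => φ (p + v) - φ p := by
      exact (lip_shift hL v).sub hL
    have c1 : HasCompactSupport fun p => φ (p + v) - φ p := HasCompactSupport.intro hQ fun p hp => by
      have := hQ0 p 0 (by simp) hp
      rw [add_zero] at this
      rw [hQ0 p v (ev n) hp, this, sub_zero]
    simp only [a1, smul_neg, ← sub_eq_add_neg]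
    rw [integral_const_mul, hU.integral_lineDeriv_mul_eq l1 c1]
    have ld : ∀ p, lineDeriv ℝ (fun p => φ (p + v) - φ p) p (-(1, 0)) = - (Dx φ (p + v) - Dx φ p) := fun p => by
      have hd := h1.differentiable one_ne_zero
      have := (fd_shift (hd (p + v)).hasFDerivAt).fun_sub (hd p).hasFDerivAt
      rw [lineDeriv_neg, (this.hasLineDerivAt (1, 0)).lineDeriv, (dx_of (hd p).hasFDerivAt).1, (dx_of (hd (p + v)).hasFDerivAt).1]
      simp
    have s1 := integral_add_right_eq_self (μ := volume) (fun p => U (p - v) * Dx φ p) v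
    simp only [add_sub_cancel_right] at s1
    have j1 := iU (-v)
    have j2 := iU 0
    simp only [← sub_eq_add_neg, add_zero] at j1 j2
    have j3 := j1.comp_add_right v
    simp only [add_sub_cancel_right] at j3
    have r1 : ∫ p, lineDeriv ℝ (fun p => φ (p + v) - φ p) p (-(1, 0)) * U p = (∫ p, U p * Dx φ p) - ∫ p, U p * Dx φ (p + v) := by
      rw [← integral_sub j2 j3]
      refine integral_congr_ae (Eventually.of_forall fun p => ?_)
      simp only [ld]; ring
    have r2 : ∫ p, (hn n)⁻¹ • (U (p - v) - U p) * Dx φ p = (hn n)⁻¹ * ((∫ p, U (p - v) * Dx φ p) - ∫ p, U p * Dx φ p) := by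
      rw [← integral_sub j1 j2, ← integral_const_mul]
      refine integral_congr_ae (Eventually.of_forall fun p => ?_)
      simp only [smul_eq_mul]; ring
    rw [r1, r2, s1]; ring
  have := tendsto_nhds_unique t1 (t2.congr fun n => (e n).symm)
  simp only [lineDeriv_neg, line_t, neg_mul, integral_neg, neg_neg] at this
  rw [← this]
  refine integral_congr_ae (Eventually.of_forall fun p => ?_)
  by_cases hp : p ∈ Q
  · simp only [indicator_of_mem hp]; ring
  · have : Dt φ p = 0 := by
      rw [← line_t]
      refine lineDeriv_zero_of_notin fun h => hp ?_
      exact closure_minimal (fun q hq => by_contra fun h => (Function.mem_support.1 hq) (by simpa using hQ0 q 0 (by simp) h)) hQ.isClosed h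
    simp [this]
end S19

section S20
open scoped Convolution Topology NNReal

lemma abs_line {Z : ℝ² → ℝ} {D : ℝ² →L[ℝ] ℝ} {p : ℝ²} (h : HasFDerivAt Z D p)
    (h' : DifferentiableAt ℝ (fun p => |Z p|) p) (d : ℝ²) : lineDeriv ℝ (fun p => |Z p|) p d = Real.sign (Z p) * D d := by
  rw [h'.lineDeriv_eq_fderiv]
  rcases lt_trichotomy (Z p) 0 with hz | hz | hz
  · have : (fun p => |Z p|) =ᶠ[𝓝 p] fun p => - Z p := by
      filter_upwards [h.continuousAt.eventually_lt_const hz] with q hq using abs_of_neg hq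
    rw [this.fderiv_eq, h.fun_neg.fderiv, Real.sign_of_neg hz]; simp
  · have : IsLocalMin (fun p => |Z p|) p := Eventually.of_forall fun q => by simp [hz]
    rw [this.fderiv_eq_zero, hz]; simp
  · have : (fun p => |Z p|) =ᶠ[𝓝 p] Z := by
      filter_upwards [h.continuousAt.eventually_const_lt hz] with q hq using abs_of_pos hq
    rw [this.fderiv_eq, h.fderiv, Real.sign_of_pos hz]; simp

section Krz
variable {f : ℝ → ℝ} {U ψ : ℝ² → ℝ} {m : ℝ → ℝ → ℝ} {S : Set ℝ} {K L : ℝ≥0} {a k ε : ℝ}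

structure Hl (S : Set ℝ) : Prop where
  o : IsOpen S
  z : (0 : ℝ) ∉ S
  s : ∀ x ∈ S, ∀ y, |y - x| < |x| → y ∈ S

lemma Hl.ne (h : Hl S) {x : ℝ} (hx : x ∈ S) : x ≠ 0 := fun e => h.z (e ▸ hx)

lemma Tch.hj (h : Tch f U m S) (hS : Hl S) (hU : LipschitzWith K U) : ∀ᵐ p : ℝ², p.1 ∈ S → 0 < p.2 →
    (∃ D : ℝ² →L[ℝ] ℝ, HasFDerivAt U D p ∧ ∀ a b, D (a, b) = uu U p.1 p.2 * a - f (uu U p.1 p.2) * b) ∧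
      uu U p.1 p.2 = m p.1 p.2 := by
  filter_upwards [hU.ae_differentiableAt (μ := volume)] with p hp h1 h2
  have d := hp.hasFDerivAt
  have dx : HasDerivAt (fun y => U (y, p.2)) (fderiv ℝ U p (1, 0)) p.1 :=
    HasFDerivAt.comp_hasDerivAt (l := U) p.1 d ((hasDerivAt_id p.1).prodMk (hasDerivAt_const _ _))
  have dt : HasDerivAt (fun s => U (p.1, s)) (fderiv ℝ U p (0, 1)) p.2 :=
    HasFDerivAt.comp_hasDerivAt (l := U) p.2 d ((hasDerivAt_const _ _).prodMk (hasDerivAt_id p.2))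
  have e1 := h.dx hS.o h1 (hS.ne h1) h2 dx
  have e2 := h.dt h1 (hS.ne h1) h2 dt
  have e3 : uu U p.1 p.2 = m p.1 p.2 := (uu_of dx).trans e1
  refine ⟨⟨_, d, fun a b => ?_⟩, e3⟩
  have : ((a, b) : ℝ²) = a • (1, 0) + b • (0, 1) := by ext <;> simp
  rw [this, map_add, map_smul, map_smul, e1, e2, e3, smul_eq_mul, smul_eq_mul]; ring

def gk (f : ℝ → ℝ) (k q : ℝ) : ℝ := f q - f k - deriv f k * (q - k)

lemma gk_nonneg (hf : CF f a) (k q : ℝ) : 0 ≤ gk f k q := by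
  have := hf.tang k q
  unfold gk; linarith

lemma gk_small (hf : CF f a) (k : ℝ) {η : ℝ} (hη : 0 < η) : ∃ δ > 0, ∀ q, |q - k| ≤ δ → gk f k q ≤ η * |q - k| := by
  have := (hf.hd k).isLittleO.def hη
  obtain ⟨δ, hδ, H⟩ := Metric.eventually_nhds_iff.1 this
  refine ⟨δ / 2, by positivity, fun q hq => ?_⟩
  have := H (show dist q k < δ by rw [Real.dist_eq]; linarith)
  simp only [Real.norm_eq_abs, smul_eq_mul] at this
  refine (le_abs_self _).trans ?_
  unfold gk
  rwa [mul_comm (deriv f k)]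

lemma krz_id (hf : CF f a) (h : Tch f U m S) (hS : Hl S) (hU : LipschitzWith K U) (hψ : LipschitzWith L ψ) (hc : HasCompactSupport ψ)
    (hs : ∀ p, ψ p ≠ 0 → p.1 ∈ S ∧ ε ≤ |p.1| ∧ ε ≤ p.2) (hε : 0 < ε) (k : ℝ) {n : ℕ} (hh : hn n < ε) :
    ∫ p : ℝ², |quo U n p.1 p.2 - k| * lineDeriv ℝ ψ p (deriv f k, 1) = ∫ p : ℝ², (hn n)⁻¹ * (gk f k (uu U p.1 p.2) *
      (Real.sign (quo U n (p.1 - hn n) p.2 - k) * ψ (p.1 - hn n, p.2) - Real.sign (quo U n p.1 p.2 - k) * ψ p)) := by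
  set v : ℝ² := (hn n, 0) with hv
  set Z : ℝ² → ℝ := fun p => quo U n p.1 p.2 - k with hZ
  set G : ℝ² → ℝ := fun p => gk f k (uu U p.1 p.2) with hG
  have Ze : Z = fun p => (hn n)⁻¹ * (U (p + v) - U p) - k := funext fun p => by
    simp only [hZ, quo, hv, div_eq_inv_mul]; congr 4; ext <;> simp
  have Zl : LipschitzWith (Real.toNNReal (hn n)⁻¹ * (K + K) + 0) Z := by
    rw [Ze]
    refine LipschitzWith.sub (LipschitzWith.of_dist_le_mul fun p q => ?_) (LipschitzWith.const _)
    have := ((lip_shift hU v).sub hU).dist_le_mul p q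
    rw [Real.dist_eq] at this ⊢
    have hp := inv_pos.2 (hn_pos n)
    rw [← mul_sub, abs_mul, abs_of_pos hp, NNReal.coe_mul, Real.coe_toNNReal _ hp.le, mul_assoc]
    gcongr
  have Zal : LipschitzWith (1 * (Real.toNNReal (hn n)⁻¹ * (K + K) + 0)) fun p => |Z p| :=
    (LipschitzWith.of_dist_le_mul fun x y => by simpa [Real.dist_eq] using abs_abs_sub_abs_le x y : LipschitzWith 1 fun x : ℝ => |x|).comp Zl
  have mu := uu_meas hU.continuous
  have mZ : Measurable Z := Zl.continuous.measurable
  have mG : Measurable G := by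
    have := hf.cont.measurable
    have h1 : Measurable (gk f k) := by unfold gk; fun_prop
    exact h1.comp mu
  obtain ⟨C, hC0, hC⟩ := cont_bdd (show Continuous (gk f k) by have := hf.cont; unfold gk; fun_prop) K
  have bG : ∀ p, |G p| ≤ C := fun p => hC _ (uu_bdd hU _ _)
  have I : ∀ {w : ℝ² → ℝ}, Measurable w → (∀ p, |w p| ≤ C) → Integrable fun p => w p * (Real.sign (Z p) * ψ p) := fun {w} mw bw => by
    refine (hψ.continuous.integrable_of_hasCompactSupport hc).bdd_mul (c := C * 1) (f := fun p => w p * Real.sign (Z p)) ?_ ?_ |>.congr (Eventually.of_forall fun p => mul_assoc _ _ _)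
    · exact (mw.mul (meas_sign.comp mZ)).aestronglyMeasurable
    · refine Eventually.of_forall fun p => ?_
      rw [norm_mul]
      exact mul_le_mul (bw p) (abs_sign_le _) (norm_nonneg _) hC0
  have i1 : Integrable fun p => G (p + v) * (Real.sign (Z p) * ψ p) := I (mG.comp (measurable_id.add_const v)) (fun p => bG (p + v))
  have i2 := I mG bG
  have i3 := i1.comp_sub_right v
  have s3 := integral_sub_right_eq_self (μ := volume) (fun p => G (p + v) * (Real.sign (Z p) * ψ p)) v
  simp only [sub_add_cancel] at i3 s3
  have e2 := Zal.integral_lineDeriv_mul_eq (μ := volume) hψ hc (-(deriv f k, 1))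
  rw [neg_neg] at e2
  have e3 : ∫ p, |Z p| * lineDeriv ℝ ψ p (deriv f k, 1) = ∫ p, lineDeriv ℝ (fun p => |Z p|) p (-(deriv f k, 1)) * ψ p := by
    rw [e2]; exact integral_congr_ae (Eventually.of_forall fun p => mul_comm _ _)
  have sub : ∀ p : ℝ², (p.1 - hn n, p.2) = p - v := fun p => by ext <;> simp [hv]
  have sub2 : ∀ p : ℝ², quo U n (p.1 - hn n) p.2 - k = Z (p - v) := fun p => by rw [← sub]
  simp only [sub2, sub]
  rw [e3, integral_const_mul]
  have hj := h.hj hS hU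
  have hj2 := (measurePreserving_add_right volume v).quasiMeasurePreserving.ae hj
  have key : ∫ p, lineDeriv ℝ (fun p => |Z p|) p (-(deriv f k, 1)) * ψ p =
      ∫ p, (hn n)⁻¹ * (G (p + v) * (Real.sign (Z p) * ψ p) - G p * (Real.sign (Z p) * ψ p)) := by
    refine integral_congr_ae ?_
    filter_upwards [hj, hj2, Zal.ae_differentiableAt (μ := volume)] with p h1 h2 h3
    by_cases hp : ψ p = 0
    · simp [hp]
    obtain ⟨q1, q2, q3⟩ := hs p hp
    obtain ⟨⟨D1, d1, l1⟩, -⟩ := h1 q1 (hε.trans_le q3)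
    obtain ⟨⟨D2, d2, l2⟩, -⟩ := h2 (hS.s _ q1 _ (by simp only [hv, Prod.fst_add, add_sub_cancel_left, abs_of_pos (hn_pos n)]; linarith))
      (by simpa [hv] using hε.trans_le q3)
    have dZ : HasFDerivAt Z ((hn n)⁻¹ • (D2 - D1)) p := by
      rw [Ze]; exact (((fd_shift d2).fun_sub d1).const_mul _).sub_const k
    rw [lineDeriv_neg, abs_line dZ h3]
    simp only [FunLike.coe_smul, Pi.smul_apply, ContinuousLinearMap.sub_apply, l1, l2, smul_eq_mul, hG, gk]
    ring
  rw [key, integral_const_mul, integral_sub i1 i2, ← s3, ← integral_sub i3 i2]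
  congr 1
  refine integral_congr_ae (Eventually.of_forall fun p => ?_)
  simp only [hG]; ring

lemma krz_pt (hf : CF f a) (h : Tch f U m S) (hS : Hl S) (hU : LipschitzWith K U) (hp : ∀ p, 0 ≤ ψ p)
    (hs : ∀ p, ψ p ≠ 0 → p.1 ∈ S ∧ ε ≤ |p.1| ∧ ε ≤ p.2) (hε : 0 < ε) (k : ℝ) {η : ℝ} (hη : 0 < η) : ∀ᶠ n in atTop, ∀ᵐ p : ℝ²,
    -(Real.sign (quo U n p.1 p.2 - k) * gk f k (uu U p.1 p.2) * ((ψ p - ψ (p.1 - hn n, p.2)) / hn n)) - η * ψ (p.1 - hn n, p.2) ≤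
      (hn n)⁻¹ * (gk f k (uu U p.1 p.2) *
      (Real.sign (quo U n (p.1 - hn n) p.2 - k) * ψ (p.1 - hn n, p.2) - Real.sign (quo U n p.1 p.2 - k) * ψ p)) := by
  obtain ⟨C, δ, hC, hδ, H⟩ := h (ε / 2) (by positivity)
  obtain ⟨δ', hδ', H'⟩ := gk_small hf k (η := η / (2 * (C + 1))) (by positivity)
  have l2 : Tendsto (fun n => C * hn n) atTop (𝓝 0) := by simpa using hn_lim.const_mul C
  filter_upwards [l2.eventually_lt_const hδ', hn_lim.eventually_lt_const hδ, hn_lim.eventually_lt_const (by positivity : 0 < ε / 2)] with n n1 n2 n3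
  filter_upwards [h.hj hS hU] with p hj
  have hpos := hn_pos n
  set σ := Real.sign (quo U n p.1 p.2 - k) with hσ
  set σ' := Real.sign (quo U n (p.1 - hn n) p.2 - k) with hσ'
  set G := gk f k (uu U p.1 p.2) with hG
  set y := ψ (p.1 - hn n, p.2) with hy
  suffices hsu : 0 ≤ G * (σ' - σ) * y + η * hn n * y by
    have e : (hn n)⁻¹ * (G * (σ' * y - σ * ψ p)) - (-(σ * G * ((ψ p - y) / hn n)) - η * y) = (hn n)⁻¹ * (G * (σ' - σ) * y + η * hn n * y) := by
      field_simp; ring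
    have := mul_nonneg (inv_pos.2 hpos).le hsu
    linarith
  have hG0 : 0 ≤ G := gk_nonneg hf k _
  have hy0 : 0 ≤ y := hp _
  by_cases yz : y = 0
  · simp [yz]
  obtain ⟨q1, q2, q3⟩ := hs _ yz
  simp only at q1 q2 q3
  have pS : p.1 ∈ S := hS.s _ q1 _ (by rw [sub_sub_cancel, abs_of_pos hpos]; linarith)
  have pa : ε / 2 ≤ |p.1| := by
    have := abs_sub p.1 (hn n)
    rw [abs_of_pos hpos] at this
    linarith
  have um := (hj pS (by linarith)).2
  have hle : - (η * hn n) ≤ G * (σ' - σ) := by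
    by_cases hlt : σ ≤ σ'
    · have := mul_nonneg hG0 (sub_nonneg.2 hlt)
      have := mul_pos hη hpos
      linarith
    push Not at hlt
    have z1 : 0 ≤ quo U n p.1 p.2 - k := by
      by_contra hh; push Not at hh
      rw [hσ, Real.sign_of_neg hh] at hlt
      linarith [(abs_le.1 (abs_sign_le (quo U n (p.1 - hn n) p.2 - k))).1]
    have z2 : quo U n (p.1 - hn n) p.2 - k ≤ 0 := by
      by_contra hh; push Not at hh
      rw [hσ', Real.sign_of_pos hh] at hlt
      linarith [(abs_le.1 (abs_sign_le (quo U n p.1 p.2 - k))).2]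
    have t1 := H p.1 p.2 pS pa (by linarith) (p.1 + hn n) p.2 (by rw [add_sub_cancel_left, abs_of_pos hpos]; exact n2.le) (by simpa using hδ.le)
    have t2 := H p.1 p.2 pS pa (by linarith) (p.1 - hn n) p.2 (by rw [sub_sub_cancel_left, abs_neg, abs_of_pos hpos]; exact n2.le) (by simpa using hδ.le)
    simp only [add_sub_cancel_left, sub_sub_cancel_left, abs_neg, abs_of_pos hpos, sub_self, abs_zero, add_zero, mul_zero, sub_zero, ← um] at t1 t2
    rw [quo, sub_nonneg, le_div_iff₀ hpos] at z1
    rw [quo, sub_nonpos, div_le_iff₀ hpos, sub_add_cancel] at z2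
    have b1 : k ≤ uu U p.1 p.2 + C * hn n := le_of_mul_le_mul_right (by linarith) hpos
    have b2 : uu U p.1 p.2 - C * hn n ≤ k := le_of_mul_le_mul_right (by linarith) hpos
    have b3 : |uu U p.1 p.2 - k| ≤ C * hn n := by rw [abs_le]; constructor <;> linarith
    have b4 := H' _ (b3.trans n1.le)
    have b5 : G * 2 ≤ η * hn n := by
      calc G * 2 ≤ η / (2 * (C + 1)) * (C * hn n) * 2 := by gcongr; exact b4.trans (by gcongr)
        _ = η * hn n * (C / (C + 1)) := by field_simp
        _ ≤ η * hn n * 1 := by gcongr; rw [div_le_one (by positivity)]; linarith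
        _ = _ := mul_one _
    have b6 : -2 ≤ σ' - σ := by
      linarith [(abs_le.1 (abs_sign_le (quo U n (p.1 - hn n) p.2 - k))).1, (abs_le.1 (abs_sign_le (quo U n p.1 p.2 - k))).2]
    have := mul_le_mul_of_nonneg_left b6 hG0
    linarith
  have := mul_le_mul_of_nonneg_right hle hy0
  linarith
end Krz
end S20

section S21
open scoped Convolution Topology NNReal

lemma bint {w g : ℝ² → ℝ} (mw : Measurable w) {C : ℝ} (bw : ∀ p, |w p| ≤ C) (hg : Integrable g) : Integrable fun p => w p * g p :=
  hg.bdd_mul (c := C) mw.aestronglyMeasurable (Eventually.of_forall bw)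

section Krz
variable {f : ℝ → ℝ} {U ψ : ℝ² → ℝ} {m : ℝ → ℝ → ℝ} {S : Set ℝ} {K L : ℝ≥0} {a k ε : ℝ}

lemma quo_meas (hU : LipschitzWith K U) (n : ℕ) : Measurable fun p : ℝ² => quo U n p.1 p.2 := by
  have := hU.continuous
  exact Continuous.measurable (by unfold quo; fun_prop)

lemma krz (hf : CF f a) (h : Tch f U m S) (hS : Hl S) (hU : LipschitzWith K U) (hψ : LipschitzWith L ψ) (hc : HasCompactSupport ψ)
    (hp : ∀ p, 0 ≤ ψ p) (hs : ∀ p, ψ p ≠ 0 → p.1 ∈ S ∧ ε ≤ |p.1| ∧ ε ≤ p.2) (hε : 0 < ε) (k : ℝ) :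
    0 ≤ ∫ p : ℝ², (|uu U p.1 p.2 - k| * Dt ψ p + qq f k (uu U p.1 p.2) * Dx ψ p) := by
  obtain ⟨Q, hQ, hQ0⟩ := shift_cs hc
  set d : ℝ² := (deriv f k, 1) with hd
  have mu := uu_meas hU.continuous
  have cg : Continuous (gk f k) := by have := hf.cont; unfold gk; fun_prop
  have mG : Measurable fun p : ℝ² => gk f k (uu U p.1 p.2) := cg.measurable.comp mu
  obtain ⟨C, hC0, hC⟩ := cont_bdd cg K
  have bG : ∀ p : ℝ², |gk f k (uu U p.1 p.2)| ≤ C := fun p => hC _ (uu_bdd hU _ _)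
  have mq : ∀ n, Measurable fun p : ℝ² => quo U n p.1 p.2 - k := fun n => (quo_meas hU n).sub_const k
  have bq : ∀ n (p : ℝ²), |quo U n p.1 p.2 - k| ≤ K + |k| := fun n p => (abs_sub _ _).trans (by gcongr; exact quo_bdd hU _ _ _)
  have sub : ∀ n (p : ℝ²), (p.1 - hn n, p.2) = p + (- hn n, 0) := fun n p => by ext <;> simp [sub_eq_add_neg]
  have nv : ∀ n, ‖((- hn n, 0) : ℝ²)‖ ≤ 1 := fun n => by
    simpa [Prod.norm_def, abs_of_pos (hn_pos n), (hn_pos n).le] using hn_one n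
  have z0 : ∀ p, p ∉ Q → ψ p = 0 := fun p hp => by simpa using hQ0 p 0 (by simp) hp
  have tQ : ∀ p, p ∉ Q → p ∉ tsupport ψ := fun p hp h =>
    hp (closure_minimal (fun q hq => by_contra fun h => (Function.mem_support.1 hq) (z0 q h)) hQ.isClosed h)
  have mσ : ∀ n, Measurable fun p : ℝ² => Real.sign (quo U n p.1 p.2 - k) := fun n => meas_sign.comp (mq n)
  have iψ := hψ.continuous.integrable_of_hasCompactSupport hc (μ := volume)
  have iψ' : ∀ n, Integrable fun p : ℝ² => ψ (p.1 - hn n, p.2) := fun n => by simpa only [sub] using iψ.comp_add_right _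
  have ml : Measurable fun p => lineDeriv ℝ ψ p d := measurable_lineDeriv hψ.continuous
  have bl : ∀ p, |lineDeriv ℝ ψ p d| ≤ L * ‖d‖ := fun p => norm_lineDeriv_le_of_lipschitz ℝ hψ
  have il : Integrable fun p => lineDeriv ℝ ψ p d := cs_integrable hQ ml bl fun p hp => lineDeriv_zero_of_notin (tQ p hp)
  have bs : ∀ (p : ℝ²) x, |Real.sign x * gk f k (uu U p.1 p.2)| ≤ C := fun p x => by
    rw [abs_mul]
    exact (mul_le_mul (abs_sign_le x) (bG p) (abs_nonneg _) zero_le_one).trans (one_mul C).le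
  have i1 : ∀ n, Integrable fun p : ℝ² => |quo U n p.1 p.2 - k| * lineDeriv ℝ ψ p d := fun n =>
    bint (mq n).abs (C := K + |k|) (fun p => by rw [abs_abs]; exact bq n p) il
  have i2 : ∀ n, Integrable fun p : ℝ² => Real.sign (quo U n p.1 p.2 - k) * gk f k (uu U p.1 p.2) * ((ψ p - ψ (p.1 - hn n, p.2)) / hn n) :=
    fun n => bint ((mσ n).mul mG) (fun p => bs p _) ((iψ.sub (iψ' n)).div_const _)
  have low : ∀ η > 0, ∀ᶠ n in atTop, - (η * ∫ p, ψ p) ≤ ∫ p : ℝ², (|quo U n p.1 p.2 - k| * lineDeriv ℝ ψ p d +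
      Real.sign (quo U n p.1 p.2 - k) * gk f k (uu U p.1 p.2) * ((ψ p - ψ (p.1 - hn n, p.2)) / hn n)) := fun η hη => by
    filter_upwards [krz_pt hf h hS hU hp hs hε k hη, hn_lim.eventually_lt_const hε] with n h1 h2
    rw [integral_add (i1 n) (i2 n), krz_id hf h hS hU hψ hc hs hε k h2]
    have i3 : Integrable fun p : ℝ² => (hn n)⁻¹ * (gk f k (uu U p.1 p.2) *
        (Real.sign (quo U n (p.1 - hn n) p.2 - k) * ψ (p.1 - hn n, p.2) - Real.sign (quo U n p.1 p.2 - k) * ψ p)) := by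
      refine (bint mG bG (Integrable.sub ?_ ?_)).const_mul _
      · refine bint (meas_sign.comp ((mq n).comp (g := fun p : ℝ² => quo U n p.1 p.2 - k) (f := fun p : ℝ² => (p.1 - hn n, p.2)) (by fun_prop))) (fun p => abs_sign_le _) (iψ' n)
      · exact bint (mσ n) (fun p => abs_sign_le _) iψ
    have := integral_mono_ae ((i2 n).neg.sub ((iψ' n).const_mul η)) i3 h1
    have e : ∫ p : ℝ², ψ (p.1 - hn n, p.2) = ∫ p, ψ p := by simpa only [sub] using integral_add_right_eq_self (μ := volume) ψ (- hn n, 0)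
    rw [integral_sub' (i2 n).neg ((iψ' n).const_mul η), integral_neg', integral_const_mul, e] at this
    linarith
  have lim : Tendsto (fun n => ∫ p : ℝ², (|quo U n p.1 p.2 - k| * lineDeriv ℝ ψ p d +
      Real.sign (quo U n p.1 p.2 - k) * gk f k (uu U p.1 p.2) * ((ψ p - ψ (p.1 - hn n, p.2)) / hn n))) atTop
      (𝓝 (∫ p : ℝ², (|uu U p.1 p.2 - k| * Dt ψ p + qq f k (uu U p.1 p.2) * Dx ψ p))) := by
    refine tendsto_integral_of_dominated_convergence (Q.indicator fun _ => (K + |k|) * (L * ‖d‖) + C * L) (fun n => ((i1 n).add (i2 n)).aestronglyMeasurable)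
      ((integrableOn_const hQ.measure_lt_top.ne).integrable_indicator hQ.measurableSet) (fun n => Eventually.of_forall fun p => ?_) ?_
    · by_cases hpq : p ∈ Q
      · rw [indicator_of_mem hpq]
        refine (norm_add_le _ _).trans (add_le_add ?_ ?_)
        · rw [norm_mul, Real.norm_eq_abs, abs_abs]
          exact mul_le_mul (bq n p) (bl p) (abs_nonneg _) (by positivity)
        · rw [norm_mul]
          refine mul_le_mul (bs p _) ?_ (abs_nonneg _) hC0
          rw [norm_div, div_le_iff₀ (norm_pos_iff.2 (hn_pos n).ne')]
          have := lip_x hψ (p.1 - hn n) p.1 p.2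
          rwa [sub_sub_cancel] at this
      · rw [indicator_of_notMem hpq, lineDeriv_zero_of_notin (tQ p hpq), sub, hQ0 p _ (nv n) hpq, z0 p hpq]; simp
    · filter_upwards [hU.ae_differentiableAt (μ := volume), hψ.ae_differentiableAt (μ := volume)] with p h1 h2
      have hx : HasDerivAt (fun y => U (y, p.2)) (fderiv ℝ U p (1, 0)) p.1 :=
        HasFDerivAt.comp_hasDerivAt (l := U) p.1 h1.hasFDerivAt ((hasDerivAt_id p.1).prodMk (hasDerivAt_const _ _))
      have ψx : HasDerivAt (fun y => ψ (y, p.2)) (fderiv ℝ ψ p (1, 0)) p.1 :=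
        HasFDerivAt.comp_hasDerivAt (l := ψ) p.1 h2.hasFDerivAt ((hasDerivAt_id p.1).prodMk (hasDerivAt_const _ _))
      have q1 := (quo_lim hx).sub_const k
      rw [← uu_of hx] at q1
      set w := uu U p.1 p.2 with hw
      have dd := dx_of h2.hasFDerivAt
      have ld : lineDeriv ℝ ψ p d = Dt ψ p + deriv f k * Dx ψ p := by
        rw [h2.lineDeriv_eq_fderiv, dd.1, dd.2]
        have : d = (0, 1) + deriv f k • (1, 0) := by ext <;> simp [hd]
        rw [this, map_add, map_smul, smul_eq_mul]
      have q2 : Tendsto (fun n => Real.sign (quo U n p.1 p.2 - k) * gk f k w) atTop (𝓝 (Real.sign (w - k) * gk f k w)) := by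
        rcases lt_trichotomy (w - k) 0 with hz | hz | hz
        · refine tendsto_const_nhds.congr' ?_
          filter_upwards [q1.eventually_lt_const hz] with n e
          rw [Real.sign_of_neg hz, Real.sign_of_neg e]
        · have : w = k := by linarith
          simp [this, gk]
        · refine tendsto_const_nhds.congr' ?_
          filter_upwards [q1.eventually_const_lt hz] with n e
          rw [Real.sign_of_pos hz, Real.sign_of_pos e]
      have q3 : Tendsto (fun n => (ψ p - ψ (p.1 - hn n, p.2)) / hn n) atTop (𝓝 (Dx ψ p)) := by
        rw [dd.1]
        have hm : Tendsto (fun n => - hn n) atTop (𝓝[≠] 0) :=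
          tendsto_nhdsWithin_iff.2 ⟨by simpa using hn_lim.neg, Eventually.of_forall fun n => by simpa using (hn_pos n).ne'⟩
        refine (ψx.tendsto_slope_zero.comp hm).congr fun n => ?_
        have := (hn_pos n).ne'
        simp only [Function.comp, smul_eq_mul, ← sub_eq_add_neg]
        field_simp
        ring
      have := (q1.abs.mul_const (lineDeriv ℝ ψ p d)).add (q2.mul q3)
      convert this using 2
      rw [ld, qq, gk]
      rcases lt_trichotomy (w - k) 0 with hz | hz | hz
      · rw [Real.sign_of_neg hz, abs_of_neg hz]; ring
      · rw [hz]; simp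
      · rw [Real.sign_of_pos hz, abs_of_pos hz]; ring
  have pos : 0 ≤ ∫ p, ψ p := integral_nonneg hp
  refine le_of_forall_pos_le_add fun η hη => ?_
  have h1 := ge_of_tendsto lim (low (η / ((∫ p, ψ p) + 1)) (by positivity))
  have h2 : η / ((∫ p, ψ p) + 1) * (∫ p, ψ p) ≤ η := by
    rw [div_mul_eq_mul_div, div_le_iff₀ (by positivity)]
    nlinarith
  linarith
end Krz
end S21

section S22
open scoped Convolution Topology NNReal

structure Cut (S : Set ℝ) (σ : ℝ) (α : ℕ → ℝ → ℝ) : Prop where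
  lip : ∀ n, ∃ K, LipschitzWith K (α n)
  mem : ∀ n x, 0 ≤ α n x ∧ α n x ≤ 1
  sup : ∀ n x, α n x ≠ 0 → x ∈ S ∧ hn n ≤ |x|
  lim : ∀ x, Tendsto (fun n => α n x) atTop (𝓝 (S.indicator (fun _ => 1) x))
  int : ∀ n, Integrable (deriv (α n))
  tot : ∀ n, ∫ x, |deriv (α n) x| ≤ 1
  tr : ∀ {m : ℝ → ℝ} {M l : ℝ}, Measurable m → (∀ x, |m x| ≤ M) → Tendsto m (𝓝[S] 0) (𝓝 l) →
    Tendsto (fun n => ∫ x, m x * deriv (α n) x) atTop (𝓝 (σ * l))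

def rp (n : ℕ) : ℝ → ℝ := rmp (hn n) (hn n)

lemma rp_lim (x : ℝ) : Tendsto (fun n => rp n x) atTop (𝓝 ((Ioi (0 : ℝ)).indicator (fun _ => 1) x)) := by
  by_cases hx : 0 < x
  · rw [indicator_of_mem (by exact hx)]
    refine tendsto_const_nhds.congr' ?_
    filter_upwards [hn_lim.eventually_lt_const (half_pos hx)] with n hn'
    exact (rmp_one (hn_pos n) (by linarith)).symm
  · rw [indicator_of_notMem (by exact hx)]
    refine tendsto_const_nhds.congr fun n => ?_
    exact (rmp_zero (hn_pos n) (by linarith [hn_pos n])).symm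

lemma rp_sup {n : ℕ} {x : ℝ} (h : rp n x ≠ 0) : hn n ≤ x := by
  by_contra hh; push Not at hh
  exact h (rmp_zero (hn_pos n) hh.le)

lemma cut_right : Cut (Ioi 0) 1 rp where
  lip n := ⟨_, rmp_lip _ (hn_pos n)⟩
  mem n x := rmp_mem _ _ x
  sup n x h := ⟨(hn_pos n).trans_le (rp_sup h), (rp_sup h).trans (le_abs_self x)⟩
  lim := rp_lim
  int n := rmp_d_integrable (hn_pos n)
  tot n := by
    have h := hn_pos n
    have e : ∫ x, |deriv (rp n) x| = ∫ x, 1 * deriv (rp n) x := by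
      refine integral_congr_ae ?_
      filter_upwards [rmp_deriv_ae (hn n) h] with x hx
      rw [one_mul, rp, hx.1, abs_of_nonneg (indicator_nonneg (fun _ _ => (inv_pos.2 h).le) _)]
    rw [e, rp, rmp_integral _ h]
    simp [h.ne']
  tr {m M l} hm hM hl := by
    rw [one_mul, Metric.tendsto_nhds]
    intro η hη
    have h1 := Metric.tendsto_nhds.1 hl (η / 2) (by positivity)
    obtain ⟨δ, hδ, H⟩ := mem_nhdsGT_iff_exists_Ioo_subset.1 h1
    filter_upwards [hn_lim.eventually_lt_const (half_pos hδ)] with n n1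
    have h := hn_pos n
    rw [rp, rmp_integral _ h, Real.dist_eq]
    have e : (hn n)⁻¹ * (∫ x in hn n..hn n + hn n, m x) - l = (hn n)⁻¹ * ∫ x in hn n..hn n + hn n, (m x - l) := by
      rw [intervalIntegral.integral_sub (ABSol.bdd_ii hm hM _ _) intervalIntegrable_const, intervalIntegral.integral_const]
      simp only [add_sub_cancel_right, smul_eq_mul]
      field_simp
    have b := intervalIntegral.norm_integral_le_of_norm_le_const (a := hn n) (b := hn n + hn n) (f := fun x => m x - l) (C := η / 2) fun x hx => by
      rw [uIoc_of_le (by linarith)] at hx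
      exact le_of_lt (H ⟨h.trans hx.1, by linarith [hx.2]⟩)
    rw [add_sub_cancel_right, abs_of_pos h] at b
    rw [e, abs_mul, abs_of_pos (inv_pos.2 h), inv_mul_lt_iff₀ h]
    have := mul_pos hη h
    refine b.trans_lt (by linarith)

lemma cut_left : Cut (Iio 0) (-1) fun n x => rp n (-x) := by
  have d : ∀ n x, deriv (fun x => rp n (-x)) x = - deriv (rp n) (-x) := fun n x => deriv_comp_neg _ _
  refine ⟨fun n => ?_, fun n x => rmp_mem _ _ _, fun n x h => ?_, fun x => ?_, fun n => ?_, fun n => ?_, fun {m M l} hm hM hl => ?_⟩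
  · obtain ⟨K, h⟩ := cut_right.lip n
    exact ⟨K, LipschitzWith.of_dist_le_mul fun x y => by simpa using h.dist_le_mul (-x) (-y)⟩
  · have := cut_right.sup n (-x) h
    rw [abs_neg] at this
    exact ⟨by simpa using this.1, this.2⟩
  · simpa [indicator_apply] using rp_lim (-x)
  · simp only [funext (d n)]
    exact (cut_right.int n).comp_neg.neg
  · simp only [d, abs_neg]
    exact (integral_neg_eq_self (fun x => |deriv (rp n) x|) volume).trans_le (cut_right.tot n)
  · have hneg : Tendsto (fun x : ℝ => -x) (𝓝[>] 0) (𝓝[<] 0) := by simpa using tendsto_neg_nhdsGT (a := (0 : ℝ))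
    have := (cut_right.tr (hm.comp measurable_neg) (fun x => hM (-x)) (hl.comp hneg)).neg
    rw [one_mul] at this
    rw [neg_one_mul]
    refine this.congr fun n => ?_
    rw [← integral_neg_eq_self, ← integral_neg]
    refine integral_congr_ae (Eventually.of_forall fun x => ?_)
    simp [d]

lemma lip_mul {f g : ℝ² → ℝ} {K L M : ℝ≥0} (hf : LipschitzWith K f) (hg : LipschitzWith L g) (bf : ∀ p, |f p| ≤ M) (bg : ∀ p, |g p| ≤ 1) :
    LipschitzWith (M * L + K) fun p => f p * g p := by
  refine LipschitzWith.of_dist_le_mul fun p q => ?_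
  have h1 := hf.dist_le_mul p q
  have h2 := hg.dist_le_mul p q
  rw [Real.dist_eq] at h1 h2 ⊢
  have : f p * g p - f q * g q = f p * (g p - g q) + (f p - f q) * g q := by ring
  rw [this, NNReal.coe_add, NNReal.coe_mul]
  refine (abs_add_le _ _).trans ?_
  rw [abs_mul, abs_mul]
  have a1 := mul_le_mul (bf p) h2 (abs_nonneg _) M.coe_nonneg
  have a2 := mul_le_mul h1 (bg q) (abs_nonneg _) (by positivity)
  linarith

section Bd
variable {f : ℝ → ℝ} {U φ : ℝ² → ℝ} {m : ℝ → ℝ → ℝ} {S : Set ℝ} {K : ℝ≥0} {a k σ : ℝ} {α : ℕ → ℝ → ℝ} {N : ℝ → ℝ}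

lemma bdry_R (hα : Cut S σ α) {w : ℝ² → ℝ} (mw : Measurable w) {M R : ℝ} (hM : ∀ p, |w p| ≤ M) (hR : ∀ p : ℝ², R < |p.2| → w p = 0)
    (h0 : ∀ p : ℝ², p.2 ≤ 0 → w p = 0) {l : ℝ → ℝ} (hl : ∀ t > 0, Tendsto (fun x => w (x, t)) (𝓝[S] 0) (𝓝 (l t))) (l0 : ∀ t ≤ 0, l t = 0) :
    (∀ n, Integrable fun p : ℝ² => w p * (deriv (α n) p.1 * rp n p.2)) ∧
    Tendsto (fun n => ∫ p : ℝ², w p * (deriv (α n) p.1 * rp n p.2)) atTop (𝓝 (σ * ∫ t, l t)) := by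
  have iχ : ∀ n, Integrable ((Icc (-R) R).indicator (rp n)) := fun n =>
    (((rmp_lip _ (hn_pos n)).continuous.continuousOn).integrableOn_compact isCompact_Icc).integrable_indicator measurableSet_Icc
  have e : ∀ n (p : ℝ²), w p * (deriv (α n) p.1 * rp n p.2) = w p * (deriv (α n) p.1 * (Icc (-R) R).indicator (rp n) p.2) := fun n p => by
    by_cases hp : p.2 ∈ Icc (-R) R
    · rw [indicator_of_mem hp]
    · rw [hR p (by rw [mem_Icc, ← abs_le] at hp; linarith)]; simp
  simp only [e]
  refine ⟨fun n => prod_int mw hM (hα.int n) (iχ n), ?_⟩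
  simp only [prod_int_t mw hM (hα.int _) (iχ _)]
  rw [← integral_const_mul]
  have bi : ∀ n t, |∫ x, w (x, t) * deriv (α n) x| ≤ M := fun n t => by
    have h9 : ‖∫ x, w (x, t) * deriv (α n) x‖ ≤ ∫ x, M * |deriv (α n) x| :=
      norm_integral_le_of_norm_le ((hα.int n).abs.const_mul M) (Eventually.of_forall fun x => by
        rw [norm_mul]; exact mul_le_mul_of_nonneg_right (hM _) (abs_nonneg _))
    refine h9.trans ?_
    rw [integral_const_mul]
    exact (mul_le_mul_of_nonneg_left (hα.tot n) ((abs_nonneg _).trans (hM 0))).trans (mul_one M).le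
  refine tendsto_integral_of_dominated_convergence ((Icc (-R) R).indicator fun _ => M) (fun n => ?_)
    ((integrableOn_const isCompact_Icc.measure_lt_top.ne).integrable_indicator measurableSet_Icc) (fun n => Eventually.of_forall fun t => ?_)
    (Eventually.of_forall fun t => ?_)
  · exact (int_t_meas mw (measurable_deriv _)).aestronglyMeasurable.mul (iχ n).aestronglyMeasurable
  · by_cases ht : t ∈ Icc (-R) R
    · rw [indicator_of_mem ht, indicator_of_mem ht, norm_mul]
      have h1 := rmp_mem (hn n) (hn n) t
      refine (mul_le_mul (bi n t) (show ‖rp n t‖ ≤ 1 by rw [Real.norm_eq_abs, rp, abs_of_nonneg h1.1]; exact h1.2) (norm_nonneg _) ((abs_nonneg _).trans (hM 0))).trans (mul_one M).le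
    · simp [indicator_of_notMem ht]
  · rcases le_or_gt t 0 with ht | ht
    · simp [l0 t ht, h0 (_, t) ht]
    have h1 := hα.tr (mw.comp (by fun_prop : Measurable fun x : ℝ => (x, t))) (fun x => hM _) (hl t ht)
    by_cases hR' : t ∈ Icc (-R) R
    · have := h1.mul (rp_lim t)
      rw [indicator_of_mem (by exact ht), mul_one] at this
      simpa only [indicator_of_mem hR', Function.comp_def] using this
    · have wz : ∀ x, w (x, t) = 0 := fun x => hR _ (by rw [mem_Icc, ← abs_le] at hR'; simpa using hR')
      simp only [Function.comp_def, wz, zero_mul, integral_zero] at h1 ⊢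
      exact h1

lemma bdry (hf : CF f a) (h : Tch f U m S) (hS : Hl S) (hU : LipschitzWith K U) (hα : Cut S σ α)
    (hN : ∀ t > 0, Tendsto (fun y => uu U y t) (𝓝[S] 0) (𝓝 (N t))) (hφ : ContDiff ℝ 1 φ) (hc : HasCompactSupport φ)
    (hp : ∀ p, 0 ≤ φ p) (h0 : ∀ p : ℝ², p.2 ≤ 0 → φ p = 0) (k : ℝ) :
    0 ≤ (∫ p : ℝ², S.indicator (fun _ => 1) p.1 * (|uu U p.1 p.2 - k| * Dt φ p + qq f k (uu U p.1 p.2) * Dx φ p)) +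
      σ * ∫ t, qq f k (N t) * φ (0, t) := by
  obtain ⟨L, hL⟩ := c1_lip hφ hc
  have mu := uu_meas hU.continuous
  have cq := qq_cont hf.cont k
  have mq : Measurable fun p : ℝ² => qq f k (uu U p.1 p.2) := cq.measurable.comp mu
  obtain ⟨C, hC0, hC⟩ := cont_bdd cq K
  obtain ⟨Mφ, hMφ⟩ := hL.continuous.bounded_above_of_compact_support hc
  obtain ⟨R, hR⟩ := hc.isCompact.isBounded.subset_closedBall 0
  have zt : ∀ p, p ∉ tsupport φ → φ p = 0 := fun p hp => image_eq_zero_of_notMem_tsupport hp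
  have bq : ∀ p : ℝ², |qq f k (uu U p.1 p.2)| ≤ C := fun p => hC _ (uu_bdd hU _ _)
  have bu : ∀ p : ℝ², |uu U p.1 p.2 - k| ≤ K + |k| := fun p => (abs_sub _ _).trans (by gcongr; exact uu_bdd hU _ _)
  obtain ⟨iR, tR⟩ := bdry_R hα (w := fun p => qq f k (uu U p.1 p.2) * φ p) (mq.mul hL.continuous.measurable) (M := C * Mφ) (R := R)
    (fun p => by rw [abs_mul]; exact mul_le_mul (bq p) (hMφ p) (abs_nonneg _) hC0)
    (fun p hp => by
      rw [zt p, mul_zero]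
      intro hh
      have := hR hh
      rw [mem_closedBall_zero_iff, Prod.norm_def] at this
      exact absurd ((le_max_right _ _).trans this) (not_le.2 hp))
    (fun p hp => by rw [h0 p hp, mul_zero]) (l := fun t => qq f k (N t) * φ (0, t))
    (fun t ht => ((cq.tendsto _).comp (hN t ht)).mul (((by have := hL.continuous; fun_prop : Continuous fun x : ℝ => φ (x, t)).tendsto 0).mono_left nhdsWithin_le_nhds))
    (fun t ht => by rw [h0 _ ht, mul_zero])
  have dτ : ∀ n, ∀ᵐ p : ℝ², DifferentiableAt ℝ (α n) p.1 ∧ DifferentiableAt ℝ (rp n) p.2 ∧ deriv (rp n) p.2 = (Ioo (hn n) (hn n + hn n)).indicator (fun _ => (hn n)⁻¹) p.2 := fun n => by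
    obtain ⟨Kα, h1⟩ := hα.lip n
    filter_upwards [Measure.quasiMeasurePreserving_fst.ae (μb := volume) (h1.ae_differentiableAt (μ := volume)), Measure.quasiMeasurePreserving_snd.ae (rmp_deriv_ae (hn n) (hn_pos n))] with p a1 a2
    exact ⟨a1, a2.2, a2.1⟩
  set E : ℕ → ℝ² → ℝ := fun n p => |uu U p.1 p.2 - k| * (Dt φ p * (α n p.1 * rp n p.2) + φ p * (α n p.1 * deriv (rp n) p.2)) +
    qq f k (uu U p.1 p.2) * (Dx φ p * (α n p.1 * rp n p.2)) with hE
  have mE : ∀ n, Measurable (E n) := fun n => by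
    obtain ⟨Kα, h1⟩ := hα.lip n
    have a1 : Measurable fun p : ℝ² => α n p.1 := h1.continuous.measurable.comp (measurable_fst (α := ℝ) (β := ℝ))
    have a2 : Measurable fun p : ℝ² => rp n p.2 := (rmp_lip (hn n) (hn_pos n)).continuous.measurable.comp (measurable_snd (α := ℝ) (β := ℝ))
    have a3 : Measurable fun p : ℝ² => deriv (rp n) p.2 := (measurable_deriv (rp n)).comp (measurable_snd (α := ℝ) (β := ℝ))
    exact ((mu.sub_const k).abs.mul (((Dt_meas hL.continuous).mul (a1.mul a2)).add (hL.continuous.measurable.mul (a1.mul a3)))).add (mq.mul ((Dx_meas hL.continuous).mul (a1.mul a2)))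
  have bE : ∀ n, ∀ᵐ p, ‖E n p‖ ≤ (tsupport φ).indicator (fun _ => (K + |k|) * (L + 2 * L) + C * L) p := fun n => by
    filter_upwards [dτ n] with p hd
    by_cases hpq : p ∈ tsupport φ
    · rw [indicator_of_mem hpq]
      have m1 := hα.mem n p.1
      have m2 := rmp_mem (hn n) (hn n) p.2
      have m3 : |α n p.1 * rp n p.2| ≤ 1 := by
        rw [abs_mul, abs_of_nonneg m1.1, rp, abs_of_nonneg m2.1]; exact mul_le_one₀ m1.2 m2.1 m2.2
      have m4 : |φ p * (α n p.1 * deriv (rp n) p.2)| ≤ 2 * L := by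
        rw [hd.2.2]
        by_cases ht : p.2 ∈ Ioo (hn n) (hn n + hn n)
        · rw [indicator_of_mem ht, abs_mul, abs_mul, abs_of_nonneg m1.1, abs_of_pos (inv_pos.2 (hn_pos n))]
          have h3 := lip_t hL p.1 p.2 0
          rw [h0 (p.1, 0) le_rfl, sub_zero, sub_zero, abs_of_pos ((hn_pos n).trans ht.1)] at h3
          have h4 : |φ p| ≤ L * (2 * hn n) := h3.trans (by gcongr; linarith [ht.2])
          calc |φ p| * (α n p.1 * (hn n)⁻¹) ≤ L * (2 * hn n) * (1 * (hn n)⁻¹) := by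
                have := hn_pos n
                exact mul_le_mul h4 (mul_le_mul_of_nonneg_right m1.2 (inv_pos.2 this).le) (mul_nonneg m1.1 (inv_pos.2 this).le) (by positivity)
            _ = 2 * L := by have := (hn_pos n).ne'; field_simp
        · rw [indicator_of_notMem ht]; simp
      have m5 : |Dt φ p * (α n p.1 * rp n p.2)| ≤ L := by
        rw [abs_mul]; exact (mul_le_mul (Dt_bdd hL p) m3 (abs_nonneg _) L.2).trans (mul_one _).le
      have m6 : |Dx φ p * (α n p.1 * rp n p.2)| ≤ L := by
        rw [abs_mul]; exact (mul_le_mul (Dx_bdd hL p) m3 (abs_nonneg _) L.2).trans (mul_one _).le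
      refine (norm_add_le _ _).trans (add_le_add ?_ ?_)
      · rw [norm_mul, Real.norm_eq_abs, abs_abs]
        exact mul_le_mul (bu p) ((abs_add_le _ _).trans (add_le_add m5 m4)) (abs_nonneg _) (by positivity)
      · rw [norm_mul]; exact mul_le_mul (bq p) m6 (abs_nonneg _) hC0
    · rw [indicator_of_notMem hpq]
      simp [hE, zt p hpq, ← line_t, ← line_x, lineDeriv_zero_of_notin hpq]
  have iB : Integrable ((tsupport φ).indicator fun _ => (K + |k|) * (L + 2 * L) + C * (L : ℝ)) :=
    (integrableOn_const hc.isCompact.measure_lt_top.ne).integrable_indicator (isClosed_tsupport _).measurableSet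
  have tE : Tendsto (fun n => ∫ p, E n p) atTop (𝓝 (∫ p : ℝ², S.indicator (fun _ => 1) p.1 * (|uu U p.1 p.2 - k| * Dt φ p + qq f k (uu U p.1 p.2) * Dx φ p))) := by
    refine tendsto_integral_of_dominated_convergence _ (fun n => (mE n).aestronglyMeasurable) iB bE ?_
    have n0 : ∀ᵐ p : ℝ², p.2 ≠ 0 := Measure.quasiMeasurePreserving_snd.ae (μb := volume) (Measure.ae_ne volume (0 : ℝ))
    filter_upwards [ae_all_iff.2 dτ, n0] with p hd p0
    rcases lt_or_gt_of_ne p0 with ht | ht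
    · have z : φ =ᶠ[𝓝 p] fun _ => 0 := by
        filter_upwards [continuous_snd.continuousAt.eventually_lt_const ht] with q hq using h0 q hq.le
      have := (notMem_tsupport_iff_eventuallyEq.2 z)
      simp [hE, zt p this, ← line_t, ← line_x, lineDeriv_zero_of_notin this]
    · have l1 := (hα.lim p.1).mul (rp_lim p.2)
      rw [indicator_of_mem (show p.2 ∈ Ioi 0 from ht), mul_one] at l1
      have l2 : Tendsto (fun n => φ p * (α n p.1 * deriv (rp n) p.2)) atTop (𝓝 0) := by
        refine tendsto_const_nhds.congr' ?_
        filter_upwards [hn_lim.eventually_lt_const (half_pos ht)] with n hn'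
        rw [(hd n).2.2, indicator_of_notMem fun h => by linarith [h.2]]; simp
      have := ((l1.const_mul (Dt φ p)).add l2).const_mul (|uu U p.1 p.2 - k|) |>.add ((l1.const_mul (Dx φ p)).const_mul (qq f k (uu U p.1 p.2)))
      convert this using 2
      ring
  refine ge_of_tendsto' (tE.add tR) fun n => ?_
  have iE : Integrable (E n) := iB.mono' (mE n).aestronglyMeasurable (bE n)
  rw [← integral_add iE (iR n)]
  obtain ⟨Kα, hKα⟩ := hα.lip n
  have lp := prod_lip hKα (rmp_lip (hn n) (hn_pos n)) (fun x => by rw [abs_of_nonneg (hα.mem n x).1]; exact (hα.mem n x).2)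
    (fun x => by have := rmp_mem (hn n) (hn n) x; rw [abs_of_nonneg this.1]; exact this.2)
  have hψ := lip_mul (M := Real.toNNReal Mφ) hL lp (fun p => (hMφ p).trans (Real.le_coe_toNNReal _))
    (fun p => by
      have m1 := hα.mem n p.1
      have m2 := rmp_mem (hn n) (hn n) p.2
      rw [abs_mul, abs_of_nonneg m1.1, abs_of_nonneg m2.1]; exact mul_le_one₀ m1.2 m2.1 m2.2)
  have := krz hf h hS hU hψ (hc.mul_right) (fun p => mul_nonneg (hp p) (mul_nonneg (hα.mem n p.1).1 (rmp_mem (hn n) (hn n) p.2).1))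
    (ε := hn n) (fun p hp => by
      have h1 := (mul_ne_zero_iff.1 (mul_ne_zero_iff.1 hp).2)
      exact ⟨(hα.sup n _ h1.1).1, (hα.sup n _ h1.1).2, rp_sup h1.2⟩) (hn_pos n) k
  refine this.trans_eq (integral_congr_ae ?_)
  filter_upwards [dτ n] with p hd
  have dd := (hφ.differentiable one_ne_zero p).hasFDerivAt
  have x1 : HasDerivAt (fun y => φ (y, p.2)) (Dx φ p) p.1 := by
    rw [(dx_of dd).1]
    exact HasFDerivAt.comp_hasDerivAt (l := φ) p.1 dd ((hasDerivAt_id p.1).prodMk (hasDerivAt_const _ _))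
  have x2 : HasDerivAt (fun y => φ (p.1, y)) (Dt φ p) p.2 := by
    rw [(dx_of dd).2]
    exact HasFDerivAt.comp_hasDerivAt (l := φ) p.2 dd ((hasDerivAt_const _ _).prodMk (hasDerivAt_id p.2))
  have y1 := (x1.fun_mul (hd.1.hasDerivAt.mul_const (rp n p.2))).deriv
  have y2 := (x2.fun_mul (hd.2.1.hasDerivAt.const_mul (α n p.1))).deriv
  have w1 : Dx (fun p => φ p * (α n p.1 * rmp (hn n) (hn n) p.2)) p = Dx φ p * (α n p.1 * rp n p.2) + φ p * (deriv (α n) p.1 * rp n p.2) := y1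
  have w2 : Dt (fun p => φ p * (α n p.1 * rmp (hn n) (hn n) p.2)) p = Dt φ p * (α n p.1 * rp n p.2) + φ p * (α n p.1 * deriv (rp n) p.2) := y2
  simp only [w1, w2, hE]
  ring
end Bd
end S22

section S23
open scoped Convolution Topology NNReal

structure Gl (fl fr U0 b : ℝ → ℝ) (K : ℝ≥0) (U : ℝ² → ℝ) (m : ℝ → ℝ → ℝ) : Prop where
  lip : LipschitzWith K U
  tl : Tch fl U m (Iio 0)
  tr : Tch fr U m (Ioi 0)
  bd : ∀ t, 0 ≤ t → U (0, t) = b t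
  i : ∀ x, U (x, 0) = U0 x
  ll : ∀ t, 0 < t → ∃ L, Tendsto (fun x => m x t) (𝓝[<] 0) (𝓝 L)
  lr : ∀ t, 0 < t → ∃ L, Tendsto (fun x => m x t) (𝓝[>] 0) (𝓝 L)
  init : ∀ x, x ≠ 0 → ∀ q, HasDerivAt U0 q x → Tendsto (fun t => m x t) (𝓝[>] 0) (𝓝 q)
  Dl : ∀ x t y, x ≤ 0 → y ≤ 0 → 0 < t → U (x, t) ≤ U0 y + t * LL fl ((x - y) / t)
  Dr : ∀ x t y, 0 ≤ x → 0 ≤ y → 0 < t → U (x, t) ≤ U0 y + t * LL fr ((x - y) / t)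

lemma exists_Gl {fl fr U0 b : ℝ → ℝ} {A B a γ : ℝ} {N : ℝ≥0} (d : Dat fl fr A B a γ) (hU : LipschitzWith N U0) (hb : Bd fl fr U0 γ b) :
    ∃ K U m, Gl fl fr U0 b K U m := by
  obtain ⟨N', hN'⟩ := hb.lip
  have u1 := hU.weaken (le_max_left N N')
  have b1 := hN'.weaken (le_max_right N N')
  have u2 : LipschitzWith (max N N') fun x => U0 (-x) := LipschitzWith.of_dist_le_mul fun x y => by simpa using u1.dist_le_mul (-x) (-y)
  obtain ⟨Hl, hl⟩ := exists_HS d.l u1 b1 hb.z hb.l fun s t hs hst => by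
    have := mul_le_mul_of_nonneg_left (d.l.LL0_ge A) (sub_nonneg.2 hst)
    rw [d.fA] at this
    linarith [hb.g s t hs hst]
  obtain ⟨Hr, hr⟩ := exists_HS d.r.reflect u2 b1 (by simpa using hb.z) (fun t ht p hp => by
      have := hb.r t ht (-p) (by linarith)
      rw [d.r.LL_reflect, ← neg_mul]; exact this) fun s t hs hst => by
    have := mul_le_mul_of_nonneg_left (d.r.LL0_ge B) (sub_nonneg.2 hst)
    rw [d.fB] at this
    rw [d.r.LL_reflect, neg_zero]
    linarith [hb.g s t hs hst]
  obtain ⟨ml, hml⟩ := hl.exists_m d.l hb.tc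
  obtain ⟨mr, hmr⟩ := hr.exists_m d.r.reflect hb.tc
  obtain ⟨K1, k1⟩ := hl.lip
  obtain ⟨K2, k2⟩ := hr.lip
  have f1 := LipschitzWith.prod_fst (α := ℝ) (β := ℝ)
  have f2 := LipschitzWith.prod_snd (α := ℝ) (β := ℝ)
  have c1 := k1.comp ((f1.min_const 0).prodMk f2)
  have c2 := k2.comp ((f1.neg.min_const 0).prodMk f2)
  have c3 := hN'.comp (f2.max_const 0)
  set U : ℝ² → ℝ := fun p => Hl (min p.1 0) p.2 + Hr (min (-p.1) 0) p.2 - b (max p.2 0) with hUd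
  set m : ℝ → ℝ → ℝ := fun x t => if x < 0 then ml x t else - mr (-x) t with hm
  have H0 : ∀ t, Hl 0 t = b (max t 0) ∧ Hr 0 t = b (max t 0) := fun t => by
    rcases le_total t 0 with h | h
    · rw [max_eq_right h, hl.i 0 le_rfl t h, hr.i 0 le_rfl t h, hb.z, neg_zero]; exact ⟨rfl, rfl⟩
    · rw [max_eq_left h, hl.bd t h, hr.bd t h]; exact ⟨rfl, rfl⟩
  have UL : ∀ x t, x ≤ 0 → U (x, t) = Hl x t := fun x t hx => by
    simp only [hUd, min_eq_left hx, min_eq_right (neg_nonneg.2 hx), (H0 t).2]; ring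
  have UR : ∀ x t, 0 ≤ x → U (x, t) = Hr (-x) t := fun x t hx => by
    simp only [hUd, min_eq_right hx, min_eq_left (neg_nonpos.2 hx), (H0 t).1]; ring
  have mL : ∀ x t, x < 0 → m x t = ml x t := fun x t hx => if_pos hx
  have mR : ∀ x t, 0 < x → m x t = - mr (-x) t := fun x t hx => if_neg hx.not_gt
  refine ⟨_, U, m, (c1.add c2).sub c3, fun ε hε => ?_, fun ε hε => ?_, fun t ht => ?_, fun x => ?_, fun t ht => ?_, fun t ht => ?_,
    fun x x0 q hq => ?_, fun x t y hx hy ht => ?_, fun x t y hx hy ht => ?_⟩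
  · obtain ⟨C, δ, hC, hδ, H⟩ := hml.touch ε hε
    refine ⟨C, min δ ε, hC, lt_min hδ hε, fun x t hx hx' ht x' t' h1 h2 => ?_⟩
    have hx : x < 0 := hx
    rw [abs_of_neg hx] at hx'
    have := (le_abs_self _).trans (h1.trans (min_le_right _ _))
    rw [UL _ _ hx.le, UL _ _ (by linarith), mL _ _ hx]
    exact H x t (by linarith) ht x' t' (h1.trans (min_le_left _ _)) (h2.trans (min_le_left _ _))
  · obtain ⟨C, δ, hC, hδ, H⟩ := hmr.touch ε hε
    refine ⟨C, min δ ε, hC, lt_min hδ hε, fun x t hx hx' ht x' t' h1 h2 => ?_⟩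
    have hx : 0 < x := hx
    rw [abs_of_pos hx] at hx'
    have := (neg_abs_le (x' - x))
    have := (h1.trans (min_le_right _ _))
    rw [UR _ _ hx.le, UR _ _ (by linarith), mR _ _ hx]
    have e : -x' - -x = -(x' - x) := by ring
    have := H (-x) t (by linarith) ht (-x') t' (by rw [e, abs_neg]; exact h1.trans (min_le_left _ _)) (h2.trans (min_le_left _ _))
    rw [e, abs_neg] at this
    linarith
  · rw [UL _ _ le_rfl, hl.bd t ht]
  · rcases le_total x 0 with h | h
    · rw [UL _ _ h, hl.i x h 0 le_rfl]
    · rw [UR _ _ h, hr.i (-x) (by linarith) 0 le_rfl, neg_neg]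
  · obtain ⟨L, h⟩ := hml.lim0 t ht
    exact ⟨L, h.congr' (by filter_upwards [self_mem_nhdsWithin] with x hx using (mL x t hx).symm)⟩
  · obtain ⟨L, h⟩ := hmr.lim0 t ht
    have hneg : Tendsto (fun x : ℝ => -x) (𝓝[>] 0) (𝓝[<] 0) := by simpa using tendsto_neg_nhdsGT (a := (0 : ℝ))
    exact ⟨-L, (h.comp hneg).neg.congr' (by filter_upwards [self_mem_nhdsWithin] with x hx using (mR x t hx).symm)⟩
  · rcases lt_or_gt_of_ne x0 with h | h
    · simpa only [mL x _ h] using hml.init x h q hq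
    · simp only [mR x _ h]
      have hq' : HasDerivAt U0 q (- -x) := by rwa [neg_neg]
      simpa using (hmr.init (-x) (by linarith) (-q) (by have := HasDerivAt.comp (-x) hq' (hasDerivAt_neg (-x)); rw [mul_neg_one] at this; exact this)).neg
  · have := hl.D x t y 0 hx hy le_rfl ht
    rw [cst, hl.i y hy 0 le_rfl, sub_zero] at this
    rw [UL _ _ hx]; exact this
  · have := hr.D (-x) t (-y) 0 (by linarith) (by linarith) le_rfl ht
    rw [cst, hr.i (-y) (by linarith) 0 le_rfl, sub_zero, d.r.LL_reflect, neg_neg, ← neg_div] at this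
    rw [UR _ _ hx]; convert this using 4; ring

lemma slp {g v : ℝ → ℝ} {K : ℝ≥0} {N G C : ℝ} (hg : LipschitzWith K g) (hv : ∀ y q, HasDerivAt g q y → v y = q)
    (hN : Tendsto v (𝓝[<] 0) (𝓝 N)) (H : ∀ x < 0, g x ≤ g 0 + G * x + C * x ^ 2) : G ≤ N := by
  by_contra hc; push Not at hc
  obtain ⟨δ, hδ, h⟩ := mem_nhdsLT_iff_exists_Ioo_subset.1 (hN.eventually_lt_const (show N < (N + G) / 2 by linarith))
  have key : ∀ x, δ < x → x < 0 → (G - N) / 2 ≤ C * -x := fun x h1 h2 => by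
    have e := lip_ftc hg x 0
    have l : ∫ t in x..0, deriv g t ≤ ∫ t in x..0, (N + G) / 2 := by
      refine intervalIntegral.integral_mono_ae_restrict h2.le (ABSol.bdd_ii (measurable_deriv g) (fun x => norm_deriv_le_of_lipschitz hg) _ _) intervalIntegrable_const ?_
      rw [EventuallyLE, ae_restrict_iff' measurableSet_Icc]
      filter_upwards [hg.ae_differentiableAt (μ := volume), Measure.ae_ne volume (0 : ℝ)] with y hy y0 hy'
      rw [← hv y _ hy.hasDerivAt]
      exact le_of_lt (h ⟨h1.trans_le hy'.1, lt_of_le_of_ne hy'.2 y0⟩)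
    rw [e, intervalIntegral.integral_const, smul_eq_mul] at l
    have := H x h2
    nlinarith
  have lim : Tendsto (fun x : ℝ => C * -x) (𝓝[<] 0) (𝓝 (C * -0)) := ((continuous_const.mul continuous_neg).tendsto 0).mono_left nhdsWithin_le_nhds
  have := ge_of_tendsto lim (b := (G - N) / 2) (by filter_upwards [Ioo_mem_nhdsLT hδ] with x hx using key x hx.1 hx.2)
  simp only [neg_zero, mul_zero] at this
  linarith
end S23

section S24
open scoped Convolution Topology NNReal

lemma hl_left : Hl (Iio 0) := ⟨isOpen_Iio, by simp, fun x hx y h => by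
  have hx : x < 0 := hx
  rw [abs_of_neg hx] at h
  exact show y < 0 by linarith [le_abs_self (y - x)]⟩

lemma hl_right : Hl (Ioi 0) := ⟨isOpen_Ioi, by simp, fun x hx y h => by
  have hx : 0 < x := hx
  rw [abs_of_pos hx] at h
  exact show 0 < y by linarith [neg_abs_le (y - x)]⟩

section Gl
variable {fl fr U0 b : ℝ → ℝ} {K : ℝ≥0} {U : ℝ² → ℝ} {m : ℝ → ℝ → ℝ} {A B a γ : ℝ}

lemma Gl.lims (h : Gl fl fr U0 b K U m) (x t : ℝ) (ht : 0 < t) :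
    (∃ L, Tendsto (fun y => uu U y t) (𝓝[<] x) (𝓝 L)) ∧ ∃ L, Tendsto (fun y => uu U y t) (𝓝[>] x) (𝓝 L) := by
  rcases lt_trichotomy x 0 with hx | rfl | hx
  · obtain ⟨⟨L, hL⟩, R, hR⟩ := h.tl.lims h.lip isOpen_Iio hx hx.ne ht
    exact ⟨⟨L, h.tl.uu_lim isOpen_Iio (by simp) ht isOpen_Iio (nhdsWithin_le_nhds (Iio_mem_nhds hx)) hL⟩,
      R, h.tl.uu_lim isOpen_Iio (by simp) ht isOpen_Ioi (nhdsWithin_le_nhds (Iio_mem_nhds hx)) hR⟩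
  · obtain ⟨L, hL⟩ := h.ll t ht
    obtain ⟨R, hR⟩ := h.lr t ht
    exact ⟨⟨L, h.tl.uu_lim isOpen_Iio (by simp) ht isOpen_Iio self_mem_nhdsWithin hL⟩,
      R, h.tr.uu_lim isOpen_Ioi (by simp) ht isOpen_Ioi self_mem_nhdsWithin hR⟩
  · obtain ⟨⟨L, hL⟩, R, hR⟩ := h.tr.lims h.lip isOpen_Ioi hx hx.ne' ht
    exact ⟨⟨L, h.tr.uu_lim isOpen_Ioi (by simp) ht isOpen_Iio (nhdsWithin_le_nhds (Ioi_mem_nhds hx)) hL⟩,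
      R, h.tr.uu_lim isOpen_Ioi (by simp) ht isOpen_Ioi (nhdsWithin_le_nhds (Ioi_mem_nhds hx)) hR⟩

lemma Gl.aeD (h : Gl fl fr U0 b K U m) : AeD U (fun p => uu U p.1 p.2) fun p => dflux fl fr p.1 (uu U p.1 p.2) := by
  have n0 : ∀ᵐ p : ℝ², p.1 ≠ 0 := Measure.quasiMeasurePreserving_fst.ae (μb := volume) (Measure.ae_ne volume (0 : ℝ))
  filter_upwards [h.tl.hj hl_left h.lip, h.tr.hj hl_right h.lip, n0] with p h1 h2 p0 hp
  rcases lt_or_gt_of_ne p0 with hx | hx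
  · obtain ⟨D, a1, a2⟩ := (h1 hx hp).1
    exact ⟨D, a1, by simpa only [dflux, if_pos hx] using a2⟩
  · obtain ⟨D, a1, a2⟩ := (h2 hx hp).1
    exact ⟨D, a1, by simpa only [dflux, if_neg hx.not_gt] using a2⟩

lemma Gl.trace (h : Gl fl fr U0 b K U m) (hb : ∃ K, LipschitzWith K b) {f : ℝ → ℝ} (hf : Continuous f) {N : ℝ → ℝ} {z : ℕ → ℝ}
    (z0 : Tendsto z atTop (𝓝 0)) (hN : ∀ t, 0 < t → Tendsto (fun n => uu U (z n) t) atTop (𝓝 (N t))) (N0 : ∀ t ≤ 0, N t = 0)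
    (hz : ∀ n a b, 0 ≤ a → a ≤ b → U (z n, b) - U (z n, a) = ∫ t in a..b, - f (uu U (z n) t)) :
    Measurable N ∧ (∀ t, |N t| ≤ K) ∧ ∀ᵐ t, 0 < t → f (N t) = - deriv b t := by
  obtain ⟨Kb, hKb⟩ := hb
  have mu := uu_meas h.lip.continuous
  have mz : ∀ n, Measurable fun t => uu U (z n) t := fun n => mu.of_uncurry_left
  have mN : Measurable N := by
    have mi : ∀ n, Measurable ((Ioi (0 : ℝ)).indicator fun t => uu U (z n) t) := fun n => (mz n).indicator measurableSet_Ioi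
    have li : ∀ t, Tendsto (fun n => (Ioi (0 : ℝ)).indicator (fun t => uu U (z n) t) t) atTop (𝓝 (N t)) := fun t => by
      by_cases ht : 0 < t
      · simpa only [indicator_of_mem (show t ∈ Ioi 0 from ht)] using hN t ht
      · simp [indicator_apply, ht, N0 t (not_lt.1 ht)]
    exact measurable_of_tendsto_metrizable mi (tendsto_pi_nhds.2 li)
  have bN : ∀ t, |N t| ≤ K := fun t => by
    by_cases ht : 0 < t
    · exact le_of_tendsto (hN t ht).abs (Eventually.of_forall fun n => uu_bdd h.lip _ _)
    · simp [N0 t (not_lt.1 ht)]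
  obtain ⟨C, hC0, hC⟩ := cont_bdd hf K
  have mf : Measurable fun t => f (N t) := hf.measurable.comp mN
  have mfz : ∀ n, Measurable fun t => - f (uu U (z n) t) := fun n => (hf.measurable.comp (mz n)).neg
  have key : ∀ s t, 0 < s → s ≤ t → ∫ r in s..t, f (N r) = b s - b t := fun s t hs hst => by
    have l1 : Tendsto (fun n => ∫ r in s..t, - f (uu U (z n) r)) atTop (𝓝 (∫ r in s..t, - f (N r))) := by
      have q : ∀ n r, ‖- f (uu U (z n) r)‖ ≤ C := fun n r => by rw [norm_neg]; exact hC _ (uu_bdd h.lip _ _)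
      refine intervalIntegral.tendsto_integral_filter_of_dominated_convergence (fun _ => C) (Eventually.of_forall fun n => (mfz n).aestronglyMeasurable)
        (Eventually.of_forall fun n => Eventually.of_forall fun r _ => q n r) intervalIntegrable_const (Eventually.of_forall fun r hr => ?_)
      rw [uIoc_of_le hst] at hr
      exact ((hf.tendsto _).comp (hN r (hs.trans hr.1))).neg
    have l2 : ∀ r, 0 ≤ r → Tendsto (fun n => U (z n, r)) atTop (𝓝 (b r)) := fun r hr => by
      rw [← h.bd r hr]
      exact (h.lip.continuous.tendsto _).comp (z0.prodMk_nhds tendsto_const_nhds)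
    have := tendsto_nhds_unique (l1.congr fun n => (hz n s t hs.le hst).symm) ((l2 t (hs.le.trans hst)).sub (l2 s hs.le))
    rw [intervalIntegral.integral_neg] at this
    linarith
  have mg : Measurable fun t => f (N t) + deriv b t := mf.add (measurable_deriv b)
  have bg : ∀ t, |f (N t) + deriv b t| ≤ C + Kb := fun t => (abs_add_le _ _).trans (add_le_add (hC _ (bN t)) (norm_deriv_le_of_lipschitz hKb))
  have ig : ∀ s t, 0 < s → s ≤ t → ∫ r in s..t, (f (N r) + deriv b r) = 0 := fun s t hs hst => by
    rw [intervalIntegral.integral_add (ABSol.bdd_ii mf (fun x => hC _ (bN x)) _ _) (ABSol.bdd_ii (measurable_deriv b) (fun x => norm_deriv_le_of_lipschitz hKb) _ _),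
      lip_ftc hKb, key s t hs hst]; ring
  refine ⟨mN, bN, ?_⟩
  have g1 := ae_of_int mg bg fun s t hs hst => (ig s t hs hst).ge
  have g2 := ae_of_int (h := fun t => -(f (N t) + deriv b t)) mg.neg (fun t => (abs_neg _).trans_le (bg t)) fun s t hs hst => by
    rw [intervalIntegral.integral_neg, ig s t hs hst, neg_zero]
  filter_upwards [g1, g2] with t h1 h2 ht
  linarith [h1 ht, h2 ht]

lemma Gl.traces (h : Gl fl fr U0 b K U m) (hb : ∃ K, LipschitzWith K b) (hl : Continuous fl) (hr : Continuous fr) {N P : ℝ → ℝ}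
    (hN : ∀ t, 0 < t → Tendsto (fun y => uu U y t) (𝓝[<] 0) (𝓝 (N t))) (N0 : ∀ t ≤ 0, N t = 0)
    (hP : ∀ t, 0 < t → Tendsto (fun y => uu U y t) (𝓝[>] 0) (𝓝 (P t))) (P0 : ∀ t ≤ 0, P t = 0) :
    (Measurable N ∧ (∀ t, |N t| ≤ K) ∧ ∀ᵐ t, 0 < t → fl (N t) = - deriv b t) ∧ (Measurable P ∧ (∀ t, |P t| ≤ K) ∧ ∀ᵐ t, 0 < t → fr (P t) = - deriv b t) := by
  have h0 := h.aeD.path h.lip (LipschitzWith.const (0 : ℝ))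
  simp only [deriv_const, mul_zero, zero_sub] at h0
  have pos : ∀ z : ℕ → ℝ, Tendsto z atTop (𝓝[>] 0) → ∃ z' : ℕ → ℕ, (∀ n, 0 < z (z' n)) ∧ Tendsto (z ∘ z') atTop (𝓝[>] 0) := fun z hz => by
    obtain ⟨n0, hn⟩ := eventually_atTop.1 (tendsto_nhdsWithin_iff.1 hz).2
    exact ⟨fun n => n + n0, fun n => hn _ (Nat.le_add_left _ _), hz.comp (tendsto_add_atTop_nat n0)⟩
  have hneg : Tendsto (fun x : ℝ => -x) (𝓝[>] 0) (𝓝[<] 0) := by simpa using tendsto_neg_nhdsGT (a := (0 : ℝ))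
  constructor
  · obtain ⟨z, hz, hz0⟩ := ae_seq_right h0
    obtain ⟨k, p1, p2⟩ := pos z hz0
    refine h.trace hb hl (z := fun n => - z (k n)) ((hneg.comp p2).mono_right nhdsWithin_le_nhds) (fun t ht => (hN t ht).comp (hneg.comp p2)) N0 fun n s t hs hst => ?_
    simpa only [dflux, if_pos (neg_neg_iff_pos.2 (p1 n))] using hz (k n) s t hs hst
  · obtain ⟨z, hz, hz0⟩ := ae_seq_right ((Measure.measurePreserving_neg volume).quasiMeasurePreserving.ae h0)
    obtain ⟨k, p1, p2⟩ := pos z hz0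
    refine h.trace hb hr (z := fun n => z (k n)) (p2.mono_right nhdsWithin_le_nhds) (fun t ht => (hP t ht).comp p2) P0 fun n s t hs hst => ?_
    simpa only [neg_neg, dflux, if_neg (p1 n).not_gt] using hz (k n) s t hs hst

lemma Gl.iface (h : Gl fl fr U0 b K U m) (d : Dat fl fr A B a γ) (hb : Bd fl fr U0 γ b) {n p t : ℝ} (ht : 0 < t) (db : DifferentiableAt ℝ b t)
    (hn : fl n = - deriv b t) (hp : fr p = - deriv b t)
    (hN : Tendsto (fun y => uu U y t) (𝓝[<] 0) (𝓝 n)) (hP : Tendsto (fun y => uu U y t) (𝓝[>] 0) (𝓝 p)) : qq fr B p ≤ qq fl A n := by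
  have hg := lip_sl h.lip t
  simp only [qq, d.fA, d.fB, hn, hp]
  by_cases e : - deriv b t = γ
  · simp [e]
  have ge : γ ≤ - deriv b t := by
    have := (hasDerivAt_iff_tendsto_slope.1 db.hasDerivAt).mono_left (nhdsGT_le_nhdsNE t)
    have := le_of_tendsto this (b := -γ) (by
      filter_upwards [self_mem_nhdsWithin] with r hr
      have hr : t < r := hr
      rw [slope_def_field, div_le_iff₀ (sub_pos.2 hr)]
      linarith [hb.g t r ht.le hr.le])
    linarith
  have gt : 0 < - deriv b t - γ := by rcases ge.lt_or_eq with h | h; linarith; exact absurd h.symm e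
  have s1 := abs_le.1 (abs_sign_le (p - B))
  have s2 := abs_le.1 (abs_sign_le (n - A))
  refine mul_le_mul_of_nonneg_right ?_ gt.le
  rcases hb.alt t ht with ⟨s, s0, st, H⟩ | ⟨q, hq, H⟩ | ⟨q, hq, H⟩
  · exfalso
    have h1 : HasDerivWithinAt b (-γ) (Icc s t) t := by
      refine HasDerivWithinAt.congr (f := fun r => b t + γ * (t - r)) ?_ (fun r hr => H r hr.1 hr.2) (by simp)
      have := (((hasDerivAt_id t).const_sub t).const_mul γ).const_add (b t)
      simpa using this.hasDerivWithinAt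
    have := (uniqueDiffOn_Icc st t ⟨st.le, le_rfl⟩).eq_deriv _ h1 db.hasDerivAt.hasDerivWithinAt
    exact e (by rw [← this, neg_neg])
  · have : GG fl q ≤ n := slp (C := 1 / (a * t)) hg (fun y q hq => uu_of hq) hN fun x hx => by
      have h1 := h.Dl x t (-q * t) hx.le (by nlinarith) ht
      have h2 := d.l.phi_quad q t (x - -q * t) ht
      rw [h.bd t ht.le, H]
      have e : x - -q * t - q * t = x := by ring
      rw [e, sub_self] at h2
      rw [div_mul_eq_mul_div, one_mul]
      simp only [mul_zero, sub_zero] at h2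
      linarith
    have hA : A ≤ GG fl q := d.l.smono.le_iff_le.1 (by rw [d.l.dG]; linarith [d.dA])
    have hne : A ≠ n := fun h' => e (by rw [← hn, ← h', d.fA])
    rw [Real.sign_of_pos (sub_pos.2 (lt_of_le_of_ne (hA.trans this) hne))]
    exact s1.2
  · have hneg : Tendsto (fun x : ℝ => -x) (𝓝[<] 0) (𝓝[>] 0) := by simpa using tendsto_neg_nhdsLT (a := (0 : ℝ))
    have hg' : LipschitzWith K fun x => U (-x, t) := LipschitzWith.of_dist_le_mul fun x y => by simpa using hg.dist_le_mul (-x) (-y)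
    have : - GG fr q ≤ -p := slp (C := 1 / (a * t)) hg' (v := fun x => - uu U (-x) t) (fun y q hq => by
        have hq' : HasDerivAt (fun x => U (-x, t)) q (- -y) := by rwa [neg_neg]
        have := HasDerivAt.comp (-y) hq' (hasDerivAt_neg (-y))
        rw [uu_of (q := -q) (by simpa [Function.comp_def] using this), neg_neg]) (hP.comp hneg).neg fun x hx => by
      have h1 := h.Dr (-x) t (-q * t) (by linarith) (by nlinarith) ht
      have h2 := d.r.phi_quad q t (-x - -q * t) ht
      rw [neg_zero, h.bd t ht.le, H]
      have e : -x - -q * t - q * t = -x := by ring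
      rw [e, sub_self] at h2
      rw [div_mul_eq_mul_div, one_mul]
      simp only [mul_zero, sub_zero, neg_sq] at h2
      linarith
    have hB : GG fr q ≤ B := d.r.smono.le_iff_le.1 (by rw [d.r.dG]; linarith [d.dB])
    have hne : p ≠ B := fun h' => e (by rw [← hp, h', d.fB])
    rw [Real.sign_of_neg (sub_neg.2 (lt_of_le_of_ne (by linarith) hne))]
    exact s2.1
end Gl
end S24

section S25
open scoped Convolution Topology NNReal

lemma d_zero {φ : ℝ² → ℝ} {p : ℝ²} (h : φ =ᶠ[𝓝 p] fun _ => 0) : Dx φ p = 0 ∧ Dt φ p = 0 := by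
  have := notMem_tsupport_iff_eventuallyEq.2 h
  simp [← line_t, ← line_x, lineDeriv_zero_of_notin this]

section Gl
variable {fl fr U0 b u0 : ℝ → ℝ} {K : ℝ≥0} {U φ : ℝ² → ℝ} {m : ℝ → ℝ → ℝ} {A B a γ σ : ℝ} {S : Set ℝ}

lemma d_int (h1 : ContDiff ℝ 1 φ) (hc : HasCompactSupport φ) {g g' : ℝ² → ℝ} {M : ℝ} (hg : Measurable g) (hM : ∀ p, |g p| ≤ M)
    (hg' : Measurable g') (hM' : ∀ p, |g' p| ≤ M) : Integrable fun p => g p * Dt φ p + g' p * Dx φ p := by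
  obtain ⟨L, hL⟩ := c1_lip h1 hc
  refine cs_integrable hc.isCompact ((hg.mul (Dt_meas hL.continuous)).add (hg'.mul (Dx_meas hL.continuous))) (M := M * L + M * L) (fun p => ?_) fun p hp => ?_
  · refine (abs_add_le _ _).trans ?_
    rw [abs_mul, abs_mul]
    have := (abs_nonneg _).trans (hM 0)
    gcongr
    exacts [hM p, Dt_bdd hL p, hM' p, Dx_bdd hL p]
  · have := d_zero (notMem_tsupport_iff_eventuallyEq.1 hp)
    simp [this.1, this.2]

lemma Gl.weak (h : Gl fl fr U0 b K U m) (hl : Continuous fl) (hr : Continuous fr) (h1 : ContDiff ℝ 1 φ) (hc : HasCompactSupport φ) (h0 : ∀ p : ℝ², p.2 ≤ 0 → φ p = 0) :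
    ∫ p : ℝ², (uu U p.1 p.2 * Dt φ p + dflux fl fr p.1 (uu U p.1 p.2) * Dx φ p) = 0 := by
  have e : ∀ᵐ p : ℝ², uu U p.1 p.2 * Dt φ p + dflux fl fr p.1 (uu U p.1 p.2) * Dx φ p = (Dx U p * Dt φ p + 0 * Dx φ p) - (0 * Dt φ p + Dt U p * Dx φ p) := by
    have n0 : ∀ᵐ p : ℝ², p.2 ≠ 0 := Measure.quasiMeasurePreserving_snd.ae (μb := volume) (Measure.ae_ne volume (0 : ℝ))
    filter_upwards [h.aeD, n0] with p hp p0
    rcases lt_or_gt_of_ne p0 with ht | ht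
    · have z := d_zero (φ := φ) (p := p) (by filter_upwards [continuous_snd.continuousAt.eventually_lt_const ht] with q hq using h0 q hq.le)
      simp [z.1, z.2]
    · obtain ⟨D, d1, d2⟩ := hp ht
      rw [(dx_of d1).1, (dx_of d1).2, d2, d2]; ring
  have hU := h.lip
  have z : ∀ p : ℝ², |(fun _ => (0 : ℝ)) p| ≤ K := fun p => by simp
  have i1 := d_int h1 hc (Dx_meas hU.continuous) (Dx_bdd hU) measurable_const z
  have i2 := d_int h1 hc measurable_const z (Dt_meas hU.continuous) (Dt_bdd hU)
  rw [integral_congr_ae e, integral_sub i1 i2]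
  simp only [zero_mul, add_zero, zero_add]
  rw [curl hU h1 hc, sub_self]

lemma kr {f N : ℝ → ℝ} {α : ℕ → ℝ → ℝ} (hf : CF f a) (h : Tch f U m S) (hS : Hl S) (hU : LipschitzWith K U) (hα : Cut S σ α)
    (hN : ∀ t > 0, Tendsto (fun y => uu U y t) (𝓝[S] 0) (𝓝 (N t))) (hφ : ContDiff ℝ 1 φ) (hc : HasCompactSupport φ)
    (hp : ∀ p, 0 ≤ φ p) (h0 : ∀ p : ℝ², p.2 ≤ 0 → φ p = 0) (hz : ∀ p : ℝ², p.1 ∉ S → φ p = 0) (hSc : ∀ x, x ≠ 0 → x ∉ S → Sᶜ ∈ 𝓝 x) (k : ℝ) :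
    0 ≤ ∫ p : ℝ², (|uu U p.1 p.2 - k| * Dt φ p + qq f k (uu U p.1 p.2) * Dx φ p) := by
  have := bdry hf h hS hU hα hN hφ hc hp h0 k
  simp only [hz (0, _) hS.z, mul_zero, integral_zero, add_zero] at this
  refine this.trans_eq (integral_congr_ae ?_)
  have n0 : ∀ᵐ p : ℝ², p.1 ≠ 0 := Measure.quasiMeasurePreserving_fst.ae (μb := volume) (Measure.ae_ne volume (0 : ℝ))
  filter_upwards [n0] with p p0
  by_cases hs : p.1 ∈ S
  · rw [indicator_of_mem hs, one_mul]
  · have z := d_zero (φ := φ) (p := p) (by filter_upwards [continuous_fst.continuousAt.preimage_mem_nhds (hSc _ p0 hs)] with q hq using hz q hq)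
    simp [z.1, z.2]

lemma ent_int {f : ℝ → ℝ} (hf : Continuous f) (hU : LipschitzWith K U) (hS : MeasurableSet S) (h1 : ContDiff ℝ 1 φ) (hc : HasCompactSupport φ) (k : ℝ) :
    Integrable fun p : ℝ² => S.indicator (fun _ => 1) p.1 * (|uu U p.1 p.2 - k| * Dt φ p + qq f k (uu U p.1 p.2) * Dx φ p) := by
  obtain ⟨C, hC0, hC⟩ := cont_bdd (qq_cont hf k) K
  have mu := uu_meas hU.continuous
  have mS : Measurable fun p : ℝ² => S.indicator (fun _ => (1 : ℝ)) p.1 := (measurable_const.indicator hS).comp measurable_fst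
  have bS : ∀ x, |S.indicator (fun _ => (1 : ℝ)) x| ≤ 1 := fun x => by by_cases h : x ∈ S <;> simp [h]
  have m1 : Measurable fun p : ℝ² => |uu U p.1 p.2 - k| := (mu.sub_const k).abs
  have m2 : Measurable fun p : ℝ² => qq f k (uu U p.1 p.2) := (qq_cont hf k).measurable.comp mu
  have b : ∀ (p : ℝ²) (y Y : ℝ), |y| ≤ Y → |S.indicator (fun _ => (1 : ℝ)) p.1 * y| ≤ Y := fun p y Y h => by
    rw [abs_mul]
    exact (mul_le_mul (bS p.1) h (abs_nonneg _) zero_le_one).trans (one_mul Y).le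
  have := d_int h1 hc (M := max (K + |k|) C) (mS.mul m1) (fun p => b p |uu U p.1 p.2 - k| _ (by
    rw [abs_abs]; exact ((abs_sub _ _).trans (by gcongr; exact uu_bdd hU _ _)).trans (le_max_left _ _))) (mS.mul m2)
    (fun p => b p (qq f k (uu U p.1 p.2)) _ ((hC _ (uu_bdd hU _ _)).trans (le_max_right _ _)))
  refine this.congr (Eventually.of_forall fun p => ?_)
  simp only [Pi.mul_apply]; ring

lemma Gl.ent (h : Gl fl fr U0 b K U m) (d : Dat fl fr A B a γ) (hb : Bd fl fr U0 γ b) {N P : ℝ → ℝ}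
    (hN : ∀ t, 0 < t → Tendsto (fun y => uu U y t) (𝓝[<] 0) (𝓝 (N t))) (N0 : ∀ t ≤ 0, N t = 0)
    (hP : ∀ t, 0 < t → Tendsto (fun y => uu U y t) (𝓝[>] 0) (𝓝 (P t))) (P0 : ∀ t ≤ 0, P t = 0)
    (h1 : ContDiff ℝ 1 φ) (hc : HasCompactSupport φ) (hp : ∀ p, 0 ≤ φ p) (h0 : ∀ p : ℝ², p.2 ≤ 0 → φ p = 0) :
    0 ≤ ∫ p : ℝ², (|uu U p.1 p.2 - cAB A B p.1| * Dt φ p +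
        Real.sign (uu U p.1 p.2 - cAB A B p.1) * (dflux fl fr p.1 (uu U p.1 p.2) - dflux fl fr p.1 (cAB A B p.1)) * Dx φ p) := by
  have e1 := bdry d.l h.tl hl_left h.lip cut_left hN h1 hc hp h0 A
  have e2 := bdry d.r h.tr hl_right h.lip cut_right hP h1 hc hp h0 B
  obtain ⟨⟨n1, n2, n3⟩, p1, p2, p3⟩ := h.traces hb.lip d.l.cont d.r.cont hN N0 hP P0
  have cφ : Continuous fun t : ℝ => φ (0, t) := h1.continuous.comp (by fun_prop)
  have iφ : Integrable fun t : ℝ => φ (0, t) := by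
    refine cφ.integrable_of_hasCompactSupport (.of_support_subset_isCompact (hc.isCompact.image continuous_snd) fun t ht => ?_)
    exact ⟨(0, t), subset_tsupport _ ht, rfl⟩
  have iq : ∀ {f N : ℝ → ℝ} {k : ℝ}, Continuous f → Measurable N → (∀ t, |N t| ≤ K) → Integrable fun t => qq f k (N t) * φ (0, t) := fun {f N k} hf hm hN => by
    obtain ⟨C, hC0, hC⟩ := cont_bdd (qq_cont hf k) K
    exact iφ.bdd_mul ((qq_cont hf k).measurable.comp hm).aestronglyMeasurable (Eventually.of_forall fun t => hC _ (hN t))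
  have mono : ∫ t, qq fr B (P t) * φ (0, t) ≤ ∫ t, qq fl A (N t) * φ (0, t) := by
    refine integral_mono_ae (iq d.r.cont p1 p2) (iq d.l.cont n1 n2) ?_
    obtain ⟨Kb, hKb⟩ := hb.lip
    filter_upwards [n3, p3, hKb.ae_differentiableAt (μ := volume)] with t a1 a2 a3
    rcases le_or_gt t 0 with ht | ht
    · rw [h0 _ ht, mul_zero, mul_zero]
    · exact mul_le_mul_of_nonneg_right (h.iface d hb ht a3 (a1 ht) (a2 ht) (hN t ht) (hP t ht)) (hp _)
  have := integral_add (ent_int (S := Iio 0) d.l.cont h.lip measurableSet_Iio h1 hc A) (ent_int (S := Ioi 0) d.r.cont h.lip measurableSet_Ioi h1 hc B)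
  have n0 : ∀ᵐ p : ℝ², p.1 ≠ 0 := Measure.quasiMeasurePreserving_fst.ae (μb := volume) (Measure.ae_ne volume (0 : ℝ))
  rw [integral_congr_ae (g := fun p : ℝ² => (Iio 0).indicator (fun _ => 1) p.1 * (|uu U p.1 p.2 - A| * Dt φ p + qq fl A (uu U p.1 p.2) * Dx φ p) +
    (Ioi 0).indicator (fun _ => 1) p.1 * (|uu U p.1 p.2 - B| * Dt φ p + qq fr B (uu U p.1 p.2) * Dx φ p)), this]
  · linarith
  filter_upwards [n0] with p p0
  rcases lt_or_gt_of_ne p0 with ht | ht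
  · simp [indicator_apply, ht, ht.not_gt, dflux, cAB, qq, ht.le]
  · simp [indicator_apply, ht, ht.not_gt, dflux, cAB, qq, ht.not_ge]

lemma Gl.tc (h : Gl fl fr U0 b K U m) (r : ℝ) {t₀ : ℝ} (h0 : 0 ≤ t₀) :
    Tendsto (fun t => ∫ x in Icc (-r) r, |uu U x t - uu U x t₀|) (𝓝[Ici 0] t₀) (𝓝 0) := by
  refine tendsto_of_seq_tendsto fun s hs => ?_
  have hs' := tendsto_nhdsWithin_iff.1 hs
  have mt : ∀ t, Measurable fun x => uu U x t := fun t => (uu_meas h.lip.continuous).of_uncurry_right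
  have dm : ∀ x t q, x ≠ 0 → 0 < t → HasDerivAt (fun y => U (y, t)) q x → q = m x t ∧ Tendsto (fun s => m x s) (𝓝 t) (𝓝 q) := fun x t q x0 ht hq => by
    rcases lt_or_gt_of_ne x0 with hx | hx
    · exact ⟨h.tl.dx isOpen_Iio hx x0 ht hq, h.tl.tc h.lip isOpen_Iio hx x0 ht hq⟩
    · exact ⟨h.tr.dx isOpen_Ioi hx x0 ht hq, h.tr.tc h.lip isOpen_Ioi hx x0 ht hq⟩
  have di : ∀ t, ∀ᵐ x, DifferentiableAt ℝ (fun y => U (y, t)) x := fun t => (lip_sl h.lip t).ae_differentiableAt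
  have lim : ∀ᵐ x, Tendsto (fun n => |uu U x (s n) - uu U x t₀|) atTop (𝓝 0) := by
    filter_upwards [ae_all_iff.2 fun n => di (s n), di t₀, di 0, Measure.ae_ne volume (0 : ℝ)] with x a1 a2 a3 x0
    have e : Tendsto (fun t => if 0 < t then m x t else uu U x 0) (𝓝[Ici 0] t₀) (𝓝 (uu U x t₀)) := by
      rcases h0.lt_or_eq with ht | rfl
      · have := (dm x t₀ _ x0 ht a2.hasDerivAt).2
        rw [← uu_of a2.hasDerivAt] at this
        refine (this.mono_left nhdsWithin_le_nhds).congr' ?_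
        filter_upwards [nhdsWithin_le_nhds (Ioi_mem_nhds ht)] with t ht
        exact (if_pos ht).symm
      · rw [← Ioi_insert, nhdsWithin_insert, tendsto_sup]
        constructor
        · exact tendsto_pure_left.2 fun s hs => by simpa using mem_of_mem_nhds hs
        · have := h.init x x0 (uu U x 0) (by rw [uu_of a2.hasDerivAt]; simpa only [h.i] using a2.hasDerivAt)
          refine this.congr' ?_
          filter_upwards [self_mem_nhdsWithin] with t ht
          exact (if_pos ht).symm
    have l : Tendsto (fun n => uu U x (s n)) atTop (𝓝 (uu U x t₀)) := by
      refine (e.comp hs).congr' ?_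
      filter_upwards [hs'.2] with n hn
      rcases (show 0 ≤ s n from hn).lt_or_eq with ht | ht
      · simp only [Function.comp, if_pos ht]
        rw [uu_of (a1 n).hasDerivAt]
        exact (dm x _ _ x0 ht (a1 n).hasDerivAt).1.symm
      · simp [← ht]
    simpa using (l.sub_const (uu U x t₀)).abs
  have := tendsto_integral_of_dominated_convergence (μ := volume.restrict (Icc (-r) r)) (fun _ => (K : ℝ) + K)
    (F := fun n x => |uu U x (s n) - uu U x t₀|) (f := fun _ => 0)
    (fun n => ((mt _).sub (mt _)).abs.aestronglyMeasurable) (integrableOn_const isCompact_Icc.measure_lt_top.ne)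
    (fun n => Eventually.of_forall fun x => by
      rw [Real.norm_eq_abs, abs_abs]; exact (abs_sub _ _).trans (add_le_add (uu_bdd h.lip _ _) (uu_bdd h.lip _ _))) (ae_restrict_of_ae lim)
  simp only [integral_zero] at this
  exact this

theorem exists_sol (d : Dat fl fr A B a γ) (hu : IsLinf u0) : Nonempty (ABSol fl fr A B u0) := by
  obtain ⟨mu, M, hM⟩ := hu
  have li : LocallyIntegrable u0 volume := fun x => ⟨Icc (x - 1) (x + 1), Icc_mem_nhds (by linarith) (by linarith),
    Measure.integrableOn_of_bounded (M := M) (by simp) mu.aestronglyMeasurable (ae_restrict_of_ae hM)⟩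
  have ii : ∀ x y, IntervalIntegrable u0 volume x y := fun x y => (li.integrableOn_isCompact isCompact_uIcc).intervalIntegrable
  have hU : LipschitzWith M.toNNReal fun x => ∫ y in (0 : ℝ)..x, u0 y := LipschitzWith.of_dist_le_mul fun x y => by
    rw [Real.dist_eq, intervalIntegral.integral_interval_sub_left (ii _ _) (ii _ _), dist_comm, Real.dist_eq, ← abs_neg (y - x), neg_sub]
    exact intervalIntegral.norm_integral_le_of_norm_le_const_ae (f := u0) (C := (M.toNNReal : ℝ)) (hM.mono fun z hz _ => hz.trans (Real.le_coe_toNNReal M))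
  obtain ⟨b, hb⟩ := exists_b d.l d.r hU γ
  obtain ⟨K, U, m, h⟩ := exists_Gl d hU hb
  choose L hL using fun x t ht => (h.lims x t ht).1
  choose R hR using fun x t ht => (h.lims x t ht).2
  set N : ℝ → ℝ → ℝ := fun x t => if ht : 0 < t then L x t ht else 0
  set P : ℝ → ℝ → ℝ := fun x t => if ht : 0 < t then R x t ht else 0
  have hN : ∀ x t, 0 < t → Tendsto (fun y => uu U y t) (𝓝[<] x) (𝓝 (N x t)) := fun x t ht => by simp only [N, dif_pos ht]; exact hL x t ht
  have hP : ∀ x t, 0 < t → Tendsto (fun y => uu U y t) (𝓝[>] x) (𝓝 (P x t)) := fun x t ht => by simp only [P, dif_pos ht]; exact hR x t ht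
  refine ⟨{ u := uu U
            meas := uu_meas h.lip.continuous
            bdd := ⟨K, uu_bdd h.lip⟩
            um := N
            up := P
            um_spec := hN
            up_spec := hP
            weak := fun φ h1 hc h0 => h.weak d.l.cont d.r.cont h1 hc fun p hp => h0 p.1 p.2 hp
            kruzkov_l := fun k φ h1 hc hp h0 => kr d.l h.tl hl_left h.lip cut_left (hN 0) h1 hc (fun p => hp p.1 p.2) (fun p hp => h0 p.1 p.2 (Or.inr hp))
              (fun p hp => h0 p.1 p.2 (Or.inl (not_lt.1 hp))) (fun x x0 hx => by rw [compl_Iio]; exact Ici_mem_nhds (lt_of_le_of_ne (not_lt.1 hx) x0.symm)) k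
            kruzkov_r := fun k φ h1 hc hp h0 => kr d.r h.tr hl_right h.lip cut_right (hP 0) h1 hc (fun p => hp p.1 p.2) (fun p hp => h0 p.1 p.2 (Or.inr hp))
              (fun p hp => h0 p.1 p.2 (Or.inl (not_lt.1 hp))) (fun x x0 hx => by rw [compl_Ioi]; exact Iic_mem_nhds (lt_of_le_of_ne (not_lt.1 hx) x0)) k
            interfaceEntropy := fun φ h1 hc hp h0 => h.ent d hb (hN 0) (fun t ht => dif_neg ht.not_gt) (hP 0) (fun t ht => dif_neg ht.not_gt) h1 hc
              (fun p => hp p.1 p.2) (fun p hp => h0 p.1 p.2 hp)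
            timeCont := fun r t₀ h0 => h.tc r h0
            init := ?_ }⟩
  filter_upwards [LocallyIntegrable.ae_hasDerivAt_integral li] with x hx
  exact uu_of (by simpa only [h.i] using hx 0)
end Gl
end S25

/-- characterization of the set of initial data `I_T^{[AB]}(ω^T)`
(Theorem 1.1 (i) of the paper, quantified over every point `x̄ ∈ ℝ`). -/
theorem initial_data_identification
    {T a θl θr A B : ℝ} {fl fr : ℝ → ℝ}
    (hT : 0 < T)
    (hflC : ContDiff ℝ 2 fl) (hfrC : ContDiff ℝ 2 fr)
    (ha : 0 < a)
    (hfl2 : ∀ w : ℝ, a ≤ deriv (deriv fl) w)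
    (hfr2 : ∀ w : ℝ, a ≤ deriv (deriv fr) w)
    (hf0 : fl 0 = fr 0) (hf1 : fl 1 = fr 1)
    (hθl : deriv fl θl = 0) (hθr : deriv fr θr = 0)
    (hθl0 : 0 ≤ θl) (hθr1 : θr ≤ 1)
    (hAB : fl A = fr B) (hA' : deriv fl A ≤ 0) (hB' : 0 ≤ deriv fr B)
    {Bb Aa : ℝ} {ω : ℝ → ℝ}
    (hBb : Bb ≤ θr) (hBbf : fr Bb = fr B)
    (hAa : θl ≤ Aa) (hAaf : fl Aa = fl A)
    (hω : Attainable T fl fr A B ω)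
    (v : ABSol fr fl Bb Aa (fun x => ω (-x)))
    (ustar : ABSol fl fr A B (fun x => v.u (-x) T))
    (u0 : ℝ → ℝ) (hu0 : IsLinf u0) :
    u0 ∈ InitialSet T fl fr A B ω ↔
      ∀ xb : ℝ, ∃ yb ∈ charSet0 T fl fr (fl A) ustar xb,
        (∀ y : ℝ, y < sInf (charSet0 T fl fr (fl A) ustar xb) →
          (∫ x in y..yb, u0 x) ≤ ∫ x in y..yb, v.u (-x) T) ∧
        (∀ y : ℝ, sSup (charSet0 T fl fr (fl A) ustar xb) < y →
          (∫ x in yb..y, v.u (-x) T) ≤ ∫ x in yb..y, u0 x) := by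
  have d : Dat fl fr A B a (fl A) := ⟨⟨hflC, ha, hfl2⟩, ⟨hfrC, ha, hfr2⟩, rfl, hAB.symm, hA', hB'⟩
  have d' : Dat fr fl Bb Aa a (fl A) := ⟨⟨hfrC, ha, hfr2⟩, ⟨hflC, ha, hfl2⟩, hBbf.trans hAB.symm, hAaf,
    hθr ▸ d.r.smono.monotone hBb, hθl ▸ d.l.smono.monotone hAa⟩
  exact main_reduction hT d d' hω v ustar u0 hu0 (exists_sol d hu0)
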